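/- For all real x ≥ 2.5·10^{14}, |U(x)| ≤ 3071.82·x/log x, where U(x) = ∑_{n ≤ x, n odd} (−2)^{Ω(n)}. -/

import Mathlib

section
open Finset ArithmeticFunction

/-- `U x = ∑_{n ≤ x, n odd} (-2)^{Ω(n)}`. -/
noncomputable def U (x : ℝ) : ℝ :=
  ∑ n ∈ (Finset.Icc 1 ⌊x⌋₊).filter (fun n => Odd n), (-2 : ℝ) ^ (cardFactors n)

end

section
open Complex Metric Set Filter Topology


theorem factor_zeros (R : ℝ) (n : ℕ) : ∀ (f : ℂ → ℂ), Differentiable ℂ f → f 0 ≠ 0 →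
    ∀ S : Finset ℂ, (∀ z, f z = 0 → z ∈ closedBall (0:ℂ) R → z ∈ S) →
    (∑ z ∈ S, analyticOrderNatAt f z = n) →
    ∃ (Z : Multiset ℂ) (g : ℂ → ℂ), Differentiable ℂ g ∧
      (∀ z, f z = (Z.map (fun ρ => z - ρ)).prod * g z) ∧
      (∀ z ∈ closedBall (0:ℂ) R, g z ≠ 0) ∧ (∀ ρ ∈ Z, f ρ = 0 ∧ ‖ρ‖ ≤ R) := by
  induction n with
  | zero =>
    intro f hf h0 S hS hsum
    refine ⟨0, f, hf, by simp, ?_, by simp⟩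
    intro z hz hfz
    have hzS := hS z hfz hz
    rw [Finset.sum_eq_zero_iff] at hsum
    have := hsum z hzS
    have han : AnalyticAt ℂ f z := hf.analyticAt z
    have hfin : analyticOrderAt f z ≠ ⊤ := by
      intro htop
      rw [analyticOrderAt_eq_top] at htop
      have : f = fun _ => 0 := by
        apply AnalyticOnNhd.eq_of_eventuallyEq (z₀ := z) (𝕜 := ℂ)
        · exact fun w _ => hf.analyticAt w
        · exact fun w _ => analyticAt_const
        · exact htop
      exact h0 (by rw [this])
    have h1 : analyticOrderAt f z ≠ 0 := by
      rw [Ne, han.analyticOrderAt_eq_zero]; simpa using hfz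
    have h2 : (analyticOrderNatAt f z : ℕ∞) = analyticOrderAt f z := Nat.cast_analyticOrderNatAt hfin
    rw [this] at h2
    exact h1 (by simpa using h2.symm)
  | succ n ih =>
    intro f hf h0 S hS hsum
    by_cases hz : ∃ ρ ∈ closedBall (0:ℂ) R, f ρ = 0
    · obtain ⟨ρ, hρ, hfρ⟩ := hz
      have hfin : ∀ g : ℂ → ℂ, Differentiable ℂ g → g 0 ≠ 0 → ∀ z, analyticOrderAt g z ≠ ⊤ := by
        intro g hg hg0 z htop
        rw [analyticOrderAt_eq_top] at htop
        have : g = fun _ => 0 := by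
          apply AnalyticOnNhd.eq_of_eventuallyEq (z₀ := z) (𝕜 := ℂ)
          · exact fun w _ => hg.analyticAt w
          · exact fun w _ => analyticAt_const
          · exact htop
        exact hg0 (by rw [this])
      set g := dslope f ρ with hgdef
      have hg : Differentiable ℂ g := by
        rw [← differentiableOn_univ]
        rw [hgdef, Complex.differentiableOn_dslope univ_mem]
        exact hf.differentiableOn
      have hfg : ∀ z, f z = (z - ρ) * g z := by
        intro z
        have := sub_smul_dslope f ρ z
        rw [smul_eq_mul, hfρ, sub_zero] at this
        exact this.symm
      have hfg' : f = (fun z => z - ρ) * g := by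
        funext z; simpa using hfg z
      have hg0 : g 0 ≠ 0 := by
        intro h; apply h0; rw [hfg, h, mul_zero]
      have hord : ∀ z, analyticOrderNatAt f z = analyticOrderNatAt (fun z : ℂ => z - ρ) z + analyticOrderNatAt g z := by
        intro z
        have ha : AnalyticAt ℂ (fun z : ℂ => z - ρ) z := by fun_prop
        have h1 := analyticOrderAt_mul ha (hg.analyticAt z)
        rw [← hfg'] at h1
        have h2 := hfin f hf h0 z
        unfold analyticOrderNatAt
        rw [h1, ENat.toNat_add]
        · intro h; rw [h1, h] at h2; simp at h2
        · exact hfin g hg hg0 z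
      have hρS := hS ρ hfρ hρ
      have hlin : ∀ z, analyticOrderNatAt (fun z : ℂ => z - ρ) z = if z = ρ then 1 else 0 := by
        intro z
        have ha : AnalyticAt ℂ (fun z : ℂ => z - ρ) z := by fun_prop
        split_ifs with h
        · have : analyticOrderAt (fun z : ℂ => z - ρ) z = (1:ℕ) := by
            rw [ha.analyticOrderAt_eq_natCast]
            refine ⟨fun _ => 1, analyticAt_const, one_ne_zero, ?_⟩
            filter_upwards with w
            rw [h]; simp
          unfold analyticOrderNatAt; rw [this]; simp
        · have : analyticOrderAt (fun z : ℂ => z - ρ) z = 0 := by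
            rw [ha.analyticOrderAt_eq_zero]; exact sub_ne_zero.mpr h
          unfold analyticOrderNatAt; rw [this]; simp
      have hsum' : ∑ z ∈ S, analyticOrderNatAt g z = n := by
        simp only [hord, hlin, Finset.sum_add_distrib] at hsum
        rw [Finset.sum_ite_eq' S ρ, if_pos hρS] at hsum
        omega
      obtain ⟨Z, G, hG, h1, h2, h3⟩ := ih g hg hg0 S
        (fun z hz hzb => hS z (by rw [hfg, hz, mul_zero]) hzb) hsum'
      refine ⟨ρ ::ₘ Z, G, hG, ?_, h2, ?_⟩
      · intro z; rw [hfg, h1]; simp [mul_assoc]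
      · intro r hr
        rw [Multiset.mem_cons] at hr
        rcases hr with rfl | hr
        · exact ⟨hfρ, by simpa using hρ⟩
        · exact ⟨by rw [hfg, (h3 r hr).1, mul_zero], (h3 r hr).2⟩
    · push Not at hz
      exact ⟨0, f, hf, by simp, hz, by simp⟩

theorem finite_zeros (f : ℂ → ℂ) (hf : Differentiable ℂ f) (h0 : f 0 ≠ 0) (R : ℝ) :
    ({z | f z = 0} ∩ closedBall (0:ℂ) R).Finite := by
  by_contra hinf
  obtain ⟨x, hx, hacc⟩ := Set.Infinite.exists_accPt_of_subset_isCompact hinf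
    (isCompact_closedBall (0:ℂ) R) inter_subset_right
  rw [accPt_iff_frequently_nhdsNE] at hacc
  have : f = fun _ => 0 := by
    apply AnalyticOnNhd.eq_of_frequently_eq (z₀ := x) (𝕜 := ℂ)
    · exact fun w _ => hf.analyticAt w
    · exact fun w _ => analyticAt_const
    · exact hacc.mono (fun y hy => hy.1)
  exact h0 (by rw [this])

theorem exists_factor (f : ℂ → ℂ) (hf : Differentiable ℂ f) (h0 : f 0 ≠ 0) (R : ℝ) :
    ∃ (Z : Multiset ℂ) (g : ℂ → ℂ), Differentiable ℂ g ∧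
      (∀ z, f z = (Z.map (fun ρ => z - ρ)).prod * g z) ∧
      (∀ z ∈ closedBall (0:ℂ) R, g z ≠ 0) ∧ (∀ ρ ∈ Z, f ρ = 0 ∧ ‖ρ‖ ≤ R) :=
  factor_zeros R _ f hf h0 (finite_zeros f hf h0 R).toFinset
    (fun z hz hzb => by simpa using ⟨hz, by simpa using hzb⟩) rfl

theorem exists_log_ball (g : ℂ → ℂ) (R : ℝ) (hR : 0 < R) (hg : Differentiable ℂ g)
    (hne : ∀ z ∈ ball (0:ℂ) R, g z ≠ 0) (h0 : g 0 = 1) :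
    ∃ h : ℂ → ℂ, h 0 = 0 ∧ DifferentiableOn ℂ h (ball 0 R) ∧
      (∀ z ∈ ball (0:ℂ) R, exp (h z) = g z) ∧ (∀ z ∈ ball (0:ℂ) R, deriv h z = logDeriv g z) := by
  have hd : DifferentiableOn ℂ (fun z => deriv g z / g z) (ball 0 R) := by
    intro z hz
    apply DifferentiableAt.differentiableWithinAt
    exact ((hg.analyticAt z).deriv.differentiableAt).div hg.differentiableAt (hne z hz)
  obtain ⟨F, hF0, hF⟩ := hd.isExactOn_ball.with_val_at 0 0
  have hFd : ∀ z ∈ ball (0:ℂ) R, HasDerivAt F (deriv g z / g z) z := hF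
  refine ⟨F, hF0, fun z hz => (hFd z hz).differentiableAt.differentiableWithinAt, ?_, ?_⟩
  · intro z hz
    have key : ∀ w ∈ ball (0:ℂ) R, exp (-F w) * g w = exp (-F 0) * g 0 := by
      intro w hw
      apply (convex_ball (0:ℂ) R).is_const_of_fderivWithin_eq_zero (𝕜 := ℂ)
        (f := fun w => exp (-F w) * g w) ?_ ?_ hw (mem_ball_self hR)
      · intro y hy
        exact (((hFd y hy).neg.cexp).mul (hg y).hasDerivAt).differentiableAt.differentiableWithinAt
      · intro y hy
        have h1 := ((hFd y hy).neg.cexp).mul (hg y).hasDerivAt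
        have h2 : exp (-F y) * -(deriv g y / g y) * g y + exp (-F y) * deriv g y = 0 := by
          field_simp [hne y hy]; ring
        have h1' : HasDerivAt (fun w => exp (-F w) * g w) 0 y := by
          have := h1
          rw [show (exp ((-F) y) * -(deriv g y / g y) * g y + exp ((-F) y) * deriv g y) = 0 from h2] at this
          exact this
        rw [fderivWithin_of_isOpen isOpen_ball hy]
        have := h1'.hasFDerivAt.fderiv
        rw [this]; ext; simp
    have := key z hz
    rw [hF0, h0] at this
    simp only [neg_zero, exp_zero, mul_one] at this
    rw [exp_neg] at this
    field_simp at this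
    exact this.symm
  · intro z hz
    rw [(hFd z hz).deriv, logDeriv_apply]

theorem logDeriv_factor (Z : Multiset ℂ) (f g : ℂ → ℂ) (hg : Differentiable ℂ g)
    (hfg : ∀ z, f z = (Z.map (fun ρ => z - ρ)).prod * g z) (s : ℂ) (hs : f s ≠ 0) :
    logDeriv f s = (Z.map (fun ρ => 1 / (s - ρ))).sum + logDeriv g s := by
  induction Z using Multiset.induction generalizing f with
  | empty =>
    have : f = g := by funext z; simpa using hfg z
    simp [this]
  | cons a Z ih =>
    have hP : ∀ W : Multiset ℂ, Differentiable ℂ (fun z : ℂ => (W.map (fun ρ => z - ρ)).prod) := by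
      intro W
      induction W using Multiset.induction with
      | empty => simp
      | cons b W ihW => simp only [Multiset.map_cons, Multiset.prod_cons]; fun_prop
    set f1 : ℂ → ℂ := fun z => (Z.map (fun ρ => z - ρ)).prod * g z with hf1
    have hf1d : Differentiable ℂ f1 := (hP Z).mul hg
    have h1 : f = fun z => (z - a) * f1 z := by
      funext z; rw [hfg]; simp [f1, mul_assoc]
    have hs' : (s - a) * f1 s ≠ 0 := by rw [h1] at hs; exact hs
    rw [h1, logDeriv_mul s (left_ne_zero_of_mul hs') (right_ne_zero_of_mul hs') (by fun_prop) (hf1d s),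
      ih f1 (fun z => rfl) (right_ne_zero_of_mul hs')]
    have : logDeriv (fun z => z - a) s = 1 / (s - a) := by
      rw [logDeriv_apply]; simp
    rw [this]; simp [add_assoc]

theorem hadamard_lite (f : ℂ → ℂ) (hf : Differentiable ℂ f) (h0 : f 0 = 1)
    (hgrow : ∀ ε > 0, ∃ R0 : ℝ, ∀ R ≥ R0, ∀ z, ‖z‖ ≤ R → ‖f z‖ ≤ Real.exp (ε * R ^ 2))
    (B : ℝ) (ε : ℝ) (hε : 0 < ε) : ∃ R0 : ℝ, ∀ R ≥ R0, ∃ Z : Multiset ℂ,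
      (∀ ρ ∈ Z, f ρ = 0 ∧ ‖ρ‖ ≤ R) ∧ (∀ ρ, f ρ = 0 → ‖ρ‖ ≤ R → ρ ∈ Z) ∧
      ∀ s s', ‖s‖ ≤ B → ‖s'‖ ≤ B → f s ≠ 0 → f s' ≠ 0 →
        ‖(logDeriv f s - logDeriv f s') -
          ((Z.map (fun ρ => 1 / (s - ρ))).sum - (Z.map (fun ρ => 1 / (s' - ρ))).sum)‖ ≤ ε := by
  set B' := |B| + 1
  have hB' : 0 < B' := by positivity
  obtain ⟨R0, hR0⟩ := hgrow (ε / (2048 * B')) (by positivity)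
  refine ⟨max (max R0 1) (8 * B'), fun R hR => ?_⟩
  have hRR0 : R0 ≤ R := le_trans (le_trans (le_max_left _ _) (le_max_left _ _)) hR
  have hR1 : 1 ≤ R := le_trans (le_trans (le_max_right _ _) (le_max_left _ _)) hR
  have hRB : 8 * B' ≤ R := le_trans (le_max_right _ _) hR
  have hRpos : 0 < R := by linarith
  obtain ⟨Z, g, hg, hfg, hgne, hZ⟩ := exists_factor f hf (by rw [h0]; exact one_ne_zero) R
  refine ⟨Z, hZ, ?_, ?_⟩
  · intro ρ hρ hρR
    by_contra hmem
    have h1 := hfg ρ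
    rw [hρ] at h1
    have h2 := hgne ρ (by simpa using hρR)
    have h3 : (Z.map (fun r => ρ - r)).prod ≠ 0 := by
      rw [Ne, Multiset.prod_eq_zero_iff]
      intro hc
      rw [Multiset.mem_map] at hc
      obtain ⟨r, hr, hr0⟩ := hc
      rw [sub_eq_zero] at hr0
      exact hmem (hr0 ▸ hr)
    exact mul_ne_zero h3 h2 h1.symm
  have hg0 : g 0 ≠ 0 := hgne 0 (by simp [hRpos.le])
  set M := ε / (2048 * B') * (4 * R) ^ 2 with hM
  have hMpos : 0 < M := by positivity

  have hgb : ∀ z ∈ closedBall (0:ℂ) (4 * R), ‖g z / g 0‖ ≤ Real.exp M := by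
    intro z hz
    apply Complex.norm_le_of_forall_mem_frontier_norm_le (U := ball 0 (4 * R)) isBounded_ball
      (f := fun z => g z / g 0)
    · apply Differentiable.diffContOnCl; exact hg.div_const _
    · intro w hw
      rw [frontier_ball (0:ℂ) (by positivity)] at hw
      have hwn : ‖w‖ = 4 * R := by simpa using hw
      have hb := hR0 (4 * R) (by linarith) w hwn.le
      have hp0 : ∀ W : Multiset ℂ, (∀ ρ ∈ W, ‖ρ‖ ≤ R) →
          ‖(W.map (fun ρ => (0:ℂ) - ρ)).prod‖ ≤ ‖(W.map (fun ρ => w - ρ)).prod‖ := by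
        intro W
        induction W using Multiset.induction with
        | empty => simp
        | cons a W ih =>
          intro h
          simp only [Multiset.map_cons, Multiset.prod_cons, norm_mul]
          have ha := h a (Multiset.mem_cons_self a W)
          apply mul_le_mul _ (ih (fun ρ hρ => h ρ (Multiset.mem_cons_of_mem hρ))) (norm_nonneg _)
            (norm_nonneg _)
          have := norm_sub_norm_le w a
          rw [zero_sub, norm_neg]
          linarith
      have hp := hp0 Z (fun ρ hρ => (hZ ρ hρ).2)
      have e1 : ‖(Z.map (fun ρ => (0:ℂ) - ρ)).prod‖ * ‖g 0‖ = 1 := by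
        rw [← norm_mul, ← hfg, h0, norm_one]
      have e2 : ‖(Z.map (fun ρ => w - ρ)).prod‖ * ‖g w‖ = ‖f w‖ := by
        rw [← norm_mul, ← hfg]
      have hg0p : 0 < ‖g 0‖ := norm_pos_iff.mpr hg0
      have hgle : ‖g w‖ / ‖g 0‖ ≤ ‖f w‖ := by
        rw [← e2]
        have : ‖(Z.map (fun ρ => (0:ℂ) - ρ)).prod‖ = 1 / ‖g 0‖ := by
          field_simp; linarith
        rw [this] at hp
        calc ‖g w‖ / ‖g 0‖ = (1 / ‖g 0‖) * ‖g w‖ := by ring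
          _ ≤ _ := mul_le_mul_of_nonneg_right hp (norm_nonneg _)
      rw [norm_div]
      exact hgle.trans hb
    · rw [closure_ball (0:ℂ) (by positivity)]; exact hz
  obtain ⟨h, hh0, hhd, hhexp, hhder⟩ := exists_log_ball (fun z => g z / g 0) R hRpos (hg.div_const _)
    (fun z hz => div_ne_zero (hgne z (ball_subset_closedBall hz)) hg0) (div_self hg0)
  have hre : ∀ z ∈ ball (0:ℂ) R, (h z).re ≤ M := by
    intro z hz
    have h1 := hgb z (closedBall_subset_closedBall (by linarith) (ball_subset_closedBall hz))
    rw [← hhexp z hz, Complex.norm_exp, Real.exp_le_exp] at h1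
    exact h1
  have hbc : ∀ z ∈ closedBall (0:ℂ) (R / 2), ‖h z‖ ≤ 2 * M := by
    intro z hz
    have hzn : ‖z‖ ≤ R / 2 := by simpa using hz
    have hzb : z ∈ ball (0:ℂ) R := by simp; linarith
    have := Complex.borelCaratheodory_zero hMpos hhd (fun z hz => hre z hz) hRpos hzb hh0
    refine this.trans ?_
    rw [div_le_iff₀ (by linarith)]
    nlinarith [norm_nonneg z]
  have hd1 : ∀ z ∈ closedBall (0:ℂ) (R / 4), ‖deriv h z‖ ≤ 2 * M / (R / 4) := by
    intro z hz
    have hzn : ‖z‖ ≤ R / 4 := by simpa using hz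
    apply Complex.norm_deriv_le_of_forall_mem_sphere_norm_le (by positivity)
    · apply DifferentiableOn.diffContOnCl
      rw [closure_ball _ (by positivity)]
      apply hhd.mono
      intro w hw
      have : ‖w - z‖ ≤ R / 4 := by simpa [dist_eq_norm] using hw
      have := norm_le_norm_add_norm_sub' w z
      simp; linarith
    · intro w hw
      apply hbc
      have : ‖w - z‖ = R / 4 := by simpa [dist_eq_norm] using hw
      have := norm_le_norm_add_norm_sub' w z
      simp; linarith
  have hdan : DifferentiableOn ℂ (deriv h) (ball 0 R) := hhd.deriv isOpen_ball
  have hd2 : ∀ z ∈ ball (0:ℂ) (R / 8), ‖deriv (deriv h) z‖ ≤ 2 * M / (R / 4) / (R / 8) := by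
    intro z hz
    have hzn : ‖z‖ < R / 8 := by simpa using hz
    apply Complex.norm_deriv_le_of_forall_mem_sphere_norm_le (by positivity)
    · apply DifferentiableOn.diffContOnCl
      rw [closure_ball _ (by positivity)]
      apply hdan.mono
      intro w hw
      have : ‖w - z‖ ≤ R / 8 := by simpa [dist_eq_norm] using hw
      have := norm_le_norm_add_norm_sub' w z
      simp; linarith
    · intro w hw
      apply hd1
      have : ‖w - z‖ = R / 8 := by simpa [dist_eq_norm] using hw
      have := norm_le_norm_add_norm_sub' w z
      simp; linarith
  intro s s' hs hs' hfs hfs'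
  have hsB : ‖s‖ < B' := by have := le_abs_self B; simp only [B']; linarith
  have hsB' : ‖s'‖ < B' := by have := le_abs_self B; simp only [B']; linarith
  have hsb : s ∈ ball (0:ℂ) (R / 8) := by simp; linarith
  have hsb' : s' ∈ ball (0:ℂ) (R / 8) := by simp; linarith
  have hmv := (convex_ball (0:ℂ) (R / 8)).norm_image_sub_le_of_norm_deriv_le (f := deriv h) (𝕜 := ℂ)
    (fun z hz => hdan.differentiableAt (isOpen_ball.mem_nhds (ball_subset_ball (by linarith) hz)))
    hd2 hsb' hsb
  have hld : ∀ z ∈ ball (0:ℂ) (R / 8), deriv h z = logDeriv g z := by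
    intro z hz
    rw [hhder z (ball_subset_ball (by linarith) hz)]
    have : (fun z => g z / g 0) = fun z => (g 0)⁻¹ * g z := by funext z; rw [div_eq_inv_mul]
    rw [this, logDeriv_const_mul]
    exact inv_ne_zero hg0
  rw [hld s hsb, hld s' hsb'] at hmv
  rw [logDeriv_factor Z f g hg hfg s hfs, logDeriv_factor Z f g hg hfg s' hfs']
  have e : ∀ a b c d : ℂ, (a + b) - (c + d) - (a - c) = b - d := by intros; ring
  rw [e]
  refine hmv.trans ?_
  have h3 : ‖s - s'‖ ≤ 2 * B' := by have := norm_sub_le s s'; linarith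
  calc 2 * M / (R / 4) / (R / 8) * ‖s - s'‖ ≤ 2 * M / (R / 4) / (R / 8) * (2 * B') := by
        apply mul_le_mul_of_nonneg_left h3; positivity
    _ = ε := by rw [hM]; field_simp; ring

end

section
open Complex Metric Set Filter Topology

noncomputable def xi (s : ℂ) : ℂ := s * (s - 1) * completedRiemannZeta₀ s + 1

theorem xi_diff : Differentiable ℂ xi := by
  unfold xi
  have := differentiable_completedZeta₀
  fun_prop

theorem xi_zero : xi 0 = 1 := by simp [xi]
theorem xi_one : xi 1 = 1 := by simp [xi]

theorem xi_one_sub (s : ℂ) : xi (1 - s) = xi s := by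
  unfold xi; rw [completedRiemannZeta₀_one_sub]; ring

theorem xi_eq_completed (s : ℂ) (h0 : s ≠ 0) (h1 : s ≠ 1) :
    xi s = s * (s - 1) * completedRiemannZeta s := by
  have h1' : 1 - s ≠ 0 := sub_ne_zero.mpr h1.symm
  rw [completedRiemannZeta_eq, xi]; field_simp; ring

theorem xi_eq (s : ℂ) (h0 : 0 < s.re) (h1 : s ≠ 1) :
    xi s = s * (s - 1) * Gammaℝ s * riemannZeta s := by
  have hs : s ≠ 0 := by rintro rfl; simp at h0
  rw [xi_eq_completed s hs h1, riemannZeta_def_of_ne_zero hs]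
  have := Gammaℝ_ne_zero_of_re_pos h0
  field_simp

theorem xi_ne_zero_of_one_le (s : ℂ) (h : 1 ≤ s.re) : xi s ≠ 0 := by
  by_cases h1 : s = 1
  · rw [h1, xi_one]; exact one_ne_zero
  rw [xi_eq s (by linarith) h1]
  have hs : s ≠ 0 := by rintro rfl; simp at h; linarith
  exact mul_ne_zero (mul_ne_zero (mul_ne_zero hs (sub_ne_zero.mpr h1))
    (Gammaℝ_ne_zero_of_re_pos (by linarith))) (riemannZeta_ne_zero_of_one_le_re h)

theorem xi_zero_re (s : ℂ) (h : xi s = 0) : 0 < s.re ∧ s.re < 1 := by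
  constructor
  · by_contra hc
    apply xi_ne_zero_of_one_le (1 - s) _ (by rw [xi_one_sub, h])
    simp; linarith
  · by_contra hc
    exact xi_ne_zero_of_one_le s (by linarith) h

theorem Gammaℝ_conj' (s : ℂ) : Gammaℝ (starRingEnd ℂ s) = starRingEnd ℂ (Gammaℝ s) := by
  have h2 : starRingEnd ℂ (2:ℂ) = 2 := Complex.conj_ofNat 2
  have e1 : -(starRingEnd ℂ s) / 2 = starRingEnd ℂ (-s / 2) := by simp [h2]
  have e2 : (starRingEnd ℂ s) / 2 = starRingEnd ℂ (s / 2) := by simp [h2]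
  rw [Gammaℝ_def, Gammaℝ_def, map_mul, ← Complex.Gamma_conj, e1, e2, cpow_conj, conj_ofReal]
  rw [arg_ofReal_of_nonneg Real.pi_pos.le]; exact Real.pi_pos.ne

theorem xi_conj (s : ℂ) : xi (starRingEnd ℂ s) = starRingEnd ℂ (xi s) := by
  have key : ∀ s : ℂ, 0 < s.re → xi (starRingEnd ℂ s) = starRingEnd ℂ (xi s) := by
    intro s hs
    by_cases h1 : s = 1
    · rw [h1]; simp [xi_one]
    · rw [xi_eq s hs h1, xi_eq _ (by simpa using hs)
        (by intro h; apply h1; have := congrArg (starRingEnd ℂ) h; simpa using this)]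
      rw [riemannZeta_conj, Gammaℝ_conj']; simp
  by_cases hs : 0 < s.re
  · exact key s hs
  · have := key (1 - s) (by simp; linarith)
    rw [xi_one_sub] at this
    rw [← this, ← xi_one_sub (starRingEnd ℂ s)]; simp

theorem logDeriv_xi_refl (s : ℂ) : logDeriv xi (1 - starRingEnd ℂ s) = - starRingEnd ℂ (logDeriv xi s) := by
  rw [logDeriv_apply, logDeriv_apply, xi_one_sub, xi_conj, map_div₀]
  have h1 : deriv xi (1 - starRingEnd ℂ s) = - deriv xi (starRingEnd ℂ s) := by
    have h2 : HasDerivAt (fun z => xi (1 - z)) (- deriv xi (1 - starRingEnd ℂ s)) (starRingEnd ℂ s) := by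
      have := (xi_diff (1 - starRingEnd ℂ s)).hasDerivAt.comp (starRingEnd ℂ s)
        ((hasDerivAt_id (starRingEnd ℂ s)).const_sub 1)
      simpa [Function.comp_def] using this
    have h3 : (fun z => xi (1 - z)) = xi := by funext z; exact xi_one_sub z
    rw [h3] at h2
    rw [h2.deriv]; ring
  have h4 : deriv xi (starRingEnd ℂ s) = starRingEnd ℂ (deriv xi s) := by
    have h5 : xi = starRingEnd ℂ ∘ xi ∘ starRingEnd ℂ := by
      funext z; simp [xi_conj]
    have h6 := (xi_diff s).hasDerivAt.conj_conj
    rw [← h5] at h6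
    exact h6.deriv
  rw [h1, h4]; ring

theorem norm_Gamma_le (s : ℂ) (hs : 0 < s.re) : ‖Complex.Gamma s‖ ≤ Real.Gamma s.re := by
  rw [Complex.Gamma_eq_integral hs, Real.Gamma_eq_integral hs, Complex.GammaIntegral]
  refine (MeasureTheory.norm_integral_le_integral_norm _).trans (le_of_eq ?_)
  apply MeasureTheory.setIntegral_congr_fun measurableSet_Ioi
  intro x hx
  have hx' : (0:ℝ) < x := hx
  simp only [norm_mul]
  rw [Complex.norm_cpow_eq_rpow_re_of_pos hx', Complex.norm_real, Real.norm_of_nonneg (Real.exp_pos _).le]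
  simp

theorem strip_bound : ∃ C : ℝ, 0 < C ∧ ∀ s : ℂ, -4 ≤ s.re → s.re ≤ 4 → ‖completedRiemannZeta₀ s‖ ≤ C := by
  set P := HurwitzZeta.hurwitzEvenFEPair 0
  have hconv : ∀ s : ℂ, MellinConvergent P.f_modif s := fun s =>
    (P.isStrongFEPair_toStrongFEPair.hasMellin s).1
  have h2 := (hconv 2).norm
  have h2' := (hconv (-2)).norm
  refine ⟨1 + ((∫ t in Ioi (0:ℝ), ‖(t:ℂ) ^ ((2:ℂ) - 1) • P.f_modif t‖) +
    ∫ t in Ioi (0:ℝ), ‖(t:ℂ) ^ ((-2:ℂ) - 1) • P.f_modif t‖), ?_, ?_⟩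
  · have : 0 ≤ ∫ t in Ioi (0:ℝ), ‖(t:ℂ) ^ ((2:ℂ) - 1) • P.f_modif t‖ :=
      MeasureTheory.integral_nonneg (fun _ => norm_nonneg _)
    have : 0 ≤ ∫ t in Ioi (0:ℝ), ‖(t:ℂ) ^ ((-2:ℂ) - 1) • P.f_modif t‖ :=
      MeasureTheory.integral_nonneg (fun _ => norm_nonneg _)
    linarith
  intro s hs1 hs2
  have e : completedRiemannZeta₀ s = (mellin P.f_modif (s / 2)) / 2 := rfl
  rw [e, norm_div]
  have h3 : ‖mellin P.f_modif (s / 2)‖ ≤ (∫ t in Ioi (0:ℝ), ‖(t:ℂ) ^ ((2:ℂ) - 1) • P.f_modif t‖) +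
    ∫ t in Ioi (0:ℝ), ‖(t:ℂ) ^ ((-2:ℂ) - 1) • P.f_modif t‖ := by
    rw [mellin, ← MeasureTheory.integral_add h2 h2']
    refine (MeasureTheory.norm_integral_le_integral_norm _).trans ?_
    apply MeasureTheory.setIntegral_mono_on (hconv (s/2)).norm (h2.add h2') measurableSet_Ioi
    intro t ht
    have ht' : (0:ℝ) < t := ht
    simp only [norm_smul, Pi.add_apply]
    rw [← add_mul]
    apply mul_le_mul_of_nonneg_right _ (norm_nonneg _)
    simp only [Complex.norm_cpow_eq_rpow_re_of_pos ht']
    have er : (s / 2 - 1).re = s.re / 2 - 1 := by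
      simp
    rw [er]
    norm_num
    rcases le_total 1 t with h | h
    · have := Real.rpow_le_rpow_of_exponent_le h (show s.re / 2 - 1 ≤ 1 by linarith)
      simp at *
      have : 0 < (t ^ 3)⁻¹ := by positivity
      linarith
    · have := Real.rpow_le_rpow_of_exponent_ge ht' h (show -3 ≤ s.re / 2 - 1 by linarith)
      simp at *
      linarith
  have := norm_nonneg (mellin P.f_modif (s / 2))
  simp only [Complex.norm_ofNat]
  linarith

theorem zeta_bound_two : ∃ C : ℝ, 0 < C ∧ ∀ s : ℂ, 2 ≤ s.re → ‖riemannZeta s‖ ≤ C := by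
  have hsum : Summable (fun n : ℕ => 1 / (n:ℝ) ^ (2:ℝ)) := Real.summable_one_div_nat_rpow.mpr (by norm_num)
  refine ⟨1 + ∑' n : ℕ, 1 / (n:ℝ) ^ (2:ℝ), ?_, ?_⟩
  · have : 0 ≤ ∑' n : ℕ, 1 / (n:ℝ) ^ (2:ℝ) := tsum_nonneg (fun n => by positivity)
    linarith
  intro s hs
  rw [zeta_eq_tsum_one_div_nat_cpow (by linarith)]
  have hle : ∀ n : ℕ, ‖1 / (n:ℂ) ^ s‖ ≤ 1 / (n:ℝ) ^ (2:ℝ) := by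
    intro n
    rcases Nat.eq_zero_or_pos n with rfl | hn
    · have : s ≠ 0 := by rintro rfl; norm_num at hs
      simp [this]
    · rw [norm_div, norm_one, Complex.norm_natCast_cpow_of_pos hn]
      apply one_div_le_one_div_of_le (by positivity)
      exact Real.rpow_le_rpow_of_exponent_le (by exact_mod_cast hn) hs
  have := tsum_of_norm_bounded hsum.hasSum hle
  linarith

theorem Gamma_bound (x R : ℝ) (hx : 2 ≤ x) (hxR : 2 * x ≤ R) :
    Real.Gamma x ≤ Real.exp (R * Real.log (R + 5)) := by
  have h1 : Real.Gamma x ≤ Real.Gamma (⌈x⌉₊ + 1) :=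
    Real.Gamma_strictMonoOn_Ici.monotoneOn (by simpa using hx)
      (by have := Nat.le_ceil x; simp; linarith) (by have := Nat.le_ceil x; linarith)
  rw [Real.Gamma_nat_eq_factorial] at h1
  have h2 : ((⌈x⌉₊).factorial : ℝ) ≤ (⌈x⌉₊ : ℝ) ^ ⌈x⌉₊ := by exact_mod_cast Nat.factorial_le_pow _
  have h3 : (⌈x⌉₊ : ℝ) ≤ R := by
    have := Nat.ceil_lt_add_one (show 0 ≤ x by linarith); linarith
  refine h1.trans (h2.trans ?_)
  rw [← Real.rpow_natCast]
  have hc : (0:ℝ) ≤ ⌈x⌉₊ := by positivity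
  calc (⌈x⌉₊ : ℝ) ^ (⌈x⌉₊ : ℝ) ≤ (R + 5) ^ (⌈x⌉₊ : ℝ) := Real.rpow_le_rpow hc (by linarith) hc
    _ ≤ (R + 5) ^ R := Real.rpow_le_rpow_of_exponent_le (by linarith) h3
    _ = _ := by rw [Real.rpow_def_of_pos (by linarith), mul_comm]

theorem xi_bound_right : ∃ C : ℝ, 0 < C ∧ ∀ R : ℝ, 1 ≤ R → ∀ s : ℂ, 1/2 ≤ s.re → ‖s‖ ≤ R →
    ‖xi s‖ ≤ C * (R + 5)^2 * Real.exp (R * Real.log (R + 5)) := by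
  obtain ⟨C1, hC1, h1⟩ := strip_bound
  obtain ⟨C2, hC2, h2⟩ := zeta_bound_two
  refine ⟨C1 + C2 + 1, by positivity, ?_⟩
  intro R hR s hs hsR
  have hE : 1 ≤ Real.exp (R * Real.log (R + 5)) := by
    apply Real.one_le_exp; apply mul_nonneg (by linarith); apply Real.log_nonneg; linarith
  have hss : ‖s * (s - 1)‖ ≤ R * (R + 1) := by
    rw [norm_mul]
    have : ‖s - 1‖ ≤ R + 1 := (norm_sub_le _ _).trans (by simp; linarith)
    apply mul_le_mul hsR this (norm_nonneg _) (by linarith)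
  rcases le_total s.re 4 with h | h
  · unfold xi
    have := h1 s (by linarith) h
    have h5 : ‖s * (s - 1) * completedRiemannZeta₀ s + 1‖ ≤ R * (R + 1) * C1 + 1 := by
      refine (norm_add_le _ _).trans ?_
      rw [norm_mul, norm_one]
      have := mul_le_mul hss this (norm_nonneg _) (by positivity)
      linarith
    refine h5.trans ?_
    have : R * (R + 1) * C1 + 1 ≤ (C1 + C2 + 1) * (R + 5)^2 := by nlinarith
    refine this.trans ?_
    have : 0 ≤ (C1 + C2 + 1) * (R + 5)^2 := by positivity
    nlinarith
  · have hs1 : s ≠ 1 := by rintro rfl; norm_num at h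
    rw [xi_eq s (by linarith) hs1, norm_mul, norm_mul]
    have hG : ‖Gammaℝ s‖ ≤ Real.exp (R * Real.log (R + 5)) := by
      rw [Gammaℝ_def, norm_mul, Complex.norm_cpow_eq_rpow_re_of_pos Real.pi_pos]
      have e1 : Real.pi ^ ((-s / 2).re) ≤ 1 := by
        apply Real.rpow_le_one_of_one_le_of_nonpos
        · have := Real.pi_gt_three; linarith
        · simp; linarith
      have e2 : ‖Complex.Gamma (s / 2)‖ ≤ Real.exp (R * Real.log (R + 5)) := by
        have hre : (s / 2).re = s.re / 2 := by simp
        refine (norm_Gamma_le (s / 2) (by rw [hre]; linarith)).trans ?_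
        rw [hre]
        apply Gamma_bound _ _ (by linarith)
        have := (Complex.re_le_norm s).trans hsR
        linarith
      calc _ ≤ 1 * Real.exp (R * Real.log (R + 5)) := mul_le_mul e1 e2 (norm_nonneg _) zero_le_one
        _ = _ := one_mul _
    have hz := h2 s (by linarith)
    calc ‖s * (s - 1)‖ * ‖Gammaℝ s‖ * ‖riemannZeta s‖
        ≤ (R * (R + 1)) * Real.exp (R * Real.log (R + 5)) * C2 := by
          apply mul_le_mul _ hz (norm_nonneg _) (by positivity)
          apply mul_le_mul hss hG (norm_nonneg _) (by positivity)
      _ = (R * (R + 1) * C2) * Real.exp (R * Real.log (R + 5)) := by ring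
      _ ≤ _ := by
        apply mul_le_mul_of_nonneg_right _ (by positivity)
        nlinarith

theorem xi_growth : ∀ ε > 0, ∃ R0 : ℝ, ∀ R ≥ R0, ∀ z, ‖z‖ ≤ R → ‖xi z‖ ≤ Real.exp (ε * R ^ 2) := by
  intro ε hε
  obtain ⟨C, hC, hb⟩ := xi_bound_right
  have hlim : Tendsto (fun x : ℝ => Real.log x / x) atTop (𝓝 0) := by
    have := Real.isLittleO_log_id_atTop.tendsto_div_nhds_zero
    simpa using this
  have hev : ∀ᶠ x : ℝ in atTop, Real.log x / x < ε / 64 := hlim.eventually_lt_const (by positivity)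
  have hev2 : ∀ᶠ R : ℝ in atTop, Real.log (R + 6) / (R + 6) < ε / 64 :=
    (tendsto_atTop_add_const_right atTop 6 tendsto_id).eventually hev
  have hev3 : ∀ᶠ R : ℝ in atTop, Real.log C / (ε / 2) < R := eventually_gt_atTop _
  obtain ⟨R0, hR0⟩ := eventually_atTop.mp (hev2.and (hev3.and (eventually_ge_atTop 6)))
  refine ⟨R0, fun R hR z hz => ?_⟩
  obtain ⟨h1, h2, h3⟩ := hR0 R hR
  have hmain : ‖xi z‖ ≤ C * ((R + 1) + 5)^2 * Real.exp ((R + 1) * Real.log ((R + 1) + 5)) := by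
    rcases le_total (1/2) z.re with h | h
    · exact hb (R + 1) (by linarith) z h (by linarith)
    · rw [← xi_one_sub]
      apply hb (R + 1) (by linarith) (1 - z) (by simp; linarith)
      exact (norm_sub_le _ _).trans (by simp; linarith)
  refine hmain.trans ?_
  have e6 : R + 1 + 5 = R + 6 := by ring
  rw [e6]
  have hR6 : 0 < R + 6 := by linarith
  rw [div_lt_iff₀ hR6] at h1
  rw [div_lt_iff₀ (by positivity)] at h2
  have : C * (R + 6)^2 = Real.exp (Real.log C + 2 * Real.log (R + 6)) := by
    rw [Real.exp_add, Real.exp_log hC, two_mul, Real.exp_add, Real.exp_log hR6]; ring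
  rw [this, ← Real.exp_add]
  apply Real.exp_le_exp.mpr
  have h4 : (R + 3) * Real.log (R + 6) ≤ (R + 3) * (ε / 64 * (R + 6)) :=
    mul_le_mul_of_nonneg_left h1.le (by linarith)
  have h5 : (R + 3) * (R + 6) ≤ 4 * R ^ 2 := by nlinarith
  have h6 : ε / 64 * ((R + 3) * (R + 6)) ≤ ε / 64 * (4 * R^2) := mul_le_mul_of_nonneg_left h5 (by positivity)
  have h7 : R * (ε / 2) ≤ ε / 2 * R^2 := by
    have : 0 ≤ ε / 2 := by positivity
    nlinarith
  nlinarith [mul_nonneg hε.le (sq_nonneg R)]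

end

section
open Complex Metric Set Filter Topology

noncomputable def PP (s : ℂ) : ℝ := (logDeriv xi s).re
noncomputable def Fz (s ρ : ℂ) : ℝ := (1 / (s - ρ)).re + (1 / (s - 1 + starRingEnd ℂ ρ)).re

theorem Fz_sum (Z : Multiset ℂ) (s : ℂ) :
    ((Z.map (fun ρ => 1 / (s - ρ))).sum - (Z.map (fun ρ => 1 / ((1 - starRingEnd ℂ s) - ρ))).sum).re
      = (Z.map (fun ρ => Fz s ρ)).sum := by
  induction Z using Multiset.induction with
  | empty => simp
  | cons a Z ih =>
    simp only [Multiset.map_cons, Multiset.sum_cons]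
    rw [← ih]
    have : (1 / (1 - starRingEnd ℂ s - a)).re = - (1 / (s - 1 + starRingEnd ℂ a)).re := by
      have h : 1 / (1 - starRingEnd ℂ s - a) = - starRingEnd ℂ (1 / (s - 1 + starRingEnd ℂ a)) := by
        simp only [map_div₀, map_one, map_add, map_sub, conj_conj]
        rw [← div_neg]; congr 1; ring
      rw [h, Complex.neg_re, Complex.conj_re]
    simp only [Complex.add_re, Complex.sub_re, Fz]
    rw [this]; ring

theorem PP_linear (c c' : ℝ) (s s' : ℂ) (hs : xi s ≠ 0) (hs' : xi s' ≠ 0)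
    (hpos : ∀ ρ, xi ρ = 0 → 0 ≤ c * Fz s ρ + c' * Fz s' ρ) (S : Finset ℂ) (hS : ∀ ρ ∈ S, xi ρ = 0) :
    ∑ ρ ∈ S, (c * Fz s ρ + c' * Fz s' ρ) ≤ 2 * (c * PP s + c' * PP s') := by
  apply le_of_forall_pos_le_add
  intro ε hε
  set δ := ε / (|c| + |c'| + 1)
  have hδ : 0 < δ := by positivity
  set B := ‖s‖ + ‖s'‖ + 1 
  obtain ⟨R0, hR0⟩ := hadamard_lite xi xi_diff xi_zero xi_growth B δ hδ
  set R := max R0 (∑ ρ ∈ S, ‖ρ‖)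
  obtain ⟨Z, hZ1, hZ2, hZ3⟩ := hR0 R (le_max_left _ _)
  have key : ∀ w, ‖w‖ + 1 ≤ B → xi w ≠ 0 → |2 * PP w - (Z.map (fun ρ => Fz w ρ)).sum| ≤ δ := by
    intro w hw hxw
    have hx' : xi (1 - starRingEnd ℂ w) ≠ 0 := by
      rw [xi_one_sub, xi_conj]; simpa using hxw
    have h := hZ3 w (1 - starRingEnd ℂ w) (by linarith)
      ((norm_sub_le _ _).trans (by simp; linarith)) hxw hx'
    have h2 := (Complex.abs_re_le_norm _).trans h
    rw [Complex.sub_re, Fz_sum, logDeriv_xi_refl] at h2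
    have e : (logDeriv xi w - -(starRingEnd ℂ) (logDeriv xi w)).re = 2 * PP w := by
      simp [PP]; ring
    rw [e] at h2
    exact h2
  have k1 := key s (by simp only [B]; linarith [norm_nonneg s']) hs
  have k2 := key s' (by simp only [B]; linarith [norm_nonneg s]) hs'
  have hsub : S.val ≤ Z := by
    rw [Multiset.le_iff_subset S.nodup]
    intro ρ hρ
    apply hZ2 ρ (hS ρ hρ)
    exact (Finset.single_le_sum (f := fun ρ => ‖ρ‖) (fun _ _ => norm_nonneg _) hρ).trans (le_max_right _ _)
  obtain ⟨W, hW⟩ := Multiset.le_iff_exists_add.mp hsub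
  have hsum : (Z.map (fun ρ => c * Fz s ρ + c' * Fz s' ρ)).sum =
      c * (Z.map (fun ρ => Fz s ρ)).sum + c' * (Z.map (fun ρ => Fz s' ρ)).sum := by
    rw [Multiset.sum_map_add, Multiset.sum_map_mul_left, Multiset.sum_map_mul_left]
  have hge : ∑ ρ ∈ S, (c * Fz s ρ + c' * Fz s' ρ) ≤ (Z.map (fun ρ => c * Fz s ρ + c' * Fz s' ρ)).sum := by
    rw [hW, Multiset.map_add, Multiset.sum_add]
    have : 0 ≤ (W.map (fun ρ => c * Fz s ρ + c' * Fz s' ρ)).sum := by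
      apply Multiset.sum_nonneg
      intro x hx
      rw [Multiset.mem_map] at hx
      obtain ⟨ρ, hρ, rfl⟩ := hx
      apply hpos
      exact (hZ1 ρ (by rw [hW]; exact Multiset.mem_add.mpr (Or.inr hρ))).1
    simp only [Finset.sum]
    linarith
  rw [hsum] at hge
  have h1 : c * ((Z.map (fun ρ => Fz s ρ)).sum - 2 * PP s) ≤ |c| * δ := by
    refine (le_abs_self _).trans ?_
    rw [abs_mul, abs_sub_comm]; exact mul_le_mul_of_nonneg_left k1 (abs_nonneg _)
  have h2 : c' * ((Z.map (fun ρ => Fz s' ρ)).sum - 2 * PP s') ≤ |c'| * δ := by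
    refine (le_abs_self _).trans ?_
    rw [abs_mul, abs_sub_comm]; exact mul_le_mul_of_nonneg_left k2 (abs_nonneg _)
  have h3 : (|c| + |c'|) * δ ≤ ε := by
    have : (|c| + |c'| + 1) * δ = ε := by simp only [δ]; field_simp
    nlinarith
  linarith

theorem xi_refl_zero (ρ : ℂ) (h : xi ρ = 0) : xi (1 - starRingEnd ℂ ρ) = 0 := by
  rw [xi_one_sub, xi_conj, h, map_zero]

theorem Fz_refl (s ρ : ℂ) : Fz s (1 - starRingEnd ℂ ρ) = Fz s ρ := by
  unfold Fz
  rw [show s - (1 - starRingEnd ℂ ρ) = s - 1 + starRingEnd ℂ ρ by ring,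
    show s - 1 + starRingEnd ℂ (1 - starRingEnd ℂ ρ) = s - ρ by simp]
  ring

theorem PP_linear_nonneg (c c' : ℝ) (s s' : ℂ) (hs : xi s ≠ 0) (hs' : xi s' ≠ 0)
    (hpos : ∀ ρ, xi ρ = 0 → 0 ≤ c * Fz s ρ + c' * Fz s' ρ) :
    0 ≤ c * PP s + c' * PP s' := by
  have := PP_linear c c' s s' hs hs' hpos ∅ (by simp)
  simp at this; linarith

theorem PP_linear_single (c c' : ℝ) (s s' : ℂ) (hs : xi s ≠ 0) (hs' : xi s' ≠ 0)
    (hpos : ∀ ρ, xi ρ = 0 → 0 ≤ c * Fz s ρ + c' * Fz s' ρ) (ρ : ℂ) (hρ : xi ρ = 0) (hre : ρ.re ≠ 1/2) :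
    c * Fz s ρ + c' * Fz s' ρ ≤ c * PP s + c' * PP s' := by
  have hne : ρ ≠ 1 - starRingEnd ℂ ρ := by
    intro h; apply hre
    have := congrArg Complex.re h; simp at this; linarith
  have := PP_linear c c' s s' hs hs' hpos {ρ, 1 - starRingEnd ℂ ρ} (by
    intro r hr; simp at hr; rcases hr with rfl | rfl
    · exact hρ
    · exact xi_refl_zero ρ hρ)
  rw [Finset.sum_pair hne, Fz_refl, Fz_refl] at this
  linarith

end

section
open Complex Metric Set Filter Topology

theorem slitPlane_of_re_pos {z : ℂ} (h : 0 < z.re) : z ∈ slitPlane := Or.inl h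

theorem log_one_add_bound (w : ℂ) (hw : 0 ≤ w.re) : ‖log (1 + w) - w‖ ≤ ‖w‖ ^ 2 / 2 := by
  have hpos : ∀ u : ℝ, 0 ≤ u → 1 ≤ (1 + (u:ℂ) * w).re := by
    intro u hu; simp; positivity
  have hd : ∀ u : ℝ, 0 ≤ u → HasDerivAt (fun u : ℝ => log (1 + (u:ℂ) * w) - (u:ℂ) * w)
      (w / (1 + (u:ℂ) * w) - w) u := by
    intro u hu
    have h1 : HasDerivAt (fun u : ℝ => (u:ℂ) * w) w u := by
      simpa using (Complex.ofRealCLM.hasDerivAt (x := u)).mul_const w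
    have h2 := (h1.const_add 1).clog_real (slitPlane_of_re_pos (by linarith [hpos u hu]))
    exact h2.sub h1
  have := image_norm_le_of_norm_deriv_right_le_deriv_boundary (a := 0) (b := 1)
    (f := fun u : ℝ => log (1 + (u:ℂ) * w) - (u:ℂ) * w) (f' := fun u => w / (1 + (u:ℂ) * w) - w)
    (B := fun u => ‖w‖^2 * u^2 / 2) (B' := fun u => ‖w‖^2 * u)
    (fun u hu => (hd u hu.1).continuousAt.continuousWithinAt)
    (fun u hu => (hd u hu.1).hasDerivWithinAt) (by simp)
    (fun u => by
      have := ((hasDerivAt_pow 2 u).const_mul (‖w‖^2)).div_const 2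
      exact this.congr_deriv (by push_cast; ring))
    (fun u hu => by
      have h1 := hpos u hu.1
      have hn : 1 ≤ ‖1 + (u:ℂ) * w‖ := h1.trans (re_le_norm _)
      have hne : 1 + (u:ℂ) * w ≠ 0 := by intro h; rw [h] at hn; norm_num at hn
      have e : w / (1 + (u:ℂ) * w) - w = - (u * w^2) / (1 + (u:ℂ) * w) := by
        rw [eq_div_iff hne, sub_mul, div_mul_cancel₀ _ hne]; ring
      rw [e, norm_div, norm_neg, norm_mul, norm_pow, Complex.norm_real, Real.norm_of_nonneg hu.1]
      rw [div_le_iff₀ (by linarith)]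
      have : 0 ≤ u * ‖w‖^2 := mul_nonneg hu.1 (by positivity)
      nlinarith) (right_mem_Icc.mpr zero_le_one)
  simpa using this

theorem trap_bound (w : ℂ) (hw : 0 < w.re) :
    ‖log (w + 1) - log w - (1 / w + 1 / (w + 1)) / 2‖ ≤ 1 / (6 * ‖w‖ ^ 3) := by
  have hpos : ∀ u : ℝ, 0 ≤ u → 0 < (w + (u:ℂ)).re := by
    intro u hu; simp; linarith
  have hw0 : w ≠ 0 := by rintro rfl; simp at hw
  have hne : ∀ u : ℝ, 0 ≤ u → w + (u:ℂ) ≠ 0 := by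
    intro u hu h; have := hpos u hu; rw [h] at this; simp at this
  have hd : ∀ u : ℝ, 0 ≤ u → HasDerivAt
      (fun u : ℝ => log (w + (u:ℂ)) - log w - (u:ℂ) * (1 / w + 1 / (w + (u:ℂ))) / 2)
      (1 / (w + (u:ℂ)) - (1 * (1 / w + 1 / (w + (u:ℂ))) + (u:ℂ) * (- 1 / (w + (u:ℂ))^2)) / 2) u := by
    intro u hu
    have h0 : HasDerivAt (fun u : ℝ => (u:ℂ)) 1 u := by
      exact (Complex.ofRealCLM.hasDerivAt (x := u))
    have h1 := h0.const_add w
    have h2 := h1.clog_real (slitPlane_of_re_pos (hpos u hu))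
    have h3 := (h1.inv (hne u hu)).const_add (1 / w)
    have h4 := (h0.mul h3).div_const 2
    have h5 := (h2.sub_const (log w)).sub h4
    simpa [one_div, Pi.mul_def, Pi.sub_def] using h5
  have hwn : 0 < ‖w‖ := norm_pos_iff.mpr hw0
  have := image_norm_le_of_norm_deriv_right_le_deriv_boundary (a := 0) (b := 1)
    (f := fun u : ℝ => log (w + (u:ℂ)) - log w - (u:ℂ) * (1 / w + 1 / (w + (u:ℂ))) / 2)
    (f' := fun u => (1 / (w + (u:ℂ)) - (1 * (1 / w + 1 / (w + (u:ℂ))) + (u:ℂ) * (- 1 / (w + (u:ℂ))^2)) / 2))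
    (B := fun u => u^3 / (6 * ‖w‖^3)) (B' := fun u => u^2 / (2 * ‖w‖^3))
    (fun u hu => (hd u hu.1).continuousAt.continuousWithinAt)
    (fun u hu => (hd u hu.1).hasDerivWithinAt) (by simp)
    (fun u => by
      have := (hasDerivAt_pow 3 u).div_const (6 * ‖w‖^3)
      exact this.congr_deriv (by push_cast; field_simp; ring))
    (fun u hu => by
      have h1 := hne u hu.1
      have e : (1 / (w + (u:ℂ)) - (1 * (1 / w + 1 / (w + (u:ℂ))) + (u:ℂ) * (- 1 / (w + (u:ℂ))^2)) / 2)
        = - (u^2) / (2 * w * (w + u)^2) := by field_simp; ring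
      rw [e, norm_div, norm_neg, norm_mul, norm_mul, norm_pow, norm_pow, Complex.norm_real, Real.norm_of_nonneg hu.1]
      simp only [Complex.norm_ofNat]
      apply div_le_div_of_nonneg_left (by positivity) (by positivity)
      have hle : ‖w‖ ≤ ‖w + u‖ := by
        apply Real.le_sqrt_of_sq_le _ |>.trans_eq rfl
        rw [Complex.sq_norm, normSq_apply, normSq_apply]
        have := hu.1
        simp
        nlinarith
      have : ‖w‖^2 ≤ ‖w + u‖^2 := by gcongr
      nlinarith) (right_mem_Icc.mpr zero_le_one)
  simpa using this

noncomputable def hk (k : ℕ) (z : ℂ) : ℂ :=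
  z * ((Real.log (k + 2) - Real.log (k + 1) : ℝ) : ℂ) - log (1 + z / (k + 1))

theorem hk_bound (k : ℕ) (z : ℂ) (hz : 0 ≤ z.re) :
    ‖hk k z‖ ≤ (‖z‖ + ‖z‖^2) / 2 * (1 / ((k:ℝ) + 1)^2) := by
  have hk1 : (0:ℝ) < (k:ℝ) + 1 := by positivity
  set w : ℂ := z / (k + 1)
  have hwre : 0 ≤ w.re := by
    have : w = z / (((k:ℝ) + 1 : ℝ) : ℂ) := by simp [w]
    rw [this, Complex.div_ofReal_re]; positivity
  have h1 := log_one_add_bound w hwre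
  have h2 := log_one_add_bound ((1 / ((k:ℝ) + 1) : ℝ) : ℂ) (by rw [ofReal_re]; positivity)
  have e2 : log (1 + ((1 / ((k:ℝ) + 1) : ℝ) : ℂ)) = ((Real.log (k + 2) - Real.log (k + 1) : ℝ) : ℂ) := by
    rw [← ofReal_one, ← ofReal_add, ← ofReal_log (by positivity), ← Real.log_div (by positivity) (by positivity)]
    congr 2; field_simp; ring
  rw [e2, Complex.norm_real, Real.norm_of_nonneg (by positivity)] at h2
  have e3 : hk k z = z * (((Real.log (k + 2) - Real.log (k + 1) : ℝ) : ℂ) - ((1 / ((k:ℝ) + 1) : ℝ) : ℂ)) - (log (1 + w) - w) := by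
    simp only [hk, w]; push_cast; ring
  have hwn : ‖w‖ = ‖z‖ / (k + 1) := by
    simp only [w]; rw [norm_div]
    congr 1
    have : ((k:ℂ) + 1) = (((k:ℝ) + 1 : ℝ) : ℂ) := by simp
    rw [this, Complex.norm_real, Real.norm_of_nonneg hk1.le]
  rw [e3]
  refine (norm_sub_le _ _).trans ?_
  rw [norm_mul]
  have h3 := mul_le_mul_of_nonneg_left h2 (norm_nonneg z)
  rw [hwn] at h1
  calc _ ≤ ‖z‖ * ((1 / ((k:ℝ) + 1))^2 / 2) + (‖z‖ / (k + 1))^2 / 2 := add_le_add h3 h1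
    _ = _ := by field_simp

theorem hk_sum (n : ℕ) : ∑ k ∈ Finset.range n, ((Real.log (k + 2) - Real.log (k + 1) : ℝ) : ℂ)
    = (Real.log (n + 1) : ℂ) := by
  rw [← ofReal_sum]
  congr 1
  induction n with
  | zero => simp
  | succ n ih => rw [Finset.sum_range_succ, ih]; push_cast; ring_nf

theorem exp_hk (z : ℂ) (hz : 0 < z.re) (n : ℕ) :
    exp (∑ k ∈ Finset.range n, hk k z) = (z * GammaSeq z (n + 1)) * ((z + n + 1) / (n + 1)) := by
  have hz0 : z ≠ 0 := by rintro rfl; simp at hz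
  have hne : ∀ j : ℕ, z + j ≠ 0 := by
    intro j h; have := congrArg re h; simp at this
    have h2 : (0:ℝ) ≤ j := by positivity
    linarith
  have hn1 : ((n:ℂ) + 1) ≠ 0 := by exact_mod_cast Nat.succ_ne_zero n
  have e1 : exp (∑ k ∈ Finset.range n, hk k z) = ((n:ℂ) + 1) ^ z * (n.factorial : ℂ) /
      ∏ j ∈ Finset.range n, (z + (j + 1)) := by
    simp only [hk]
    rw [Finset.sum_sub_distrib, exp_sub, ← Finset.mul_sum, hk_sum n, exp_sum]
    rw [cpow_def_of_ne_zero hn1]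
    have : log ((n:ℂ) + 1) = (Real.log (n + 1) : ℂ) := by
      rw [ofReal_log (by positivity)]; push_cast; rfl
    rw [this, mul_comm z, mul_div_assoc]
    congr 1
    have e2 : ∀ k ∈ Finset.range n, exp (log (1 + z / (k + 1))) = (z + (k + 1)) / (k + 1) := by
      intro k _
      have hk1 : ((k:ℂ) + 1) ≠ 0 := by exact_mod_cast Nat.succ_ne_zero k
      have : (1 + z / (k + 1)) = (z + (k + 1)) / (k + 1) := by field_simp; ring
      rw [this, exp_log]
      apply div_ne_zero _ hk1
      have := hne (k + 1); push_cast at this; exact this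
    rw [Finset.prod_congr rfl e2, Finset.prod_div_distrib]
    have : ∏ x ∈ Finset.range n, ((x:ℂ) + 1) = n.factorial := by
      rw [← Finset.prod_range_add_one_eq_factorial]; push_cast; rfl
    rw [this, div_div_eq_mul_div, mul_div_assoc]
  rw [e1, GammaSeq, Finset.prod_range_succ, Finset.prod_range_succ', Nat.factorial_succ]
  have h1 : ∏ j ∈ Finset.range n, (z + (j + 1)) ≠ 0 := by
    rw [Finset.prod_ne_zero_iff]; intro j _
    have := hne (j + 1); push_cast at this; exact this
  have h2 := hne (n + 1)
  push_cast at h2 ⊢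
  have h3 : z + n + 1 ≠ 0 := by rw [add_assoc]; exact h2
  rw [add_zero]
  field_simp
  ring

theorem digamma_hasSum (z : ℂ) (hz : 0 < z.re) :
    HasSum (fun k : ℕ => ((Real.log (k + 2) - Real.log (k + 1) : ℝ) : ℂ) - 1 / (z + k + 1)) (digamma z + 1 / z) := by
  set U : Set ℂ := {w | 0 < w.re} ∩ ball 0 (‖z‖ + 1)
  have hU : IsOpen U := (isOpen_lt continuous_const continuous_re).inter isOpen_ball
  have hzU : z ∈ U := ⟨hz, by simp⟩
  set M := ((‖z‖ + 1) + (‖z‖ + 1)^2) / 2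
  have hu : Summable (fun k : ℕ => M * (1 / ((k:ℝ) + 1)^2)) := by
    apply Summable.mul_left
    have := (summable_nat_add_iff 1).mpr (Real.summable_one_div_nat_pow.mpr (show 1 < 2 by norm_num))
    simpa using this
  have hbd : ∀ (k : ℕ) (w : ℂ), w ∈ U → ‖hk k w‖ ≤ M * (1 / ((k:ℝ) + 1)^2) := by
    intro k w hw
    refine (hk_bound k w hw.1.le).trans ?_
    have : ‖w‖ ≤ ‖z‖ + 1 := by have := hw.2; simp at this; linarith
    apply mul_le_mul_of_nonneg_right _ (by positivity)
    simp only [M]; gcongr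
  have hder : ∀ (k : ℕ) (w : ℂ), w ∈ U → HasDerivAt (hk k)
      (((Real.log (k + 2) - Real.log (k + 1) : ℝ) : ℂ) - 1 / (w + k + 1)) w := by
    intro k w hw
    have hk1 : ((k:ℂ) + 1) ≠ 0 := by exact_mod_cast Nat.succ_ne_zero k
    have h1 := (hasDerivAt_id w).mul_const (((Real.log (k + 2) - Real.log (k + 1) : ℝ) : ℂ))
    have hre : 0 < (1 + w / (k + 1)).re := by
      have : w / ((k:ℂ) + 1) = w / (((k:ℝ) + 1 : ℝ) : ℂ) := by simp
      rw [this, add_re, one_re, Complex.div_ofReal_re]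
      have := hw.1
      simp only [mem_ofPred_eq] at this
      positivity
    have h2 := (((hasDerivAt_id w).div_const ((k:ℂ) + 1)).const_add 1).clog (slitPlane_of_re_pos hre)
    have h3 := h1.sub h2
    have e : (1 / (k + 1)) / (1 + w / (k + 1)) = 1 / (w + k + 1) := by
      have : (1 + w / (k + 1)) ≠ 0 := by intro h; rw [h] at hre; simp at hre
      have h' : w + k + 1 ≠ 0 := by
        intro h'; apply this; field_simp; linear_combination h'
      rw [div_div, mul_add, mul_one, mul_div_cancel₀ _ hk1]; congr 1; ring
    simp only [id] at h3
    rw [e, one_mul] at h3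
    exact h3
  have hs := Complex.hasSum_deriv_of_summable_norm hu
    (fun k w hw => (hder k w hw).differentiableAt.differentiableWithinAt) hU hbd hzU
  set S : ℂ → ℂ := fun w => ∑' k, hk k w
  have hSdiff : DifferentiableAt ℂ S z := by
    exact (Complex.differentiableOn_tsum_of_summable_norm hu
      (fun k w hw => (hder k w hw).differentiableAt.differentiableWithinAt) hU hbd).differentiableAt
      (hU.mem_nhds hzU)
  have hexp : ∀ w ∈ U, exp (S w) = w * Gamma w := by
    intro w hw
    have hsm : Summable (fun k => hk k w) := Summable.of_norm_bounded hu (fun k => hbd k w hw)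
    have t1 : Tendsto (fun n => exp (∑ k ∈ Finset.range n, hk k w)) atTop (𝓝 (exp (S w))) :=
      (continuous_exp.tendsto _).comp hsm.hasSum.tendsto_sum_nat
    have t2 : Tendsto (fun n : ℕ => (w * GammaSeq w (n + 1)) * ((w + n + 1) / (n + 1))) atTop
        (𝓝 ((w * Gamma w) * 1)) := by
      apply Tendsto.mul
      · exact ((GammaSeq_tendsto_Gamma w).comp (tendsto_add_atTop_nat 1)).const_mul w
      · have h1 : Tendsto (fun n : ℕ => w * (1 / ((n:ℂ) + 1)) + 1) atTop (𝓝 (w * 0 + 1)) :=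
          (tendsto_one_div_add_atTop_nhds_zero_nat.const_mul w).add_const 1
        rw [mul_zero, zero_add] at h1
        refine h1.congr (fun n => ?_)
        have hn1 : ((n:ℂ) + 1) ≠ 0 := by exact_mod_cast Nat.succ_ne_zero n
        field_simp; ring
    rw [mul_one] at t2
    refine tendsto_nhds_unique t1 (t2.congr (fun n => (exp_hk w hw.1 n).symm))
  have hz0 : z ≠ 0 := by rintro rfl; simp at hz
  have hlog : deriv S z = digamma z + 1 / z := by
    have h1 : HasDerivAt (fun w => exp (S w)) (exp (S z) * deriv S z) z := hSdiff.hasDerivAt.cexp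
    have h2 : (fun w => exp (S w)) =ᶠ[𝓝 z] fun w => w * Gamma w := by
      filter_upwards [hU.mem_nhds hzU] with w hw using hexp w hw
    have hGd : DifferentiableAt ℂ Gamma z := by
      apply differentiableAt_Gamma; intro m h; rw [h] at hz; simp at hz
      have : (0:ℝ) ≤ m := by positivity
      linarith
    have h3 := (hasDerivAt_id z).mul hGd.hasDerivAt
    have h4 := (h1.congr_of_eventuallyEq h2.symm).unique h3
    rw [hexp z hzU] at h4
    have hG0 : Gamma z ≠ 0 := Gamma_ne_zero_of_re_pos hz
    rw [digamma_def, logDeriv_apply]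
    simp only [id] at h4
    field_simp
    linear_combination h4
  rw [hlog] at hs
  refine hs.congr_fun ?_ |> fun h => h
  intro k; exact ((hder k z hzU).deriv).symm

theorem digamma_tendsto (z : ℂ) (hz : 0 < z.re) :
    Tendsto (fun n : ℕ => (Real.log (n + 1) : ℂ) - ∑ k ∈ Finset.range (n + 1), 1 / (z + k)) atTop (𝓝 (digamma z)) := by
  have h := (digamma_hasSum z hz).tendsto_sum_nat.sub_const (1 / z)
  rw [add_sub_cancel_right] at h
  refine h.congr (fun n => ?_)
  rw [Finset.sum_sub_distrib, hk_sum n, Finset.sum_range_succ' _ n]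
  push_cast
  simp only [add_zero, add_assoc]
  ring

end

section
open Complex Metric Set Filter Topology

theorem inv_cube_sum (y : ℝ) (hy : 0 < y) (n : ℕ) :
    ∑ k ∈ Finset.range n, 1 / (√((k:ℝ)^2 + y^2))^3 ≤ 1 / y^3 + 1 / y^2 := by
  have hder : ∀ u : ℝ, HasDerivAt (fun u : ℝ => u / (y^2 * √(u^2 + y^2))) (1 / (√(u^2 + y^2))^3) u := by
    intro u
    have hp : 0 < u^2 + y^2 := by positivity
    have hs : 0 < √(u^2 + y^2) := Real.sqrt_pos.mpr hp
    have h1 : HasDerivAt (fun u : ℝ => u^2 + y^2) (2 * u) u := by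
      simpa using (hasDerivAt_pow 2 u).add_const (y^2)
    have h2 := (h1.sqrt hp.ne').const_mul (y^2)
    have h3 := (hasDerivAt_id u).div h2 (by positivity)
    refine h3.congr_deriv ?_
    have hsq : √(u^2 + y^2)^2 = u^2 + y^2 := Real.sq_sqrt hp.le
    simp only [id]
    set r := √(u^2 + y^2)
    field_simp
    linear_combination hsq
  have key : ∀ k : ℕ, 1 / (√(((k+1:ℕ):ℝ)^2 + y^2))^3 ≤
      ((k+1:ℕ):ℝ) / (y^2 * √(((k+1:ℕ):ℝ)^2 + y^2)) - (k:ℝ) / (y^2 * √((k:ℝ)^2 + y^2)) := by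
    intro k
    have hlt : (k:ℝ) < ((k+1:ℕ):ℝ) := by push_cast; linarith
    obtain ⟨c, hc, h⟩ := exists_hasDerivAt_eq_slope (fun u : ℝ => u / (y^2 * √(u^2 + y^2)))
      (fun u => 1 / (√(u^2 + y^2))^3) hlt (fun u _ => (hder u).continuousAt.continuousWithinAt)
      (fun u _ => hder u)
    have e : ((k+1:ℕ):ℝ) - k = 1 := by push_cast; ring
    rw [e, div_one] at h
    rw [← h]
    have hk0 : (0:ℝ) ≤ k := by positivity
    have hc0 : 0 < c := lt_of_le_of_lt hk0 hc.1
    apply one_div_le_one_div_of_le (by positivity)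
    have : c^2 ≤ ((k+1:ℕ):ℝ)^2 := by apply pow_le_pow_left₀ hc0.le hc.2.le
    gcongr
  have hup : ∀ k : ℕ, (k:ℝ) / (y^2 * √((k:ℝ)^2 + y^2)) ≤ 1 / y^2 := by
    intro k
    rw [div_le_div_iff₀ (by positivity) (by positivity)]
    have : (k:ℝ) ≤ √((k:ℝ)^2 + y^2) := Real.le_sqrt_of_sq_le (by nlinarith)
    nlinarith [sq_nonneg y]
  cases n with
  | zero => simp; positivity
  | succ n =>
    rw [Finset.sum_range_succ']
    have h1 : ∑ k ∈ Finset.range n, 1 / (√(((k+1:ℕ):ℝ)^2 + y^2))^3 ≤ (n:ℝ) / (y^2 * √((n:ℝ)^2 + y^2)) := by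
      refine (Finset.sum_le_sum (fun k _ => key k)).trans ?_
      rw [Finset.sum_range_sub (fun k : ℕ => (k:ℝ) / (y^2 * √((k:ℝ)^2 + y^2)))]
      simp
    have h2 : √(((0:ℕ):ℝ)^2 + y^2) = y := by simp [Real.sqrt_sq hy.le]
    rw [h2]
    linarith [hup n]

theorem log_shift_tendsto (z : ℂ) (hz : 0 < z.re) :
    Tendsto (fun n : ℕ => (Real.log (n + 1) : ℂ) - log (z + n)) atTop (𝓝 0) := by
  have h1 : Tendsto (fun n : ℕ => 1 + (z - 1) * (1 / ((n:ℂ) + 1))) atTop (𝓝 (1 + (z - 1) * 0)) :=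
    (tendsto_one_div_add_atTop_nhds_zero_nat.const_mul (z - 1)).const_add 1
  rw [mul_zero, add_zero] at h1
  have h2 := (h1.clog (by simp [slitPlane])).neg
  rw [log_one, neg_zero] at h2
  refine h2.congr (fun n => ?_)
  have hn1 : ((n:ℂ) + 1) ≠ 0 := by exact_mod_cast Nat.succ_ne_zero n
  have e : z + n = (((n:ℝ) + 1 : ℝ) : ℂ) * (1 + (z - 1) * (1 / ((n:ℂ) + 1))) := by
    push_cast; field_simp; ring
  have hne : 1 + (z - 1) * (1 / ((n:ℂ) + 1)) ≠ 0 := by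
    intro h0; rw [h0, mul_zero] at e
    have := congrArg re e; simp at this
    have h3 : (0:ℝ) ≤ n := by positivity
    linarith
  rw [e, log_ofReal_mul (by positivity) hne]
  ring


theorem trap_sum (z : ℂ) (n : ℕ) :
    ∑ k ∈ Finset.range n, (log (z + k + 1) - log (z + k) - (1 / (z + k) + 1 / (z + k + 1)) / 2)
      = log (z + n) - log z - ∑ k ∈ Finset.range (n + 1), 1 / (z + k) + (1 / z + 1 / (z + n)) / 2 := by
  induction n with
  | zero => simp
  | succ n ih =>
    rw [Finset.sum_range_succ, ih, Finset.sum_range_succ _ (n+1)]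
    push_cast
    simp only [add_assoc]
    ring

theorem trap_tendsto (z : ℂ) (hz : 0 < z.re) :
    Tendsto (fun n : ℕ => ∑ k ∈ Finset.range n, (log (z + k + 1) - log (z + k) - (1 / (z + k) + 1 / (z + k + 1)) / 2))
      atTop (𝓝 (digamma z - log z + 1 / (2 * z))) := by
  have h1 := digamma_tendsto z hz
  have h2 := log_shift_tendsto z hz
  have h3 : Tendsto (fun n : ℕ => 1 / (z + n)) atTop (𝓝 0) := by
    have : Tendsto (fun n : ℕ => ‖1 / (z + n)‖) atTop (𝓝 0) := by
      refine squeeze_zero' (Eventually.of_forall fun _ => norm_nonneg _) (g := fun n : ℕ => 1 / (n:ℝ)) ?_ tendsto_one_div_atTop_nhds_zero_nat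
      filter_upwards [eventually_ge_atTop 1] with n hn
      rw [norm_div, norm_one]
      have hn' : (1:ℝ) ≤ n := by exact_mod_cast hn
      apply one_div_le_one_div_of_le (by linarith)
      refine le_trans ?_ (re_le_norm _)
      simp; linarith
    exact tendsto_zero_iff_norm_tendsto_zero.mpr this
  have h4 := ((h1.sub h2).sub_const (log z)).add ((h3.const_add (1/z)).div_const 2)
  have e : digamma z - 0 - log z + (1 / z + 0) / 2 = digamma z - log z + 1 / (2 * z) := by
    rw [sub_zero, add_zero, div_div, mul_comm z 2]
  rw [e] at h4
  refine h4.congr (fun n => ?_)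
  rw [trap_sum]; ring

theorem digamma_bound (z : ℂ) (hz : 0 < z.re) (y : ℝ) (hy : 0 < y) (hzy : y ≤ |z.im|) :
    ‖digamma z - log z + 1 / (2 * z)‖ ≤ (1 / y^3 + 1 / y^2) / 6 := by
  refine le_of_tendsto (trap_tendsto z hz).norm (Eventually.of_forall fun n => ?_)
  refine (norm_sum_le _ _).trans ?_
  have h1 : ∀ k ∈ Finset.range n, ‖log (z + k + 1) - log (z + k) - (1 / (z + k) + 1 / (z + k + 1)) / 2‖
      ≤ (1 / (√((k:ℝ)^2 + y^2))^3) * (1/6) := by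
    intro k _
    have hk0 : (0:ℝ) ≤ k := by positivity
    refine (trap_bound (z + k) (by simp; linarith)).trans ?_
    rw [mul_comm 6, ← one_div_mul_one_div]
    apply mul_le_mul_of_nonneg_right _ (by norm_num)
    have hp : 0 < (k:ℝ)^2 + y^2 := by positivity
    apply one_div_le_one_div_of_le (by positivity)
    have : √((k:ℝ)^2 + y^2) ≤ ‖z + k‖ := by
      apply Real.sqrt_le_sqrt
      rw [normSq_apply]
      simp
      have : y^2 ≤ z.im * z.im := by rw [← sq, ← sq_abs z.im]; gcongr
      nlinarith
    gcongr
  refine (Finset.sum_le_sum h1).trans ?_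
  rw [← Finset.sum_mul]
  have := inv_cube_sum y hy n
  linarith

theorem digamma_re_le (x : ℝ) (hx : 0 < x) : (digamma (x:ℂ)).re ≤ Real.log x - 1 / (2 * x) := by
  have h := (continuous_re.tendsto _).comp (trap_tendsto (x:ℂ) (by simpa using hx))
  have h2 : (digamma (x:ℂ) - log (x:ℂ) + 1 / (2 * (x:ℂ))).re ≤ 0 := by
    refine le_of_tendsto h (Eventually.of_forall fun n => ?_)
    simp only [Function.comp, re_sum]
    apply Finset.sum_nonpos
    intro k _
    set w : ℝ := x + k
    have hw : 0 < w := by positivity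
    have e : (log ((x:ℂ) + k + 1) - log ((x:ℂ) + k) - (1 / ((x:ℂ) + k) + 1 / ((x:ℂ) + k + 1)) / 2)
       = ((Real.log (w + 1) - Real.log w - (1 / w + 1 / (w + 1)) / 2 : ℝ) : ℂ) := by
      have e1 : ((x:ℂ) + k) = (w : ℂ) := by simp [w]
      rw [e1]
      have e2 : log ((w:ℂ) + 1) = (Real.log (w + 1) : ℂ) := by rw [ofReal_log (by linarith)]; push_cast; rfl
      rw [e2, ← ofReal_log hw.le]; push_cast; rfl
    rw [e, ofReal_re]
    have hl : Real.log (w + 1) - Real.log w ≤ (1 / w + 1 / (w + 1)) / 2 := by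
      rw [← Real.log_div (by positivity) (by positivity)]
      set q := (w + 1) / w
      have hq : 1 ≤ q := by rw [le_div_iff₀ hw]; linarith

      have : Real.log q ≤ (q - 1 / q) / 2 := by
        have hd : ∀ u : ℝ, 0 < u → HasDerivAt (fun u : ℝ => (u - u⁻¹) / 2 - Real.log u) ((1 + 1 / u^2) / 2 - u⁻¹) u := by
          intro u hu
          have := (((hasDerivAt_id u).sub (hasDerivAt_inv hu.ne')).div_const 2).sub (Real.hasDerivAt_log hu.ne')
          refine this.congr_deriv ?_
          simp
        have hm : MonotoneOn (fun u : ℝ => (u - u⁻¹) / 2 - Real.log u) (Ici 1) := by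
          apply monotoneOn_of_deriv_nonneg (convex_Ici 1)
          · intro u hu; exact (hd u (lt_of_lt_of_le one_pos hu)).continuousAt.continuousWithinAt
          · intro u hu; rw [interior_Ici] at hu; exact (hd u (lt_trans one_pos hu)).differentiableAt.differentiableWithinAt
          · intro u hu; rw [interior_Ici] at hu
            have hu0 : 0 < u := lt_trans one_pos hu
            rw [(hd u hu0).deriv]
            have : (1 + 1 / u^2) / 2 - u⁻¹ = (1 - 1/u)^2 / 2 := by field_simp; ring
            rw [this]; positivity
        have := hm (show (1:ℝ) ∈ Ici 1 by simp) (show q ∈ Ici 1 from hq) hq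
        simp only [Real.log_one, inv_one, sub_self, zero_div] at this
        rw [one_div]; linarith
      refine this.trans (le_of_eq ?_)
      simp only [q]; field_simp; ring
    linarith
  have e : (digamma (x:ℂ) - log (x:ℂ) + 1 / (2 * (x:ℂ))).re = (digamma (x:ℂ)).re - Real.log x + 1 / (2 * x) := by
    rw [← ofReal_log hx.le]
    have : (1 / (2 * (x:ℂ))) = ((1 / (2 * x) : ℝ) : ℂ) := by push_cast; rfl
    rw [this, add_re, sub_re, ofReal_re, ofReal_re]
  rw [e] at h2; linarith

theorem le_digamma_re (x : ℝ) (hx : 0 < x) : Real.log x - 1 / x ≤ (digamma (x:ℂ)).re := by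
  have h := (continuous_re.tendsto _).comp (digamma_tendsto (x:ℂ) (by simpa using hx))
  have h2 : Tendsto (fun n : ℕ => ((Real.log (n + 1) : ℂ) - log ((x:ℂ) + n)).re + (Real.log x - 1 / x)) atTop (𝓝 ((0:ℂ).re + (Real.log x - 1 / x))) :=
    ((continuous_re.tendsto _).comp (log_shift_tendsto (x:ℂ) (by simpa using hx))).add_const _
  rw [zero_re, zero_add] at h2
  refine le_of_tendsto_of_tendsto' h2 h (fun n => ?_)
  simp only [Function.comp]
  have e1 : log ((x:ℂ) + n) = (Real.log (x + n) : ℂ) := by rw [ofReal_log (by positivity)]; push_cast; rfl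
  have e2 : ∑ k ∈ Finset.range (n + 1), 1 / ((x:ℂ) + k) = ((∑ k ∈ Finset.range (n + 1), 1 / (x + k) : ℝ) : ℂ) := by
    push_cast; rfl
  rw [e1, e2, sub_re, sub_re, ofReal_re, ofReal_re, ofReal_re]
  suffices h : ∑ k ∈ Finset.range (n + 1), 1 / (x + k) ≤ 1 / x + Real.log (x + n) - Real.log x by linarith
  induction n with
  | zero => simp
  | succ n ih =>
    rw [Finset.sum_range_succ]
    have ih' := ih (by rw [ofReal_log (by positivity)]; push_cast; rfl) (by push_cast; rfl)
    have hw : 0 < x + n := by positivity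
    have : 1 / (x + ((n+1:ℕ):ℝ)) ≤ Real.log (x + ((n+1:ℕ):ℝ)) - Real.log (x + n) := by
      push_cast
      rw [← Real.log_div (by positivity) (by positivity)]
      have := Real.one_sub_inv_le_log_of_pos (show 0 < (x + (n+1)) / (x + n) by positivity)
      refine le_trans (le_of_eq ?_) this
      rw [inv_div]; field_simp; ring
    linarith

theorem digamma_shift (z : ℂ) (hz : 0 < z.re) : digamma z = digamma (z + 1) - 1 / z := by
  have h1 := digamma_hasSum z hz
  have h2 := digamma_tendsto z hz
  have h3 := digamma_tendsto (z + 1) (by simp; linarith)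
  have h4 : Tendsto (fun n : ℕ => 1 / (z + 1 + n)) atTop (𝓝 0) := by
    have := (digamma_tendsto (z+1) (by simp; linarith))
    have t := ((this.comp (tendsto_add_atTop_nat 1)).sub this)
    have t2 : Tendsto (fun n : ℕ => (Real.log ((n:ℝ) + 1 + 1) - Real.log ((n:ℝ) + 1) : ℂ)) atTop (𝓝 0) := by
      have hh := log_shift_tendsto 2 (by norm_num)
      have := hh.neg
      rw [neg_zero] at this
      refine this.congr (fun n => ?_)
      have : log ((2:ℂ) + n) = (Real.log ((n:ℝ) + 1 + 1) : ℂ) := by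
        rw [ofReal_log (by positivity)]; push_cast; congr 1; ring
      rw [this]; ring
    have t3 := t2.sub t
    rw [sub_self, sub_zero] at t3
    rw [← tendsto_add_atTop_iff_nat 1]
    refine t3.congr (fun n => ?_)
    simp only [Function.comp]
    rw [Finset.sum_range_succ _ (n+1)]
    push_cast; ring
  have h5 := (h3.sub_const (1/z)).add h4
  rw [add_zero] at h5
  refine tendsto_nhds_unique h2 (h5.congr (fun n => ?_))
  rw [Finset.sum_range_succ' (fun k : ℕ => 1 / (z + k)), Finset.sum_range_succ (fun k : ℕ => 1 / (z + 1 + k))]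
  push_cast
  simp only [add_zero]
  have : ∀ k : ℕ, 1 / (z + ((k:ℂ) + 1)) = 1 / (z + 1 + k) := by intro k; congr 1; ring
  simp only [this]; ring

end

section
open Complex Metric Set Filter Topology

theorem logDeriv_Gammaℝ (s : ℂ) (hs : 0 < s.re) :
    logDeriv Gammaℝ s = - (Real.log Real.pi : ℂ) / 2 + digamma (s / 2) / 2 := by
  have hs2 : 0 < (s / 2).re := by
    have : s / 2 = s / ((2:ℝ):ℂ) := by simp
    rw [this, div_ofReal_re]; positivity
  have hpi : (Real.pi : ℂ) ≠ 0 := by exact_mod_cast Real.pi_ne_zero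
  have hG : DifferentiableAt ℂ Gamma (s / 2) := by
    apply differentiableAt_Gamma; intro m h; rw [h] at hs2; simp at hs2
    have : (0:ℝ) ≤ m := by positivity
    linarith
  have hd2 : HasDerivAt (fun s : ℂ => s / 2) (1 / 2) s := (hasDerivAt_id s).div_const 2
  have h1 : HasDerivAt (fun s : ℂ => Gamma (s / 2)) (deriv Gamma (s/2) * (1/2)) s :=
    hG.hasDerivAt.comp s hd2
  have h2 : HasDerivAt (fun s : ℂ => (Real.pi : ℂ) ^ (-s / 2)) ((Real.pi : ℂ) ^ (-s / 2) * log Real.pi * (-1/2)) s := by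
    have : HasDerivAt (fun s : ℂ => -s / 2) (-1/2) s := (hasDerivAt_neg s).div_const 2
    exact this.const_cpow (Or.inl hpi)
  have e : Gammaℝ = fun s : ℂ => (Real.pi : ℂ) ^ (-s / 2) * Gamma (s / 2) := by
    funext s; exact Gammaℝ_def s
  have h3 := h2.mul h1
  have hg0 : Gamma (s/2) ≠ 0 := Gamma_ne_zero_of_re_pos hs2
  have hp0 : (Real.pi : ℂ) ^ (-s / 2) ≠ 0 := by
    rw [cpow_def_of_ne_zero hpi]; exact exp_ne_zero _
  rw [e, logDeriv_apply]
  rw [show deriv (fun s : ℂ => (Real.pi : ℂ) ^ (-s / 2) * Gamma (s / 2)) s = _ from h3.deriv]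
  rw [digamma_def, logDeriv_apply, ofReal_log Real.pi_pos.le]
  field_simp

theorem logDeriv_xi_eq (s : ℂ) (hs : 0 < s.re) (h1 : s ≠ 1) (hz : riemannZeta s ≠ 0) :
    logDeriv xi s = 1 / s + 1 / (s - 1) + logDeriv Gammaℝ s + logDeriv riemannZeta s := by
  have hs0 : s ≠ 0 := by rintro rfl; simp at hs
  have hs1 : s - 1 ≠ 0 := sub_ne_zero.mpr h1
  have hU : IsOpen {w : ℂ | 0 < w.re ∧ w ≠ 1} := (isOpen_lt continuous_const continuous_re).inter isOpen_ne
  have hev : xi =ᶠ[𝓝 s] fun w => (w * (w - 1)) * (Gammaℝ w * riemannZeta w) := by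
    filter_upwards [hU.mem_nhds ⟨hs, h1⟩] with w hw
    rw [xi_eq w hw.1 hw.2]; ring
  have hdz : DifferentiableAt ℂ riemannZeta s := differentiableAt_riemannZeta h1
  have hG0 : Gammaℝ s ≠ 0 := Gammaℝ_ne_zero_of_re_pos hs
  have hdG : DifferentiableAt ℂ Gammaℝ s := by
    have := (differentiable_Gammaℝ_inv s).inv (inv_ne_zero hG0)
    simpa [Pi.inv_def] using this
  have hev2 : logDeriv xi s = logDeriv (fun w => (w * (w - 1)) * (Gammaℝ w * riemannZeta w)) s := by
    rw [logDeriv_apply, logDeriv_apply, hev.deriv_eq, hev.self_of_nhds]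
  rw [hev2]
  rw [logDeriv_mul (f := fun w : ℂ => w * (w - 1)) (g := fun w => Gammaℝ w * riemannZeta w) s
      (mul_ne_zero hs0 hs1) (mul_ne_zero hG0 hz) (by fun_prop) (hdG.mul hdz),
    logDeriv_mul (f := Gammaℝ) (g := riemannZeta) s hG0 hz hdG hdz,
    logDeriv_mul (f := fun w : ℂ => w) (g := fun w : ℂ => w - 1) s hs0 hs1 (by fun_prop) (by fun_prop)]
  have e1 : logDeriv (fun w : ℂ => w) s = 1 / s := by rw [logDeriv_apply]; simp
  have e2 : logDeriv (fun w : ℂ => w - 1) s = 1 / (s - 1) := by rw [logDeriv_apply]; simp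
  rw [e1, e2]; ring

theorem PP_eq (s : ℂ) (hs : 0 < s.re) (h1 : s ≠ 1) (hz : riemannZeta s ≠ 0) :
    PP s = (1 / s).re + (1 / (s - 1)).re - Real.log Real.pi / 2 + (digamma (s / 2)).re / 2
      + (logDeriv riemannZeta s).re := by
  rw [PP, logDeriv_xi_eq s hs h1 hz, logDeriv_Gammaℝ s hs]
  simp only [add_re]
  have e1 : (-(Real.log Real.pi : ℂ) / 2).re = - Real.log Real.pi / 2 := by
    have : (-(Real.log Real.pi : ℂ) / 2) = ((- Real.log Real.pi / 2 : ℝ) : ℂ) := by push_cast; rfl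
    rw [this, ofReal_re]
  have e2 : (digamma (s / 2) / 2).re = (digamma (s/2)).re / 2 := by
    have : digamma (s / 2) / 2 = digamma (s / 2) / ((2:ℝ) : ℂ) := by simp
    rw [this, div_ofReal_re]
  rw [e1, e2]; ring

end

section
open Complex Metric Set Filter Topology


theorem hasSum_zeta_logDeriv (σ t : ℝ) (hσ : 1 < σ) :
    HasSum (fun n : ℕ => ArithmeticFunction.vonMangoldt n * ((n:ℝ) ^ (-σ) * Real.cos (t * Real.log n)))
      (-(logDeriv riemannZeta (σ + t * I)).re) := by
  have hs : 1 < ((σ:ℂ) + t * I).re := by simpa using hσ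
  have h1 := ArithmeticFunction.LSeriesSummable_vonMangoldt hs
  have h2 := h1.LSeriesHasSum
  have h3 : HasSum _ _ := h2
  rw [ArithmeticFunction.LSeries_vonMangoldt_eq_deriv_riemannZeta_div hs] at h3
  have h4 := h3.mapL reCLM
  have e : reCLM (-deriv riemannZeta (σ + t * I) / riemannZeta (σ + t * I)) = -(logDeriv riemannZeta (σ + t * I)).re := by
    rw [logDeriv_apply, neg_div]; simp
  rw [e] at h4
  refine h4.congr_fun (fun n => ?_)
  rcases Nat.eq_zero_or_pos n with rfl | hn
  · simp
  have hn0 : (0:ℝ) < n := by exact_mod_cast hn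
  rw [LSeries.term_of_ne_zero hn.ne']
  have e2 : (n:ℂ) ^ ((σ:ℂ) + t * I) = ((n:ℝ)^σ : ℝ) * exp ((t * Real.log n : ℝ) * I) := by
    have hnc : (n:ℂ) ≠ 0 := by exact_mod_cast hn.ne'
    rw [cpow_add _ _ hnc, ofReal_cpow hn0.le]
    congr 1
    rw [cpow_def_of_ne_zero hnc, ← ofReal_natCast, ← ofReal_log hn0.le]
    push_cast; congr 1; ring
  have hp : (0:ℝ) < (n:ℝ)^σ := Real.rpow_pos_of_pos hn0 σ
  have e3 : ((ArithmeticFunction.vonMangoldt n : ℝ) : ℂ) / (n:ℂ) ^ ((σ:ℂ) + t * I)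
      = ((ArithmeticFunction.vonMangoldt n * (n:ℝ)^(-σ) : ℝ):ℂ) * exp ((-(t * Real.log n) : ℝ) * I) := by
    rw [e2, Real.rpow_neg hn0.le]
    have : exp ((-(t * Real.log n) : ℝ) * I) = (exp ((t * Real.log n : ℝ) * I))⁻¹ := by
      rw [← exp_neg]; congr 1; push_cast; ring
    rw [this]; push_cast
    rw [div_eq_mul_inv, mul_inv]; ring
  rw [e3, reCLM_apply, re_ofReal_mul, exp_ofReal_mul_I_re, Real.cos_neg]
  ring

theorem log_bounds : 1.097 ≤ Real.log 3 ∧ 1.6 ≤ Real.log 5 ∧ 1.94 ≤ Real.log 7 ∧ 2.39 ≤ Real.log 11 ∧ 2.56 ≤ Real.log 13 := by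
  have h2 := Real.log_two_gt_d9
  have key : ∀ (a : ℝ) (m n : ℕ), 0 < a → (2:ℝ)^m ≤ a^n → m * Real.log 2 ≤ n * Real.log a := by
    intro a m n ha h
    rw [← Real.log_pow, ← Real.log_pow]
    exact Real.log_le_log (by positivity) h
  have a3 := key 3 19 12 (by norm_num) (by norm_num)
  have a5 := key 5 65 28 (by norm_num) (by norm_num)
  have a7 := key 7 14 5 (by norm_num) (by norm_num)
  have a11 := key 11 38 11 (by norm_num) (by norm_num)
  have a13 := key 13 37 10 (by norm_num) (by norm_num)
  push_cast at a3 a5 a7 a11 a13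
  refine ⟨?_, ?_, ?_, ?_, ?_⟩ <;> linarith

theorem zeta_logDeriv_two : (logDeriv riemannZeta 2).re ≤ -0.5 := by
  have h := hasSum_zeta_logDeriv 2 0 (by norm_num)
  simp only [zero_mul, Real.cos_zero, mul_one, ofReal_zero, add_zero] at h
  have h2 := sum_le_hasSum {2, 3, 4, 5, 7, 8, 9, 11, 13} (fun n _ => mul_nonneg ArithmeticFunction.vonMangoldt_nonneg (Real.rpow_nonneg (Nat.cast_nonneg n) _)) h
  have hp : ∀ p : ℕ, p.Prime → ArithmeticFunction.vonMangoldt p = Real.log p :=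
    fun p hp => ArithmeticFunction.vonMangoldt_apply_prime hp
  have e4 : ArithmeticFunction.vonMangoldt 4 = Real.log 2 := by
    have := ArithmeticFunction.vonMangoldt_apply_pow (n := 2) (k := 2) (by norm_num)
    norm_num at this; rw [this, hp 2 (by norm_num)]; norm_num
  have e8 : ArithmeticFunction.vonMangoldt 8 = Real.log 2 := by
    have := ArithmeticFunction.vonMangoldt_apply_pow (n := 2) (k := 3) (by norm_num)
    norm_num at this; rw [this, hp 2 (by norm_num)]; norm_num
  have e9 : ArithmeticFunction.vonMangoldt 9 = Real.log 3 := by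
    have := ArithmeticFunction.vonMangoldt_apply_pow (n := 3) (k := 2) (by norm_num)
    norm_num at this; rw [this, hp 3 (by norm_num)]; norm_num
  have er : ∀ x : ℝ, 0 ≤ x → x ^ (-(2:ℝ)) = 1 / x^2 := by
    intro x hx; rw [Real.rpow_neg hx, one_div]; norm_cast
  rw [Finset.sum_insert (by decide), Finset.sum_insert (by decide), Finset.sum_insert (by decide),
    Finset.sum_insert (by decide), Finset.sum_insert (by decide), Finset.sum_insert (by decide),
    Finset.sum_insert (by decide), Finset.sum_insert (by decide), Finset.sum_singleton,
    e4, e8, e9, hp 2 (by norm_num), hp 3 (by norm_num), hp 5 (by norm_num), hp 7 (by norm_num),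
    hp 11 (by norm_num), hp 13 (by norm_num)] at h2
  simp only [er _ (Nat.cast_nonneg _)] at h2
  obtain ⟨b3, b5, b7, b11, b13⟩ := log_bounds
  have h2' := Real.log_two_gt_d9
  norm_num at h2 b3 b5 b7 b11 b13 ⊢
  linarith

theorem log_pi_ge : 1.1446 ≤ Real.log Real.pi := by
  have h1 := Real.pi_gt_d6

  rw [Real.le_log_iff_exp_le Real.pi_pos]
  have e : Real.exp 1.1446 = Real.exp 1 * Real.exp 0.1446 := by rw [← Real.exp_add]; norm_num
  have h2 := Real.exp_one_lt_d9
  have h3 := Real.exp_bound' (x := 0.1446) (n := 5) (by norm_num) (by norm_num) (by norm_num)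
  norm_num [Finset.sum_range_succ, Nat.factorial] at h3
  rw [e]
  have h4 : Real.exp 0.1446 ≤ 1.15558 := by norm_num; linarith
  calc Real.exp 1 * Real.exp 0.1446 ≤ 2.7182818286 * 1.15558 := by gcongr
    _ ≤ 3.141592 := by norm_num
    _ ≤ _ := h1.le

theorem log_pi_le : Real.log Real.pi ≤ 1.1448 := by
  have h1 := Real.pi_lt_d6
  rw [Real.log_le_iff_le_exp Real.pi_pos]
  have e : Real.exp 1.1448 = Real.exp 1 * Real.exp 0.1448 := by rw [← Real.exp_add]; norm_num
  have h2 := Real.exp_one_gt_d9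
  have h3 := Real.sum_le_exp_of_nonneg (x := 0.1448) (by norm_num) 5
  norm_num [Finset.sum_range_succ, Nat.factorial] at h3
  rw [e]
  have h4 : 1.15580 ≤ Real.exp 0.1448 := by norm_num; linarith
  calc Real.pi ≤ 3.141593 := h1.le
    _ ≤ 2.7182818283 * 1.15580 := by norm_num
    _ ≤ _ := by gcongr

theorem PP_two : PP 2 ≤ 0.144 := by
  rw [PP_eq 2 (by norm_num) (by norm_num) (riemannZeta_ne_zero_of_one_lt_re (by norm_num))]
  have h1 := zeta_logDeriv_two
  have h2 := log_pi_ge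
  have d1 := digamma_shift 1 (by norm_num)
  have d2 := digamma_shift 2 (by norm_num)
  have d3 := digamma_re_le 3 (by norm_num)
  have hl3 : Real.log 3 ≤ 1.099 := by
    have key : (12:ℝ) * Real.log 3 ≤ 12 * 1.099 := by
      have : Real.log ((3:ℝ)^41) ≤ Real.log ((2:ℝ)^65) := Real.log_le_log (by positivity) (by norm_num)
      rw [Real.log_pow, Real.log_pow] at this
      have := Real.log_two_lt_d9
      push_cast at *; linarith
    linarith
  have e : (digamma (2/2)).re ≤ -0.5676 := by
    have : (2:ℂ)/2 = 1 := by norm_num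
    rw [this, d1]
    have : (1:ℂ) + 1 = 2 := by norm_num
    rw [this, d2]
    have : (2:ℂ) + 1 = ((3:ℝ):ℂ) := by norm_num
    rw [this, sub_re, sub_re]
    norm_num at d3 ⊢
    linarith
  have e1 : ((1:ℂ)/2).re = 1/2 := by norm_num
  have e2 : ((1:ℂ)/(2-1)).re = 1 := by norm_num
  rw [e1, e2]
  norm_num at h1 h2 e ⊢
  linarith

theorem Fz_formula (x y β γ : ℝ) :
    Fz (x + y * I) (β + γ * I) = (x - β) / ((x - β)^2 + (y - γ)^2) + (x - 1 + β) / ((x - 1 + β)^2 + (y - γ)^2) := by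
  unfold Fz
  have h : ∀ a b : ℝ, (1 / ((a:ℂ) + b * I)).re = a / (a^2 + b^2) := by
    intro a b
    rw [one_div, inv_re, normSq_apply]; simp; ring
  have e1 : (x:ℂ) + y * I - (β + γ * I) = ((x - β : ℝ) : ℂ) + ((y - γ : ℝ) : ℂ) * I := by push_cast; ring
  have e2 : (x:ℂ) + y * I - 1 + starRingEnd ℂ (β + γ * I) = ((x - 1 + β : ℝ) : ℂ) + ((y - γ : ℝ) : ℂ) * I := by
    simp; ring
  rw [e1, e2, h, h]

theorem Fz_nonneg (s ρ : ℂ) (hs : 1 ≤ s.re) (hρ : xi ρ = 0) : 0 ≤ Fz s ρ := by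
  obtain ⟨h0, h1⟩ := xi_zero_re ρ hρ
  rw [← re_add_im s, ← re_add_im ρ, Fz_formula]
  have : 0 < s.re - ρ.re := by linarith
  have : 0 < s.re - 1 + ρ.re := by linarith
  positivity

theorem xi_conj_zero (ρ : ℂ) (h : xi ρ = 0) : xi (starRingEnd ℂ ρ) = 0 := by
  rw [xi_conj, h, map_zero]


theorem low_zeros (ρ : ℂ) (h : xi ρ = 0) : 4 < |ρ.im| := by
  by_contra hc
  push Not at hc
  obtain ⟨h0, h1⟩ := xi_zero_re ρ h
  have hx2 : xi 2 ≠ 0 := xi_ne_zero_of_one_le 2 (by norm_num)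
  have hpos : ∀ ρ, xi ρ = 0 → 0 ≤ 1 * Fz 2 ρ + 0 * Fz 2 ρ := by
    intro ρ hρ
    have := Fz_nonneg 2 ρ (by norm_num) hρ
    linarith
  have hP := PP_two
  have hF : ∀ γ : ℝ, γ^2 ≤ 16 → 0.15 < (2 - ρ.re) / ((2 - ρ.re)^2 + γ^2) + (2 - 1 + ρ.re) / ((2 - 1 + ρ.re)^2 + γ^2) := by
    intro γ hγ
    have e1 : (2 - ρ.re) / ((2 - ρ.re)^2 + 16) ≤ (2 - ρ.re) / ((2 - ρ.re)^2 + γ^2) := by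
      apply div_le_div_of_nonneg_left (by linarith) _ (by linarith)
      have : 0 < 2 - ρ.re := by linarith
      positivity
    have e2 : (2 - 1 + ρ.re) / ((2 - 1 + ρ.re)^2 + 16) ≤ (2 - 1 + ρ.re) / ((2 - 1 + ρ.re)^2 + γ^2) := by
      apply div_le_div_of_nonneg_left (by linarith) _ (by linarith)
      have : 0 < 2 - 1 + ρ.re := by linarith
      positivity
    have e3 : (2 - ρ.re) / 20 ≤ (2 - ρ.re) / ((2 - ρ.re)^2 + 16) := by
      apply div_le_div_of_nonneg_left (by linarith) (by positivity) (by nlinarith)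
    have e4 : (2 - 1 + ρ.re) / 20 ≤ (2 - 1 + ρ.re) / ((2 - 1 + ρ.re)^2 + 16) := by
      apply div_le_div_of_nonneg_left (by linarith) (by positivity) (by nlinarith)
    have e5 : (2 - ρ.re) / ((2 - ρ.re)^2 + 16) + (2 - 1 + ρ.re) / ((2 - 1 + ρ.re)^2 + 16) > 0.15 := by
      set b := ρ.re
      have d1 : 0 < (2 - b)^2 + 16 := by positivity
      have d2 : 0 < (2 - 1 + b)^2 + 16 := by positivity
      rw [gt_iff_lt, div_add_div _ _ d1.ne' d2.ne', lt_div_iff₀ (by positivity)]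
      nlinarith [mul_pos h0 (sub_pos.mpr h1), mul_nonneg (mul_pos h0 (sub_pos.mpr h1)).le (mul_pos h0 (sub_pos.mpr h1)).le]
    linarith
  have hsq : ρ.im^2 ≤ 16 := by rw [← sq_abs]; nlinarith [abs_nonneg ρ.im]
  have hFρ : ∀ τ : ℂ, τ.re = ρ.re → τ.im^2 = ρ.im^2 → 0.15 < Fz 2 τ := by
    intro τ ht1 ht2
    have := hF τ.im (by rw [ht2]; exact hsq)
    rw [← re_add_im τ, show (2:ℂ) = ((2:ℝ):ℂ) + ((0:ℝ):ℂ) * I by simp, Fz_formula, ht1]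
    rw [zero_sub, neg_sq]; exact this
  by_cases hre : ρ.re = 1/2
  · by_cases him : ρ.im = 0
    · have := PP_linear 1 0 2 2 hx2 hx2 hpos {ρ} (by simpa using h)
      simp only [Finset.sum_singleton, one_mul, zero_mul, add_zero] at this
      have e : Fz 2 ρ = 4/3 := by
        rw [← re_add_im ρ, show (2:ℂ) = ((2:ℝ):ℂ) + ((0:ℝ):ℂ) * I by simp, Fz_formula, hre, him]; norm_num
      rw [e] at this; linarith
    · have hne : ρ ≠ starRingEnd ℂ ρ := by
        intro hh; have := congrArg im hh; simp at this; apply him; linarith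
      have := PP_linear 1 0 2 2 hx2 hx2 hpos {ρ, starRingEnd ℂ ρ} (by
        intro τ hτ; simp at hτ; rcases hτ with rfl | rfl
        · exact h
        · exact xi_conj_zero _ h)
      rw [Finset.sum_pair hne] at this
      have a1 := hFρ ρ rfl rfl
      have a2 := hFρ (starRingEnd ℂ ρ) (by simp) (by simp)
      linarith
  · have := PP_linear_single 1 0 2 2 hx2 hx2 hpos ρ h hre
    have a1 := hFρ ρ rfl rfl
    linarith

end

section
open Complex Metric Set Filter Topology

theorem F_combine (c b Y : ℝ) (h1 : 0 < c - b) (h2 : 0 < c + b) (hY : 0 ≤ Y) :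
    (c - b) / ((c - b)^2 + Y) + (c + b) / ((c + b)^2 + Y)
      = 2 * c * (c^2 - b^2 + Y) / (Y^2 + 2 * (c^2 + b^2) * Y + (c^2 - b^2)^2) := by
  have d1 : 0 < (c - b)^2 + Y := by positivity
  have d2 : 0 < (c + b)^2 + Y := by positivity
  have e : Y^2 + 2 * (c^2 + b^2) * Y + (c^2 - b^2)^2 = ((c - b)^2 + Y) * ((c + b)^2 + Y) := by ring
  rw [e, div_add_div _ _ d1.ne' d2.ne']
  congr 1; ring


theorem stechkin (c b Y : ℝ) (hc : 1/2 ≤ c) (hc2 : c ≤ 0.69) (hb : |b| < 1/2) (hY : 0 ≤ Y) :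
    5/12 * ((6/5 - b) / ((6/5 - b)^2 + Y) + (6/5 + b) / ((6/5 + b)^2 + Y)) ≤
    (c - b) / ((c - b)^2 + Y) + (c + b) / ((c + b)^2 + Y) := by
  obtain ⟨hb1, hb2⟩ := abs_lt.mp hb
  rw [F_combine c b Y (by linarith) (by linarith) hY, F_combine (6/5) b Y (by linarith) (by linarith) hY]
  have hB : b^2 ≤ 1/4 := by nlinarith
  have hB0 : 0 ≤ b^2 := sq_nonneg b
  have hcsq : 1/4 ≤ c^2 := by nlinarith
  have hcb : 0 < c^2 - b^2 := by nlinarith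
  generalize b^2 = B at *
  have d1 : 0 < Y^2 + 2 * (c^2 + B) * Y + (c^2 - B)^2 := by positivity
  have d2 : 0 < Y^2 + 2 * ((6/5)^2 + B) * Y + ((6/5)^2 - B)^2 := by
    have : 0 < ((6/5:ℝ)^2 - B)^2 := by apply pow_pos; norm_num; linarith
    positivity
  rw [← mul_div_assoc, div_le_div_iff₀ d2 d1]
  have k3 : 0 ≤ 2 * c - 1 := by linarith
  have k2 : 0 ≤ 2 * c * (c^2 + B + 2 * (36/25)) - (36/25 + B + 2 * c^2) := by nlinarith
  have k1 : 0 ≤ 2 * c * ((36/25 - B)^2 + 2 * (c^2 - B) * (36/25 + B)) - ((c^2 - B)^2 + 2 * (36/25 - B) * (c^2 + B)) := by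
    have a1 : (36/25 - B)^2 + 2 * (c^2 - B) * (36/25 + B) ≤ 2 * c * ((36/25 - B)^2 + 2 * (c^2 - B) * (36/25 + B)) := by
      have : 0 ≤ (36/25 - B)^2 + 2 * (c^2 - B) * (36/25 + B) := by positivity
      nlinarith
    have hc3 : c^2 ≤ 0.4761 := by nlinarith

    have a2 : 0 ≤ (36/25 - B)^2 + 2 * (c^2 - B) * (36/25 + B) - ((c^2 - B)^2 + 2 * (36/25 - B) * (c^2 + B)) := by
      generalize c^2 = C at *
      nlinarith [mul_nonneg hB0 (sub_nonneg.mpr hB), mul_nonneg hB0 (sub_nonneg.mpr hcsq)]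
    linarith
  have k0 : 0 ≤ (36/25 - B) * (c^2 - B) * (2 * c * (36/25 - B) - (c^2 - B)) := by
    apply mul_nonneg (mul_nonneg (by linarith) hcb.le)
    nlinarith
  have e : 2 * c * (c^2 - B + Y) * (Y^2 + 2 * ((6/5)^2 + B) * Y + ((6/5)^2 - B)^2)
     - 5/12 * (2 * (6/5) * ((6/5)^2 - B + Y)) * (Y^2 + 2 * (c^2 + B) * Y + (c^2 - B)^2)
     = (2 * c - 1) * Y^3 + (2 * c * (c^2 + B + 2 * (36/25)) - (36/25 + B + 2 * c^2)) * Y^2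
      + (2 * c * ((36/25 - B)^2 + 2 * (c^2 - B) * (36/25 + B)) - ((c^2 - B)^2 + 2 * (36/25 - B) * (c^2 + B))) * Y
      + (36/25 - B) * (c^2 - B) * (2 * c * (36/25 - B) - (c^2 - B)) := by ring
  have : 0 ≤ (2 * c - 1) * Y^3 + (2 * c * (c^2 + B + 2 * (36/25)) - (36/25 + B + 2 * c^2)) * Y^2
      + (2 * c * ((36/25 - B)^2 + 2 * (c^2 - B) * (36/25 + B)) - ((c^2 - B)^2 + 2 * (36/25 - B) * (c^2 + B))) * Y
      + (36/25 - B) * (c^2 - B) * (2 * c * (36/25 - B) - (c^2 - B)) := by positivity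
  linarith

theorem Fz_stechkin (d t : ℝ) (hd : 0 ≤ d) (hd2 : d ≤ 0.19) (ρ : ℂ) (hρ : xi ρ = 0) :
    0 ≤ 1 * Fz (((1 + d : ℝ):ℂ) + t * I) ρ + (-(5/12)) * Fz (((1.7 : ℝ):ℂ) + t * I) ρ := by
  obtain ⟨h0, h1⟩ := xi_zero_re ρ hρ
  have hs := stechkin (1/2 + d) (ρ.re - 1/2) ((t - ρ.im)^2) (by linarith) (by linarith)
    (by rw [abs_lt]; constructor <;> linarith) (sq_nonneg _)
  have e := Fz_formula (1+d) t ρ.re ρ.im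
  have e' := Fz_formula 1.7 t ρ.re ρ.im
  rw [re_add_im] at e e'
  rw [e, e']
  have r1 : 1 + d - ρ.re = 1/2 + d - (ρ.re - 1/2) := by ring
  have r2 : 1 + d - 1 + ρ.re = 1/2 + d + (ρ.re - 1/2) := by ring
  have r3 : 1.7 - ρ.re = 6/5 - (ρ.re - 1/2) := by ring
  have r4 : 1.7 - 1 + ρ.re = 6/5 + (ρ.re - 1/2) := by ring
  rw [r1, r2, r3, r4]; linarith

noncomputable def RR (d t : ℝ) : ℝ :=
  (PP (((1 + d : ℝ):ℂ) + t * I) - (logDeriv riemannZeta (((1 + d : ℝ):ℂ) + t * I)).re)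
   - 5/12 * (PP (((1.7 : ℝ):ℂ) + t * I) - (logDeriv riemannZeta (((1.7 : ℝ):ℂ) + t * I)).re)
noncomputable def WW (d t : ℝ) : ℝ :=
  -(logDeriv riemannZeta (((1 + d : ℝ):ℂ) + t * I)).re - 5/12 * (-(logDeriv riemannZeta (((1.7 : ℝ):ℂ) + t * I)).re)

theorem WW_le (d t : ℝ) (hd : 0 < d) (hd2 : d ≤ 0.19) : WW d t ≤ RR d t := by
  have h := PP_linear_nonneg 1 (-(5/12)) (((1 + d : ℝ):ℂ) + t * I) (((1.7 : ℝ):ℂ) + t * I)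
    (xi_ne_zero_of_one_le _ (by simp; linarith)) (xi_ne_zero_of_one_le _ (by simp; norm_num))
    (fun ρ hρ => Fz_stechkin d t hd.le hd2 ρ hρ)
  unfold WW RR; linarith

theorem WW_le_zero (d : ℝ) (hd : 0 < d) (hd2 : d ≤ 0.19) (ρ : ℂ) (hρ : xi ρ = 0) (hre : 1/2 < ρ.re) :
    WW d ρ.im ≤ RR d ρ.im - 1 / (d + (1 - ρ.re)) := by
  have h := PP_linear_single 1 (-(5/12)) (((1 + d : ℝ):ℂ) + ρ.im * I) (((1.7 : ℝ):ℂ) + ρ.im * I)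
    (xi_ne_zero_of_one_le _ (by simp; linarith)) (xi_ne_zero_of_one_le _ (by simp; norm_num))
    (fun ρ' hρ' => Fz_stechkin d ρ.im hd.le hd2 ρ' hρ') ρ hρ hre.ne'
  obtain ⟨h0, h1⟩ := xi_zero_re ρ hρ
  have hF : 1 / (d + (1 - ρ.re)) ≤ 1 * Fz (((1 + d : ℝ):ℂ) + ρ.im * I) ρ + (-(5/12)) * Fz (((1.7 : ℝ):ℂ) + ρ.im * I) ρ := by
    have e := Fz_formula (1+d) ρ.im ρ.re ρ.im
    have e' := Fz_formula 1.7 ρ.im ρ.re ρ.im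
    rw [re_add_im] at e e'
    rw [e, e', sub_self, zero_pow two_ne_zero, add_zero, add_zero, add_zero, add_zero]
    have q : ∀ a : ℝ, 0 < a → a / a^2 = 1 / a := by intro a ha; field_simp
    rw [q _ (by linarith), q _ (by linarith), q _ (by linarith), q _ (by linarith)]
    have e1 : 1 + d - ρ.re = d + (1 - ρ.re) := by ring
    rw [e1]
    have : 5/12 * (1 / (1.7 - ρ.re) + 1 / (1.7 - 1 + ρ.re)) ≤ 1 / (1 + d - 1 + ρ.re) := by
      have p1 : 0 < 1.7 - ρ.re := by linarith
      have p2 : 0 < 1.7 - 1 + ρ.re := by linarith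
      have p3 : 0 < 1 + d - 1 + ρ.re := by linarith
      rw [div_add_div _ _ p1.ne' p2.ne', ← mul_div_assoc, div_le_div_iff₀ (by positivity) p3]
      nlinarith
    linarith
  unfold WW RR; linarith

theorem trig_nonneg (θ : ℝ) : 0 ≤ 5 + 8 * Real.cos θ + 4 * Real.cos (2 * θ) + Real.cos (3 * θ) := by
  rw [Real.cos_two_mul, Real.cos_three_mul]
  have h : 5 + 8 * Real.cos θ + 4 * (2 * Real.cos θ^2 - 1) + (4 * Real.cos θ^3 - 3 * Real.cos θ)
    = (1 + Real.cos θ) * (1 + 2 * Real.cos θ)^2 := by ring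
  rw [h]
  have := Real.neg_one_le_cos θ
  have : 0 ≤ 1 + Real.cos θ := by linarith
  positivity

theorem WW_trig (d γ : ℝ) (hd : 0 < d) (hd2 : d ≤ 0.19) :
    0 ≤ 5 * WW d 0 + 8 * WW d γ + 4 * WW d (2 * γ) + WW d (3 * γ) := by
  have hW : ∀ t : ℝ, HasSum (fun n : ℕ => ArithmeticFunction.vonMangoldt n * ((n:ℝ)^(-(1+d)) - 5/12 * (n:ℝ)^(-(1.7:ℝ))) * Real.cos (t * Real.log n)) (WW d t) := by
    intro t
    have := (hasSum_zeta_logDeriv (1 + d) t (by linarith)).sub ((hasSum_zeta_logDeriv 1.7 t (by norm_num)).mul_left (5/12))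
    refine this.congr_fun (fun n => ?_)
    ring
  have h := (((hW 0).mul_left 5).add ((hW γ).mul_left 8)).add ((hW (2*γ)).mul_left 4) |>.add (hW (3*γ))
  refine h.nonneg (fun n => ?_)
  have e : 5 * (ArithmeticFunction.vonMangoldt n * ((n:ℝ)^(-(1+d)) - 5/12 * (n:ℝ)^(-(1.7:ℝ))) * Real.cos (0 * Real.log n))
    + 8 * (ArithmeticFunction.vonMangoldt n * ((n:ℝ)^(-(1+d)) - 5/12 * (n:ℝ)^(-(1.7:ℝ))) * Real.cos (γ * Real.log n))
    + 4 * (ArithmeticFunction.vonMangoldt n * ((n:ℝ)^(-(1+d)) - 5/12 * (n:ℝ)^(-(1.7:ℝ))) * Real.cos (2 * γ * Real.log n))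
    + ArithmeticFunction.vonMangoldt n * ((n:ℝ)^(-(1+d)) - 5/12 * (n:ℝ)^(-(1.7:ℝ))) * Real.cos (3 * γ * Real.log n)
    = ArithmeticFunction.vonMangoldt n * ((n:ℝ)^(-(1+d)) - 5/12 * (n:ℝ)^(-(1.7:ℝ))) *
      (5 + 8 * Real.cos (γ * Real.log n) + 4 * Real.cos (2 * (γ * Real.log n)) + Real.cos (3 * (γ * Real.log n))) := by
    rw [zero_mul, Real.cos_zero, mul_assoc 2, mul_assoc 3]; ring
  rw [e]
  rcases Nat.eq_zero_or_pos n with rfl | hn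
  · simp
  apply mul_nonneg (mul_nonneg ArithmeticFunction.vonMangoldt_nonneg _) (trig_nonneg _)
  have hn1 : (1:ℝ) ≤ n := by exact_mod_cast hn
  have : (n:ℝ)^(-(1.7:ℝ)) ≤ (n:ℝ)^(-(1+d)) := Real.rpow_le_rpow_of_exponent_le hn1 (by linarith)
  have : 0 ≤ (n:ℝ)^(-(1.7:ℝ)) := by positivity
  linarith

end

section
open Complex Metric Set Filter Topology

theorem RR_eq (d t : ℝ) (hd : 0 < d) : RR d t =
   ((1/(((1 + d : ℝ):ℂ) + t * I)).re + (1/((((1 + d : ℝ):ℂ) + t * I)-1)).re - Real.log Real.pi/2 + (digamma ((((1 + d : ℝ):ℂ) + t * I)/2)).re/2)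
   - 5/12 * ((1/(((1.7 : ℝ):ℂ) + t * I)).re + (1/((((1.7 : ℝ):ℂ) + t * I)-1)).re - Real.log Real.pi/2 + (digamma ((((1.7 : ℝ):ℂ) + t * I)/2)).re/2) := by
  unfold RR
  have h : ∀ σ : ℝ, 1 < σ → PP ((σ:ℂ) + t * I) - (logDeriv riemannZeta ((σ:ℂ) + t * I)).re
      = ((1/((σ:ℂ) + t * I)).re + (1/(((σ:ℂ) + t * I)-1)).re - Real.log Real.pi/2 + (digamma (((σ:ℂ) + t * I)/2)).re/2) := by
    intro σ hσ
    have hre : ((σ:ℂ) + t * I).re = σ := by simp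
    have hne : ((σ:ℂ) + t * I) ≠ 1 := by
      intro hh; rw [hh] at hre; simp at hre; linarith
    rw [PP_eq _ (by rw [hre]; linarith) hne (riemannZeta_ne_zero_of_one_le_re (by rw [hre]; linarith))]
    ring
  rw [h _ (by linarith), h 1.7 (by norm_num)]

theorem RR_zero (d : ℝ) (hd : 0 < d) (hd2 : d ≤ 0.19) : RR d 0 ≤ 1/d - 0.92 + 0.23 * d := by
  rw [RR_eq d 0 hd]
  have e1 : (1/(((1 + d : ℝ):ℂ) + (0:ℝ) * I)).re = 1/(1+d) := by
    simp only [ofReal_zero, zero_mul, add_zero]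
    norm_cast
  have e2 : (1/((((1 + d : ℝ):ℂ) + (0:ℝ) * I)-1)).re = 1/d := by
    have : (((1 + d : ℝ):ℂ) + (0:ℝ) * I)-1 = (d:ℂ) := by push_cast; ring
    rw [this]; norm_cast
  have e3 : (1/(((1.7 : ℝ):ℂ) + (0:ℝ) * I)).re = 1/1.7 := by
    simp only [ofReal_zero, zero_mul, add_zero]
    norm_cast
  have e4 : (1/((((1.7 : ℝ):ℂ) + (0:ℝ) * I)-1)).re = 1/0.7 := by
    have : (((1.7 : ℝ):ℂ) + (0:ℝ) * I)-1 = ((0.7:ℝ):ℂ) := by push_cast; norm_num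
    rw [this]; norm_cast
  have e5 : (digamma ((((1 + d : ℝ):ℂ) + (0:ℝ) * I)/2)).re ≤ Real.log ((3+d)/2) - 1/(3+d) - 2/(1+d) := by
    have h1 : (((1 + d : ℝ):ℂ) + (0:ℝ) * I)/2 = (((1+d)/2:ℝ):ℂ) := by push_cast; ring
    rw [h1, digamma_shift _ (by rw [ofReal_re]; linarith)]
    have h2 : (((1+d)/2:ℝ):ℂ) + 1 = (((3+d)/2:ℝ):ℂ) := by push_cast; ring
    have h3 : (1/(((1+d)/2:ℝ):ℂ)).re = 2/(1+d) := by
      have : 1/(((1+d)/2:ℝ):ℂ) = ((2/(1+d):ℝ):ℂ) := by push_cast; field_simp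
      rw [this, ofReal_re]
    rw [sub_re, h2, h3]
    have := digamma_re_le ((3+d)/2) (by linarith)
    have h4 : 1/(2*((3+d)/2)) = 1/(3+d) := by ring
    rw [h4] at this
    linarith
  have e6 : 1.044 - 1/2.85 - 1/1.85 - 1/0.85 ≤ (digamma ((((1.7 : ℝ):ℂ) + (0:ℝ) * I)/2)).re := by
    have h1 : (((1.7 : ℝ):ℂ) + (0:ℝ) * I)/2 = ((0.85:ℝ):ℂ) := by push_cast; norm_num
    rw [h1, digamma_shift _ (by rw [ofReal_re]; norm_num)]
    have h2 : ((0.85:ℝ):ℂ) + 1 = ((1.85:ℝ):ℂ) := by push_cast; norm_num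
    rw [h2, digamma_shift _ (by rw [ofReal_re]; norm_num)]
    have h3 : ((1.85:ℝ):ℂ) + 1 = ((2.85:ℝ):ℂ) := by push_cast; norm_num
    rw [h3]
    have h4 : (1/((0.85:ℝ):ℂ)).re = 1/0.85 := by norm_cast
    have h5 : (1/((1.85:ℝ):ℂ)).re = 1/1.85 := by norm_cast
    rw [sub_re, sub_re, h4, h5]
    have := le_digamma_re 2.85 (by norm_num)
    have hl : 1.044 ≤ Real.log 2.85 := by
      have h3 := log_bounds.1
      have : Real.log 2.85 = Real.log 3 + Real.log 0.95 := by
        rw [← Real.log_mul (by norm_num) (by norm_num)]; norm_num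
      have h6 := Real.one_sub_inv_le_log_of_pos (show (0:ℝ) < 0.95 by norm_num)
      rw [this]
      norm_num at h6 h3 ⊢
      linarith
    linarith
  have e7 : Real.log ((3+d)/2) ≤ 0.4055 + d/3 := by
    have : (3+d)/2 = 1.5 * (1 + d/3) := by ring
    rw [this, Real.log_mul (by norm_num) (by positivity)]
    have h1 : Real.log 1.5 ≤ 0.4055 := by
      rw [Real.log_le_iff_le_exp (by norm_num)]
      have := Real.sum_le_exp_of_nonneg (show (0:ℝ) ≤ 0.4055 by norm_num) 7
      refine le_trans ?_ this
      norm_num [Finset.sum_range_succ, Nat.factorial]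
    have h2 := Real.log_le_sub_one_of_pos (show 0 < 1 + d/3 by positivity)
    linarith
  have e8 : 1/3 - d/9 ≤ 1/(3+d) := by
    rw [le_div_iff₀ (by linarith)]; nlinarith
  have hpi := log_pi_ge
  rw [e1, e2, e3, e4]
  have e9 : 2/(1+d) = 2 * (1/(1+d)) := by ring
  rw [e9] at e5
  norm_num at e6 ⊢
  norm_num at e5 e8 e7 hpi
  nlinarith

theorem inv_re_le (a t : ℝ) (ha : 0 ≤ a) (ht : 0 < t) : (1/((a:ℂ) + t * I)).re ≤ a / t^2 := by
  have : (1/((a:ℂ) + t * I)).re = a / (a^2 + t^2) := by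
    rw [one_div, inv_re, normSq_apply]; simp; ring
  rw [this]
  apply div_le_div_of_nonneg_left ha (by positivity)
  nlinarith [sq_nonneg a]
theorem inv_re_nonneg (a t : ℝ) (ha : 0 ≤ a) : 0 ≤ (1/((a:ℂ) + t * I)).re := by
  have : (1/((a:ℂ) + t * I)).re = a / (a^2 + t^2) := by
    rw [one_div, inv_re, normSq_apply]; simp; ring
  rw [this]; positivity

theorem digamma_abs (σ t : ℝ) (hσ : 0 < σ) (ht : 4 ≤ t) :
   |(digamma (((σ:ℂ) + t * I)/2)).re - (Real.log ‖((σ:ℂ) + t * I)/2‖ - (1/((σ:ℂ) + t * I)).re)| ≤ 1/t^2 := by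
  have ht0 : 0 < t := by linarith
  have hre : (((σ:ℂ) + t * I)/2).re = σ/2 := by
    rw [show (2:ℂ) = ((2:ℝ):ℂ) by norm_num, div_ofReal_re]; simp
  have him : (((σ:ℂ) + t * I)/2).im = t/2 := by
    rw [show (2:ℂ) = ((2:ℝ):ℂ) by norm_num, div_ofReal_im]; simp
  have h := digamma_bound (((σ:ℂ) + t * I)/2) (by rw [hre]; linarith) (t/2) (by linarith)
    (by rw [him]; exact le_abs_self _)
  have h2 := (abs_re_le_norm _).trans h
  rw [add_re, sub_re, log_re] at h2
  have e : 2 * (((σ:ℂ) + t * I)/2) = (σ:ℂ) + t * I := by ring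
  rw [e] at h2
  have e2 : (1/(t/2)^3 + 1/(t/2)^2)/6 ≤ 1/t^2 := by
    have : (1/(t/2)^3 + 1/(t/2)^2)/6 = (8/t + 4)/6 / t^2 := by field_simp; try ring
    rw [this]
    apply div_le_div_of_nonneg_right _ (by positivity)
    have : 8/t ≤ 2 := by rw [div_le_iff₀ ht0]; linarith
    linarith
  refine le_trans (le_of_eq ?_) (h2.trans e2)
  congr 1; ring

theorem log_norm_half (σ t : ℝ) (ht : 0 < t) :
   Real.log (t/2) ≤ Real.log ‖((σ:ℂ) + t * I)/2‖ ∧ Real.log ‖((σ:ℂ) + t * I)/2‖ ≤ Real.log (t/2) + σ^2/(2*t^2) := by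
  have hn : ‖((σ:ℂ) + t * I)/2‖^2 = (σ^2 + t^2)/4 := by
    rw [norm_div, div_pow, ← normSq_eq_norm_sq, normSq_apply]; simp; ring
  have hpos : 0 < ‖((σ:ℂ) + t * I)/2‖ := by
    rw [norm_pos_iff]; intro h
    rw [h] at hn; simp at hn; nlinarith [sq_nonneg σ]
  have hl : 2 * Real.log ‖((σ:ℂ) + t * I)/2‖ = Real.log ((σ^2 + t^2)/4) := by
    rw [← hn, Real.log_pow]; norm_num
  have e : (σ^2 + t^2)/4 = (t/2)^2 * (1 + σ^2/t^2) := by field_simp; try ring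
  rw [e, Real.log_mul (by positivity) (by positivity), Real.log_pow] at hl
  push_cast at hl
  have p : 0 ≤ σ^2/t^2 := by positivity
  have h1 := Real.log_nonneg (show 1 ≤ 1 + σ^2/t^2 by linarith)
  have h2 := Real.log_le_sub_one_of_pos (show 0 < 1 + σ^2/t^2 by linarith)
  have h3 : σ^2/(2*t^2) = σ^2/t^2/2 := by field_simp
  constructor <;> linarith

theorem RR_big (d t : ℝ) (hd : 0 < d) (hd2 : d ≤ 0.19) (ht : 4 ≤ t) :
    RR d t ≤ 7/24 * Real.log (t/(2*Real.pi)) + 2.8/t^2 := by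
  have ht0 : 0 < t := by linarith
  rw [RR_eq d t hd]
  have a1 := inv_re_le (1+d) t (by linarith) ht0
  have a2 := inv_re_le d t (by linarith) ht0
  have e2 : (((1 + d : ℝ):ℂ) + t * I)-1 = (d:ℂ) + t * I := by push_cast; ring
  have e4 : (((1.7 : ℝ):ℂ) + t * I)-1 = ((0.7:ℝ):ℂ) + t * I := by push_cast; norm_num; ring
  have b1 := inv_re_nonneg 1.7 t (by norm_num)
  have b1' := inv_re_le 1.7 t (by norm_num) ht0
  have b2 := inv_re_nonneg 0.7 t (by norm_num)
  rw [← e2] at a2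
  rw [← e4] at b2
  have c1 := (abs_le.mp (digamma_abs (1+d) t (by linarith) ht)).2
  have c2 := (abs_le.mp (digamma_abs 1.7 t (by norm_num) ht)).1
  have l1 := (log_norm_half (1+d) t ht0).2
  have l2 := (log_norm_half 1.7 t ht0).1
  have hl : Real.log (t/(2*Real.pi)) = Real.log (t/2) - Real.log Real.pi := by
    rw [← Real.log_div (by positivity) (by positivity)]; congr 1; field_simp
  rw [hl]
  have x1 : (1+d)/t^2 = (1+d) * (1/t^2) := by ring
  have x2 : d/t^2 = d * (1/t^2) := by ring
  have x3 : 1.7/t^2 = 1.7 * (1/t^2) := by ring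
  have x4 : 2.8/t^2 = 2.8 * (1/t^2) := by ring
  have x5 : (1+d)^2/(2*t^2) = (1+d)^2/2 * (1/t^2) := by field_simp
  have hu : 0 < 1/t^2 := by positivity
  rw [x1] at a1; rw [x2] at a2; rw [x3] at b1'; rw [x5] at l1; rw [x4]
  generalize 1/t^2 = u at *
  have : (1+d)^2/2 * u ≤ 0.7081 * u := by
    apply mul_le_mul_of_nonneg_right _ hu.le; nlinarith
  have : d * u ≤ 0.19 * u := by nlinarith
  have : (1+d) * u = u + d * u := by ring
  linarith

theorem log_23 : 4 * Real.log 2 + Real.log 3 ≤ 3.872 := by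
  have h : Real.log 3 ≤ 1.0987 := by
    rw [Real.log_le_iff_le_exp (by norm_num)]
    have := Real.sum_le_exp_of_nonneg (show (0:ℝ) ≤ 1.0987 by norm_num) 11
    refine le_trans ?_ this
    norm_num [Finset.sum_range_succ, Nat.factorial]
  have := Real.log_two_lt_d9
  norm_num at h ⊢
  linarith

theorem zero_free (d Y : ℝ) (hd : 0 < d) (hd2 : d ≤ 0.19) (ρ : ℂ) (hρ : xi ρ = 0) (hre : 1/2 < ρ.re)
    (hY : |ρ.im| ≤ Y) :
    8 / (d + (1 - ρ.re)) ≤ 5/d - 3.47 + 1.15 * d + 91/24 * Real.log (Y/(2*Real.pi)) + 25.6/Y^2 := by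

  wlog him : 0 ≤ ρ.im with H
  · have := H d Y hd hd2 ((starRingEnd ℂ) ρ) (by exact xi_conj_zero ρ hρ) (by simpa using hre) (by simpa using hY) (by simp; linarith)
    simpa using this
  have h4 := low_zeros ρ hρ
  rw [abs_of_nonneg him] at h4 hY
  set γ := ρ.im with hγ
  have hw := WW_trig d γ hd hd2
  have w0 := (WW_le d 0 hd hd2).trans (RR_zero d hd hd2)
  have w1 := WW_le_zero d hd hd2 ρ hρ hre
  have r1 := RR_big d γ hd hd2 h4.le
  have r2 := (WW_le d (2*γ) hd hd2).trans (RR_big d (2*γ) hd hd2 (by linarith))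
  have r3 := (WW_le d (3*γ) hd hd2).trans (RR_big d (3*γ) hd hd2 (by linarith))
  have g0 : 0 < γ := by linarith
  have hpi := Real.pi_pos
  have l2 : Real.log (2*γ/(2*Real.pi)) = Real.log 2 + Real.log (γ/(2*Real.pi)) := by
    rw [← Real.log_mul (by norm_num) (by positivity)]; congr 1; ring
  have l3 : Real.log (3*γ/(2*Real.pi)) = Real.log 3 + Real.log (γ/(2*Real.pi)) := by
    rw [← Real.log_mul (by norm_num) (by positivity)]; congr 1; ring
  rw [l2] at r2; rw [l3] at r3
  have y0 : 0 < Y := by linarith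

  have hlog : Real.log (Y/(2*Real.pi)) = Real.log (γ/(2*Real.pi)) + Real.log (Y/γ) := by
    rw [← Real.log_mul (by positivity) (by positivity)]; congr 1; field_simp
  have hone := Real.one_sub_inv_le_log_of_pos (show 0 < Y/γ by positivity)
  rw [inv_div] at hone
  have hmono : 25.6/γ^2 - 25.6/Y^2 ≤ 91/24 * (1 - γ/Y) := by
    have e : 25.6/γ^2 - 25.6/Y^2 = (1 - γ/Y) * (1 + γ/Y) * (25.6/γ^2) := by field_simp; ring
    rw [e]
    have : γ/Y ≤ 1 := by rw [div_le_one y0]; exact hY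
    have p : 0 ≤ γ/Y := by positivity
    have : 25.6/γ^2 ≤ 1.6 := by rw [div_le_iff₀ (by positivity)]; nlinarith
    have q : 0 ≤ 25.6/γ^2 := by positivity
    have : (1 + γ/Y) * (25.6/γ^2) ≤ 91/24 := by nlinarith
    nlinarith
  have e1 : 1/(d + (1 - ρ.re)) * 8 = 8/(d + (1 - ρ.re)) := by ring
  have x1 : 2.8/(2*γ)^2 = 0.7/γ^2 := by field_simp; norm_num
  have x2 : 2.8/(3*γ)^2 = 2.8/9 * (1/γ^2) := by field_simp; try norm_num
  have x3 : 0.7/γ^2 = 0.7 * (1/γ^2) := by ring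
  have x4 : 2.8/γ^2 = 2.8 * (1/γ^2) := by ring
  have x5 : 25.6/γ^2 = 25.6 * (1/γ^2) := by ring
  have hl := log_23
  have e2 : 5/d = 5 * (1/d) := by ring
  have hu : 0 < 1/γ^2 := by positivity
  rw [x1, x3] at r2; rw [x2] at r3; rw [x4] at r1; rw [x5] at hmono
  rw [← e1, e2, hlog]
  linarith

end

section
open Complex Metric Set Filter Topology

theorem harn (u δ Y w : ℝ) (hδ : 0 ≤ δ) (hw : 0 < w) (hY : 0 ≤ Y) (hu0 : 0 < u + δ) (hwd : w + δ ≤ 1)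
    (h : w ≤ u ∨ 1 ≤ Y) : u / (u^2 + Y) ≤ (w + δ) / w * ((u + δ) / ((u + δ)^2 + Y)) := by
  have hR : 0 < (u + δ) / ((u + δ)^2 + Y) := by positivity
  have hK : 1 ≤ (w + δ) / w := by rw [le_div_iff₀ hw]; linarith
  by_cases hwu : w ≤ u
  · have hu : 0 < u := by linarith
    rw [div_mul_div_comm, div_le_div_iff₀ (by positivity) (by positivity)]
    have e : (w + δ) * (u + δ) * (u^2 + Y) - u * (w * ((u + δ)^2 + Y)) = (u + δ) * u * (δ * (u - w)) + Y * (w * δ + δ * (u + δ)) := by ring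
    have : 0 ≤ (u + δ) * u * (δ * (u - w)) + Y * (w * δ + δ * (u + δ)) := by
      have : 0 ≤ u - w := by linarith
      positivity
    linarith
  · have hY1 : 1 ≤ Y := by tauto
    push Not at hwu
    by_cases hu : u ≤ 0
    · have : u / (u^2 + Y) ≤ 0 := div_nonpos_of_nonpos_of_nonneg hu (by positivity)
      have : 0 ≤ (w + δ) / w * ((u + δ) / ((u + δ)^2 + Y)) := by positivity
      linarith
    · push Not at hu
      have : u / (u^2 + Y) ≤ (u + δ) / ((u + δ)^2 + Y) := by
        rw [div_le_div_iff₀ (by positivity) (by positivity)]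
        have e : (u + δ) * (u^2 + Y) - u * ((u + δ)^2 + Y) = δ * (Y - u * (u + δ)) := by ring
        have : u * (u + δ) ≤ 1 := by nlinarith
        have : 0 ≤ δ * (Y - u * (u + δ)) := mul_nonneg hδ (by linarith)
        linarith
      nlinarith

theorem PP_harn (η x t : ℝ) (hη : η ≤ 0.4) (hx : -η < x) (hx2 : x ≤ 0.4)
    (ZF : ∀ ρ : ℂ, xi ρ = 0 → |ρ.im - t| ≤ 1 → ρ.re ≤ 1 - η) :
    PP (((1 + x : ℝ):ℂ) + t * I) ≤ (0.4 + η) / (x + η) * PP (((1.4 : ℝ):ℂ) + t * I) := by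
  have key : ∀ ρ, xi ρ = 0 → 0 ≤ (0.4 + η) / (x + η) * Fz (((1.4 : ℝ):ℂ) + t * I) ρ + (-1) * Fz (((1 + x : ℝ):ℂ) + t * I) ρ := by
    intro ρ hρ
    obtain ⟨h0, h1⟩ := xi_zero_re ρ hρ
    have e := Fz_formula (1+x) t ρ.re ρ.im
    have e' := Fz_formula 1.4 t ρ.re ρ.im
    rw [re_add_im] at e e'
    rw [e, e']
    have hz : ∀ τ : ℂ, xi τ = 0 → τ.im = ρ.im → x + η ≤ 1 + x - τ.re ∨ 1 ≤ (t - ρ.im)^2 := by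
      intro τ hτ hi
      by_cases hh : |ρ.im - t| ≤ 1
      · left
        have := ZF τ hτ (by rw [hi]; exact hh)
        linarith
      · right
        push Not at hh
        rw [show (t - ρ.im)^2 = |ρ.im - t|^2 by rw [sq_abs]; ring]
        nlinarith
    have a1 := harn (1 + x - ρ.re) (0.4 - x) ((t - ρ.im)^2) (x + η) (by linarith) (by linarith) (sq_nonneg _) (by linarith) (by linarith)
      (hz ρ hρ rfl)
    have hz2 := hz (1 - starRingEnd ℂ ρ) (xi_refl_zero ρ hρ) (by simp)
    have er : (1 - starRingEnd ℂ ρ).re = 1 - ρ.re := by simp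
    rw [er] at hz2
    have a2 := harn (1 + x - 1 + ρ.re) (0.4 - x) ((t - ρ.im)^2) (x + η) (by linarith) (by linarith) (sq_nonneg _) (by linarith) (by linarith)
      (by rcases hz2 with h | h
          · left; linarith
          · right; exact h)
    rw [show x + η + (0.4 - x) = 0.4 + η by ring] at a1 a2
    rw [show 1 + x - ρ.re + (0.4 - x) = 1.4 - ρ.re by ring] at a1
    rw [show 1 + x - 1 + ρ.re + (0.4 - x) = 1.4 - 1 + ρ.re by ring] at a2
    linarith
  have hne : xi (((1 + x : ℝ):ℂ) + t * I) ≠ 0 := by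
    intro h
    have := ZF _ h (by simp)
    simp at this; linarith
  have := PP_linear_nonneg _ _ (((1.4 : ℝ):ℂ) + t * I) (((1 + x : ℝ):ℂ) + t * I)
    (xi_ne_zero_of_one_le _ (by simp; norm_num)) hne key
  linarith

theorem hasDerivAt_log_norm (F : ℂ → ℂ) (t x : ℝ) (hF : DifferentiableAt ℂ F (((1 + x : ℝ):ℂ) + t * I))
    (h0 : F (((1 + x : ℝ):ℂ) + t * I) ≠ 0) :
    HasDerivAt (fun x : ℝ => Real.log ‖F (((1 + x : ℝ):ℂ) + t * I)‖) (logDeriv F (((1 + x : ℝ):ℂ) + t * I)).re x := by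
  have h1 : HasDerivAt (fun x : ℝ => F (((1 + x : ℝ):ℂ) + t * I)) (deriv F (((1 + x : ℝ):ℂ) + t * I)) x := by
    have hin : HasDerivAt (fun x : ℝ => ((1 + x : ℝ):ℂ) + t * I) 1 x := by
      have : HasDerivAt (fun x : ℝ => (1 + x : ℝ)) 1 x := by simpa using (hasDerivAt_id x).const_add 1
      simpa using this.ofReal_comp.add_const (t * I)
    have := hF.hasDerivAt.comp x hin
    rw [mul_one] at this
    exact this
  have h2 := h1.norm_sq
  have h3 := h2.log (by exact pow_ne_zero 2 (norm_ne_zero_iff.mpr h0))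
  have h4 := h3.div_const 2
  refine (h4.congr_deriv ?_).congr_of_eventuallyEq (Eventually.of_forall (fun y => ?_))
  · rw [logDeriv_apply, Complex.inner]
    set a := F (((1 + x : ℝ):ℂ) + t * I)
    set b := deriv F (((1 + x : ℝ):ℂ) + t * I)
    rw [← normSq_eq_norm_sq, div_re, mul_re, conj_re, conj_im]
    have : normSq a ≠ 0 := by simpa using h0
    field_simp; ring
  · show _ = Real.log (‖F (((1 + y : ℝ):ℂ) + t * I)‖^2) / 2
    rw [Real.log_pow]; push_cast; ring

noncomputable def iz (s : ℂ) : ℂ := s * (s - 1) * Gammaℝ s / xi s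

theorem iz_eq (s : ℂ) (h0 : 0 < s.re) (h1 : s ≠ 1) : iz s = (riemannZeta s)⁻¹ := by
  unfold iz
  rw [xi_eq s h0 h1]
  have hs : s ≠ 0 := by rintro rfl; simp at h0
  have h2 := sub_ne_zero.mpr h1
  have h3 := Gammaℝ_ne_zero_of_re_pos h0
  by_cases hz : riemannZeta s = 0
  · rw [hz]; simp
  field_simp

theorem PP_nonneg (s : ℂ) (hs : 1 ≤ s.re) : 0 ≤ PP s := by
  have h := PP_linear_nonneg 1 0 s s (xi_ne_zero_of_one_le _ hs) (xi_ne_zero_of_one_le _ hs)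
    (fun ρ hρ => by have := Fz_nonneg s ρ hs hρ; linarith)
  linarith

theorem iz_bound (η η' t P D Z x : ℝ) (hη : η ≤ 0.4) (h1 : 0 < η') (h2 : η' < η)
    (ZF : ∀ ρ : ℂ, xi ρ = 0 → |ρ.im - t| ≤ 1 → ρ.re ≤ 1 - η)
    (hP : PP (((1.4 : ℝ):ℂ) + t * I) ≤ P)
    (hD : ∀ y : ℝ, -η' ≤ y → y ≤ 0.4 → D ≤ (logDeriv Gammaℝ (((1 + y : ℝ):ℂ) + t * I)).re)
    (hZ : ‖(riemannZeta (((1.4 : ℝ):ℂ) + t * I))⁻¹‖ ≤ Z)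
    (hx : -η' ≤ x) (hx2 : x ≤ 0.4) :
    ‖iz (((1 + x : ℝ):ℂ) + t * I)‖ ≤ Z * Real.exp (-D * (0.4 - x) + P * ((0.4 + η) * Real.log ((0.4 + η) / (x + η)))) := by
  set f : ℝ → ℝ := fun y => Real.log ‖xi (((1 + y : ℝ):ℂ) + t * I)‖ - Real.log ‖Gammaℝ (((1 + y : ℝ):ℂ) + t * I)‖
    - P * (0.4 + η) * Real.log (y + η) + D * y with hf
  have hxi : ∀ y : ℝ, -η' ≤ y → xi (((1 + y : ℝ):ℂ) + t * I) ≠ 0 := by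
    intro y hy h
    have := ZF _ h (by simp)
    simp at this; linarith
  have hG : ∀ y : ℝ, -η' ≤ y → Gammaℝ (((1 + y : ℝ):ℂ) + t * I) ≠ 0 := by
    intro y hy; apply Gammaℝ_ne_zero_of_re_pos; simp; linarith
  have hGd : ∀ y : ℝ, -η' ≤ y → DifferentiableAt ℂ Gammaℝ (((1 + y : ℝ):ℂ) + t * I) := by
    intro y hy
    have hd := differentiable_Gammaℝ_inv (((1 + y : ℝ):ℂ) + t * I)
    have := hd.inv (inv_ne_zero (hG y hy))
    simpa [Pi.inv_def] using this
  have hP0 : 0 ≤ P := (PP_nonneg _ (by simp; norm_num)).trans hP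
  have hder : ∀ y : ℝ, -η' ≤ y → HasDerivAt f (PP (((1 + y : ℝ):ℂ) + t * I) - (logDeriv Gammaℝ (((1 + y : ℝ):ℂ) + t * I)).re
      - P * (0.4 + η) * (1 / (y + η)) + D) y := by
    intro y hy
    have a1 := hasDerivAt_log_norm xi t y (xi_diff _) (hxi y hy)
    have a2 := hasDerivAt_log_norm Gammaℝ t y (hGd y hy) (hG y hy)
    have a3 : HasDerivAt (fun y : ℝ => Real.log (y + η)) (1 / (y + η)) y :=
      ((hasDerivAt_id y).add_const η).log (by simp; linarith)
    have a4 : HasDerivAt (fun y : ℝ => D * y) D y := by simpa using (hasDerivAt_id y).const_mul D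
    exact ((a1.sub a2).sub (a3.const_mul _)).add a4
  have hanti : AntitoneOn f (Icc (-η') 0.4) := by
    apply antitoneOn_of_deriv_nonpos (convex_Icc _ _)
    · intro y hy; exact (hder y hy.1).continuousAt.continuousWithinAt
    · intro y hy
      rw [interior_Icc] at hy
      exact (hder y hy.1.le).differentiableAt.differentiableWithinAt
    · intro y hy
      rw [interior_Icc] at hy
      rw [(hder y hy.1.le).deriv]
      have b1 := PP_harn η y t hη (by linarith [hy.1]) hy.2.le ZF
      have b2 := hD y hy.1.le hy.2.le
      have hyη : 0 < y + η := by linarith [hy.1]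
      have b3 : (0.4 + η) / (y + η) * PP (((1.4 : ℝ):ℂ) + t * I) ≤ (0.4 + η) / (y + η) * P :=
        mul_le_mul_of_nonneg_left hP (by apply div_nonneg <;> linarith)
      have b4 : (0.4 + η) / (y + η) * P = P * (0.4 + η) * (1 / (y + η)) := by ring
      linarith
  have hle := hanti (show x ∈ Icc (-η') 0.4 from ⟨hx, hx2⟩) (show (0.4:ℝ) ∈ Icc (-η') 0.4 from ⟨by linarith, le_rfl⟩) hx2
  simp only [hf] at hle
  have e14 : (1 + 0.4 : ℝ) = 1.4 := by norm_num
  rw [e14] at hle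
  set s := ((1 + x : ℝ):ℂ) + t * I with hs
  set s0 := ((1.4 : ℝ):ℂ) + t * I with hs0
  have hs0r : s0.re = 1.4 := by simp [hs0]
  have hs0ne : s0 ≠ 1 := by intro h; rw [h] at hs0r; norm_num at hs0r
  have n1 : 0 < ‖xi s‖ := norm_pos_iff.mpr (hxi x hx)
  have n2 : 0 < ‖Gammaℝ s‖ := norm_pos_iff.mpr (hG x hx)
  have n3 : 0 < ‖xi s0‖ := norm_pos_iff.mpr (xi_ne_zero_of_one_le _ (by rw [hs0r]; norm_num))
  have n4 : 0 < ‖Gammaℝ s0‖ := norm_pos_iff.mpr (Gammaℝ_ne_zero_of_re_pos (by rw [hs0r]; norm_num))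
  have hlog : Real.log ((0.4 + η) / (x + η)) = Real.log (0.4 + η) - Real.log (x + η) :=
    Real.log_div (by linarith) (by linarith)
  have hE : ‖Gammaℝ s‖ / ‖xi s‖ ≤ ‖Gammaℝ s0‖ / ‖xi s0‖ * Real.exp (-D * (0.4 - x) + P * ((0.4 + η) * Real.log ((0.4 + η) / (x + η)))) := by
    rw [← Real.exp_log (show 0 < ‖Gammaℝ s‖ / ‖xi s‖ by positivity), ← Real.exp_log (show 0 < ‖Gammaℝ s0‖ / ‖xi s0‖ by positivity), ← Real.exp_add]
    apply Real.exp_le_exp.mpr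
    rw [Real.log_div n2.ne' n1.ne', Real.log_div n4.ne' n3.ne', hlog]
    linarith
  have hzz : ‖(riemannZeta s0)⁻¹‖ = ‖s0‖ * ‖s0 - 1‖ * (‖Gammaℝ s0‖ / ‖xi s0‖) := by
    rw [← iz_eq s0 (by rw [hs0r]; norm_num) hs0ne, iz, norm_div, norm_mul, norm_mul]; ring
  have hsm : ‖s‖ * ‖s - 1‖ ≤ ‖s0‖ * ‖s0 - 1‖ := by
    have c : ∀ a b : ℝ, |a| ≤ b → ‖(a:ℂ) + t * I‖ ≤ ‖(b:ℂ) + t * I‖ := by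
      intro a b hab
      apply le_of_sq_le_sq _ (norm_nonneg _) |> fun h => h
      rw [← normSq_eq_norm_sq, ← normSq_eq_norm_sq, normSq_apply, normSq_apply]
      simp
      nlinarith [abs_le.mp hab]
    apply mul_le_mul _ _ (norm_nonneg _) (norm_nonneg _)
    · exact c _ _ (by rw [abs_le]; constructor <;> linarith)
    · have r1 : s - 1 = (x:ℂ) + t * I := by rw [hs]; push_cast; ring
      have r2 : s0 - 1 = ((0.4:ℝ):ℂ) + t * I := by rw [hs0]; push_cast; norm_num; ring
      rw [r1, r2]
      exact c _ _ (by rw [abs_le]; constructor <;> linarith)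
  calc ‖iz s‖ = ‖s‖ * ‖s - 1‖ * (‖Gammaℝ s‖ / ‖xi s‖) := by rw [iz, norm_div, norm_mul, norm_mul]; ring
    _ ≤ (‖s0‖ * ‖s0 - 1‖) * (‖Gammaℝ s0‖ / ‖xi s0‖ * Real.exp (-D * (0.4 - x) + P * ((0.4 + η) * Real.log ((0.4 + η) / (x + η))))) := by
        gcongr
    _ = ‖(riemannZeta s0)⁻¹‖ * Real.exp (-D * (0.4 - x) + P * ((0.4 + η) * Real.log ((0.4 + η) / (x + η)))) := by rw [hzz]; ring
    _ ≤ _ := by gcongr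

end

section
open Complex Metric Set Filter Topology

theorem rpow_step (a : ℝ) (ha : 0 < a) (n : ℕ) (hn : 1 ≤ n) :
    ((n + 1 : ℕ):ℝ)^(-(1+a)) ≤ ((n:ℝ)^(-a) - ((n + 1 : ℕ):ℝ)^(-a)) / a := by
  have hn0 : (0:ℝ) < n := by exact_mod_cast hn
  have hm0 : (0:ℝ) < (n + 1 : ℕ) := by positivity
  rw [le_div_iff₀ ha]
  have e1 : ((n + 1 : ℕ):ℝ)^(-(1+a)) = ((n + 1 : ℕ):ℝ)^(-a) * (1 / (n + 1 : ℕ)) := by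
    rw [show -(1+a) = -a + (-1) by ring, Real.rpow_add hm0, Real.rpow_neg_one, one_div]
  have e2 : (n:ℝ)^(-a) = ((n + 1 : ℕ):ℝ)^(-a) * ((n / (n + 1 : ℕ) : ℝ))^(-a) := by
    rw [← Real.mul_rpow hm0.le (by positivity)]; congr 1; field_simp
  have h : 1 + a * (1 / (n + 1 : ℕ)) ≤ ((n / (n + 1 : ℕ) : ℝ))^(-a) := by
    have hq : (0:ℝ) < n / (n + 1 : ℕ) := by positivity
    rw [Real.rpow_def_of_pos hq]
    have hl := Real.log_le_sub_one_of_pos hq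
    have e3 : (n:ℝ) / (n + 1 : ℕ) - 1 = -(1 / (n + 1 : ℕ)) := by push_cast; field_simp; ring
    rw [e3] at hl
    have := Real.add_one_le_exp (Real.log ((n:ℝ) / (n + 1 : ℕ)) * -a)
    nlinarith
  rw [e1, e2]
  have hp : 0 < ((n + 1 : ℕ):ℝ)^(-a) := by positivity
  nlinarith

theorem sum_rpow_le (a : ℝ) (ha : 0 < a) (N : ℕ) (hN : 1 ≤ N) (M : ℕ) :
    ∑ n ∈ Finset.range M, ((n + 1 : ℕ):ℝ)^(-(1+a)) ≤ ∑ n ∈ Finset.range N, ((n + 1 : ℕ):ℝ)^(-(1+a)) + (N:ℝ)^(-a) / a := by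
  have key : ∀ k : ℕ, ∑ n ∈ Finset.range (N + k), ((n + 1 : ℕ):ℝ)^(-(1+a)) ≤
     ∑ n ∈ Finset.range N, ((n + 1 : ℕ):ℝ)^(-(1+a)) + (N:ℝ)^(-a) / a - ((N + k : ℕ):ℝ)^(-a) / a := by
    intro k
    induction k with
    | zero => simp
    | succ k ih =>
      rw [← add_assoc, Finset.sum_range_succ]
      have := rpow_step a ha (N + k) (by omega)
      rw [sub_div] at this
      linarith
  have hmono : ∑ n ∈ Finset.range M, ((n + 1 : ℕ):ℝ)^(-(1+a)) ≤ ∑ n ∈ Finset.range (N + M), ((n + 1 : ℕ):ℝ)^(-(1+a)) := by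
    apply Finset.sum_le_sum_of_subset_of_nonneg
    · intro n hn; simp at hn ⊢; omega
    · intros; positivity
  have := key M
  have : 0 ≤ ((N + M : ℕ):ℝ)^(-a) / a := by positivity
  linarith

theorem norm_LSeries_le (f : ℕ → ℂ) (hf : ∀ n, ‖f n‖ ≤ 1) (s : ℂ) (C : ℝ)
    (h : ∀ M : ℕ, ∑ n ∈ Finset.range M, ((n + 1 : ℕ):ℝ)^(-s.re) ≤ C) : ‖LSeries f s‖ ≤ C := by
  have hb : ∀ n : ℕ, ‖LSeries.term f s (n+1)‖ ≤ ((n + 1 : ℕ):ℝ)^(-s.re) := by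
    intro n
    rw [LSeries.norm_term_eq, if_neg (by omega), Real.rpow_neg (by positivity), ← one_div]
    gcongr; exact hf _
  have hpart : ∀ u : Finset ℕ, ∑ n ∈ u, ‖LSeries.term f s n‖ ≤ C := by
    intro u
    calc ∑ n ∈ u, ‖LSeries.term f s n‖ ≤ ∑ n ∈ Finset.range (u.sup id + 1), ‖LSeries.term f s n‖ := by
          apply Finset.sum_le_sum_of_subset_of_nonneg
          · intro n hn; simp only [Finset.mem_range]
            exact Nat.lt_succ_of_le (Finset.le_sup (f := id) hn)
          · intros; positivity
      _ = ∑ n ∈ Finset.range (u.sup id), ‖LSeries.term f s (n+1)‖ := by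
          rw [Finset.sum_range_succ']; simp
      _ ≤ ∑ n ∈ Finset.range (u.sup id), ((n + 1 : ℕ):ℝ)^(-s.re) := Finset.sum_le_sum (fun n _ => hb n)
      _ ≤ C := h _
  have hs : Summable (fun n => ‖LSeries.term f s n‖) :=
    summable_of_sum_le (fun _ => norm_nonneg _) hpart
  exact (norm_tsum_le_tsum_norm hs).trans (hs.tsum_le_of_sum_le hpart)

theorem zeta_inv_norm (s : ℂ) (hs : 1 < s.re) (C : ℝ)
    (h : ∀ M : ℕ, ∑ n ∈ Finset.range M, ((n + 1 : ℕ):ℝ)^(-s.re) ≤ C) : ‖(riemannZeta s)⁻¹‖ ≤ C := by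
  have e := ArithmeticFunction.LSeries_zeta_mul_Lseries_moebius hs
  rw [ArithmeticFunction.LSeries_zeta_eq_riemannZeta hs] at e
  have e2 : (riemannZeta s)⁻¹ = LSeries (fun n => (ArithmeticFunction.moebius n : ℂ)) s :=
    inv_eq_of_mul_eq_one_right e
  rw [e2]
  refine norm_LSeries_le _ (fun n => ?_) s C h
  have := @ArithmeticFunction.abs_moebius_le_one n
  rw [Complex.norm_intCast]
  exact_mod_cast this

theorem zeta_inv_gen (s : ℂ) (hs : 1 < s.re) : ‖(riemannZeta s)⁻¹‖ ≤ 1 + 1 / (s.re - 1) := by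
  apply zeta_inv_norm s hs
  intro M
  have := sum_rpow_le (s.re - 1) (by linarith) 1 le_rfl M
  simp at this
  simpa using this

theorem zeta_inv_14 (t : ℝ) : ‖(riemannZeta (((1.4:ℝ):ℂ) + t * I))⁻¹‖ ≤ 3.2 := by
  have hre : (((1.4:ℝ):ℂ) + t * I).re = 1.4 := by simp
  apply zeta_inv_norm _ (by rw [hre]; norm_num)
  intro M
  rw [hre]
  have := sum_rpow_le 0.4 (by norm_num) 4 (by norm_num) M
  rw [show (1 + 0.4 : ℝ) = 1.4 by norm_num] at this
  refine this.trans ?_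
  have hp : ∀ (x c : ℝ) (k : ℕ), 0 < x → 0 ≤ c → (x⁻¹)^k ≤ c^5 → x^(-((k:ℝ)/5)) ≤ c := by
    intro x c k hx hc h
    apply le_of_pow_le_pow_left₀ (n := 5) (by norm_num) hc
    refine le_trans (le_of_eq ?_) h
    rw [← Real.rpow_natCast (x^(-((k:ℝ)/5))), ← Real.rpow_mul hx.le, inv_pow, ← Real.rpow_natCast x k, ← Real.rpow_neg hx.le]
    congr 1; push_cast; ring
  have h2 := hp 2 0.3795 7 (by norm_num) (by norm_num) (by norm_num)
  have h3 := hp 3 0.2150 7 (by norm_num) (by norm_num) (by norm_num)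
  have h4 := hp 4 0.1438 7 (by norm_num) (by norm_num) (by norm_num)
  have h5 := hp 4 0.575 2 (by norm_num) (by norm_num) (by norm_num)
  norm_num [Finset.sum_range_succ] at h2 h3 h4 h5 ⊢
  linarith

theorem B_bound : -(logDeriv riemannZeta (((1.4:ℝ):ℂ) + ((0:ℝ):ℂ) * I)).re ≤ 2.05 := by
  have hre : (((1.4:ℝ):ℂ) + ((0:ℝ):ℂ) * I).re = 1.4 := by simp
  have hne : (((1.4:ℝ):ℂ) + ((0:ℝ):ℂ) * I) ≠ 1 := by intro h; rw [h] at hre; norm_num at hre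
  have h := PP_nonneg (((1.4:ℝ):ℂ) + ((0:ℝ):ℂ) * I) (by rw [hre]; norm_num)
  rw [PP_eq _ (by rw [hre]; norm_num) hne (riemannZeta_ne_zero_of_one_le_re (by rw [hre]; norm_num))] at h
  have e1 : (1/(((1.4 : ℝ):ℂ) + (0:ℝ) * I)).re = 1/1.4 := by
    simp only [ofReal_zero, zero_mul, add_zero]
    norm_cast
  have e2 : (1/((((1.4 : ℝ):ℂ) + (0:ℝ) * I)-1)).re = 2.5 := by
    have : (((1.4 : ℝ):ℂ) + (0:ℝ) * I)-1 = ((0.4:ℝ):ℂ) := by push_cast; norm_num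
    rw [this, show (1:ℂ) / ((0.4:ℝ):ℂ) = ((2.5:ℝ):ℂ) by push_cast; norm_num, ofReal_re]
  have e5 : (digamma ((((1.4 : ℝ):ℂ) + (0:ℝ) * I)/2)).re ≤ Real.log 1.7 - 1/3.4 - 1/0.7 := by
    have h1 : (((1.4 : ℝ):ℂ) + (0:ℝ) * I)/2 = ((0.7:ℝ):ℂ) := by push_cast; norm_num
    rw [h1, digamma_shift _ (by rw [ofReal_re]; norm_num)]
    have h2 : ((0.7:ℝ):ℂ) + 1 = ((1.7:ℝ):ℂ) := by push_cast; norm_num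
    have h3 : (1/((0.7:ℝ):ℂ)).re = 1/0.7 := by norm_cast
    rw [sub_re, h2, h3]
    have := digamma_re_le 1.7 (by norm_num)
    rw [show (2 * 1.7:ℝ) = 3.4 by norm_num] at this
    linarith
  have hl : Real.log 1.7 ≤ 0.531 := by
    rw [Real.log_le_iff_le_exp (by norm_num)]
    have := Real.sum_le_exp_of_nonneg (show (0:ℝ) ≤ 0.531 by norm_num) 7
    refine le_trans ?_ this
    norm_num [Finset.sum_range_succ, Nat.factorial]
  have hpi := log_pi_ge
  rw [e1, e2] at h
  norm_num at e5 hpi hl h ⊢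
  linarith

theorem zeta_re_bound (t : ℝ) : (logDeriv riemannZeta (((1.4:ℝ):ℂ) + t * I)).re ≤ 2.05 := by
  have h1 := hasSum_zeta_logDeriv 1.4 t (by norm_num)
  have h0 := hasSum_zeta_logDeriv 1.4 0 (by norm_num)
  have := h1.add h0
  have hn : 0 ≤ -(logDeriv riemannZeta (((1.4:ℝ):ℂ) + t * I)).re + -(logDeriv riemannZeta (((1.4:ℝ):ℂ) + ((0:ℝ):ℂ) * I)).re := by
    refine this.nonneg (fun n => ?_)
    rw [← mul_add, ← mul_add, zero_mul, Real.cos_zero]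
    apply mul_nonneg ArithmeticFunction.vonMangoldt_nonneg
    apply mul_nonneg (by positivity)
    linarith [Real.neg_one_le_cos (t * Real.log n)]
  have := B_bound
  linarith

theorem PP_14 (t : ℝ) : PP (((1.4:ℝ):ℂ) + t * I) ≤ (1/(((1.4:ℝ):ℂ) + t * I)).re + (1/(((0.4:ℝ):ℂ) + t * I)).re
     - Real.log Real.pi/2 + (digamma ((((1.4:ℝ):ℂ) + t * I)/2)).re/2 + 2.05 := by
  have hre : (((1.4:ℝ):ℂ) + t * I).re = 1.4 := by simp
  have hne : (((1.4:ℝ):ℂ) + t * I) ≠ 1 := by intro h; rw [h] at hre; norm_num at hre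
  rw [PP_eq _ (by rw [hre]; norm_num) hne (riemannZeta_ne_zero_of_one_le_re (by rw [hre]; norm_num))]
  have := zeta_re_bound t
  have e2 : (((1.4:ℝ):ℂ) + t * I)-1 = ((0.4:ℝ):ℂ) + t * I := by push_cast; norm_num; ring
  rw [e2]; linarith

theorem log_2pi (t : ℝ) (ht : 0 < t) : Real.log (t/(2*Real.pi)) = Real.log (t/2) - Real.log Real.pi := by
  rw [← Real.log_div (by positivity) (by positivity)]; congr 1; field_simp

theorem P_hi (t : ℝ) (ht : 4 ≤ t) : PP (((1.4:ℝ):ℂ) + t * I) ≤ 1/2 * Real.log (t/(2*Real.pi)) + 2.05 + 2.1 / t^2 := by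
  have ht0 : 0 < t := by linarith
  have h := PP_14 t
  have a1 := inv_re_le 1.4 t (by norm_num) ht0
  have a2 := inv_re_le 0.4 t (by norm_num) ht0
  have c1 := (abs_le.mp (digamma_abs 1.4 t (by norm_num) ht)).2
  have l1 := (log_norm_half 1.4 t ht0).2
  rw [log_2pi t ht0]
  have x1 : 1.4/t^2 = 1.4 * (1/t^2) := by ring
  have x2 : 0.4/t^2 = 0.4 * (1/t^2) := by ring
  have x4 : 2.1/t^2 = 2.1 * (1/t^2) := by ring
  have x5 : (1.4:ℝ)^2/(2*t^2) = 0.98 * (1/t^2) := by field_simp; norm_num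
  have hu : 0 < 1/t^2 := by positivity
  rw [x1] at a1; rw [x2] at a2; rw [x5] at l1; rw [x4]
  linarith

theorem re_logDeriv_Gammaℝ (σ t : ℝ) (hσ : 0 < σ) : (logDeriv Gammaℝ ((σ:ℂ) + t * I)).re =
    (digamma (((σ:ℂ) + t * I)/2)).re/2 - Real.log Real.pi/2 := by
  rw [logDeriv_Gammaℝ _ (by simpa using hσ), add_re]
  rw [show (-(Real.log Real.pi : ℂ) / 2) = ((- Real.log Real.pi / 2 : ℝ) : ℂ) by push_cast; rfl, ofReal_re,
    show (2:ℂ) = ((2:ℝ):ℂ) by norm_num, div_ofReal_re]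
  ring

theorem D_hi (t σ : ℝ) (ht : 4 ≤ t) (hσ : 0 < σ) (hσ2 : σ ≤ 1.4) :
    1/2 * Real.log (t/(2*Real.pi)) - 1.2 / t^2 ≤ (logDeriv Gammaℝ ((σ:ℂ) + t * I)).re := by
  have ht0 : 0 < t := by linarith
  rw [re_logDeriv_Gammaℝ σ t hσ]
  have a1 := inv_re_le σ t hσ.le ht0
  have c1 := (abs_le.mp (digamma_abs σ t hσ ht)).1
  have l1 := (log_norm_half σ t ht0).1
  rw [log_2pi t ht0]
  have x1 : σ/t^2 ≤ 1.4 * (1/t^2) := by rw [div_eq_mul_one_div]; gcongr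
  have x4 : 1.2/t^2 = 1.2 * (1/t^2) := by ring
  rw [x4]
  linarith

theorem digamma_abs2 (σ t : ℝ) (hσ : 0 < σ) (ht : 2 ≤ t) :
   |(digamma (((σ:ℂ) + t * I)/2)).re - (Real.log ‖((σ:ℂ) + t * I)/2‖ - (1/((σ:ℂ) + t * I)).re)| ≤ (4/3)/t^2 := by
  have ht0 : 0 < t := by linarith
  have hre : (((σ:ℂ) + t * I)/2).re = σ/2 := by
    rw [show (2:ℂ) = ((2:ℝ):ℂ) by norm_num, div_ofReal_re]; simp
  have him : (((σ:ℂ) + t * I)/2).im = t/2 := by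
    rw [show (2:ℂ) = ((2:ℝ):ℂ) by norm_num, div_ofReal_im]; simp
  have h := digamma_bound (((σ:ℂ) + t * I)/2) (by rw [hre]; linarith) (t/2) (by linarith)
    (by rw [him]; exact le_abs_self _)
  have h2 := (abs_re_le_norm _).trans h
  rw [add_re, sub_re, log_re] at h2
  have e : 2 * (((σ:ℂ) + t * I)/2) = (σ:ℂ) + t * I := by ring
  rw [e] at h2
  have e2 : (1/(t/2)^3 + 1/(t/2)^2)/6 ≤ (4/3)/t^2 := by
    have : (1/(t/2)^3 + 1/(t/2)^2)/6 = (8/t + 4)/6 / t^2 := by field_simp; try ring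
    rw [this]
    apply div_le_div_of_nonneg_right _ (by positivity)
    have : 8/t ≤ 4 := by rw [div_le_iff₀ ht0]; linarith
    linarith
  refine le_trans (le_of_eq ?_) (h2.trans e2)
  congr 1; ring

theorem inv_re_eq (a t : ℝ) : (1/((a:ℂ) + t * I)).re = a / (a^2 + t^2) := by
  rw [one_div, inv_re, normSq_apply]; simp; ring

theorem P_mid (t : ℝ) (ht : 2 ≤ t) (ht4 : t ≤ 4) : PP (((1.4:ℝ):ℂ) + t * I) ≤ 2.07 := by
  have ht0 : 0 < t := by linarith
  have h := PP_14 t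
  have c1 := (abs_le.mp (digamma_abs2 1.4 t (by norm_num) ht)).2
  have hn : ‖(((1.4:ℝ):ℂ) + t * I)/2‖^2 = ((1.4:ℝ)^2 + t^2)/4 := by
    rw [norm_div, div_pow, ← normSq_eq_norm_sq, normSq_apply]; simp; ring
  have hl : 2 * Real.log ‖(((1.4:ℝ):ℂ) + t * I)/2‖ = Real.log (((1.4:ℝ)^2 + t^2)/4) := by
    rw [← hn, Real.log_pow]; norm_num
  rw [inv_re_eq] at h c1
  rw [inv_re_eq] at h
  have hw1 : 4 ≤ t^2 := by nlinarith
  have hw2 : t^2 ≤ 16 := by nlinarith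
  generalize t^2 = w at *
  have hl2 : Real.log (((1.4:ℝ)^2 + w)/4) ≤ 1.5088 + ((1.96 + w)/17.96 - 1) := by
    have e : ((1.4:ℝ)^2 + w)/4 = 2^2 * (1.1225 * ((1.96 + w)/17.96)) := by ring
    have p : 0 < (1.96 + w)/17.96 := by positivity
    rw [e, Real.log_mul (by norm_num) (by positivity), Real.log_mul (by norm_num) (by positivity), Real.log_pow]
    have := Real.log_two_lt_d9
    have h1 := Real.log_le_sub_one_of_pos (show (0:ℝ) < 1.1225 by norm_num)
    have h2 := Real.log_le_sub_one_of_pos p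
    push_cast
    norm_num at this h1 h2 ⊢
    linarith
  have ch : ∀ c : ℝ, 0 ≤ c → 1/(c + w) ≤ (c + 20 - w)/((c+4)*(c+16)) := by
    intro c hc
    rw [div_le_div_iff₀ (by linarith) (by positivity)]
    nlinarith [mul_nonneg (sub_nonneg.mpr hw1) (sub_nonneg.mpr hw2)]
  have k1 := ch 1.96 (by norm_num)
  have k2 := ch 0.16 (by norm_num)
  have k3 := ch 0 le_rfl
  have r1 : 1.4/((1.4:ℝ)^2 + w) = 1.4 * (1/(1.96 + w)) := by norm_num; ring
  have r2 : 0.4/((0.4:ℝ)^2 + w) = 0.4 * (1/(0.16 + w)) := by norm_num; ring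
  have r3 : (4/3)/w = (4/3) * (1/(0 + w)) := by rw [zero_add]; ring
  have hpi := log_pi_ge
  rw [r1] at h c1
  rw [r2] at h
  rw [r3] at c1
  norm_num at *
  linarith

theorem D_mid (t σ : ℝ) (ht : 2 ≤ t) (hσ : 0 < σ) :
    -0.865 ≤ (logDeriv Gammaℝ ((σ:ℂ) + t * I)).re := by
  have ht0 : 0 < t := by linarith
  rw [re_logDeriv_Gammaℝ σ t hσ]
  have c1 := (abs_le.mp (digamma_abs2 σ t hσ ht)).1
  have l1 := (log_norm_half σ t ht0).1
  have l2 : 0 ≤ Real.log (t/2) := Real.log_nonneg (by linarith)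
  have a1 : (1/((σ:ℂ) + t * I)).re ≤ 0.25 := by
    rw [inv_re_eq, div_le_iff₀ (by positivity)]
    nlinarith [sq_nonneg (σ - 2)]
  have : (4/3)/t^2 ≤ 1/3 := by
    rw [div_le_iff₀ (by positivity)]; nlinarith
  have hpi := log_pi_le
  norm_num at *
  linarith

theorem P_low (t : ℝ) (ht0 : 0 ≤ t) (ht : t ≤ 2) : PP (((1.4:ℝ):ℂ) + t * I) ≤ 0.43 := by
  have key : ∀ ρ, xi ρ = 0 → 0 ≤ 2.95 * Fz (((2 : ℝ):ℂ) + (0:ℝ) * I) ρ + (-1) * Fz (((1.4 : ℝ):ℂ) + t * I) ρ := by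
    intro ρ hρ
    obtain ⟨h0, h1⟩ := xi_zero_re ρ hρ
    have e := Fz_formula 2 0 ρ.re ρ.im
    have e' := Fz_formula 1.4 t ρ.re ρ.im
    rw [re_add_im] at e e'
    rw [e, e']
    have h4 := low_zeros ρ hρ
    set b := ρ.re
    set γ := ρ.im
    have hg : 16 ≤ γ^2 := by rw [← sq_abs]; nlinarith
    have hY : γ^2/4 ≤ (t - γ)^2 := by
      have : |γ|/2 ≤ |t - γ| := by
        have := abs_sub_abs_le_abs_sub γ t
        rw [abs_sub_comm γ t, abs_of_nonneg ht0] at this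
        linarith
      rw [← sq_abs γ, ← sq_abs (t - γ)]
      nlinarith [abs_nonneg γ]
    have p : 0 < γ^2/4 + 0.16 := by positivity
    have a1 : (1.4 - b) / ((1.4 - b)^2 + (t - γ)^2) ≤ (1.4 - b) / (γ^2/4 + 0.16) := by
      apply div_le_div_of_nonneg_left (by linarith) p
      nlinarith
    have a2 : (1.4 - 1 + b) / ((1.4 - 1 + b)^2 + (t - γ)^2) ≤ (1.4 - 1 + b) / (γ^2/4 + 0.16) := by
      apply div_le_div_of_nonneg_left (by linarith) p
      nlinarith
    have q1 : 0 < 2 - b := by linarith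
    have q2 : 0 < 2 - 1 + b := by linarith
    have a3 : (2 - b) / (4 + γ^2) ≤ (2 - b) / ((2 - b)^2 + (0 - γ)^2) := by
      apply div_le_div_of_nonneg_left (by linarith) (by positivity)
      nlinarith
    have a4 : (2 - 1 + b) / (4 + γ^2) ≤ (2 - 1 + b) / ((2 - 1 + b)^2 + (0 - γ)^2) := by
      apply div_le_div_of_nonneg_left (by linarith) (by positivity)
      nlinarith
    have a5 : (1.4 - b) / (γ^2/4 + 0.16) + (1.4 - 1 + b) / (γ^2/4 + 0.16) ≤ 2.95 * ((2 - b) / (4 + γ^2) + (2 - 1 + b) / (4 + γ^2)) := by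
      rw [← add_div, ← add_div, ← mul_div_assoc, div_le_div_iff₀ p (by positivity)]
      nlinarith
    linarith
  have h := PP_linear_nonneg 2.95 (-1) (((2 : ℝ):ℂ) + (0:ℝ) * I) (((1.4 : ℝ):ℂ) + t * I)
    (xi_ne_zero_of_one_le _ (by simp)) (xi_ne_zero_of_one_le _ (by simp; norm_num)) key
  have e2 : ((2 : ℝ):ℂ) + (0:ℝ) * I = 2 := by simp
  rw [e2] at h
  have := PP_two
  norm_num at *
  linarith

theorem digamma_re_ge_real (x y : ℝ) (hx : 0 < x) :
    (digamma ((x:ℂ) + y * I)).re + (1/((x:ℂ) + y * I)).re ≥ (digamma (x:ℂ)).re + (1/(x:ℂ)).re := by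
  have h1 := (digamma_hasSum ((x:ℂ) + y * I) (by simpa using hx)).mapL reCLM
  have h2 := (digamma_hasSum (x:ℂ) (by simpa using hx)).mapL reCLM
  have := hasSum_le (fun k => ?_) h2 h1
  · simpa using this
  · simp only [reCLM_apply, sub_re]
    apply sub_le_sub_left
    have e1 : (x:ℂ) + y * I + k + 1 = ((x + k + 1 : ℝ):ℂ) + y * I := by push_cast; ring
    have e2 : (x:ℂ) + k + 1 = ((x + k + 1 : ℝ):ℂ) + (0:ℝ) * I := by push_cast; ring
    rw [e1, e2, inv_re_eq, inv_re_eq]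
    have : (0:ℝ) < x + k + 1 := by positivity
    apply div_le_div_of_nonneg_left this.le (by positivity)
    nlinarith [sq_nonneg y]

theorem D_low (t σ : ℝ) (hσ : 0.9 ≤ σ) :
    -1.79 ≤ (logDeriv Gammaℝ ((σ:ℂ) + t * I)).re := by
  rw [re_logDeriv_Gammaℝ σ t (by linarith)]
  have e : ((σ:ℂ) + t * I)/2 = ((σ/2:ℝ):ℂ) + ((t/2:ℝ):ℂ) * I := by push_cast; ring
  rw [e]
  set x := σ/2 with hx
  have hx1 : 0.45 ≤ x := by linarith
  have h := digamma_re_ge_real x (t/2) (by linarith)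
  have d1 := digamma_shift (x:ℂ) (by rw [ofReal_re]; linarith)
  have d2 := digamma_shift ((x + 1 : ℝ):ℂ) (by rw [ofReal_re]; linarith)
  have d3 := le_digamma_re (x + 1 + 1) (by linarith)
  rw [show (x:ℂ) + 1 = ((x+1:ℝ):ℂ) by push_cast; rfl] at d1
  rw [show ((x+1:ℝ):ℂ) + 1 = ((x+1+1:ℝ):ℂ) by push_cast; rfl] at d2
  have e3 : (1/(x:ℂ)).re = 1/x := by norm_cast
  have e4 : (1/((x+1:ℝ):ℂ)).re = 1/(x+1) := by norm_cast
  have d1' := congrArg Complex.re d1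
  have d2' := congrArg Complex.re d2
  rw [sub_re, e3] at d1'
  rw [sub_re, e4] at d2'
  rw [e3] at h
  have i1 : (1/((x:ℂ) + ((t/2:ℝ):ℂ) * I)).re ≤ 1/0.45 := by
    rw [inv_re_eq]
    calc x/(x^2 + (t/2)^2) ≤ x/x^2 := by
          apply div_le_div_of_nonneg_left (by linarith) (by nlinarith) (by nlinarith [sq_nonneg (t/2)])
      _ = 1/x := by have : x ≠ 0 := by linarith
                    field_simp
      _ ≤ 1/0.45 := one_div_le_one_div_of_le (by norm_num) hx1
  have i2 : 1/(x+1) ≤ 1/1.45 := one_div_le_one_div_of_le (by norm_num) (by linarith)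
  have i3 : 1/(x+1+1) ≤ 1/2.45 := one_div_le_one_div_of_le (by norm_num) (by linarith)
  have i4 : 0.894 ≤ Real.log (x+1+1) := by
    have : Real.log 2.45 ≤ Real.log (x+1+1) := Real.log_le_log (by norm_num) (by linarith)
    refine le_trans ?_ this
    rw [Real.le_log_iff_exp_le (by norm_num)]
    have := Real.exp_bound' (show (0:ℝ) ≤ 0.894 by norm_num) (by norm_num) (n := 7) (by norm_num)
    refine this.trans ?_
    norm_num [Finset.sum_range_succ, Nat.factorial]
  have hpi := log_pi_le
  norm_num at *
  linarith

end

section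
open Complex Metric Set Filter Topology

def ZF (Y η : ℝ) : Prop := ∀ ρ : ℂ, xi ρ = 0 → |ρ.im| ≤ Y → ρ.re ≤ 1 - η

noncomputable def QQ (η x : ℝ) : ℝ := (0.4 + η) * Real.log ((0.4 + η) / (x + η))

theorem ZF_of (d Y η : ℝ) (hd : 0 < d) (hd2 : d ≤ 0.19) (hη0 : 0 < η) (hη : η ≤ 1/2)
    (h : (5/d - 3.47 + 1.15 * d + 91/24 * Real.log (Y/(2*Real.pi)) + 25.6/Y^2) * (d + η) ≤ 8) : ZF Y η := by
  intro ρ h0 hY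
  by_cases hre : ρ.re ≤ 1/2
  · linarith
  push Not at hre
  have h1 := zero_free d Y hd hd2 ρ h0 hre hY
  have hlt := (xi_zero_re ρ h0).2
  set R := 5/d - 3.47 + 1.15 * d + 91/24 * Real.log (Y/(2*Real.pi)) + 25.6/Y^2
  have hp : 0 < d + (1 - ρ.re) := by linarith
  rw [div_le_iff₀ hp] at h1
  by_contra hc
  push Not at hc
  have hR : 0 < R := by
    by_contra hR
    push Not at hR
    nlinarith
  nlinarith

theorem iz_conj (s : ℂ) : iz (starRingEnd ℂ s) = starRingEnd ℂ (iz s) := by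
  simp only [iz, xi_conj, Gammaℝ_conj', map_div₀, map_mul, map_sub, map_one]

theorem iz_norm_neg (σ t : ℝ) : ‖iz ((σ:ℂ) + (-t : ℝ) * I)‖ = ‖iz ((σ:ℂ) + t * I)‖ := by
  have : ((σ:ℂ) + (-t : ℝ) * I) = starRingEnd ℂ ((σ:ℂ) + t * I) := by simp
  rw [this, iz_conj, Complex.norm_conj]

theorem iz_norm_abs (σ t : ℝ) : ‖iz ((σ:ℂ) + t * I)‖ = ‖iz ((σ:ℂ) + (|t| : ℝ) * I)‖ := by
  rcases abs_cases t with ⟨h, _⟩ | ⟨h, _⟩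
  · rw [h]
  · rw [h, iz_norm_neg]

theorem QQ_nonneg (η x : ℝ) (h : 0 < x + η) (h4 : x ≤ 0.4) (hη : 0 < η) : 0 ≤ QQ η x := by
  unfold QQ
  apply mul_nonneg (by linarith)
  apply Real.log_nonneg
  rw [le_div_iff₀ h]; linarith

theorem QQ_anti (η x y : ℝ) (h : 0 < x + η) (hxy : x ≤ y) (hη : 0 < η) : QQ η y ≤ QQ η x := by
  unfold QQ
  apply mul_le_mul_of_nonneg_left _ (by linarith)
  apply Real.log_le_log
  · apply div_pos <;> linarith
  · apply div_le_div_of_nonneg_left <;> linarith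

theorem ZF_loc (η t T : ℝ) (hZ : ZF (T+1) η) (ht : |t| ≤ T) :
    ∀ ρ : ℂ, xi ρ = 0 → |ρ.im - t| ≤ 1 → ρ.re ≤ 1 - η := by
  intro ρ h0 h1
  apply hZ ρ h0
  have : |ρ.im| ≤ |ρ.im - t| + |t| := by
    have := abs_add_le (ρ.im - t) t; simpa using this
  linarith

theorem izc_low (η η' t T : ℝ) (hη : η ≤ 0.4) (h1 : 0 < η') (h2 : η' < η) (h3 : η' ≤ 0.1) (hT : 4 ≤ T)
    (hZ : ZF (T+1) η) (ht : |t| ≤ 2) :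
    ‖iz (((1 - η' : ℝ):ℂ) + t * I)‖ ≤ 3.2 * Real.exp (1.79 * (0.4 + η') + 0.43 * QQ η (-η')) := by
  rw [iz_norm_abs]
  have hz := ZF_loc η |t| T hZ (by rw [abs_abs]; linarith)
  have := iz_bound η η' |t| 0.43 (-1.79) 3.2 (-η') hη h1 h2 hz (P_low _ (abs_nonneg t) ht)
    (fun y hy _ => D_low _ _ (by linarith)) (zeta_inv_14 _) le_rfl (by linarith)
  refine le_trans (le_of_eq ?_) (this.trans (le_of_eq ?_))
  · rw [← sub_eq_add_neg]
  · unfold QQ; congr 2; ring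

theorem izc_mid (η η' t T : ℝ) (hη : η ≤ 0.4) (h1 : 0 < η') (h2 : η' < η) (h3 : η' ≤ 0.1) (hT : 4 ≤ T)
    (hZ : ZF (T+1) η) (ht : 2 ≤ |t|) (ht4 : |t| ≤ 4) :
    ‖iz (((1 - η' : ℝ):ℂ) + t * I)‖ ≤ 3.2 * Real.exp (0.865 * (0.4 + η') + 2.07 * QQ η (-η')) := by
  rw [iz_norm_abs]
  have hz := ZF_loc η |t| T hZ (by rw [abs_abs]; linarith)
  have := iz_bound η η' |t| 2.07 (-0.865) 3.2 (-η') hη h1 h2 hz (P_mid _ ht ht4)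
    (fun y hy _ => D_mid _ _ ht (by linarith)) (zeta_inv_14 _) le_rfl (by linarith)
  refine le_trans (le_of_eq ?_) (this.trans (le_of_eq ?_))
  · rw [← sub_eq_add_neg]
  · unfold QQ; congr 2; ring

theorem izc_hi_gen (η η' t T : ℝ) (hη : η ≤ 0.4) (h1 : 0 < η') (h2 : η' < η) (h3 : η' ≤ 0.1)
    (hZ : ZF (T+1) η) (x : ℝ) (ht : 4 ≤ |t|) (htT : |t| ≤ T) (hx : -η' ≤ x) (hx2 : x ≤ 0.4) :
    ‖iz (((1 + x : ℝ):ℂ) + t * I)‖ ≤ 3.2 * Real.exp (-(1/2 * Real.log (|t|/(2*Real.pi))) * (0.4 - x)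
      + (1/2 * Real.log (|t|/(2*Real.pi)) + 2.182) * QQ η x + 0.04) := by
  rw [iz_norm_abs]
  have hz := ZF_loc η |t| T hZ (by rw [abs_abs]; linarith)
  have := iz_bound η η' |t| _ _ 3.2 x hη h1 h2 hz (P_hi _ ht)
    (fun y hy hy2 => D_hi |t| _ ht (by linarith) (by linarith)) (zeta_inv_14 _) hx hx2
  refine this.trans ?_
  apply mul_le_mul_of_nonneg_left _ (by norm_num)
  apply Real.exp_le_exp.mpr
  have hq := QQ_nonneg η x (by linarith) hx2 (by linarith)
  unfold QQ at hq ⊢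
  set q := (0.4 + η) * Real.log ((0.4 + η) / (x + η))
  have ht2 : (16:ℝ) ≤ |t|^2 := by nlinarith
  have a1 : 1.2 / |t|^2 ≤ 0.075 := by rw [div_le_iff₀ (by linarith)]; linarith
  have a2 : 2.1 / |t|^2 ≤ 0.13125 := by rw [div_le_iff₀ (by linarith)]; linarith
  have a3 : 1.2 / |t|^2 * (0.4 - x) ≤ 0.075 * (0.4 - x) := mul_le_mul_of_nonneg_right a1 (by linarith)
  have a4 : 2.1 / |t|^2 * q ≤ 0.13125 * q := mul_le_mul_of_nonneg_right a2 hq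
  nlinarith

end

section
open Complex Metric Set Filter Topology

theorem euler_bound (b : ℕ → ℝ) (h0 : ∀ n, 0 ≤ b n) (hb0 : b 0 = 0) (hb1 : b 1 = 1)
    (hmul : ∀ {m n : ℕ}, Nat.Coprime m n → b (m * n) = b m * b n) (E : ℕ → ℝ)
    (hs : ∀ {p : ℕ}, p.Prime → Summable (fun n : ℕ => b (p ^ n)))
    (hE : ∀ {p : ℕ}, p.Prime → ∑' n : ℕ, b (p ^ n) ≤ E p) (G : ℝ)
    (hG : ∀ N : ℕ, ∏ p ∈ N.primesBelow, E p ≤ G) : Summable b ∧ ∑' n, b n ≤ G := by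
  have key : ∀ u : Finset ℕ, ∑ n ∈ u, b n ≤ G := by
    intro u
    set N := u.sup id + 1
    have h := EulerProduct.summable_and_hasSum_smoothNumbers_prod_primesBelow_tsum (f := b) hb1 hmul
      (fun hp => by simpa [Real.norm_eq_abs, abs_of_nonneg (h0 _)] using hs hp) N
    have h1 : ∏ p ∈ N.primesBelow, ∑' n : ℕ, b (p ^ n) ≤ G := by
      refine le_trans (Finset.prod_le_prod (fun p _ => tsum_nonneg (fun _ => h0 _)) (fun p hp => ?_)) (hG N)
      exact hE (Nat.prime_of_mem_primesBelow hp)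
    have h2 := hasSum_subtype_iff_indicator.mp h.2
    refine le_trans ?_ h1
    refine le_trans (le_of_eq ?_) (sum_le_hasSum u (fun n _ => Set.indicator_nonneg (fun n _ => h0 n) n) h2)
    apply Finset.sum_congr rfl
    intro n hn
    by_cases hn0 : n = 0
    · subst hn0; simp [Set.indicator, hb0]
    · rw [Set.indicator_of_mem]
      apply Nat.mem_smoothNumbers_of_lt (Nat.pos_of_ne_zero hn0)
      exact Nat.lt_succ_of_le (Finset.le_sup (f := id) hn)
  have hsum := summable_of_sum_le h0 key
  exact ⟨hsum, hsum.tsum_le_of_sum_le key⟩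

theorem prod_tail (E w : ℕ → ℝ) (P : ℝ) (hw : ∀ n, 0 ≤ w n) (hE1 : ∀ {p : ℕ}, p.Prime → 1 ≤ E p)
    (hP : E 2 * E 3 * E 5 * E 7 * E 11 * E 13 ≤ P)
    (hstep : ∀ n : ℕ, 17 ≤ n → E n ≤ Real.exp (w (n-2) - w n)) (N : ℕ)
    (hw2 : ∀ n : ℕ, 17 ≤ n → w n ≤ w (n-2)) :
    ∏ p ∈ N.primesBelow, E p ≤ P * Real.exp (w 15) := by
  have hPp : 0 ≤ P := by
    refine le_trans ?_ hP
    have h2 := hE1 Nat.prime_two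
    have h3 := hE1 Nat.prime_three
    have h5 := hE1 Nat.prime_five
    have h7 := hE1 (show Nat.Prime 7 by norm_num)
    have h11 := hE1 (show Nat.Prime 11 by norm_num)
    have h13 := hE1 (show Nat.Prime 13 by norm_num)
    positivity
  have key : ∀ m : ℕ, ∏ p ∈ (17 + 2 * m).primesBelow, E p ≤ P * Real.exp (w 15 - w (15 + 2 * m)) := by
    intro m
    induction m with
    | zero =>
      have : (17 + 2*0).primesBelow = {2,3,5,7,11,13} := by decide
      rw [this]
      simp only [mul_zero, add_zero, sub_self, Real.exp_zero, mul_one]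
      refine le_trans (le_of_eq ?_) hP
      rw [Finset.prod_insert (by decide), Finset.prod_insert (by decide), Finset.prod_insert (by decide),
        Finset.prod_insert (by decide), Finset.prod_insert (by decide), Finset.prod_singleton]
      ring
    | succ m ih =>
      have hnp : ¬ (17 + 2 * m + 1).Prime := by
        intro h
        rcases h.eq_one_or_self_of_dvd 2 ⟨9 + m, by ring⟩ with h | h <;> omega
      rw [show 17 + 2 * (m+1) = (17 + 2*m + 1) + 1 by ring, Nat.primesBelow_succ, if_neg hnp, Nat.primesBelow_succ]
      have hs := hstep (17 + 2*m) (by omega)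
      have hs2 := hw2 (17 + 2*m) (by omega)
      rw [show 17 + 2*m - 2 = 15 + 2*m by omega] at hs hs2
      rw [show 15 + 2 * (m+1) = 17 + 2*m by ring]
      split_ifs with hp
      · rw [Finset.prod_insert (by simp [Nat.primesBelow])]
        calc _ ≤ Real.exp (w (15 + 2*m) - w (17+2*m)) * (P * Real.exp (w 15 - w (15 + 2 * m))) := by
              apply mul_le_mul hs ih
              · exact Finset.prod_nonneg (fun p hp => zero_le_one.trans (hE1 (Nat.prime_of_mem_primesBelow hp)))
              · positivity
          _ = P * Real.exp (w 15 - w (17+2*m)) := by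
              rw [mul_left_comm, ← Real.exp_add]; congr 2; ring
      · refine ih.trans ?_
        gcongr
  have hsub : N.primesBelow ⊆ (17 + 2 * N).primesBelow := by
    intro p hp
    rw [Nat.mem_primesBelow] at hp ⊢
    exact ⟨by omega, hp.2⟩
  calc _ ≤ ∏ p ∈ (17 + 2 * N).primesBelow, E p := by
        apply Finset.prod_le_prod_of_subset_of_one_le hsub
        · exact fun p hp => zero_le_one.trans (hE1 (Nat.prime_of_mem_primesBelow hp))
        · exact fun p hp _ => hE1 (Nat.prime_of_mem_primesBelow hp)
    _ ≤ _ := key N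
    _ ≤ _ := by
        gcongr; linarith [hw (15 + 2*N)]

theorem rpow_step2 (a x : ℝ) (ha : 0 < a) (hx : 2 < x) :
    2 * a * x^(-(1+a)) ≤ (x - 2)^(-a) - x^(-a) := by
  have hx0 : (0:ℝ) < x := by linarith
  have hy0 : (0:ℝ) < x - 2 := by linarith
  have e1 : x^(-(1+a)) = x^(-a) * (1 / x) := by
    rw [show -(1+a) = -a + (-1) by ring, Real.rpow_add hx0, Real.rpow_neg_one, one_div]
  have e2 : (x-2)^(-a) = x^(-a) * ((x-2)/x)^(-a) := by
    rw [← Real.mul_rpow hx0.le (by positivity)]; congr 1; field_simp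
  have h : 1 + a * (2 / x) ≤ ((x-2)/x)^(-a) := by
    have hq : (0:ℝ) < (x-2)/x := by positivity
    rw [Real.rpow_def_of_pos hq]
    have hl := Real.log_le_sub_one_of_pos hq
    have e3 : (x-2)/x - 1 = -(2 / x) := by field_simp; ring
    rw [e3] at hl
    have := Real.add_one_le_exp (Real.log ((x-2)/x) * -a)
    nlinarith
  rw [e1, e2]
  have hp : 0 < x^(-a) := by positivity
  have : x^(-a) * (1 + a * (2/x)) ≤ x^(-a) * ((x-2)/x)^(-a) := mul_le_mul_of_nonneg_left h hp.le
  have e4 : 2 * a * (x^(-a) * (1/x)) = x^(-a) * (1 + a * (2/x)) - x^(-a) := by ring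
  rw [e4]; linarith

end

section
open Complex Metric Set Filter Topology


def pw (c : ℤ) : ArithmeticFunction ℤ :=
  ⟨fun n => if Odd n then c ^ (ArithmeticFunction.cardFactors n) else 0, by simp⟩

theorem pw_apply (c : ℤ) (n : ℕ) : pw c n = if Odd n then c ^ (ArithmeticFunction.cardFactors n) else 0 := rfl

theorem pw_mult (c : ℤ) : (pw c).IsMultiplicative := by
  refine ⟨by simp [pw_apply], ?_⟩
  intro m n _
  simp only [pw_apply, Nat.odd_mul]
  by_cases hm : Odd m <;> by_cases hn : Odd n <;> simp [hm, hn]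
  rw [ArithmeticFunction.cardFactors_mul (by rintro rfl; simp at hm) (by rintro rfl; simp at hn), pow_add]

theorem pw_prime_pow (c : ℤ) (p k : ℕ) (hp : p.Prime) (h2 : p ≠ 2) : pw c (p^k) = c^k := by
  have ho : Odd p := hp.odd_of_ne_two h2
  rw [pw_apply, if_pos ho.pow, ArithmeticFunction.cardFactors_apply_prime_pow hp]

theorem pw_two_pow (c : ℤ) (k : ℕ) : pw c (2^k) = if k = 0 then 1 else 0 := by
  rcases k with _ | k
  · simp [pw_apply]
  · rw [pw_apply, if_neg, if_neg (by omega)]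
    simp [pow_succ]

def aZ : ArithmeticFunction ℤ := pw (-2) * (ArithmeticFunction.zeta : ArithmeticFunction ℤ) * (ArithmeticFunction.zeta : ArithmeticFunction ℤ)

theorem mul_zeta_prime_pow (F : ArithmeticFunction ℤ) (p k : ℕ) (hp : p.Prime) :
    (F * (ArithmeticFunction.zeta : ArithmeticFunction ℤ)) (p^k) = ∑ i ∈ Finset.range (k+1), F (p^i) := by
  rw [ArithmeticFunction.coe_mul_zeta_apply, Nat.sum_divisors_prime_pow hp]

theorem aZ_mult : aZ.IsMultiplicative :=
  ((pw_mult _).mul ArithmeticFunction.isMultiplicative_zeta.natCast).mul ArithmeticFunction.isMultiplicative_zeta.natCast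

theorem sum_neg_two (k : ℕ) : 3 * ∑ i ∈ Finset.range (k+1), (-2:ℤ)^i = 1 - (-2)^(k+1) := by
  induction k with
  | zero => simp
  | succ k ih => rw [Finset.sum_range_succ, mul_add, ih]; ring

theorem aZ_prime_pow (p k : ℕ) (hp : p.Prime) (h2 : p ≠ 2) : 9 * aZ (p^k) = 3 * k + 5 + 4 * (-2)^k := by
  rw [aZ, mul_zeta_prime_pow _ _ _ hp]
  have : ∀ i, (pw (-2) * (ArithmeticFunction.zeta : ArithmeticFunction ℤ)) (p^i) = ∑ j ∈ Finset.range (i+1), (-2:ℤ)^j := by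
    intro i
    rw [mul_zeta_prime_pow _ _ _ hp]
    exact Finset.sum_congr rfl (fun j _ => pw_prime_pow _ _ _ hp h2)
  simp only [this]
  induction k with
  | zero => simp
  | succ k ih =>
    rw [Finset.sum_range_succ, mul_add, ih]
    have := sum_neg_two (k+1)
    rw [show (9:ℤ) * ∑ j ∈ Finset.range (k + 1 + 1), (-2:ℤ)^j = 3 * (3 * ∑ j ∈ Finset.range (k + 1 + 1), (-2:ℤ)^j) by ring, this]
    push_cast; ring

theorem aZ_two_pow (k : ℕ) : aZ (2^k) = k + 1 := by
  rw [aZ, mul_zeta_prime_pow _ _ _ Nat.prime_two]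
  have : ∀ i, (pw (-2) * (ArithmeticFunction.zeta : ArithmeticFunction ℤ)) (2^i) = 1 := by
    intro i
    rw [mul_zeta_prime_pow _ _ _ Nat.prime_two]
    simp [pw_two_pow]
  simp [this]

theorem aZ_abs (p k : ℕ) (hp : p.Prime) (h2 : p ≠ 2) :
    9 * |(aZ (p^k) : ℝ)| = 4 * 2^k + 3 * (k * (-1)^k) + 5 * (-1)^k := by
  have h := aZ_prime_pow p k hp h2
  have hR : 9 * (aZ (p^k) : ℝ) = 3 * k + 5 + 4 * (-2)^k := by exact_mod_cast h
  have e : (-2:ℝ)^k = (-1)^k * 2^k := by rw [← mul_pow]; norm_num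
  rw [e] at hR
  have hk : ∀ k : ℕ, 1 ≤ k → 3 * (k:ℝ) + 5 ≤ 4 * 2^k := by
    intro k hk
    induction k, hk using Nat.le_induction with
    | base => norm_num
    | succ n hn ih => push_cast; rw [pow_succ]; have : (1:ℝ) ≤ n := by exact_mod_cast hn
                      nlinarith
  rcases Nat.even_or_odd k with hev | hod
  · rw [hev.neg_one_pow] at hR ⊢
    have : 0 ≤ (aZ (p^k) : ℝ) := by
      have : (0:ℝ) ≤ 3 * k + 5 + 4 * (1 * 2^k) := by positivity
      linarith
    rw [abs_of_nonneg this]; linarith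
  · rw [hod.neg_one_pow] at hR ⊢
    have : (aZ (p^k) : ℝ) ≤ 0 := by
      have := hk k hod.pos
      linarith
    rw [abs_of_nonpos this]; linarith

theorem aZ_hasSum (p : ℕ) (hp : p.Prime) (h2 : p ≠ 2) (x : ℝ) (hx0 : 0 ≤ x) (hx : x < 1/2) :
    HasSum (fun k : ℕ => |(aZ (p^k) : ℝ)| * x^k) (1 / (1 - 3*x^2 - 2*x^3)) := by
  have h1 : HasSum (fun k : ℕ => (2*x)^k) (1 - 2*x)⁻¹ := hasSum_geometric_of_lt_one (by linarith) (by linarith)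
  have hn : ‖-x‖ < 1 := by rw [norm_neg, Real.norm_eq_abs, abs_of_nonneg hx0]; linarith
  have h3 : HasSum (fun k : ℕ => (-x)^k) (1 - (-x))⁻¹ := hasSum_geometric_of_norm_lt_one hn
  have h4 : HasSum (fun k : ℕ => (k:ℝ) * (-x)^k) (-x / (1 - (-x))^2) := hasSum_coe_mul_geometric_of_norm_lt_one hn
  have h := (((h1.mul_left 4).add (h4.mul_left 3)).add (h3.mul_left 5)).mul_left (1/9)
  have ef : (fun k : ℕ => |(aZ (p^k) : ℝ)| * x^k) = fun i : ℕ => 1 / 9 * (4 * (2 * x) ^ i + 3 * (↑i * (-x) ^ i) + 5 * (-x) ^ i) := by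
    funext k
    have := aZ_abs p k hp h2
    have e : (-x)^k = (-1)^k * x^k := by rw [← mul_pow]; norm_num
    rw [e, mul_pow]
    linear_combination (x^k/9) * this
  have ev : 1 / (1 - 3*x^2 - 2*x^3) = 1 / 9 * (4 * (1 - 2 * x)⁻¹ + 3 * (-x / (1 - -x) ^ 2) + 5 * (1 - -x)⁻¹) := by
    have a1 : (1 - 2*x) ≠ 0 := by linarith
    have a2 : (1 + x) ≠ 0 := by linarith
    have e : 1 - 3*x^2 - 2*x^3 = (1-2*x) * (1+x)^2 := by ring
    rw [e]
    simp only [sub_neg_eq_add]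
    field_simp
    ring
  rw [ef, ev]; exact h

theorem aZ_hasSum_two (x : ℝ) (hx0 : 0 ≤ x) (hx : x < 1) :
    HasSum (fun k : ℕ => |(aZ (2^k) : ℝ)| * x^k) (1 / (1 - x)^2) := by
  have hn : ‖x‖ < 1 := by rw [Real.norm_eq_abs, abs_of_nonneg hx0]; linarith
  have h3 := hasSum_geometric_of_norm_lt_one hn
  have h4 := hasSum_coe_mul_geometric_of_norm_lt_one hn
  have h := h4.add h3
  have ef : (fun k : ℕ => |(aZ (2^k) : ℝ)| * x^k) = fun i : ℕ => (i:ℝ) * x^i + x^i := by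
    funext k
    rw [aZ_two_pow]; push_cast
    rw [abs_of_nonneg (by positivity)]; ring
  have ev : 1 / (1 - x)^2 = x / (1 - x)^2 + (1 - x)⁻¹ := by
    have : 1 - x ≠ 0 := by linarith
    field_simp; ring
  rw [ef, ev]; exact h

theorem rpow_09 (p : ℕ) (r : ℝ) (hr : 0 < r) (h : 1 ≤ r^10 * (p:ℝ)^9) (hp : 0 < p) : (p:ℝ)^(-(0.9:ℝ)) ≤ r := by
  have hp0 : (0:ℝ) < p := by exact_mod_cast hp
  refine le_of_pow_le_pow_left₀ (n := 10) (by norm_num) hr.le ?_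
  rw [← Real.rpow_natCast, ← Real.rpow_mul hp0.le]
  rw [show (-(0.9:ℝ)) * ((10:ℕ):ℝ) = -((9:ℕ):ℝ) by norm_num, Real.rpow_neg hp0.le, Real.rpow_natCast]
  rw [inv_eq_one_div, div_le_iff₀ (by positivity)]
  exact h

noncomputable def EA (p : ℕ) : ℝ := if p = 2 then 1 / (1 - (p:ℝ)^(-(0.9:ℝ)))^2 else
  1 / (1 - 3*((p:ℝ)^(-(0.9:ℝ)))^2 - 2*((p:ℝ)^(-(0.9:ℝ)))^3)

theorem EA_le (p : ℕ) (h2 : p ≠ 2) (r : ℝ) (hr : 0 < r) (hr2 : r < 0.4) (h : 1 ≤ r^10 * (p:ℝ)^9) (hp : 0 < p) :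
    EA p ≤ 1 / (1 - 3*r^2 - 2*r^3) := by
  have hx := rpow_09 p r hr h hp
  have hx0 : 0 ≤ (p:ℝ)^(-(0.9:ℝ)) := by positivity
  rw [EA, if_neg h2]
  set x := (p:ℝ)^(-(0.9:ℝ))
  apply one_div_le_one_div_of_le
  · nlinarith [mul_pos hr hr]
  · have : x^2 ≤ r^2 := by gcongr
    have : x^3 ≤ r^3 := by gcongr
    linarith

theorem x_odd (p : ℕ) (hp : 3 ≤ p) : (p:ℝ)^(-(0.9:ℝ)) ≤ 0.37205 := by
  apply rpow_09 p _ (by norm_num) _ (by omega)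
  have : (3:ℝ) ≤ p := by exact_mod_cast hp
  have h9 : (3:ℝ)^9 ≤ (p:ℝ)^9 := by gcongr
  nlinarith

theorem EA_ge_one {p : ℕ} (hp : p.Prime) : 1 ≤ EA p := by
  have hx0 : 0 ≤ (p:ℝ)^(-(0.9:ℝ)) := by positivity
  by_cases h2 : p = 2
  · have hx := rpow_09 p 0.6 (by norm_num) (by rw [h2]; norm_num) hp.pos
    rw [EA, if_pos h2]
    set x := (p:ℝ)^(-(0.9:ℝ))
    rw [le_div_iff₀ (by nlinarith)]; nlinarith
  · have hx := x_odd p (by have := hp.two_le; omega)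
    rw [EA, if_neg h2]
    set x := (p:ℝ)^(-(0.9:ℝ))
    have : 0 ≤ x^2 := by positivity
    have : 0 ≤ x^3 := by positivity
    have : x^2 ≤ 0.37205^2 := by gcongr
    have : x^3 ≤ 0.37205^3 := by gcongr
    rw [le_div_iff₀] <;> norm_num at * <;> linarith

theorem pow_15 : (15:ℝ)^(-(0.8:ℝ)) ≤ 0.1146 := by
  refine le_of_pow_le_pow_left₀ (n := 5) (by norm_num) (by norm_num) ?_
  rw [← Real.rpow_natCast, ← Real.rpow_mul (by norm_num)]
  rw [show (-(0.8:ℝ)) * ((5:ℕ):ℝ) = -((4:ℕ):ℝ) by norm_num, Real.rpow_neg (by norm_num), Real.rpow_natCast]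
  norm_num

theorem EA_step (n : ℕ) (hn : 17 ≤ n) : EA n ≤ Real.exp (2.0125 * ((n-2:ℕ):ℝ)^(-(0.8:ℝ)) - 2.0125 * (n:ℝ)^(-(0.8:ℝ))) := by
  have hn' : (17:ℝ) ≤ n := by exact_mod_cast hn
  have hx : (n:ℝ)^(-(0.9:ℝ)) ≤ 0.0782 := by
    apply rpow_09 n _ (by norm_num) _ (by omega)
    have h9 : (17:ℝ)^9 ≤ (n:ℝ)^9 := by gcongr
    nlinarith
  have hx0 : 0 ≤ (n:ℝ)^(-(0.9:ℝ)) := by positivity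
  have hs := rpow_step2 0.8 n (by norm_num) (by linarith)
  have e : (n:ℝ)^(-(1+0.8:ℝ)) = ((n:ℝ)^(-(0.9:ℝ)))^2 := by
    rw [← Real.rpow_natCast, ← Real.rpow_mul (by linarith)]; norm_num
  rw [e] at hs
  have e2 : ((n-2:ℕ):ℝ) = n - 2 := by rw [Nat.cast_sub (by omega)]; norm_num
  rw [e2, EA, if_neg (by omega)]
  set x := (n:ℝ)^(-(0.9:ℝ))
  have h1 : 3.22 * x^2 ≤ 2.0125 * ((n:ℝ)-2)^(-(0.8:ℝ)) - 2.0125 * (n:ℝ)^(-(0.8:ℝ)) := by linarith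
  refine le_trans ?_ (Real.exp_le_exp.mpr h1)
  have h2 := Real.add_one_le_exp (3.22 * x^2)
  refine le_trans ?_ h2
  have h3 : x^2 ≤ 0.0782^2 := by gcongr
  have h4 : x^3 ≤ 0.0782 * x^2 := by
    rw [pow_succ]; nlinarith [sq_nonneg x]
  have hx2 := sq_nonneg x
  rw [div_le_iff₀ (by nlinarith)]
  nlinarith [mul_nonneg hx2 (sub_nonneg.mpr h3), mul_nonneg hx2 (sub_nonneg.mpr h4)]

theorem EA_prod (N : ℕ) : ∏ p ∈ N.primesBelow, EA p ≤ 18.1 := by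
  have h := prod_tail EA (fun n => 2.0125 * (n:ℝ)^(-(0.8:ℝ))) 14.307 (fun n => by positivity) EA_ge_one ?_ EA_step N ?_
  · refine h.trans ?_
    have h15 := pow_15
    have : Real.exp (2.0125 * ((15:ℕ):ℝ)^(-(0.8:ℝ))) ≤ Real.exp 0.2307 := by
      apply Real.exp_le_exp.mpr; push_cast; linarith
    have h3 : Real.exp 0.2307 ≤ 1.2596 := by
      have := Real.exp_bound' (x := 0.2307) (by norm_num) (by norm_num) (n := 5) (by norm_num)
      refine this.trans ?_
      norm_num [Finset.sum_range_succ, Nat.factorial]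
    nlinarith
  · have h3 := EA_le 3 (by norm_num) 0.37205 (by norm_num) (by norm_num) (by norm_num) (by norm_num)
    have h5 := EA_le 5 (by norm_num) 0.23493 (by norm_num) (by norm_num) (by norm_num) (by norm_num)
    have h7 := EA_le 7 (by norm_num) 0.17355 (by norm_num) (by norm_num) (by norm_num) (by norm_num)
    have h11 := EA_le 11 (by norm_num) 0.11555 (by norm_num) (by norm_num) (by norm_num) (by norm_num)
    have h13 := EA_le 13 (by norm_num) 0.09942 (by norm_num) (by norm_num) (by norm_num) (by norm_num)
    have h2 : EA 2 ≤ 1/(1-0.53589)^2 := by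
      have hx := rpow_09 2 0.53589 (by norm_num) (by norm_num) (by norm_num)
      rw [EA, if_pos rfl]
      apply one_div_le_one_div_of_le (by norm_num)
      gcongr
    have p3 := EA_ge_one (show Nat.Prime 3 by norm_num)
    have p5 := EA_ge_one (show Nat.Prime 5 by norm_num)
    have p7 := EA_ge_one (show Nat.Prime 7 by norm_num)
    have p11 := EA_ge_one (show Nat.Prime 11 by norm_num)
    have p13 := EA_ge_one (show Nat.Prime 13 by norm_num)
    have p2 := EA_ge_one (show Nat.Prime 2 by norm_num)
    calc EA 2 * EA 3 * EA 5 * EA 7 * EA 11 * EA 13 ≤ 1/(1-0.53589:ℝ)^2 * (1 / (1 - 3*0.37205^2 - 2*0.37205^3)) * (1 / (1 - 3*0.23493^2 - 2*0.23493^3))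
       * (1 / (1 - 3*0.17355^2 - 2*0.17355^3)) * (1 / (1 - 3*0.11555^2 - 2*0.11555^3)) * (1 / (1 - 3*0.09942^2 - 2*0.09942^3)) := by
          gcongr
      _ ≤ 14.307 := by norm_num
  · intro n hn
    have : (17:ℝ) ≤ n := by exact_mod_cast hn
    have e2 : ((n-2:ℕ):ℝ) = n - 2 := by rw [Nat.cast_sub (by omega)]; norm_num
    simp only [e2]
    apply mul_le_mul_of_nonneg_left _ (by norm_num)
    apply Real.rpow_le_rpow_of_nonpos <;> linarith

theorem a_sum : Summable (fun n : ℕ => |(aZ n : ℝ)| * (n:ℝ)^(-(0.9:ℝ))) ∧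
    ∑' n : ℕ, |(aZ n : ℝ)| * (n:ℝ)^(-(0.9:ℝ)) ≤ 18.1 := by
  have ep : ∀ p : ℕ, (fun k : ℕ => |(aZ (p^k) : ℝ)| * ((p^k : ℕ):ℝ)^(-(0.9:ℝ))) =
      fun k : ℕ => |(aZ (p^k) : ℝ)| * ((p:ℝ)^(-(0.9:ℝ)))^k := by
    intro p; funext k
    congr 1
    push_cast
    rw [← Real.rpow_natCast, ← Real.rpow_natCast, ← Real.rpow_mul (by positivity), ← Real.rpow_mul (by positivity), mul_comm]
  have hs : ∀ {p : ℕ}, p.Prime → HasSum (fun k : ℕ => |(aZ (p^k) : ℝ)| * ((p^k : ℕ):ℝ)^(-(0.9:ℝ))) (EA p) := by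
    intro p hp
    rw [ep p]
    by_cases h2 : p = 2
    · rw [EA, if_pos h2]
      have hx := rpow_09 p 0.6 (by norm_num) (by rw [h2]; norm_num) hp.pos
      have := aZ_hasSum_two ((p:ℝ)^(-(0.9:ℝ))) (by positivity) (by linarith)
      rw [h2] at this ⊢; exact this
    · rw [EA, if_neg h2]
      have hx := x_odd p (by have := hp.two_le; omega)
      exact aZ_hasSum p hp h2 _ (by positivity) (by linarith)
  have hmul : ∀ {m n : ℕ}, Nat.Coprime m n → |(aZ (m*n) : ℝ)| * ((m*n : ℕ):ℝ)^(-(0.9:ℝ)) =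
      (|(aZ m : ℝ)| * (m:ℝ)^(-(0.9:ℝ))) * (|(aZ n : ℝ)| * (n:ℝ)^(-(0.9:ℝ))) := by
    intro m n hmn
    rw [aZ_mult.map_mul_of_coprime hmn]
    push_cast
    rw [abs_mul, Real.mul_rpow (by positivity) (by positivity)]; ring
  have hn : ∀ n : ℕ, 0 ≤ |(aZ n : ℝ)| * (n:ℝ)^(-(0.9:ℝ)) := fun n => by positivity
  have h00 : |(aZ 0 : ℝ)| * ((0:ℕ):ℝ)^(-(0.9:ℝ)) = 0 := by rw [ArithmeticFunction.map_zero]; simp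
  have h11 : |(aZ 1 : ℝ)| * ((1:ℕ):ℝ)^(-(0.9:ℝ)) = 1 := by rw [aZ_mult.map_one]; simp
  exact euler_bound (fun n : ℕ => |(aZ n : ℝ)| * (n:ℝ)^(-(0.9:ℝ))) hn h00 h11 hmul EA
    (fun hp => (hs hp).summable) (fun hp => (hs hp).tsum_eq.le) 18.1 EA_prod

end

section
open Complex Metric Set Filter Topology

def Oi : ArithmeticFunction ℤ := ArithmeticFunction.pmul (ArithmeticFunction.moebius) (pw 1)

theorem Oi_mult : Oi.IsMultiplicative := ArithmeticFunction.isMultiplicative_moebius.pmul (pw_mult 1)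

theorem mul_Oi_zero (F : ArithmeticFunction ℤ) : (F * Oi) 1 = F 1 := by
  rw [ArithmeticFunction.mul_apply_one, Oi_mult.map_one, mul_one]

theorem mul_Oi_prime (F : ArithmeticFunction ℤ) (p k : ℕ) (hp : p.Prime) (h2 : p ≠ 2) :
    (F * Oi) (p^(k+1)) = F (p^(k+1)) - F (p^k) := by
  have hpp : 0 < p := hp.pos
  rw [ArithmeticFunction.mul_apply, Nat.sum_divisorsAntidiagonal' (fun x y => F x * Oi y), Nat.sum_divisors_prime_pow hp,
    Finset.sum_range_succ', Finset.sum_range_succ']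
  have h0 : ∑ j ∈ Finset.range k, F (p^(k+1) / p^(j+1+1)) * Oi (p^(j+1+1)) = 0 := by
    apply Finset.sum_eq_zero
    intro j _
    have : Oi (p^(j+1+1)) = 0 := by
      rw [Oi, ArithmeticFunction.pmul_apply, ArithmeticFunction.moebius_apply_prime_pow hp (by omega), if_neg (by omega), zero_mul]
    rw [this, mul_zero]
  have h1 : Oi (p^(0+1)) = -1 := by
    rw [Oi, ArithmeticFunction.pmul_apply, ArithmeticFunction.moebius_apply_prime_pow hp (by omega), if_pos (by omega), pw_prime_pow _ _ _ hp h2]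
    norm_num
  rw [h0, h1, pow_zero, Oi_mult.map_one, Nat.div_one, zero_add, pow_succ p k, pow_one, Nat.mul_div_cancel _ hpp]
  ring

theorem mul_Oi_two (F : ArithmeticFunction ℤ) (k : ℕ) : (F * Oi) (2^k) = F (2^k) := by
  rw [ArithmeticFunction.mul_apply, Nat.sum_divisorsAntidiagonal' (fun x y => F x * Oi y), Nat.sum_divisors_prime_pow Nat.prime_two,
    Finset.sum_range_succ']
  have h0 : ∑ j ∈ Finset.range k, F (2^k / 2^(j+1)) * Oi (2^(j+1)) = 0 := by
    apply Finset.sum_eq_zero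
    intro j _
    have : Oi (2^(j+1)) = 0 := by
      rw [Oi, ArithmeticFunction.pmul_apply, pw_two_pow, if_neg (by omega), mul_zero]
    rw [this, mul_zero]
  rw [h0, pow_zero, Oi_mult.map_one, Nat.div_one, zero_add, mul_one]

theorem O_mul_Oi : pw 1 * Oi = 1 := by
  rw [ArithmeticFunction.IsMultiplicative.eq_iff_eq_on_prime_powers _ ((pw_mult 1).mul Oi_mult) _ ArithmeticFunction.isMultiplicative_one]
  intro p k hp
  rcases k with _ | k
  · rw [pow_zero, mul_Oi_zero]; simp [(pw_mult 1).map_one]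
  have hne : p^(k+1) ≠ 1 := by
    rw [Ne, Nat.pow_eq_one]; have := hp.one_lt; omega
  rw [ArithmeticFunction.one_apply_ne hne]
  by_cases h2 : p = 2
  · subst h2; rw [mul_Oi_two, pw_two_pow, if_neg (by omega)]
  · rw [mul_Oi_prime _ _ _ hp h2, pw_prime_pow _ _ _ hp h2, pw_prime_pow _ _ _ hp h2]; simp

def g2 : ArithmeticFunction ℤ := pw 2 * Oi * Oi

theorem g2_mult : g2.IsMultiplicative := ((pw_mult 2).mul Oi_mult).mul Oi_mult

theorem pw2_eq : pw 2 = g2 * (pw 1 * pw 1) := by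
  have : g2 * (pw 1 * pw 1) = pw 2 * (pw 1 * Oi) * (pw 1 * Oi) := by unfold g2; ring
  rw [this, O_mul_Oi, mul_one, mul_one]

theorem g2_two (k : ℕ) : g2 (2^k) = if k = 0 then 1 else 0 := by
  rw [g2, mul_Oi_two, mul_Oi_two, pw_two_pow]

theorem g2_prime (p k : ℕ) (hp : p.Prime) (h2 : p ≠ 2) : g2 (p^(k+2)) = 2^k := by
  rw [g2, show k + 2 = (k+1)+1 by ring, mul_Oi_prime _ _ _ hp h2, mul_Oi_prime _ _ _ hp h2, mul_Oi_prime _ _ _ hp h2,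
    pw_prime_pow _ _ _ hp h2, pw_prime_pow _ _ _ hp h2, pw_prime_pow _ _ _ hp h2]
  ring

theorem g2_prime_one (p : ℕ) (hp : p.Prime) (h2 : p ≠ 2) : g2 (p^1) = 0 := by
  rw [g2, show 1 = 0+1 by ring, mul_Oi_prime _ _ _ hp h2, mul_Oi_prime _ _ _ hp h2, pow_zero, mul_Oi_zero,
    pw_prime_pow _ _ _ hp h2, (pw_mult 2).map_one]
  norm_num

theorem g2_nonneg (n : ℕ) : 0 ≤ g2 n := by
  by_cases hn : n = 0
  · subst hn; simp
  rw [g2_mult.multiplicative_factorization g2 hn]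
  apply Finset.prod_nonneg
  intro p hp
  have hpp : p.Prime := Nat.prime_of_mem_primeFactors (by simpa using hp)
  generalize n.factorization p = k
  show 0 ≤ g2 (p ^ k)
  by_cases h2 : p = 2
  · subst h2; rw [g2_two]; split_ifs <;> norm_num
  · rcases k with _ | _ | k
    · simp [g2_mult.map_one]
    · rw [zero_add, g2_prime_one p hpp h2]
    · rw [g2_prime p k hpp h2]; positivity

theorem g2_hasSum (p : ℕ) (hp : p.Prime) (h2 : p ≠ 2) (x : ℝ) (hx0 : 0 ≤ x) (hx : x < 1/2) :
    HasSum (fun k : ℕ => (g2 (p^k) : ℝ) * x^k) (1 + x^2 / (1 - 2*x)) := by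
  have h1 : HasSum (fun k : ℕ => (2*x)^k) (1 - 2*x)⁻¹ := hasSum_geometric_of_lt_one (by linarith) (by linarith)
  have h := h1.mul_left (x^2)
  have h' : HasSum (fun k : ℕ => (g2 (p^(k+2)) : ℝ) * x^(k+2)) (x^2 / (1-2*x)) := by
    have ef : (fun k : ℕ => (g2 (p^(k+2)) : ℝ) * x^(k+2)) = fun k : ℕ => x^2 * (2*x)^k := by
      funext k; rw [g2_prime p k hp h2]; push_cast; ring
    rw [ef, div_eq_mul_inv]; exact h
  have := (hasSum_nat_add_iff (f := fun k : ℕ => (g2 (p^k) : ℝ) * x^k) 2).mp h'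
  rw [Finset.sum_range_succ, Finset.sum_range_one, g2_prime_one p hp h2, pow_zero, g2_mult.map_one] at this
  simpa [add_comm] using this

theorem g2_hasSum_two (x : ℝ) : HasSum (fun k : ℕ => (g2 (2^k) : ℝ) * x^k) 1 := by
  have : (fun k : ℕ => (g2 (2^k) : ℝ) * x^k) = fun k => if k = 0 then 1 else 0 := by
    funext k; rw [g2_two]; split_ifs with h
    · simp [h]
    · simp
  rw [this]; exact hasSum_ite_eq 0 1

theorem g2_euler (s : ℝ) (E : ℕ → ℝ) (G : ℝ)
    (hE2 : 1 ≤ E 2) (hE : ∀ p : ℕ, p.Prime → p ≠ 2 → (p:ℝ)^(-s) < 1/2 ∧ 1 + ((p:ℝ)^(-s))^2 / (1 - 2*(p:ℝ)^(-s)) ≤ E p)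
    (hG : ∀ N : ℕ, ∏ p ∈ N.primesBelow, E p ≤ G) :
    Summable (fun n : ℕ => (g2 n : ℝ) * (n:ℝ)^(-s)) ∧ ∑' n : ℕ, (g2 n : ℝ) * (n:ℝ)^(-s) ≤ G := by
  have ep : ∀ p : ℕ, (fun k : ℕ => (g2 (p^k) : ℝ) * ((p^k : ℕ):ℝ)^(-s)) =
      fun k : ℕ => (g2 (p^k) : ℝ) * ((p:ℝ)^(-s))^k := by
    intro p; funext k
    congr 1
    push_cast
    rw [← Real.rpow_natCast, ← Real.rpow_natCast, ← Real.rpow_mul (by positivity), ← Real.rpow_mul (by positivity), mul_comm]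
  have hs : ∀ {p : ℕ}, p.Prime → Summable (fun k : ℕ => (g2 (p^k) : ℝ) * ((p^k : ℕ):ℝ)^(-s)) ∧
      ∑' k : ℕ, (g2 (p^k) : ℝ) * ((p^k : ℕ):ℝ)^(-s) ≤ E p := by
    intro p hp
    rw [ep p]
    by_cases h2 : p = 2
    · have := g2_hasSum_two ((p:ℝ)^(-s))
      rw [h2] at this ⊢
      exact ⟨this.summable, by rw [this.tsum_eq]; exact hE2⟩
    · have h := hE p hp h2
      have := g2_hasSum p hp h2 ((p:ℝ)^(-s)) (by positivity) h.1
      exact ⟨this.summable, by rw [this.tsum_eq]; exact h.2⟩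
  have hmul : ∀ {m n : ℕ}, Nat.Coprime m n → (g2 (m*n) : ℝ) * ((m*n : ℕ):ℝ)^(-s) =
      ((g2 m : ℝ) * (m:ℝ)^(-s)) * ((g2 n : ℝ) * (n:ℝ)^(-s)) := by
    intro m n hmn
    rw [g2_mult.map_mul_of_coprime hmn]
    push_cast
    rw [Real.mul_rpow (by positivity) (by positivity)]; ring
  have hn : ∀ n : ℕ, 0 ≤ (g2 n : ℝ) * (n:ℝ)^(-s) := fun n => by
    have : (0:ℝ) ≤ g2 n := by exact_mod_cast g2_nonneg n
    positivity
  have h00 : (g2 0 : ℝ) * ((0:ℕ):ℝ)^(-s) = 0 := by rw [ArithmeticFunction.map_zero]; simp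
  have h11 : (g2 1 : ℝ) * ((1:ℕ):ℝ)^(-s) = 1 := by rw [g2_mult.map_one]; simp
  exact euler_bound (fun n : ℕ => (g2 n : ℝ) * (n:ℝ)^(-s)) hn h00 h11 hmul E
    (fun hp => (hs hp).1) (fun hp => (hs hp).2) G hG

theorem g2_sum_09 : Summable (fun n : ℕ => (g2 n : ℝ) * (n:ℝ)^(-(0.9:ℝ))) ∧
    ∑' n : ℕ, (g2 n : ℝ) * (n:ℝ)^(-(0.9:ℝ)) ≤ 18.1 := by
  apply g2_euler 0.9 EA 18.1 (EA_ge_one Nat.prime_two) _ EA_prod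
  intro p hp h2
  have hx := x_odd p (by have := hp.two_le; omega)
  have hx0 : 0 ≤ (p:ℝ)^(-(0.9:ℝ)) := by positivity
  rw [EA, if_neg h2]
  set x := (p:ℝ)^(-(0.9:ℝ))
  refine ⟨by linarith, ?_⟩
  have a1 : 0 < 1 - 2*x := by linarith
  have e : 1 - 3*x^2 - 2*x^3 = (1-2*x) * (1+x)^2 := by ring
  rw [e, le_div_iff₀ (by positivity)]
  have : (1 + x^2/(1-2*x)) * ((1-2*x) * (1+x)^2) = (1-x^2)^2 := by
    have e2 : x^2/(1-2*x) * (1-2*x) = x^2 := div_mul_cancel₀ _ a1.ne'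
    linear_combination (1+x)^2 * e2
  rw [this]
  have : x^2 ≤ 1 := by nlinarith
  nlinarith [sq_nonneg x]

noncomputable def EG (p : ℕ) : ℝ := if p = 2 then 1 else 1 + 1 / ((p:ℝ) * (p - 2))

theorem EG_ge {p : ℕ} (hp : p.Prime) : 1 ≤ EG p := by
  rw [EG]; split_ifs with h
  · rfl
  · have : (3:ℝ) ≤ p := by have := hp.two_le; exact_mod_cast (by omega : 3 ≤ p)
    have h3 : (0:ℝ) < (p:ℝ) - 2 := by linarith
    have : 0 ≤ 1 / ((p:ℝ) * (p - 2)) := by positivity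
    linarith

theorem EG_prod (N : ℕ) : ∏ p ∈ N.primesBelow, EG p ≤ 1.54 := by
  have h := prod_tail EG (fun n => 1 / (2 * (n:ℝ))) 1.4882 (fun n => by positivity) EG_ge ?_ ?_ N ?_
  · refine h.trans ?_
    have h3 : Real.exp (1/(2*((15:ℕ):ℝ))) ≤ 1.034 := by
      have := Real.exp_bound' (x := 1/(2*((15:ℕ):ℝ))) (by norm_num) (by norm_num) (n := 3) (by norm_num)
      refine this.trans ?_
      norm_num [Finset.sum_range_succ, Nat.factorial]
    linarith
  · simp only [EG]; norm_num
  · intro n hn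
    have hn' : (17:ℝ) ≤ n := by exact_mod_cast hn
    have e2 : ((n-2:ℕ):ℝ) = n - 2 := by rw [Nat.cast_sub (by omega)]; norm_num
    rw [EG, if_neg (by omega), e2]
    have h := Real.add_one_le_exp (1 / (2 * ((n:ℝ)-2)) - 1 / (2*n))
    refine le_trans (le_of_eq ?_) h
    have : (n:ℝ) - 2 ≠ 0 := by linarith
    have : (n:ℝ) ≠ 0 := by linarith
    field_simp; ring
  · intro n hn
    have hn' : (17:ℝ) ≤ n := by exact_mod_cast hn
    have e2 : ((n-2:ℕ):ℝ) = n - 2 := by rw [Nat.cast_sub (by omega)]; norm_num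
    simp only [e2]
    apply one_div_le_one_div_of_le <;> linarith

theorem g2_sum_1 : Summable (fun n : ℕ => (g2 n : ℝ) * (n:ℝ)^(-(1:ℝ))) ∧
    ∑' n : ℕ, (g2 n : ℝ) * (n:ℝ)^(-(1:ℝ)) ≤ 1.54 := by
  apply g2_euler 1 EG 1.54 (EG_ge Nat.prime_two) _ EG_prod
  intro p hp h2
  have : (3:ℝ) ≤ p := by have := hp.two_le; exact_mod_cast (by omega : 3 ≤ p)
  rw [Real.rpow_neg_one, EG, if_neg h2]
  have h0 : (p:ℝ) ≠ 0 := by linarith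
  have h3 : (p:ℝ) - 2 ≠ 0 := by linarith
  constructor
  · rw [inv_eq_one_div, div_lt_div_iff₀ (by linarith) (by norm_num)]; linarith
  · have e : 1 - 2 * (p:ℝ)⁻¹ = (p - 2)/p := by field_simp
    rw [e]
    apply le_of_eq; field_simp

end

section
open Complex Metric Set Filter Topology

theorem odd_inv_sum (n : ℕ) (hn : 1 ≤ n) :
    ∑ a ∈ (Finset.Ioc 0 n).filter Odd, 1/(a:ℝ) ≤ 1 + 1/2 * Real.log n := by
  have hs : ∀ n : ℕ, ∑ a ∈ (Finset.Ioc 0 (n+1)).filter Odd, 1/(a:ℝ) =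
      ∑ a ∈ (Finset.Ioc 0 n).filter Odd, 1/(a:ℝ) + if Odd (n+1) then 1/((n+1 : ℕ):ℝ) else 0 := by
    intro n
    rw [Finset.sum_filter, Finset.sum_Ioc_succ_top (by omega), ← Finset.sum_filter]
  have key : ∀ n : ℕ, ∑ a ∈ (Finset.Ioc 0 (n+1)).filter Odd, 1/(a:ℝ) ≤ 1 + 1/2 * Real.log ((n+1 : ℕ):ℝ) := by
    intro n
    induction n using Nat.twoStepInduction with
    | zero => rw [hs]; simp
    | one => rw [hs, hs]; norm_num [Nat.odd_iff]; positivity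
    | more n ih1 ih2 =>
      by_cases ho : Odd (n+2+1)
      · have h2 : ¬ Odd (n+1+1) := by rw [Nat.odd_iff] at ho ⊢; omega
        rw [hs, if_pos ho, hs, if_neg h2, add_zero]
        have h := Real.one_sub_inv_le_log_of_pos (x := ((n+2+1:ℕ):ℝ)/((n+1:ℕ):ℝ)) (by positivity)
        rw [Real.log_div (by positivity) (by positivity)] at h
        have e : 1 - (((n+2+1:ℕ):ℝ)/((n+1:ℕ):ℝ))⁻¹ = 2 * (1/((n+2+1:ℕ):ℝ)) := by
          push_cast; field_simp; ring
        rw [e] at h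
        linarith
      · rw [hs, if_neg ho, add_zero]
        refine ih2.trans ?_
        gcongr
        omega
  obtain ⟨m, rfl⟩ : ∃ m, n = m+1 := ⟨n-1, by omega⟩
  exact key m

theorem odd_count0 (n : ℕ) : ((Finset.Ioc 0 n).filter Odd).card = (n+1)/2 := by
  induction n with
  | zero => simp
  | succ n ih =>
    rw [Finset.card_filter, Finset.sum_Ioc_succ_top (by omega), ← Finset.card_filter, ih]
    split_ifs with h
    · rw [Nat.odd_iff] at h; omega
    · rw [Nat.odd_iff] at h; omega

theorem odd_count (m n : ℕ) (h : m ≤ n) : (((Finset.Ioc m n).filter Odd).card : ℝ) = ((n+1)/2 : ℕ) - ((m+1)/2 : ℕ) := by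
  have h1 : Finset.Ioc 0 n = Finset.Ioc 0 m ∪ Finset.Ioc m n := (Finset.Ioc_union_Ioc_eq_Ioc (by omega) h).symm
  have h2 : ((Finset.Ioc 0 n).filter Odd).card = ((Finset.Ioc 0 m).filter Odd).card + ((Finset.Ioc m n).filter Odd).card := by
    rw [h1, Finset.filter_union, Finset.card_union_of_disjoint]
    apply Finset.disjoint_filter_filter
    exact Finset.Ioc_disjoint_Ioc_of_le le_rfl
  rw [odd_count0, odd_count0] at h2
  have : (((n+1)/2 : ℕ):ℝ) = ((m+1)/2 : ℕ) + (((Finset.Ioc m n).filter Odd).card : ℝ) := by exact_mod_cast h2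
  linarith

theorem odd_count_real (u w : ℝ) (h0 : 0 ≤ u) (h : u ≤ w) :
    (((Finset.Ioc ⌊u⌋₊ ⌊w⌋₊).filter Odd).card : ℝ) ≤ (w-u)/2 + 1 := by
  rw [odd_count _ _ (Nat.floor_le_floor h)]
  have h1 : ((2 * ((⌊w⌋₊+1)/2) : ℕ):ℝ) ≤ ((⌊w⌋₊+1 : ℕ):ℝ) := by exact_mod_cast Nat.mul_div_le _ _
  have h2 : ((⌊u⌋₊ : ℕ):ℝ) ≤ ((2 * ((⌊u⌋₊+1)/2) : ℕ):ℝ) := by exact_mod_cast (by omega)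
  have h3 := Nat.floor_le (h0.trans h)
  have h4 := Nat.lt_floor_add_one u
  push_cast at h1 h2 ⊢
  linarith

theorem DD_sum (N : ℕ) : ∑ m ∈ Finset.Ioc 0 N, ((pw 1 * pw 1) m : ℝ) =
    (((Finset.Ioc 0 N ×ˢ Finset.Ioc 0 N).filter (fun x : ℕ × ℕ => x.1*x.2 ≤ N ∧ Odd x.1 ∧ Odd x.2)).card : ℝ) := by
  have h := ArithmeticFunction.sum_Ioc_mul_eq_sum_prod_filter (pw 1) (pw 1) N
  have h' : ∑ m ∈ Finset.Ioc 0 N, (pw 1 * pw 1) m = 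
    (((Finset.Ioc 0 N ×ˢ Finset.Ioc 0 N).filter (fun x : ℕ × ℕ => x.1*x.2 ≤ N ∧ Odd x.1 ∧ Odd x.2)).card : ℤ) := by
    rw [h, Finset.card_filter, Finset.sum_filter]
    push_cast
    apply Finset.sum_congr rfl
    intro x _
    simp only [pw_apply, one_pow]
    by_cases h1 : x.1 * x.2 ≤ N <;> by_cases h2 : Odd x.1 <;> by_cases h3 : Odd x.2 <;> simp [h1, h2, h3]
  exact_mod_cast h'

theorem DD_window (x y : ℝ) (hx : 0 ≤ x) (hxy : x ≤ y) (hy : 1 ≤ y) :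
    ∑ m ∈ Finset.Ioc ⌊x⌋₊ ⌊y⌋₊, ((pw 1 * pw 1) m : ℝ) ≤ (y - x) * (1/4*Real.log y + 1) + Real.sqrt y + 1 := by
  have hfl := Nat.floor_le_floor hxy
  set P := fun N : ℕ => (Finset.Ioc 0 N ×ˢ Finset.Ioc 0 N).filter (fun x : ℕ × ℕ => x.1*x.2 ≤ N ∧ Odd x.1 ∧ Odd x.2) with hP
  have hsub : P ⌊x⌋₊ ⊆ P ⌊y⌋₊ := by
    intro z hz
    simp only [hP, Finset.mem_filter, Finset.mem_product, Finset.mem_Ioc] at hz ⊢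
    obtain ⟨⟨⟨a1, a2⟩, a3, a4⟩, a5, a6, a7⟩ := hz
    exact ⟨⟨⟨a1, a2.trans hfl⟩, a3, a4.trans hfl⟩, a5.trans hfl, a6, a7⟩
  have e1 : ∑ m ∈ Finset.Ioc ⌊x⌋₊ ⌊y⌋₊, ((pw 1 * pw 1) m : ℝ) = ((P ⌊y⌋₊ \ P ⌊x⌋₊).card : ℝ) := by
    have h1 : Finset.Ioc 0 ⌊y⌋₊ = Finset.Ioc 0 ⌊x⌋₊ ∪ Finset.Ioc ⌊x⌋₊ ⌊y⌋₊ := (Finset.Ioc_union_Ioc_eq_Ioc (by omega) hfl).symm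
    have h2 := DD_sum ⌊y⌋₊
    rw [h1, Finset.sum_union (Finset.Ioc_disjoint_Ioc_of_le le_rfl), DD_sum, ← h1] at h2
    rw [Finset.cast_card_sdiff hsub]
    simp only [hP]
    linarith
  rw [e1]
  set M := ⌊Real.sqrt y⌋₊ with hM
  set Q := ((Finset.Ioc 0 M).filter Odd).sigma (fun a : ℕ => (Finset.Ioc ⌊x/a⌋₊ ⌊y/a⌋₊).filter Odd) with hQ
  have hmem : ∀ a b : ℕ, 0 < a → (a:ℝ) ≤ Real.sqrt y → Odd a → Odd b → a*b ≤ ⌊y⌋₊ → ¬ (a*b ≤ ⌊x⌋₊) → (⟨a,b⟩ : (_ : ℕ) × ℕ) ∈ Q := by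
    intro a b ha ha2 oa ob h1 h2
    have ha' : (0:ℝ) < a := by exact_mod_cast ha
    rw [hQ, Finset.mem_sigma, Finset.mem_filter, Finset.mem_filter, Finset.mem_Ioc, Finset.mem_Ioc]
    have h1' : ((a*b:ℕ):ℝ) ≤ y := (Nat.le_floor_iff (by linarith)).mp h1
    have h2' : x < ((a*b:ℕ):ℝ) := (Nat.floor_lt hx).mp (by omega)
    push_cast at h1' h2'
    refine ⟨⟨⟨ha, Nat.le_floor ha2⟩, oa⟩, ⟨(Nat.floor_lt (by positivity)).mpr ?_, Nat.le_floor ?_⟩, ob⟩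
    · rw [div_lt_iff₀ ha']; linarith
    · rw [le_div_iff₀ ha']; linarith
  have hcard : (P ⌊y⌋₊ \ P ⌊x⌋₊).card ≤ Q.card + Q.card := by
    have hs : P ⌊y⌋₊ \ P ⌊x⌋₊ ⊆ Q.image (fun z => (z.1, z.2)) ∪ Q.image (fun z => (z.2, z.1)) := by
      rintro ⟨a, b⟩ hz
      simp only [hP, Finset.mem_sdiff, Finset.mem_filter, Finset.mem_product, Finset.mem_Ioc] at hz
      obtain ⟨⟨⟨⟨ha, _⟩, hb, _⟩, hab, oa, ob⟩, hn⟩ := hz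
      have hn' : ¬ (a*b ≤ ⌊x⌋₊) := by
        intro h
        apply hn
        refine ⟨⟨⟨ha, ?_⟩, hb, ?_⟩, h, oa, ob⟩
        · exact (Nat.le_mul_of_pos_right a hb).trans h
        · exact (Nat.le_mul_of_pos_left b ha).trans h
      have hy' : ((a*b:ℕ):ℝ) ≤ y := (Nat.le_floor_iff (by linarith)).mp hab
      push_cast at hy'
      rw [Finset.mem_union, Finset.mem_image, Finset.mem_image]
      rcases le_total a b with h | h
      · left
        have h' : (a:ℝ) ≤ b := by exact_mod_cast h
        refine ⟨⟨a,b⟩, hmem a b ha (Real.le_sqrt_of_sq_le ?_) oa ob hab hn', rfl⟩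
        nlinarith [(Nat.cast_nonneg a : (0:ℝ) ≤ a)]
      · right
        have h' : (b:ℝ) ≤ a := by exact_mod_cast h
        refine ⟨⟨b,a⟩, hmem b a hb (Real.le_sqrt_of_sq_le ?_) ob oa (by rwa [mul_comm]) (by rwa [mul_comm]), rfl⟩
        nlinarith [(Nat.cast_nonneg b : (0:ℝ) ≤ b)]
    refine (Finset.card_le_card hs).trans ((Finset.card_union_le _ _).trans ?_)
    exact add_le_add Finset.card_image_le Finset.card_image_le
  have hs1 : 1 ≤ Real.sqrt y := by rw [Real.one_le_sqrt]; exact hy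
  have hM1 : 1 ≤ M := Nat.le_floor (by exact_mod_cast hs1)
  have hM2 : (M:ℝ) ≤ Real.sqrt y := Nat.floor_le (by positivity)
  have hQc : (Q.card : ℝ) ≤ ∑ a ∈ (Finset.Ioc 0 M).filter Odd, ((y-x)/2 * (1/(a:ℝ)) + 1) := by
    rw [hQ, Finset.card_sigma]
    push_cast
    apply Finset.sum_le_sum
    intro a ha
    rw [Finset.mem_filter, Finset.mem_Ioc] at ha
    have ha' : (0:ℝ) < a := by exact_mod_cast ha.1.1
    have := odd_count_real (x/a) (y/a) (by positivity) (by gcongr)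
    refine this.trans (le_of_eq ?_)
    field_simp
  rw [Finset.sum_add_distrib, ← Finset.mul_sum, Finset.sum_const, odd_count0, nsmul_eq_mul, mul_one] at hQc
  have h1 := odd_inv_sum M hM1
  have h2 : Real.log M ≤ 1/2 * Real.log y := by
    rw [one_div, ← div_eq_inv_mul, ← Real.log_sqrt (by linarith)]
    exact Real.log_le_log (by exact_mod_cast hM1) hM2
  have h3 : ((2 * ((M+1)/2) : ℕ):ℝ) ≤ ((M+1 : ℕ):ℝ) := by exact_mod_cast Nat.mul_div_le _ _
  have h4 : (((P ⌊y⌋₊ \ P ⌊x⌋₊).card : ℕ):ℝ) ≤ Q.card + Q.card := by exact_mod_cast hcard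
  push_cast at h3
  have h5 : (y-x)/2 * ∑ a ∈ (Finset.Ioc 0 M).filter Odd, 1/(a:ℝ) ≤ (y-x)/2 * (1 + 1/4 * Real.log y) := by
    apply mul_le_mul_of_nonneg_left _ (by linarith)
    linarith
  linarith

theorem pw2_window (x y : ℝ) (hx : 0 ≤ x) (hxy : x ≤ y) (hy : 1 ≤ y) :
    ∑ m ∈ Finset.Ioc ⌊x⌋₊ ⌊y⌋₊, ((pw 2) m : ℝ) ≤ (y - x) * (0.385*Real.log y + 1.54) + 36.2 * y^(0.9:ℝ) := by
  have hfl := Nat.floor_le_floor hxy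
  have hsum : ∀ N : ℕ, N ≤ ⌊y⌋₊ → ∑ m ∈ Finset.Ioc 0 N, ((pw 2) m : ℝ) =
      ∑ d ∈ Finset.Ioc 0 ⌊y⌋₊, (g2 d : ℝ) * ∑ m ∈ Finset.Ioc 0 (N/d), ((pw 1 * pw 1) m : ℝ) := by
    intro N hN
    have h := ArithmeticFunction.sum_Ioc_mul_eq_sum_sum g2 (pw 1 * pw 1) N
    rw [← pw2_eq] at h
    have h' : ∑ m ∈ Finset.Ioc 0 N, ((pw 2) m : ℝ) = ∑ d ∈ Finset.Ioc 0 N, (g2 d : ℝ) * ∑ m ∈ Finset.Ioc 0 (N/d), ((pw 1 * pw 1) m : ℝ) := by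
      exact_mod_cast h
    rw [h']
    apply Finset.sum_subset (Finset.Ioc_subset_Ioc_right hN)
    intro d hd hd2
    rw [Finset.mem_Ioc] at hd hd2
    rw [Nat.div_eq_of_lt (by omega)]
    simp
  have h1 : Finset.Ioc 0 ⌊y⌋₊ = Finset.Ioc 0 ⌊x⌋₊ ∪ Finset.Ioc ⌊x⌋₊ ⌊y⌋₊ := (Finset.Ioc_union_Ioc_eq_Ioc (by omega) hfl).symm
  have e : ∑ m ∈ Finset.Ioc ⌊x⌋₊ ⌊y⌋₊, ((pw 2) m : ℝ) =
      ∑ d ∈ Finset.Ioc 0 ⌊y⌋₊, (g2 d : ℝ) * ∑ m ∈ Finset.Ioc ⌊x/d⌋₊ ⌊y/d⌋₊, ((pw 1 * pw 1) m : ℝ) := by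
    have h2 := hsum ⌊y⌋₊ le_rfl
    rw [h1, Finset.sum_union (Finset.Ioc_disjoint_Ioc_of_le le_rfl), hsum _ hfl, ← h1] at h2
    rw [← sub_eq_iff_eq_add'.mpr h2.symm, ← Finset.sum_sub_distrib]
    apply Finset.sum_congr rfl
    intro d hd
    rw [← mul_sub, Nat.floor_div_natCast, Nat.floor_div_natCast]
    congr 1
    have h3 : Finset.Ioc 0 (⌊y⌋₊/d) = Finset.Ioc 0 (⌊x⌋₊/d) ∪ Finset.Ioc (⌊x⌋₊/d) (⌊y⌋₊/d) := 
      (Finset.Ioc_union_Ioc_eq_Ioc (Nat.zero_le _) (Nat.div_le_div_right hfl)).symm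
    rw [h3, Finset.sum_union (Finset.Ioc_disjoint_Ioc_of_le le_rfl)]
    ring
  rw [e]
  have hly : 0 ≤ Real.log y := Real.log_nonneg hy
  have hb : ∀ d ∈ Finset.Ioc 0 ⌊y⌋₊, (g2 d : ℝ) * ∑ m ∈ Finset.Ioc ⌊x/d⌋₊ ⌊y/d⌋₊, ((pw 1 * pw 1) m : ℝ) ≤
      ((y-x) * (1/4*Real.log y + 1)) * ((g2 d : ℝ) * (d:ℝ)^(-(1:ℝ))) + (2 * y^(0.9:ℝ)) * ((g2 d : ℝ) * (d:ℝ)^(-(0.9:ℝ))) := by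
    intro d hd
    rw [Finset.mem_Ioc] at hd
    have hd0 : (0:ℝ) < d := by exact_mod_cast hd.1
    have hd1 : (1:ℝ) ≤ d := by exact_mod_cast hd.1
    have hdy : (d:ℝ) ≤ y := (Nat.le_floor_iff (by linarith)).mp hd.2
    have hz : 1 ≤ y/d := by rw [le_div_iff₀ hd0]; linarith
    have h := DD_window (x/d) (y/d) (by positivity) (by gcongr) hz
    have hg : (0:ℝ) ≤ g2 d := by exact_mod_cast g2_nonneg d
    have hl : Real.log (y/d) ≤ Real.log y := by
      apply Real.log_le_log (by linarith)
      exact div_le_self (by linarith) hd1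
    have hq : Real.sqrt (y/d) + 1 ≤ 2 * (y/d)^(0.9:ℝ) := by
      have a : (1:ℝ) ≤ (y/d)^(0.9:ℝ) := Real.one_le_rpow hz (by norm_num)
      have b : Real.sqrt (y/d) ≤ (y/d)^(0.9:ℝ) := by
        rw [Real.sqrt_eq_rpow]
        exact Real.rpow_le_rpow_of_exponent_le hz (by norm_num)
      linarith
    have e1 : (y/d)^(0.9:ℝ) = y^(0.9:ℝ) * (d:ℝ)^(-(0.9:ℝ)) := by
      rw [Real.div_rpow (by linarith) hd0.le, Real.rpow_neg hd0.le, div_eq_mul_inv]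
    have e2 : y/d - x/d = (y-x) * (d:ℝ)^(-(1:ℝ)) := by
      rw [Real.rpow_neg_one]; field_simp
    rw [e1] at hq
    rw [e2] at h
    have hp : 0 ≤ (y-x) * (d:ℝ)^(-(1:ℝ)) := mul_nonneg (by linarith) (by positivity)
    have h' : ∑ m ∈ Finset.Ioc ⌊x/d⌋₊ ⌊y/d⌋₊, ((pw 1 * pw 1) m : ℝ) ≤ 
      (y-x) * (d:ℝ)^(-(1:ℝ)) * (1/4*Real.log y + 1) + 2 * (y^(0.9:ℝ) * (d:ℝ)^(-(0.9:ℝ))) := by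
      have := mul_le_mul_of_nonneg_left (show 1/4*Real.log (y/d) + 1 ≤ 1/4*Real.log y + 1 by linarith) hp
      linarith
    have := mul_le_mul_of_nonneg_left h' hg
    linarith
  refine (Finset.sum_le_sum hb).trans ?_
  rw [Finset.sum_add_distrib, ← Finset.mul_sum, ← Finset.mul_sum]
  have hn : ∀ (s : ℝ) (n : ℕ), 0 ≤ (g2 n : ℝ) * (n:ℝ)^(-s) := fun s n => by
    have : (0:ℝ) ≤ g2 n := by exact_mod_cast g2_nonneg n
    positivity
  have s1 := (g2_sum_1.1.sum_le_tsum (Finset.Ioc 0 ⌊y⌋₊) (fun n _ => hn 1 n)).trans g2_sum_1.2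
  have s2 := (g2_sum_09.1.sum_le_tsum (Finset.Ioc 0 ⌊y⌋₊) (fun n _ => hn 0.9 n)).trans g2_sum_09.2
  have hy9 : 0 ≤ y^(0.9:ℝ) := by positivity
  have := mul_le_mul_of_nonneg_left s1 (show 0 ≤ (y-x) * (1/4*Real.log y + 1) from mul_nonneg (by linarith) (by positivity))
  have := mul_le_mul_of_nonneg_left s2 (show 0 ≤ 2 * y^(0.9:ℝ) by positivity)
  linarith

end

section
open Complex Metric Set Filter Topology MeasureTheory

noncomputable def VV (x : ℝ) : ℝ := ∑ n ∈ Finset.Ioc 0 ⌊x⌋₊, (pw (-2) n : ℝ)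

theorem VV_zero (x : ℝ) (hx : x < 1) : VV x = 0 := by
  rw [VV, Nat.floor_eq_zero.mpr hx]; simp

theorem pw_abs (n : ℕ) : |(pw (-2) n : ℝ)| = (pw 2 n : ℝ) := by
  rw [pw_apply, pw_apply]; split_ifs
  · push_cast; rw [abs_pow]; norm_num
  · simp

theorem VV_diff (x y : ℝ) (hx : 0 ≤ x) (hxy : x ≤ y) (hy : 1 ≤ y) :
    |VV y - VV x| ≤ (y - x) * (0.385*Real.log y + 1.54) + 36.2 * y^(0.9:ℝ) := by
  refine le_trans ?_ (pw2_window x y hx hxy hy)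
  have h1 : Finset.Ioc 0 ⌊y⌋₊ = Finset.Ioc 0 ⌊x⌋₊ ∪ Finset.Ioc ⌊x⌋₊ ⌊y⌋₊ :=
    (Finset.Ioc_union_Ioc_eq_Ioc (by omega) (Nat.floor_le_floor hxy)).symm
  have : VV y - VV x = ∑ n ∈ Finset.Ioc ⌊x⌋₊ ⌊y⌋₊, (pw (-2) n : ℝ) := by
    rw [VV, VV, h1, Finset.sum_union (Finset.Ioc_disjoint_Ioc_of_le le_rfl)]; ring
  rw [this]
  refine (Finset.abs_sum_le_sum_abs _ _).trans (le_of_eq ?_)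
  exact Finset.sum_congr rfl (fun n _ => pw_abs n)

theorem VV_triv (v : ℝ) (hv : 0 ≤ v) :
    |VV (Real.exp v)| ≤ Real.exp v * (0.385*v+1.54 + 36.2 * Real.exp (-0.1*v)) := by
  have h := VV_diff 0 (Real.exp v) le_rfl (by positivity) (Real.one_le_exp hv)
  rw [VV_zero 0 (by norm_num), sub_zero, sub_zero, Real.log_exp, ← Real.exp_mul] at h
  have e : Real.exp (v*0.9) = Real.exp v * Real.exp (-0.1*v) := by rw [← Real.exp_add]; ring_nf
  rw [e] at h
  linarith

theorem VV_shift (v u : ℝ) (hv : 0 ≤ v) : |VV (Real.exp (v+u)) - VV (Real.exp v)| ≤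
    Real.exp v * (|Real.exp u - 1| * (0.385*v+1.54) + 0.385*(Real.exp u - 1)^2 +
      36.2*Real.exp (-0.1*v)*(Real.exp (0.9*u) + 1)) := by
  have hE := Real.exp_pos v
  rcases le_total 0 u with hu | hu
  · have h1 : 1 ≤ Real.exp u := Real.one_le_exp hu
    have h := VV_diff (Real.exp v) (Real.exp (v+u)) hE.le (Real.exp_le_exp.mpr (by linarith)) (Real.one_le_exp (by linarith))
    rw [Real.log_exp, ← Real.exp_mul] at h
    have e : Real.exp ((v+u)*0.9) = Real.exp v * (Real.exp (-0.1*v) * Real.exp (0.9*u)) := by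
      rw [← Real.exp_add, ← Real.exp_add]; ring_nf
    rw [e, Real.exp_add] at h
    rw [abs_of_nonneg (by linarith : 0 ≤ Real.exp u - 1), Real.exp_add]
    have h3 : u * (Real.exp u - 1) ≤ (Real.exp u - 1)^2 := by
      have := Real.add_one_le_exp u
      nlinarith
    have h4 := mul_le_mul_of_nonneg_left h3 hE.le
    have h5 : 0 ≤ Real.exp v * Real.exp (-0.1*v) := by positivity
    nlinarith
  · have h1 : Real.exp u ≤ 1 := Real.exp_le_one_iff.mpr hu
    have h := VV_diff (Real.exp (v+u)) (Real.exp v) (by positivity) (Real.exp_le_exp.mpr (by linarith)) (Real.one_le_exp hv)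
    rw [Real.log_exp, ← Real.exp_mul, abs_sub_comm] at h
    have e : Real.exp (v*0.9) = Real.exp v * Real.exp (-0.1*v) := by rw [← Real.exp_add]; ring_nf
    rw [e, Real.exp_add] at h
    rw [abs_of_nonpos (by linarith : Real.exp u - 1 ≤ 0), Real.exp_add]
    have h5 : 0 ≤ Real.exp v * Real.exp (-0.1*v) * Real.exp (0.9*u) := by positivity
    have h6 : 0 ≤ Real.exp v * (Real.exp u - 1)^2 := by positivity
    nlinarith

theorem VV_meas : Measurable VV :=
  (measurable_from_nat (f := fun N : ℕ => ∑ n ∈ Finset.Ioc 0 N, (pw (-2) n : ℝ))).comp Nat.measurable_floor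

theorem gauss_mgf (a : ℝ) : Integrable (fun y : ℝ => Real.exp (a*y) * Real.exp (-(1/2)*y^2)) ∧
    ∫ y : ℝ, Real.exp (a*y) * Real.exp (-(1/2)*y^2) = Real.sqrt (2*Real.pi) * Real.exp (a^2/2) := by
  have e : (fun y : ℝ => Real.exp (a*y) * Real.exp (-(1/2)*y^2)) =
      fun y : ℝ => Real.exp (a^2/2) * Real.exp (-(1/2)*(y-a)^2) := by
    funext y; rw [← Real.exp_add, ← Real.exp_add]; ring_nf
  have hi := (integrable_exp_neg_mul_sq (b := 1/2) (by norm_num))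
  constructor
  · rw [e]; exact (hi.comp_sub_right a).const_mul _
  · rw [e, integral_const_mul, integral_sub_right_eq_self (fun y => Real.exp (-(1/2)*y^2)) a, integral_gaussian]
    rw [mul_comm]; congr 2; ring

theorem abs_gauss (b : ℝ) (hb : 0 < b) : Integrable (fun y : ℝ => |y| * Real.exp (-b*y^2)) ∧
    ∫ y : ℝ, |y| * Real.exp (-b*y^2) = 1/b := by
  constructor
  · have h := (integrable_mul_exp_neg_mul_sq hb).abs
    refine h.congr (ae_of_all _ (fun y => ?_))
    simp only
    rw [abs_mul, abs_of_pos (Real.exp_pos _)]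
  · have h := integral_comp_abs (f := fun y : ℝ => y * Real.exp (-b*y^2))
    simp only [sq_abs] at h
    rw [h]
    have h2 := integral_mul_cexp_neg_mul_sq (b := (b:ℂ)) (by simpa using hb)
    have h3 : ((∫ r : ℝ in Ioi 0, r * Real.exp (-b*r^2) : ℝ) : ℂ) = (2*(b:ℂ))⁻¹ := by
      rw [← h2, ← integral_complex_ofReal]
      congr 1; funext r; push_cast; rfl
    have h4 : ∫ r : ℝ in Ioi 0, r * Real.exp (-b*r^2) = (2*b)⁻¹ := by exact_mod_cast h3
    rw [h4]; field_simp

theorem exp_sub_one_abs (u : ℝ) : |Real.exp u - 1| ≤ |u| * (Real.exp u + 1) / 2 := by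
  have key : ∀ u : ℝ, 0 ≤ u → Real.exp u - 1 ≤ u * (Real.exp u + 1)/2 := by
    intro u hu
    set f := fun u : ℝ => u * (Real.exp u + 1)/2 - (Real.exp u - 1)
    have hd : ∀ x : ℝ, HasDerivAt f ((1 * (Real.exp x + 1) + x * Real.exp x)/2 - Real.exp x) x := by
      intro x
      exact (((hasDerivAt_id x).mul ((Real.hasDerivAt_exp x).add_const 1)).div_const 2).sub ((Real.hasDerivAt_exp x).sub_const 1)
    have hm : MonotoneOn f (Ici 0) := by
      apply monotoneOn_of_deriv_nonneg (convex_Ici 0)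
      · exact fun x _ => (hd x).continuousAt.continuousWithinAt
      · exact fun x _ => (hd x).differentiableAt.differentiableWithinAt
      · intro x hx
        rw [(hd x).deriv]
        have h1 := Real.add_one_le_exp (-x)
        have h2 : Real.exp (-x) * Real.exp x = 1 := by rw [← Real.exp_add]; simp
        have := mul_le_mul_of_nonneg_right h1 (Real.exp_pos x).le
        linarith
    have := hm (mem_Ici.mpr le_rfl) (mem_Ici.mpr hu) hu
    simp only [f] at this
    simp at this
    linarith
  rcases le_total 0 u with hu | hu
  · rw [abs_of_nonneg hu, abs_of_nonneg (by linarith [Real.one_le_exp hu])]; exact key u hu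
  · rw [abs_of_nonpos hu, abs_of_nonpos (by linarith [Real.exp_le_one_iff.mpr hu])]
    have h := key (-u) (by linarith)
    have h2 : Real.exp (-u) * Real.exp u = 1 := by rw [← Real.exp_add]; simp
    have := mul_le_mul_of_nonneg_right h (Real.exp_pos u).le
    nlinarith

theorem exp_sub_one_int (h : ℝ) (h0 : 0 < h) (h1 : h < 1) :
    Integrable (fun y : ℝ => |Real.exp (h*y) - 1| * Real.exp (-(1/2)*y^2)) ∧
    ∫ y : ℝ, |Real.exp (h*y) - 1| * Real.exp (-(1/2)*y^2) ≤ h * (1 + 1/(1-h^2)) := by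
  have hh : 0 < 1 - h^2 := by nlinarith
  have hintg0 : Integrable (fun y : ℝ => |Real.exp (h*y) - 1| * Real.exp (-(1/2)*y^2)) := by
    have hi := ((gauss_mgf h).1.sub (gauss_mgf 0).1).abs
    refine hi.congr (ae_of_all _ (fun y => ?_))
    simp only [Pi.sub_apply]
    rw [zero_mul, Real.exp_zero, ← sub_mul, abs_mul, abs_of_pos (Real.exp_pos (-(1/2)*y^2))]
  refine ⟨hintg0, ?_⟩
  set f := fun y : ℝ => |Real.exp (h*y) - 1| * Real.exp (-(1/2)*y^2) with hf
  have hneg : ∫ y, f (-y) = ∫ y, f y := integral_neg_eq_self f volume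
  have hintg0' : Integrable (fun y => f (-y)) := hintg0.comp_neg
  have h2 : 2 * ∫ y, f y = ∫ y, (f y + f (-y)) := by rw [integral_add hintg0 hintg0', hneg]; ring
  obtain ⟨i1, e1⟩ := abs_gauss (1/2) (by norm_num)
  obtain ⟨i2, e2⟩ := abs_gauss ((1-h^2)/2) (by linarith)
  have hle : ∫ y, (f y + f (-y)) ≤ ∫ y : ℝ, (h * (|y| * Real.exp (-((1-h^2)/2)*y^2)) + h * (|y| * Real.exp (-(1/2)*y^2))) := by
    apply integral_mono (hintg0.add hintg0') ((i2.const_mul h).add (i1.const_mul h))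
    intro y
    simp only [hf, neg_sq, Pi.add_apply]
    have a1 := exp_sub_one_abs (h*y)
    have a2 := exp_sub_one_abs (h*(-y))
    rw [abs_mul, abs_of_pos h0] at a1 a2
    rw [abs_neg] at a2
    have a3 := Real.cosh_le_exp_half_sq (h*y)
    rw [Real.cosh_eq] at a3
    rw [show h * -y = -(h*y) by ring] at a2 ⊢
    have a4 : Real.exp (-((1-h^2)/2)*y^2) = Real.exp ((h*y)^2/2) * Real.exp (-(1/2)*y^2) := by
      rw [← Real.exp_add]; ring_nf
    rw [a4]
    have hp : 0 < Real.exp (-(1/2)*y^2) := Real.exp_pos _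
    have a5 : |Real.exp (h*y) - 1| + |Real.exp (-(h*y)) - 1| ≤ h * |y| * (Real.exp ((h*y)^2/2) + 1) := by
      have : 0 ≤ h * |y| := by positivity
      nlinarith
    have := mul_le_mul_of_nonneg_right a5 hp.le
    linarith
  rw [integral_add (i2.const_mul h) (i1.const_mul h), integral_const_mul, integral_const_mul, e1, e2] at hle
  have : h * (1/((1-h^2)/2)) + h * (1/(1/2)) = 2 * (h * (1 + 1/(1-h^2))) := by field_simp; ring
  linarith

noncomputable def SS (v h : ℝ) : ℝ := ∫ y : ℝ, VV (Real.exp (v + h*y)) * Real.exp (-(1/2)*y^2)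

theorem SS_diff (v h : ℝ) (hv : 0 ≤ v) (h0 : 0 < h) (h1 : h < 1) :
    Integrable (fun y : ℝ => VV (Real.exp (v + h*y)) * Real.exp (-(1/2)*y^2)) ∧
    |SS v h - Real.sqrt (2*Real.pi) * VV (Real.exp v)| ≤ Real.exp v * ((h * (1 + 1/(1-h^2))) * (0.385*v+1.54) +
      Real.sqrt (2*Real.pi) * (0.385 * (Real.exp (2*h^2) - 2*Real.exp (h^2/2) + 1) +
      36.2*Real.exp (-0.1*v)*(Real.exp (0.405*h^2) + 1))) := by
  obtain ⟨i1, e1⟩ := exp_sub_one_int h h0 h1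
  obtain ⟨j0, f0⟩ := gauss_mgf 0
  obtain ⟨j1, f1⟩ := gauss_mgf h
  obtain ⟨j2, f2⟩ := gauss_mgf (2*h)
  obtain ⟨j3, f3⟩ := gauss_mgf (0.9*h)
  simp only [zero_mul, Real.exp_zero, one_mul] at j0 f0
  set G := fun y : ℝ => Real.exp v * ((0.385*v+1.54) * (|Real.exp (h*y) - 1| * Real.exp (-(1/2)*y^2)) +
     (0.385 * (Real.exp (2*h*y) * Real.exp (-(1/2)*y^2) - 2 * (Real.exp (h*y) * Real.exp (-(1/2)*y^2)) + Real.exp (-(1/2)*y^2)) +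
     36.2*Real.exp (-0.1*v) * (Real.exp (0.9*h*y) * Real.exp (-(1/2)*y^2) + Real.exp (-(1/2)*y^2)))) with hG
  have k0 : Integrable (fun y : ℝ => Real.exp (2*h*y) * Real.exp (-(1/2)*y^2) - 2 * (Real.exp (h*y) * Real.exp (-(1/2)*y^2))) := j2.sub (j1.const_mul 2)
  have k1 : Integrable (fun y : ℝ => 0.385 * (Real.exp (2*h*y) * Real.exp (-(1/2)*y^2) - 2 * (Real.exp (h*y) * Real.exp (-(1/2)*y^2)) + Real.exp (-(1/2)*y^2))) := (k0.add j0).const_mul _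
  have k2 : Integrable (fun y : ℝ => 36.2*Real.exp (-0.1*v) * (Real.exp (0.9*h*y) * Real.exp (-(1/2)*y^2) + Real.exp (-(1/2)*y^2))) := (j3.add j0).const_mul _
  have k3 : Integrable (fun y : ℝ => 0.385 * (Real.exp (2*h*y) * Real.exp (-(1/2)*y^2) - 2 * (Real.exp (h*y) * Real.exp (-(1/2)*y^2)) + Real.exp (-(1/2)*y^2)) + 36.2*Real.exp (-0.1*v) * (Real.exp (0.9*h*y) * Real.exp (-(1/2)*y^2) + Real.exp (-(1/2)*y^2))) := k1.add k2
  have hGi : Integrable G := ((i1.const_mul (0.385*v+1.54)).add k3).const_mul (Real.exp v)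
  have hGe : ∫ y, G y = Real.exp v * ((0.385*v+1.54) * (∫ y, |Real.exp (h*y) - 1| * Real.exp (-(1/2)*y^2)) +
     (0.385 * (Real.sqrt (2*Real.pi) * Real.exp ((2*h)^2/2) - 2 * (Real.sqrt (2*Real.pi) * Real.exp (h^2/2)) + Real.sqrt (2*Real.pi) * Real.exp (0^2/2)) +
     36.2*Real.exp (-0.1*v) * (Real.sqrt (2*Real.pi) * Real.exp ((0.9*h)^2/2) + Real.sqrt (2*Real.pi) * Real.exp (0^2/2)))) := by
    simp only [hG]
    rw [integral_const_mul, integral_add (i1.const_mul _) k3,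
      integral_const_mul, integral_add k1 k2, integral_const_mul, integral_const_mul,
      integral_add k0 j0, integral_sub j2 (j1.const_mul 2), integral_const_mul, integral_add j3 j0,
      f0, f1, f2, f3]
  set D := fun y : ℝ => (VV (Real.exp (v + h*y)) - VV (Real.exp v)) * Real.exp (-(1/2)*y^2) with hD
  have hDG : ∀ y, ‖D y‖ ≤ G y := by
    intro y
    simp only [hD, hG]
    rw [norm_mul, Real.norm_eq_abs, Real.norm_eq_abs, abs_of_pos (Real.exp_pos (-(1/2)*y^2))]
    have := mul_le_mul_of_nonneg_right (VV_shift v (h*y) hv) (Real.exp_pos (-(1/2)*y^2)).le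
    refine this.trans (le_of_eq ?_)
    have e : Real.exp (2*h*y) = Real.exp (h*y)^2 := by rw [← Real.exp_nat_mul]; push_cast; ring_nf
    rw [e, show 0.9*(h*y) = 0.9*h*y by ring]
    ring
  have hDm : Measurable D := by
    apply Measurable.mul
    · exact (VV_meas.comp (by fun_prop)).sub_const _
    · fun_prop
  have hDi : Integrable D := hGi.mono' hDm.aestronglyMeasurable (ae_of_all _ hDG)
  have hVi : Integrable (fun y : ℝ => VV (Real.exp (v + h*y)) * Real.exp (-(1/2)*y^2)) := by
    refine (hDi.add (j0.const_mul (VV (Real.exp v)))).congr (ae_of_all _ (fun y => ?_))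
    simp only [hD, Pi.add_apply]; ring
  refine ⟨hVi, ?_⟩
  have e0 : SS v h - Real.sqrt (2*Real.pi) * VV (Real.exp v) = ∫ y, D y := by
    have : ∫ y, D y = ∫ y : ℝ, (VV (Real.exp (v + h*y)) * Real.exp (-(1/2)*y^2) - VV (Real.exp v) * Real.exp (-(1/2)*y^2)) := by
      congr 1; funext y; simp only [hD]; ring
    rw [this, integral_sub hVi (j0.const_mul _), integral_const_mul, f0, SS]
    norm_num; ring
  rw [e0]
  have hb : ‖∫ y, D y‖ ≤ ∫ y, G y := norm_integral_le_of_norm_le hGi (ae_of_all _ hDG)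
  rw [Real.norm_eq_abs] at hb
  refine hb.trans ?_
  rw [hGe]
  apply mul_le_mul_of_nonneg_left _ (Real.exp_pos v).le
  have := mul_le_mul_of_nonneg_left e1 (show 0 ≤ 0.385*v+1.54 by linarith)
  rw [show (2*h)^2/2 = 2*h^2 by ring, show (0.9*h)^2/2 = 0.405*h^2 by ring, show (0:ℝ)^2/2 = 0 by ring, Real.exp_zero]
  linarith

end

section
open Complex Metric Set Filter Topology MeasureTheory Asymptotics

noncomputable def AA (s : ℂ) : ℂ := LSeries (fun n => (aZ n : ℂ)) s

theorem AA_term (s : ℂ) (hs : 0.9 ≤ s.re) (n : ℕ) : ‖LSeries.term (fun n => (aZ n : ℂ)) s n‖ ≤ |(aZ n:ℝ)| * (n:ℝ)^(-(0.9:ℝ)) := by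
  rw [LSeries.norm_term_eq]
  split_ifs with h
  · positivity
  · have hn : (1:ℝ) ≤ n := by exact_mod_cast Nat.one_le_iff_ne_zero.mpr h
    have e : ‖(aZ n : ℂ)‖ = |(aZ n:ℝ)| := by
      rw [← Complex.ofReal_intCast, Complex.norm_real, Real.norm_eq_abs]
    rw [e, div_eq_mul_inv, ← Real.rpow_neg (by positivity)]
    apply mul_le_mul_of_nonneg_left _ (abs_nonneg _)
    exact Real.rpow_le_rpow_of_exponent_le hn (by linarith)

theorem AA_summable (s : ℂ) (hs : 0.9 ≤ s.re) : LSeriesSummable (fun n => (aZ n : ℂ)) s :=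
  Summable.of_norm_bounded a_sum.1 (AA_term s hs)

theorem AA_bound (s : ℂ) (hs : 0.9 ≤ s.re) : ‖AA s‖ ≤ 18.1 :=
  (tsum_of_norm_bounded a_sum.1.hasSum (AA_term s hs)).trans a_sum.2

theorem AA_diff (s : ℂ) (hs : 0.9 < s.re) : DifferentiableAt ℂ AA s := by
  have h := (AA_summable (0.9:ℝ) (by norm_num)).abscissaOfAbsConv_le
  have h2 : LSeries.abscissaOfAbsConv (fun n => (aZ n : ℂ)) < s.re :=
    lt_of_le_of_lt h (by rw [Complex.ofReal_re]; exact_mod_cast hs)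
  exact (LSeries_hasDerivAt h2).differentiableAt

theorem pw2_bigO (r : ℝ) (hr : 1 < r) : (fun n : ℕ => ∑ k ∈ Finset.Icc 1 n, ‖(pw (-2) k : ℂ)‖) =O[atTop] fun n : ℕ => (n:ℝ)^r := by
  apply IsBigO.of_bound (0.385/(r-1) + 1.54 + 36.2)
  filter_upwards [eventually_ge_atTop 1] with n hn
  have hn1 : (1:ℝ) ≤ n := by exact_mod_cast hn
  have h := pw2_window 0 n le_rfl (by positivity) hn1
  rw [Nat.floor_zero, Nat.floor_natCast] at h
  have e : ∑ k ∈ Finset.Icc 1 n, ‖(pw (-2) k : ℂ)‖ = ∑ m ∈ Finset.Ioc 0 n, ((pw 2) m : ℝ) := by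
    apply Finset.sum_congr rfl
    intro k _
    rw [← pw_abs, ← Complex.ofReal_intCast, Complex.norm_real, Real.norm_eq_abs]
  rw [e]
  have hp : 0 ≤ ∑ m ∈ Finset.Ioc 0 n, ((pw 2) m : ℝ) := by
    apply Finset.sum_nonneg; intro k _; rw [← pw_abs]; positivity
  rw [Real.norm_of_nonneg hp, Real.norm_of_nonneg (by positivity)]
  refine h.trans ?_
  have hl := Real.log_le_rpow_div (x := (n:ℝ)) (by positivity) (show 0 < r - 1 by linarith)
  have e1 : (n:ℝ)^r = n * (n:ℝ)^(r-1) := by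
    rw [← Real.rpow_one_add' (by positivity) (by linarith)]; congr 1; ring
  have h9 : (n:ℝ)^(0.9:ℝ) ≤ (n:ℝ)^r := Real.rpow_le_rpow_of_exponent_le hn1 (by norm_num; linarith)
  have h1 : (n:ℝ) ≤ (n:ℝ)^r := by
    conv_lhs => rw [← Real.rpow_one (n:ℝ)]
    exact Real.rpow_le_rpow_of_exponent_le hn1 hr.le
  have h2 : (n:ℝ) * Real.log n ≤ (n:ℝ)^r/(r-1) := by
    rw [e1, mul_div_assoc]; gcongr
  have e3 : 0.385/(r-1) * (n:ℝ)^r = 0.385 * ((n:ℝ)^r/(r-1)) := by ring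
  rw [add_mul, add_mul, e3]
  linarith

theorem pw_summable (s : ℂ) (hs : 1 < s.re) : LSeriesSummable (fun n => (pw (-2) n : ℂ)) s := by
  obtain ⟨r, h1, h2⟩ := exists_between hs
  exact LSeriesSummable_of_sum_norm_bigO (pw2_bigO r h1) (by linarith) h2

noncomputable def FF (s : ℂ) : ℂ := AA s * iz s ^ 2

theorem FF_eq (s : ℂ) (hs : 1 < s.re) : LSeries (fun n => (pw (-2) n : ℂ)) s = FF s := by
  have hz : LSeriesSummable (fun n => ((ArithmeticFunction.zeta n : ℕ) : ℂ)) s := ArithmeticFunction.LSeriesSummable_zeta_iff.mpr hs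
  have hp := pw_summable s hs
  set P : ArithmeticFunction ℂ := ((pw (-2) : ArithmeticFunction ℤ) : ArithmeticFunction ℂ) with hP
  set Zt : ArithmeticFunction ℂ := ((ArithmeticFunction.zeta : ArithmeticFunction ℕ) : ArithmeticFunction ℂ) with hZ
  have hp' : LSeriesSummable (fun n => P n) s := hp
  have hz' : LSeriesSummable (fun n => Zt n) s := hz
  have hzv : LSeries (fun n => Zt n) s = riemannZeta s := ArithmeticFunction.LSeries_zeta_eq_riemannZeta hs
  have e1 := ArithmeticFunction.LSeries_mul' (ArithmeticFunction.LSeriesSummable_mul hp' hz') hz'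
  rw [ArithmeticFunction.LSeries_mul' hp' hz', hzv] at e1
  have e2 : P * Zt * Zt = ((aZ : ArithmeticFunction ℤ) : ArithmeticFunction ℂ) := by
    rw [aZ, ArithmeticFunction.intCoe_mul, ArithmeticFunction.intCoe_mul, ArithmeticFunction.coe_coe]
  rw [e2] at e1
  have e3 : AA s = LSeries (fun n => (pw (-2) n : ℂ)) s * riemannZeta s * riemannZeta s := e1
  have hne : riemannZeta s ≠ 0 := riemannZeta_ne_zero_of_one_le_re hs.le
  rw [FF, e3, iz_eq s (by linarith) (by rintro rfl; simp at hs)]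
  field_simp

theorem FF_bound_right (c t : ℝ) (hc : 1 < c) : ‖FF ((c:ℂ) + t*I)‖ ≤ 18.1 * (1 + 1/(c-1))^2 := by
  have hre : ((c:ℂ) + t*I).re = c := by simp
  have h1 := AA_bound ((c:ℂ) + t*I) (by rw [hre]; linarith)
  have h2 := zeta_inv_gen ((c:ℂ) + t*I) (by rw [hre]; exact hc)
  rw [hre] at h2
  rw [FF, iz_eq _ (by rw [hre]; linarith) (by intro h; rw [h] at hre; simp at hre; linarith), norm_mul, norm_pow]
  gcongr

theorem iz_diff (s : ℂ) (h0 : 0 < s.re) (h : xi s ≠ 0) : DifferentiableAt ℂ iz s := by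
  have hG : DifferentiableAt ℂ Gammaℝ s := by
    have e : Gammaℝ = fun s : ℂ => (Real.pi:ℂ)^(-s/2) * Complex.Gamma (s/2) := by
      funext s; rw [Complex.Gammaℝ_def]
    rw [e]
    apply DifferentiableAt.mul
    · apply DifferentiableAt.const_cpow (by fun_prop)
      left; exact_mod_cast Real.pi_ne_zero
    · apply DifferentiableAt.comp s (g := Complex.Gamma) (f := fun s : ℂ => s/2) _ (by fun_prop)
      apply Complex.differentiableAt_Gamma
      intro m hm
      have := congrArg Complex.re hm
      simp at this
      have hm' : (0:ℝ) ≤ m := by positivity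
      linarith
  have hx : DifferentiableAt ℂ xi s := xi_diff.differentiableAt
  exact (((differentiableAt_id.mul (differentiableAt_id.sub_const 1)).mul hG).div hx h)

theorem FF_diff (s : ℂ) (h0 : 0.9 < s.re) (h : xi s ≠ 0) : DifferentiableAt ℂ FF s :=
  (AA_diff s h0).mul ((iz_diff s (by linarith) h).pow 2)

theorem integral_exp_subst (g : ℝ → ℂ) : ∫ x in Ioi (0:ℝ), g x = ∫ w : ℝ, (Real.exp w : ℂ) * g (Real.exp w) := by
  have h := integral_image_eq_integral_abs_deriv_smul (s := univ) (f := Real.exp) (f' := Real.exp) MeasurableSet.univ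
    (fun x _ => (Real.hasDerivAt_exp x).hasDerivWithinAt) Real.exp_injective.injOn g
  rw [image_univ, Real.range_exp, setIntegral_univ] at h
  rw [h]
  congr 1; funext w
  rw [abs_of_pos (Real.exp_pos w)]
  exact Complex.real_smul

theorem mellin_VV (s : ℂ) (hs : 1 < s.re) : FF s = s * ∫ w : ℝ, (VV (Real.exp w) : ℂ) * cexp (-s*w) := by
  obtain ⟨r, h1, h2⟩ := exists_between hs
  rw [← FF_eq s hs, LSeries_eq_mul_integral' _ (by linarith) h2 (pw2_bigO r h1)]
  congr 1
  have e1 : ∫ t in Ioi (1:ℝ), (∑ k ∈ Finset.Icc 1 ⌊t⌋₊, (pw (-2) k : ℂ)) * (t:ℂ) ^ (-(s + 1)) =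
      ∫ t in Ioi (0:ℝ), (VV t : ℂ) * (t:ℂ) ^ (-(s + 1)) := by
    have e2 : ∫ t in Ioi (1:ℝ), (∑ k ∈ Finset.Icc 1 ⌊t⌋₊, (pw (-2) k : ℂ)) * (t:ℂ) ^ (-(s + 1)) = ∫ t in Ioi (1:ℝ), (VV t : ℂ) * (t:ℂ) ^ (-(s + 1)) := by
      congr 1; funext t
      congr 1
      rw [VV]; push_cast; rfl
    rw [e2]
    symm
    apply setIntegral_eq_of_subset_of_ae_sdiff_eq_zero measurableSet_Ioi.nullMeasurableSet (Ioi_subset_Ioi (by norm_num))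
    have : ∀ᵐ t : ℝ, t ≠ 1 := by
      rw [ae_iff]; simp
    filter_upwards [this] with t ht hd
    rw [VV_zero t]
    · simp
    · have := hd.2
      rw [mem_Ioi, not_lt] at this
      exact lt_of_le_of_ne this ht
  rw [e1, integral_exp_subst]
  congr 1; funext w
  have e3 : ((Real.exp w : ℝ):ℂ) ^ (-(s+1)) = cexp (-(s+1)*w) := by
    rw [Complex.ofReal_exp, Complex.cpow_def_of_ne_zero (Complex.exp_ne_zero _), ← Complex.ofReal_exp, ← Complex.ofReal_log (Real.exp_pos w).le, Real.log_exp]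
    ring_nf
  rw [e3, Complex.ofReal_exp]
  have e4 : cexp (-s*w) = cexp w * cexp (-(s+1)*w) := by rw [← Complex.exp_add]; ring_nf
  rw [e4]; ring

theorem VV_integrable (c : ℝ) (hc : 1 < c) : Integrable (fun w : ℝ => VV (Real.exp w) * Real.exp (-c*w)) := by
  set δ := c - 1 with hδ
  have hδ0 : 0 < δ := by linarith
  have hm : Measurable (fun w : ℝ => VV (Real.exp w) * Real.exp (-c*w)) :=
    (VV_meas.comp (by fun_prop)).mul (by fun_prop)
  have hi : Integrable (indicator (Ioi 0) (fun w : ℝ => (0.385*(2/δ) + 37.74) * Real.exp (-(δ/2)*w))) := by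
    rw [integrable_indicator_iff measurableSet_Ioi]
    exact (exp_neg_integrableOn_Ioi 0 (by linarith)).const_mul _
  apply hi.mono' hm.aestronglyMeasurable
  have : ∀ᵐ t : ℝ, t ≠ 0 := by rw [ae_iff]; simp
  filter_upwards [this] with w hw
  rcases lt_or_gt_of_ne hw with h | h
  · rw [VV_zero _ (Real.exp_lt_one_iff.mpr h), zero_mul, norm_zero, indicator_of_notMem (by rw [mem_Ioi]; linarith)]
  · rw [indicator_of_mem (by exact h), norm_mul, Real.norm_eq_abs, Real.norm_of_nonneg (Real.exp_pos _).le]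
    have h1 := VV_triv w h.le
    have h2 : Real.exp (-0.1*w) ≤ 1 := Real.exp_le_one_iff.mpr (by linarith)
    have h3 : w ≤ 2/δ * Real.exp (δ/2*w) := by
      have := Real.add_one_le_exp (δ/2*w)
      calc w = 2/δ * (δ/2*w) := by field_simp
        _ ≤ 2/δ * Real.exp (δ/2*w) := by gcongr; linarith
    have h4 : 1 ≤ Real.exp (δ/2*w) := Real.one_le_exp (by positivity)
    have h5 : 0.385*w+1.54 + 36.2 * Real.exp (-0.1*w) ≤ (0.385*(2/δ) + 37.74) * Real.exp (δ/2*w) := by nlinarith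
    calc |VV (Real.exp w)| * Real.exp (-c*w) ≤ (Real.exp w * ((0.385*(2/δ) + 37.74) * Real.exp (δ/2*w))) * Real.exp (-c*w) := by
          apply mul_le_mul_of_nonneg_right _ (Real.exp_pos _).le
          refine h1.trans ?_
          gcongr
      _ = (0.385*(2/δ) + 37.74) * (Real.exp w * Real.exp (δ/2*w) * Real.exp (-c*w)) := by ring
      _ = _ := by
          rw [← Real.exp_add, ← Real.exp_add]
          congr 2
          rw [hδ]; ring

end

section
open Complex Metric Set Filter Topology MeasureTheory Asymptotics

noncomputable def KK (v h : ℝ) (s : ℂ) : ℂ := cexp (v*s + h^2/2*s^2)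

theorem KK_norm (v h σ t : ℝ) : ‖KK v h ((σ:ℂ) + t*I)‖ = Real.exp (v*σ + h^2/2*σ^2) * Real.exp (-(h^2/2)*t^2) := by
  rw [KK, Complex.norm_exp, ← Real.exp_add]
  congr 1
  have : (v*((σ:ℂ) + t*I) + h^2/2*((σ:ℂ) + t*I)^2) = ((v*σ + h^2/2*σ^2 + -(h^2/2)*t^2 : ℝ):ℂ) + ((v*t + h^2*σ*t : ℝ):ℂ)*I := by
    push_cast; linear_combination (h^2/2*t^2 : ℂ) * Complex.I_sq
  rw [this, Complex.add_re, Complex.ofReal_re, Complex.re_ofReal_mul, Complex.I_re]; ring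

noncomputable def GG (v h : ℝ) (s : ℂ) : ℂ := FF s / s * KK v h s

theorem KK_integral (v h c w : ℝ) (h0 : 0 < h) :
    ∫ t : ℝ, cexp (-((c:ℂ)+t*I)*w) * KK v h ((c:ℂ)+t*I) =
      ((Real.sqrt (2*Real.pi)/h * Real.exp (-(1/2)*((w-v)/h)^2) : ℝ):ℂ) := by
  have e : (fun t : ℝ => cexp (-((c:ℂ)+t*I)*w) * KK v h ((c:ℂ)+t*I)) =
      fun t : ℝ => cexp ((-(h^2/2) : ℂ) * t^2 + (((v - w + h^2*c : ℝ):ℂ)*I) * t + (((v-w)*c + h^2/2*c^2 : ℝ):ℂ)) := by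
    funext t
    rw [KK, ← Complex.exp_add]
    congr 1
    push_cast
    linear_combination (h^2/2*t^2 : ℂ) * Complex.I_sq
  have hb : (-(h^2/2) : ℂ).re < 0 := by
    have : (-(h^2/2) : ℂ) = ((-(h^2/2) : ℝ):ℂ) := by push_cast; ring
    rw [this, Complex.ofReal_re]; have := sq_pos_of_pos h0; linarith
  rw [e, integral_cexp_quadratic hb]
  have e1 : ((Real.pi:ℂ) / -(-(h^2/2) : ℂ)) ^ (1/2 : ℂ) = ((Real.sqrt (2*Real.pi)/h : ℝ):ℂ) := by
    have : ((Real.pi:ℂ) / -(-(h^2/2) : ℂ)) = ((2*Real.pi/h^2 : ℝ):ℂ) := by push_cast; rw [neg_neg]; field_simp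
    rw [this, show (1/2:ℂ) = ((1/2:ℝ):ℂ) by push_cast; ring, ← Complex.ofReal_cpow (by positivity), ← Real.sqrt_eq_rpow,
      Real.sqrt_div (by positivity), Real.sqrt_sq h0.le]
  rw [e1, Complex.ofReal_mul, Complex.ofReal_exp]
  congr 2
  have hh : (h:ℂ) ≠ 0 := by exact_mod_cast h0.ne'
  push_cast
  field_simp
  linear_combination (4*(v - w + h^2*c)^2 : ℂ) * Complex.I_sq

theorem line_ne (c t : ℝ) (hc : 0 < c) : ((c:ℂ)+t*I) ≠ 0 := by
  intro h
  have := congrArg Complex.re h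
  simp at this; linarith

theorem GG_int_eq (v h c : ℝ) (h0 : 0 < h) (hc : 1 < c) :
    Integrable (fun t : ℝ => GG v h ((c:ℂ)+t*I)) ∧
    ∫ t : ℝ, GG v h ((c:ℂ)+t*I) = ((Real.sqrt (2*Real.pi) * SS v h : ℝ):ℂ) := by
  set f : ℝ × ℝ → ℂ := fun p => (VV (Real.exp p.2) : ℂ) * (cexp (-((c:ℂ)+p.1*I)*p.2) * KK v h ((c:ℂ)+p.1*I)) with hf
  have hg : Integrable (fun t : ℝ => Real.exp (v*c + h^2/2*c^2) * Real.exp (-(h^2/2)*t^2)) :=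
    (integrable_exp_neg_mul_sq (by positivity)).const_mul _
  have hprod := hg.mul_prod (VV_integrable c hc)
  have hfm : Measurable f := by
    apply Measurable.mul
    · exact Complex.measurable_ofReal.comp (VV_meas.comp (by fun_prop))
    · unfold KK; fun_prop
  have hfi : Integrable f (volume.prod volume) := by
    refine hprod.mono hfm.aestronglyMeasurable (ae_of_all _ (fun p => le_of_eq ?_))
    simp only [hf]
    simp only [norm_mul, KK_norm, Complex.norm_real, Complex.norm_exp, Real.norm_of_nonneg (Real.exp_pos _).le]
    have : (-((c:ℂ)+p.1*I)*p.2).re = -c*p.2 := by simp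
    rw [this]; ring
  have hGG : ∀ t : ℝ, GG v h ((c:ℂ)+t*I) = ∫ w : ℝ, f (t, w) := by
    intro t
    have hre : 1 < ((c:ℂ)+t*I).re := by simpa using hc
    rw [GG, mellin_VV _ hre, mul_div_cancel_left₀ _ (line_ne c t (by linarith)), ← integral_mul_const]
    congr 1; funext w
    simp only [hf]; ring
  constructor
  · have := hfi.integral_prod_left
    simp only [hGG]; exact this
  · simp only [hGG]
    rw [integral_integral_swap hfi]
    have e1 : ∀ w : ℝ, ∫ t : ℝ, f (t, w) = (((Real.sqrt (2*Real.pi)/h) * (VV (Real.exp w) * Real.exp (-(1/2)*((w-v)/h)^2)) : ℝ):ℂ) := by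
      intro w
      simp only [hf]
      rw [integral_const_mul, KK_integral v h c w h0]
      push_cast; ring
    simp only [e1]
    rw [integral_complex_ofReal, integral_const_mul, SS]
    congr 1
    set φ := fun w : ℝ => VV (Real.exp w) * Real.exp (-(1/2)*((w-v)/h)^2) with hφ
    have e2 : ∫ y : ℝ, VV (Real.exp (v + h*y)) * Real.exp (-(1/2)*y^2) = ∫ y : ℝ, φ (v + h*y) := by
      congr 1; funext y; simp only [hφ]
      congr 4; field_simp; ring
    rw [e2, Measure.integral_comp_mul_left (fun z => φ (v+z)) h, integral_add_left_eq_self φ v, abs_of_pos (by positivity), smul_eq_mul]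
    field_simp

end

section
open Complex Metric Set Filter Topology MeasureTheory

theorem split_tail (f : ℝ → ℂ) (hf : Integrable f) (T : ℝ) (hT : 0 ≤ T) :
    ∫ t, f t = (∫ t in (-T)..T, f t) + ∫ t in Ioi T, (f t + f (-t)) := by
  have h1 : ∫ t in Ioi T, f (-t) = ∫ t in Iic (-T), f t := integral_comp_neg_Ioi T f
  have h2 := intervalIntegral.integral_Iic_add_Ioi (b := T) (f := f) (μ := volume) hf.integrableOn hf.integrableOn
  have h3 := intervalIntegral.integral_Iic_sub_Iic (a := -T) (b := T) (f := f) (μ := volume) hf.integrableOn hf.integrableOn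
  rw [integral_add hf.integrableOn hf.comp_neg.integrableOn, h1, ← h2, ← h3]
  ring

theorem split_sym (f : ℝ → ℂ) (T : ℝ) (hT : 0 ≤ T) (hf : ContinuousOn f (Icc (-T) T)) :
    ∫ t in (-T)..T, f t = ∫ t in (0:ℝ)..T, (f t + f (-t)) := by
  have hi : IntervalIntegrable f volume (-T) T := by
    apply ContinuousOn.intervalIntegrable; rwa [uIcc_of_le (by linarith)]
  have h1 : IntervalIntegrable f volume (-T) 0 := hi.mono_set (by
    rw [uIcc_of_le (by linarith), uIcc_of_le (by linarith)]; exact Icc_subset_Icc le_rfl hT)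
  have h2 : IntervalIntegrable f volume 0 T := hi.mono_set (by
    rw [uIcc_of_le (by linarith), uIcc_of_le (by linarith)]; exact Icc_subset_Icc (by linarith) le_rfl)
  have h3 : IntervalIntegrable (fun t => f (-t)) volume 0 T := by
    apply ContinuousOn.intervalIntegrable
    rw [uIcc_of_le hT]
    exact hf.comp (by fun_prop) (fun t ht => ⟨by linarith [ht.2], by linarith [ht.1]⟩)
  rw [intervalIntegral.integral_add h2 h3, intervalIntegral.integral_comp_neg, neg_zero, add_comm,
    intervalIntegral.integral_add_adjacent_intervals h1 h2]

theorem GG_norm (v h σ t : ℝ) : ‖GG v h ((σ:ℂ)+t*I)‖ =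
    ‖FF ((σ:ℂ)+t*I)‖ / ‖(σ:ℂ)+t*I‖ * (Real.exp (v*σ + h^2/2*σ^2) * Real.exp (-(h^2/2)*t^2)) := by
  rw [GG, norm_mul, norm_div, KK_norm]

theorem line_norm_im (σ t : ℝ) : |t| ≤ ‖(σ:ℂ)+t*I‖ := by
  have := Complex.abs_im_le_norm ((σ:ℂ)+t*I)
  simpa using this

theorem line_norm_re (σ t : ℝ) (hσ : 0.9 ≤ σ) : 0.9 ≤ ‖(σ:ℂ)+t*I‖ := by
  have := Complex.abs_re_le_norm ((σ:ℂ)+t*I)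
  simp at this
  exact hσ.trans ((le_abs_self _).trans this)

theorem FF_le (s : ℂ) (hs : 0.9 ≤ s.re) (B : ℝ) (hB : ‖iz s‖ ≤ B) : ‖FF s‖ ≤ 18.1 * B^2 := by
  rw [FF, norm_mul, norm_pow]
  have h1 := AA_bound s hs
  have h0 := norm_nonneg (iz s)
  gcongr

theorem GG_le (v h σ t F N E : ℝ) (hF : ‖FF ((σ:ℂ)+t*I)‖ ≤ F) (hN : 0 < N) (hN' : N ≤ ‖(σ:ℂ)+t*I‖)
    (hE : v*σ + h^2/2*σ^2 ≤ E) : ‖GG v h ((σ:ℂ)+t*I)‖ ≤ F / N * (Real.exp E * Real.exp (-(h^2/2)*t^2)) := by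
  rw [GG_norm]
  have := norm_nonneg (FF ((σ:ℂ)+t*I))
  have h0 : 0 ≤ F := this.trans hF
  gcongr

theorem tail_bound (v h T : ℝ) (hv : 87 ≤ v) (h0 : 0 < h) (hT : 0 < T) :
    ‖∫ t in Ioi T, (GG v h (((1+1/v:ℝ):ℂ)+t*I) + GG v h (((1+1/v:ℝ):ℂ)+(-t:ℝ)*I))‖ ≤
      Real.exp v * (2*18.1*(1+v)^2*Real.exp (1+0.52*h^2-(h*T)^2/2)/(h*T)^2) := by
  set c : ℝ := 1+1/v with hc
  have hv0 : 0 < v := by linarith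
  have hinv : 1/v ≤ 1/87 := one_div_le_one_div_of_le (by norm_num) hv
  have hinv0 : 0 < 1/v := by positivity
  have hE : v*c + h^2/2*c^2 ≤ v+1+0.52*h^2 := by
    have e : v*c = v+1 := by rw [hc]; field_simp
    have : c^2 ≤ 1.04 := by nlinarith
    nlinarith [sq_nonneg h]
  have hcc : 18.1*(1+1/(c-1))^2 = 18.1*(1+v)^2 := by rw [hc]; congr 2; field_simp; ring
  set C := 18.1*(1+v)^2/T*(Real.exp (v+1+0.52*h^2)) with hC
  have key : ∀ t : ℝ, T < |t| → ‖GG v h ((c:ℂ)+t*I)‖ ≤ C * Real.exp (-(h^2/2)*t^2) := by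
    intro t ht
    have := GG_le v h c t _ T _ (FF_bound_right c t (by linarith)) hT (ht.le.trans (line_norm_im c t)) hE
    rw [hcc] at this
    rw [hC, mul_assoc]; exact this
  have hneg : -(h^2*T) < 0 := by have : 0 < h^2*T := by positivity
                                 linarith
  have hintg0 := (integrableOn_exp_mul_Ioi hneg T).const_mul (2*C*Real.exp ((h*T)^2/2))
  have hb := norm_integral_le_of_norm_le (μ := volume.restrict (Ioi T)) (f := fun t : ℝ => GG v h ((c:ℂ)+t*I) + GG v h ((c:ℂ)+(-t:ℝ)*I)) hintg0 (by
    refine (ae_restrict_mem measurableSet_Ioi).mono (fun t ht => ?_)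
    have ht' : T < t := ht
    have h1 := key t (by rwa [abs_of_pos (by linarith)])
    have h2 := key (-t) (by rwa [abs_neg, abs_of_pos (by linarith)])
    rw [neg_sq] at h2
    have h3 : Real.exp (-(h^2/2)*t^2) ≤ Real.exp ((h*T)^2/2) * Real.exp (-(h^2*T)*t) := by
      rw [← Real.exp_add]; apply Real.exp_le_exp.mpr
      nlinarith [mul_nonneg (sq_nonneg h) (sq_nonneg (t-T))]
    have hC0 : 0 ≤ C := by positivity
    calc _ ≤ _ := norm_add_le _ _
      _ ≤ 2*C*Real.exp (-(h^2/2)*t^2) := by linarith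
      _ ≤ 2*C*(Real.exp ((h*T)^2/2) * Real.exp (-(h^2*T)*t)) := by gcongr
      _ = _ := by ring)
  refine hb.trans (le_of_eq ?_)
  rw [integral_const_mul, integral_exp_mul_Ioi hneg, hC]
  have e1 : Real.exp (-(h^2*T)*T) = Real.exp (-(h*T)^2/2) * Real.exp (-(h*T)^2/2) := by rw [← Real.exp_add]; congr 1; ring
  have e2 : Real.exp ((h*T)^2/2) * Real.exp (-(h*T)^2/2) = 1 := by rw [← Real.exp_add, ← Real.exp_zero]; congr 1; ring
  have e3 : Real.exp (1+0.52*h^2-(h*T)^2/2) = Real.exp (1+0.52*h^2) * Real.exp (-(h*T)^2/2) := by rw [← Real.exp_add]; congr 1; ring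
  have e4 : Real.exp (v+1+0.52*h^2) = Real.exp v * Real.exp (1+0.52*h^2) := by rw [← Real.exp_add]; congr 1; ring
  rw [e1, e3, e4]
  calc _ = (2*18.1*(1+v)^2*Real.exp v * Real.exp (1+0.52*h^2) * Real.exp (-(h*T)^2/2)/(h*T)^2) * (Real.exp ((h*T)^2/2) * Real.exp (-(h*T)^2/2)) := by field_simp
    _ = _ := by rw [e2]; ring

end

section
open Complex Metric Set Filter Topology MeasureTheory

theorem GG_diff (v h : ℝ) (s : ℂ) (h1 : 0.9 < s.re) (h2 : xi s ≠ 0) : DifferentiableAt ℂ (GG v h) s := by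
  have hs : s ≠ 0 := by intro h; rw [h] at h1; norm_num at h1
  have hK : DifferentiableAt ℂ (KK v h) s := by unfold KK; fun_prop
  exact ((FF_diff s h1 h2).div differentiableAt_id hs).mul hK

theorem rect_shift (f : ℂ → ℂ) (a c T : ℝ) (hac : a ≤ c) (hT : 0 ≤ T)
    (hf : ∀ s : ℂ, a ≤ s.re → s.re ≤ c → |s.im| ≤ T → DifferentiableAt ℂ f s) :
    ‖∫ t in (-T)..T, f ((c:ℂ)+t*I)‖ ≤ ‖∫ t in (-T)..T, f ((a:ℂ)+t*I)‖ +
      ‖∫ x in a..c, f ((x:ℂ)+(T:ℝ)*I)‖ + ‖∫ x in a..c, f ((x:ℂ)+(-T:ℝ)*I)‖ := by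
  have h := Complex.integral_boundary_rect_eq_zero_of_differentiableOn f ((a:ℂ)+(-T:ℝ)*I) ((c:ℂ)+(T:ℝ)*I) (by
    intro s hs
    rw [mem_reProdIm] at hs
    simp only [add_re, ofReal_re, mul_re, I_re, mul_zero, ofReal_im, I_im, mul_one, sub_self, add_zero, add_im, mul_im, zero_add] at hs
    rw [uIcc_of_le hac, uIcc_of_le (by linarith)] at hs
    exact (hf s hs.1.1 hs.1.2 (abs_le.mpr ⟨hs.2.1, hs.2.2⟩)).differentiableWithinAt)
  simp only [add_re, ofReal_re, mul_re, I_re, mul_zero, ofReal_im, I_im, mul_one, sub_self, add_zero, add_im, mul_im, zero_add] at h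
  have h2 : I • (∫ t in (-T)..T, f ((c:ℂ)+t*I)) = I • (∫ t in (-T)..T, f ((a:ℂ)+t*I)) +
      ((∫ x in a..c, f ((x:ℂ)+(T:ℝ)*I)) - ∫ x in a..c, f ((x:ℂ)+(-T:ℝ)*I)) := by
    linear_combination h
  have h3 : ∀ z : ℂ, ‖I • z‖ = ‖z‖ := by intro z; rw [norm_smul, Complex.norm_I, one_mul]
  rw [← h3, h2]
  refine (norm_add_le _ _).trans ?_
  rw [h3, add_assoc]
  gcongr
  exact norm_sub_le _ _

theorem hor_bound (v h T η η' Q t : ℝ) (hv : 87 ≤ v) (hT : 8 ≤ T) (h1 : 0 < η') (h2 : η' < η)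
    (h3 : η' ≤ 0.0999) (hη : η ≤ 0.4) (hZ : ZF (T+1) η) (hQ : QQ η (-η') ≤ Q) (ht : |t| = T) :
    ‖∫ x in (1-η')..(1+1/v), GG v h ((x:ℂ)+t*I)‖ ≤
      Real.exp v * (18.1*10.24*Real.exp (2*((1/2*Real.log (T/(2*Real.pi))+2.182)*Q+0.04)+1+0.52*h^2-(h*T)^2/2)/T*(η'+1/v)) := by
  have hv0 : 0 < v := by linarith
  have hinv : 1/v ≤ 1/87 := one_div_le_one_div_of_le (by norm_num) hv
  have hinv0 : 0 < 1/v := by positivity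
  set L := Real.log (T/(2*Real.pi)) with hL
  have hpi := Real.pi_pos
  have hL0 : 0 ≤ L := by
    apply Real.log_nonneg; rw [le_div_iff₀ (by positivity)]; linarith [Real.pi_lt_four]
  have hb := intervalIntegral.norm_integral_le_of_norm_le_const (a := 1-η') (b := 1+1/v) (f := fun x : ℝ => GG v h ((x:ℂ)+t*I))
    (C := 18.1*(3.2*Real.exp ((1/2*L+2.182)*Q+0.04))^2/T*(Real.exp (v+1+0.52*h^2) * Real.exp (-(h^2/2)*t^2))) (by
    intro x hx
    rw [uIoc_of_le (by linarith)] at hx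
    have hx1 := hx.1
    have hx2 := hx.2
    have hiz := izc_hi_gen η η' t T hη h1 h2 (by linarith) hZ (x-1) (by rw [ht]; linarith) (by rw [ht]) (by linarith) (by linarith)
    rw [ht, ← hL, show (1+(x-1):ℝ) = x by ring] at hiz
    have hq : QQ η (x-1) ≤ Q := (QQ_anti η (-η') (x-1) (by linarith) (by linarith) (by linarith)).trans hQ
    have hq2 : ‖iz ((x:ℂ)+t*I)‖ ≤ 3.2*Real.exp ((1/2*L+2.182)*Q+0.04) := by
      refine hiz.trans ?_
      have : -(1/2*L)*(0.4-(x-1)) + (1/2*L+2.182)*QQ η (x-1) + 0.04 ≤ (1/2*L+2.182)*Q+0.04 := by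
        have a1 : 0 ≤ (1/2*L)*(0.4-(x-1)) := by apply mul_nonneg <;> linarith
        have a2 : (1/2*L+2.182)*QQ η (x-1) ≤ (1/2*L+2.182)*Q := by gcongr
        linarith
      gcongr
    refine GG_le v h x t _ T _ (FF_le _ (by simp; linarith) _ hq2) (by linarith) (by rw [← ht]; exact line_norm_im x t) ?_
    have e : v*x ≤ v+1 := by
      calc v*x ≤ v*(1+1/v) := by gcongr
        _ = v+1 := by field_simp
    have : x^2 ≤ 1.04 := by nlinarith
    nlinarith [sq_nonneg h])
  refine hb.trans (le_of_eq ?_)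
  rw [abs_of_nonneg (by linarith), show t^2 = T^2 by rw [← ht, sq_abs], mul_pow]
  have e1 : Real.exp ((1/2*L+2.182)*Q+0.04)^2 * (Real.exp (v+1+0.52*h^2) * Real.exp (-(h^2/2)*T^2)) =
    Real.exp v * Real.exp (2*((1/2*L+2.182)*Q+0.04)+1+0.52*h^2-(h*T)^2/2) := by
    rw [← Real.exp_nat_mul, ← Real.exp_add, ← Real.exp_add, ← Real.exp_add]; congr 1; push_cast; ring
  calc _ = 18.1*10.24/T*(η'+1/v) * (Real.exp ((1/2*L+2.182)*Q+0.04)^2 * (Real.exp (v+1+0.52*h^2) * Real.exp (-(h^2/2)*T^2))) := by ring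
    _ = _ := by rw [e1]; ring

set_option maxHeartbeats 2000000 in
theorem left_bound (v h T η η' Q J : ℝ) (hv : 87 ≤ v) (hT : 8 ≤ T) (h1 : 0 < η') (h2 : η' < η)
    (h3 : η' ≤ 0.0999) (hη : η ≤ 0.4) (hZ : ZF (T+1) η) (hQ : QQ η (-η') ≤ Q)
    (hJ : ∫ t in (4:ℝ)..T, t^(Q-0.4-η'-1) * Real.exp (-(h^2/2)*t^2) ≤ J)
    (hc : ContinuousOn (fun t : ℝ => GG v h (((1-η':ℝ):ℂ)+t*I)) (Icc (-T) T)) :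
    ‖∫ t in (-T)..T, GG v h (((1-η':ℝ):ℂ)+t*I)‖ ≤
      Real.exp v * (18.1*10.24*Real.exp (2*(0.43*Q+1.79*(0.4+η'))-v*η'+h^2/2)*(4/0.9)
        + 18.1*10.24*Real.exp (2*(2.07*Q+0.865*(0.4+η'))-v*η'+h^2/2-2*h^2)*(5/3)
        + 2*18.1*10.24*Real.exp (4.364*Q+0.08-v*η'+h^2/2)*(2*Real.pi)^(-(Q-0.4-η'))*J) := by
  have hpi := Real.pi_pos
  have hE : v*(1-η') + h^2/2*(1-η')^2 ≤ v - v*η' + h^2/2 := by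
    have : (1-η')^2 ≤ 1 := by nlinarith
    nlinarith [sq_nonneg h]
  set E := v - v*η' + h^2/2 with hEd
  set f := fun t : ℝ => GG v h (((1-η':ℝ):ℂ)+t*I) with hf
  have hre : ∀ t : ℝ, 0.9 ≤ (((1-η':ℝ):ℂ)+t*I).re := by intro t; simp; linarith
  rw [split_sym f T (by linarith) hc]
  set g := fun t : ℝ => f t + f (-t) with hg
  have hgc : ContinuousOn g (Icc 0 T) := by
    apply ContinuousOn.add
    · exact hc.mono (Icc_subset_Icc (by linarith) le_rfl)
    · exact hc.comp (by fun_prop) (fun t ht => ⟨by linarith [ht.2], by linarith [ht.1]⟩)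
  have hgi : ∀ a b : ℝ, 0 ≤ a → a ≤ b → b ≤ T → IntervalIntegrable g volume a b := by
    intro a b ha hab hb
    apply ContinuousOn.intervalIntegrable
    rw [uIcc_of_le hab]; exact hgc.mono (Icc_subset_Icc ha hb)
  rw [← intervalIntegral.integral_add_adjacent_intervals (hgi 0 2 le_rfl (by norm_num) (by linarith)) (hgi 2 T (by norm_num) (by linarith) le_rfl),
    ← intervalIntegral.integral_add_adjacent_intervals (hgi 2 3 (by norm_num) (by norm_num) (by linarith)) (hgi 3 T (by norm_num) (by linarith) le_rfl),
    ← intervalIntegral.integral_add_adjacent_intervals (hgi 3 4 (by norm_num) (by norm_num) (by linarith)) (hgi 4 T (by norm_num) (by linarith) le_rfl)]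
  set M2 := 3.2*Real.exp (0.865*(0.4+η')+2.07*Q) with hM2
  set M1 := 3.2*Real.exp (1.79*(0.4+η')+0.43*Q) with hM1
  have k1 : ∀ t : ℝ, |t| ≤ 2 → ‖f t‖ ≤ 18.1*M1^2/0.9*(Real.exp E) := by
    intro t ht
    have hiz := izc_low η η' t T hη h1 h2 (by linarith) (by linarith) hZ ht
    have hiz2 : ‖iz (((1-η':ℝ):ℂ)+t*I)‖ ≤ M1 := hiz.trans (by rw [hM1]; gcongr)
    have := GG_le v h (1-η') t _ 0.9 _ (FF_le _ (hre t) _ hiz2) (by norm_num) (line_norm_re _ t (by linarith)) hE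
    refine this.trans ?_
    have h5 : Real.exp (-(h^2/2)*t^2) ≤ 1 := by
      rw [Real.exp_le_one_iff]; nlinarith [mul_nonneg (sq_nonneg h) (sq_nonneg t)]
    calc _ ≤ 18.1*M1^2/0.9*(Real.exp E*1) := by gcongr
      _ = _ := by ring
  have k2 : ∀ t N : ℝ, 2 ≤ |t| → |t| ≤ 4 → 0 < N → N ≤ |t| → ‖f t‖ ≤ 18.1*M2^2/N*(Real.exp (E-2*h^2)) := by
    intro t N ht ht' hN0 hN
    have hiz := izc_mid η η' t T hη h1 h2 (by linarith) (by linarith) hZ ht ht'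
    have hiz2 : ‖iz (((1-η':ℝ):ℂ)+t*I)‖ ≤ M2 := hiz.trans (by rw [hM2]; gcongr)
    have := GG_le v h (1-η') t _ N _ (FF_le _ (hre t) _ hiz2) hN0 (hN.trans (line_norm_im _ t)) hE
    refine this.trans ?_
    rw [← Real.exp_add]
    have h4 : 4 ≤ t^2 := by rw [← sq_abs]; nlinarith
    have h5 : E + -(h^2/2)*t^2 ≤ E - 2*h^2 := by nlinarith [mul_nonneg (sq_nonneg h) (sub_nonneg.mpr h4)]
    gcongr
  set e := Q-0.4-η' with he
  set D := 18.1*10.24*Real.exp (4.364*Q+0.08)*(2*Real.pi)^(-e)*Real.exp E with hD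
  have k3 : ∀ t : ℝ, 4 ≤ |t| → |t| ≤ T → ‖f t‖ ≤ D*(|t|^(e-1) * Real.exp (-(h^2/2)*t^2)) := by
    intro t ht ht'
    have ht0 : 0 < |t| := by linarith
    have hiz := izc_hi_gen η η' t T hη h1 h2 (by linarith) hZ (-η') ht ht' le_rfl (by linarith)
    rw [show (1+ -η':ℝ) = 1-η' by ring] at hiz
    set L := Real.log (|t|/(2*Real.pi)) with hL
    have hLb : 0 ≤ 1/2*L+2.182 := by
      have : Real.log (1/2) ≤ L := by
        apply Real.log_le_log (by norm_num)
        rw [div_le_div_iff₀ (by norm_num) (by positivity)]; linarith [Real.pi_lt_four]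
      rw [one_div, Real.log_inv] at this
      linarith [Real.log_two_lt_d9]
    have hiz2 : ‖iz (((1-η':ℝ):ℂ)+t*I)‖ ≤ 3.2*Real.exp (-(1/2*L)*(0.4+η') + (1/2*L+2.182)*Q+0.04) := by
      refine hiz.trans ?_
      rw [show (0.4 - -η') = 0.4+η' by ring]
      gcongr
    have := GG_le v h (1-η') t _ |t| _ (FF_le _ (hre t) _ hiz2) ht0 (line_norm_im _ t) hE
    refine this.trans (le_of_eq ?_)
    have e1 : Real.exp (-(1/2*L)*(0.4+η') + (1/2*L+2.182)*Q+0.04)^2 = Real.exp (4.364*Q+0.08) * ((2*Real.pi)^(-e) * |t|^e) := by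
      rw [← Real.exp_nat_mul, Real.rpow_neg (by positivity), ← div_eq_inv_mul, ← Real.div_rpow ht0.le (by positivity),
        Real.rpow_def_of_pos (by positivity), ← hL, ← Real.exp_add]
      congr 1; push_cast; rw [he]; ring
    rw [mul_pow, e1, hD, Real.rpow_sub_one ht0.ne']
    ring
  have b1 : ‖∫ t in (0:ℝ)..2, g t‖ ≤ Real.exp v * (18.1*10.24*Real.exp (2*(0.43*Q+1.79*(0.4+η'))-v*η'+h^2/2)*(4/0.9)) := by
    have := intervalIntegral.norm_integral_le_of_norm_le_const (a := 0) (b := 2) (f := g) (C := 2*(18.1*M1^2/0.9*(Real.exp E))) (by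
      intro t ht
      rw [uIoc_of_le (by norm_num)] at ht
      have a1 := k1 t (by rw [abs_of_pos ht.1]; exact ht.2)
      have a2 := k1 (-t) (by rw [abs_neg, abs_of_pos ht.1]; exact ht.2)
      calc ‖g t‖ ≤ ‖f t‖+‖f (-t)‖ := norm_add_le _ _
        _ ≤ _ := by linarith)
    refine this.trans (le_of_eq ?_)
    have e1 : Real.exp (1.79*(0.4+η')+0.43*Q)^2*Real.exp E = Real.exp v * Real.exp (2*(0.43*Q+1.79*(0.4+η'))-v*η'+h^2/2) := by
      rw [← Real.exp_nat_mul, ← Real.exp_add, ← Real.exp_add]; congr 1; push_cast; rw [hEd]; ring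
    rw [hM1, mul_pow, sub_zero, abs_of_pos (by norm_num : (0:ℝ)<2)]
    linear_combination (18.1*10.24*(4/0.9))*e1
  have b2 : ∀ a : ℝ, 2 ≤ a → a ≤ 3 → ‖∫ t in a..(a+1), g t‖ ≤ Real.exp v * (18.1*10.24*Real.exp (2*(2.07*Q+0.865*(0.4+η'))-v*η'+h^2/2-2*h^2)*(2/a)) := by
    intro a ha ha'
    have := intervalIntegral.norm_integral_le_of_norm_le_const (a := a) (b := a+1) (f := g) (C := 2*(18.1*M2^2/a*(Real.exp (E-2*h^2)))) (by
      intro t ht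
      rw [uIoc_of_le (by linarith)] at ht
      have hh1 := ht.1
      have hh2 := ht.2
      have ht0 : 0 < t := by linarith
      have a1 := k2 t a (by rw [abs_of_pos ht0]; linarith) (by rw [abs_of_pos ht0]; linarith) (by linarith) (by rw [abs_of_pos ht0]; linarith)
      have a2 := k2 (-t) a (by rw [abs_neg, abs_of_pos ht0]; linarith) (by rw [abs_neg, abs_of_pos ht0]; linarith) (by linarith) (by rw [abs_neg, abs_of_pos ht0]; linarith)
      calc ‖g t‖ ≤ ‖f t‖+‖f (-t)‖ := norm_add_le _ _
        _ ≤ _ := by linarith)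
    refine this.trans (le_of_eq ?_)
    have e1 : Real.exp (0.865*(0.4+η')+2.07*Q)^2*Real.exp (E-2*h^2) = Real.exp v * Real.exp (2*(2.07*Q+0.865*(0.4+η'))-v*η'+h^2/2-2*h^2) := by
      rw [← Real.exp_nat_mul, ← Real.exp_add, ← Real.exp_add]; congr 1; push_cast; rw [hEd]; ring
    rw [hM2, mul_pow, show a+1-a = 1 by ring, abs_one]
    linear_combination (18.1*10.24*(2/a))*e1
  have b3 : ‖∫ t in (4:ℝ)..T, g t‖ ≤ 2*D*J := by
    have hcont : ContinuousOn (fun t : ℝ => 2*D*(t^(e-1) * Real.exp (-(h^2/2)*t^2))) (Icc 4 T) := by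
      apply ContinuousOn.mul continuousOn_const
      apply ContinuousOn.mul
      · exact ContinuousOn.rpow_const continuousOn_id (fun t ht => Or.inl (by have := ht.1; simp; linarith))
      · fun_prop
    have := intervalIntegral.norm_integral_le_of_norm_le (a := 4) (b := T) (f := g) (μ := volume) (g := fun t : ℝ => 2*D*(t^(e-1) * Real.exp (-(h^2/2)*t^2)))
      (by linarith) (ae_of_all _ (fun t ht => by
        have ht0 : 0 < t := by linarith [ht.1]
        have a1 := k3 t (by rw [abs_of_pos ht0]; exact ht.1.le) (by rw [abs_of_pos ht0]; exact ht.2)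
        have a2 := k3 (-t) (by rw [abs_neg, abs_of_pos ht0]; exact ht.1.le) (by rw [abs_neg, abs_of_pos ht0]; exact ht.2)
        rw [abs_neg, neg_sq] at a2
        rw [abs_of_pos ht0] at a1 a2
        calc ‖g t‖ ≤ ‖f t‖+‖f (-t)‖ := norm_add_le _ _
          _ ≤ _ := by linarith))
      (by apply ContinuousOn.intervalIntegrable; rwa [uIcc_of_le (by linarith)])
    refine this.trans ?_
    rw [intervalIntegral.integral_const_mul]
    have hD0 : 0 ≤ D := by positivity
    gcongr
  have b22 := b2 2 le_rfl (by norm_num)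
  have b23 := b2 3 (by norm_num) le_rfl
  rw [show (2:ℝ)+1 = 3 by norm_num] at b22
  rw [show (3:ℝ)+1 = 4 by norm_num] at b23
  have eD : 2*D*J = Real.exp v * (2*18.1*10.24*Real.exp (4.364*Q+0.08-v*η'+h^2/2)*(2*Real.pi)^(-e)*J) := by
    have e1 : Real.exp (4.364*Q+0.08) * Real.exp E = Real.exp v * Real.exp (4.364*Q+0.08-v*η'+h^2/2) := by
      rw [← Real.exp_add, ← Real.exp_add]; congr 1; rw [hEd]; ring
    rw [hD]; linear_combination (2*18.1*10.24*(2*Real.pi)^(-e)*J)*e1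
  rw [eD] at b3
  set X := Real.exp v
  set Y := Real.exp (2*(2.07*Q+0.865*(0.4+η'))-v*η'+h^2/2-2*h^2)
  have n1 := norm_add_le (∫ t in (0:ℝ)..2, g t) ((∫ t in (2:ℝ)..3, g t) + ((∫ t in (3:ℝ)..4, g t) + ∫ t in (4:ℝ)..T, g t))
  have n2 := norm_add_le (∫ t in (2:ℝ)..3, g t) ((∫ t in (3:ℝ)..4, g t) + ∫ t in (4:ℝ)..T, g t)
  have n3 := norm_add_le (∫ t in (3:ℝ)..4, g t) (∫ t in (4:ℝ)..T, g t)
  have b22' : ‖∫ t in (2:ℝ)..3, g t‖ ≤ X*(18.1*10.24*Y*(2/2)) := b22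
  have b23' : ‖∫ t in (3:ℝ)..4, g t‖ ≤ X*(18.1*10.24*Y*(2/3)) := b23
  linarith

theorem contour (v h T η η' Q J : ℝ) (hv : 87 ≤ v) (h0 : 0 < h) (hT : 8 ≤ T) (h1 : 0 < η') (h2 : η' < η)
    (h3 : η' ≤ 0.0999) (hη : η ≤ 0.4) (hZ : ZF (T+1) η) (hQ : QQ η (-η') ≤ Q)
    (hJ : ∫ t in (4:ℝ)..T, t^(Q-0.4-η'-1) * Real.exp (-(h^2/2)*t^2) ≤ J) :
    Real.sqrt (2*Real.pi) * |SS v h| ≤ Real.exp v * (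
      2*18.1*(1+v)^2*Real.exp (1+0.52*h^2-(h*T)^2/2)/(h*T)^2
      + 2*(18.1*10.24*Real.exp (2*((1/2*Real.log (T/(2*Real.pi))+2.182)*Q+0.04)+1+0.52*h^2-(h*T)^2/2)/T*(η'+1/v))
      + (18.1*10.24*Real.exp (2*(0.43*Q+1.79*(0.4+η'))-v*η'+h^2/2)*(4/0.9)
        + 18.1*10.24*Real.exp (2*(2.07*Q+0.865*(0.4+η'))-v*η'+h^2/2-2*h^2)*(5/3)
        + 2*18.1*10.24*Real.exp (4.364*Q+0.08-v*η'+h^2/2)*(2*Real.pi)^(-(Q-0.4-η'))*J)) := by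
  have hv0 : 0 < v := by linarith
  have hinv0 : 0 < 1/v := by positivity
  have hd : ∀ s : ℂ, 1-η' ≤ s.re → |s.im| ≤ T → DifferentiableAt ℂ (GG v h) s := by
    intro s hs ht
    apply GG_diff v h s (by linarith)
    intro hx
    have := hZ s hx (by linarith)
    linarith
  obtain ⟨hi, he⟩ := GG_int_eq v h (1+1/v) h0 (by linarith)
  have e1 : Real.sqrt (2*Real.pi) * |SS v h| = ‖∫ t : ℝ, GG v h (((1+1/v:ℝ):ℂ)+t*I)‖ := by
    rw [he, Complex.norm_real, Real.norm_eq_abs, abs_mul, abs_of_nonneg (Real.sqrt_nonneg _)]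
  rw [e1, split_tail _ hi T (by linarith)]
  have b1 := tail_bound v h T hv h0 (by linarith)
  have b2 := rect_shift (GG v h) (1-η') (1+1/v) T (by linarith) (by linarith) (fun s hs _ ht => hd s hs ht)
  have b3 := hor_bound v h T η η' Q T hv hT h1 h2 h3 hη hZ hQ (abs_of_pos (by linarith))
  have b4 := hor_bound v h T η η' Q (-T) hv hT h1 h2 h3 hη hZ hQ (by rw [abs_neg, abs_of_pos (by linarith)])
  have b5 := left_bound v h T η η' Q J hv hT h1 h2 h3 hη hZ hQ hJ (by
    intro t ht
    have hd' := (hd (((1-η':ℝ):ℂ)+t*I) (by simp) (by simpa using abs_le.mpr ⟨ht.1, ht.2⟩)).continuousAt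
    exact (ContinuousAt.comp (f := fun t : ℝ => ((1-η':ℝ):ℂ)+t*I) (g := GG v h) hd' (by fun_prop)).continuousWithinAt)
  have n1 := norm_add_le (∫ t in (-T)..T, GG v h (((1+1/v:ℝ):ℂ)+t*I)) (∫ t in Ioi T, (GG v h (((1+1/v:ℝ):ℂ)+t*I) + GG v h (((1+1/v:ℝ):ℂ)+(-t:ℝ)*I)))
  refine n1.trans ?_
  linarith

end

section
open Complex Metric Set Filter Topology MeasureTheory

theorem J_bound (h T e : ℝ) (h0 : 0 < h) (hT : 4 ≤ T) (h1 : 1 ≤ e) (h2 : e ≤ 2) :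
    ∫ t in (4:ℝ)..T, t^(e-1) * Real.exp (-(h^2/2)*t^2) ≤ ((2-e)*1.2534+(e-1)) * h^(-e) := by
  have hb : 0 < h^2/2 := by positivity
  have i1 : ∫ t in (0:ℝ)..T, Real.exp (-(h^2/2)*t^2) ≤ 1.2534/h := by
    rw [intervalIntegral.integral_of_le (by linarith)]
    have := setIntegral_mono_set (μ := volume) (s := Ioc 0 T) (t := Ioi 0) (f := fun t : ℝ => Real.exp (-(h^2/2)*t^2))
      (integrable_exp_neg_mul_sq hb).integrableOn (ae_of_all _ (fun t => (Real.exp_pos _).le)) (Ioc_subset_Ioi_self.eventuallyLE)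
    rw [integral_gaussian_Ioi] at this
    refine this.trans ?_
    have e1 : Real.pi/(h^2/2) = (2*Real.pi)/h^2 := by field_simp
    rw [e1, Real.sqrt_div (by positivity), Real.sqrt_sq h0.le, div_div, mul_comm h 2, ← div_div]
    gcongr
    rw [div_le_iff₀ (by norm_num)]
    apply Real.sqrt_le_iff.mpr ⟨by norm_num, by nlinarith [Real.pi_lt_d4]⟩
  have i2 : ∫ t in (0:ℝ)..T, t*Real.exp (-(h^2/2)*t^2) ≤ 1/h^2 := by
    have hd : ∀ t ∈ uIcc 0 T, HasDerivAt (fun t : ℝ => -(1/h^2)*Real.exp (-(h^2/2)*t^2)) (t*Real.exp (-(h^2/2)*t^2)) t := by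
      intro t _
      have := ((((hasDerivAt_pow 2 t).const_mul (-(h^2/2))).exp).const_mul (-(1/h^2)))
      refine this.congr_deriv ?_
      push_cast
      have : h^2 ≠ 0 := by positivity
      linear_combination (t*Real.exp (-(h^2/2)*t^2)) * (one_div_mul_cancel this)
    rw [intervalIntegral.integral_eq_sub_of_hasDerivAt hd (by apply Continuous.intervalIntegrable; fun_prop)]
    have : 0 < 1/h^2*Real.exp (-(h^2/2)*T^2) := by positivity
    simp only [ne_eq, OfNat.ofNat_ne_zero, not_false_eq_true, zero_pow, mul_zero, Real.exp_zero]
    linarith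
  have e0 : h^(-e) = h^(1-e)/h := by rw [← Real.rpow_sub_one h0.ne']; congr 1; ring
  set C := h^(1-e) with hC
  have hC0 : 0 < C := by positivity
  have m : ∫ t in (4:ℝ)..T, t^(e-1) * Real.exp (-(h^2/2)*t^2) ≤
      ∫ t in (4:ℝ)..T, C*((2-e)*Real.exp (-(h^2/2)*t^2) + (e-1)*h*(t*Real.exp (-(h^2/2)*t^2))) := by
    apply intervalIntegral.integral_mono_on hT
    · apply ContinuousOn.intervalIntegrable
      rw [uIcc_of_le hT]
      apply ContinuousOn.mul
      · exact ContinuousOn.rpow_const continuousOn_id (fun t ht => Or.inl (by have := ht.1; simp; linarith))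
      · fun_prop
    · apply Continuous.intervalIntegrable; fun_prop
    · intro t ht
      have ht0 : 0 < t := by linarith [ht.1]
      have hp := rpow_one_add_le_one_add_mul_self (s := h*t-1) (by nlinarith [mul_pos h0 ht0]) (p := e-1) (by linarith) (by linarith)
      rw [show 1+(h*t-1) = h*t by ring, Real.mul_rpow h0.le ht0.le] at hp
      have hcc : C * h^(e-1) = 1 := by rw [hC, ← Real.rpow_add h0]; norm_num
      have : t^(e-1) ≤ C*((2-e)+(e-1)*h*t) := by
        calc t^(e-1) = (C * h^(e-1)) * t^(e-1) := by rw [hcc, one_mul]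
          _ = C*(h^(e-1)*t^(e-1)) := by ring
          _ ≤ C*(1+(e-1)*(h*t-1)) := by gcongr
          _ = _ := by ring
      calc _ ≤ C*((2-e)+(e-1)*h*t) * Real.exp (-(h^2/2)*t^2) := by gcongr
        _ = _ := by ring
  have m2 : ∫ t in (4:ℝ)..T, C*((2-e)*Real.exp (-(h^2/2)*t^2) + (e-1)*h*(t*Real.exp (-(h^2/2)*t^2))) ≤
      ∫ t in (0:ℝ)..T, C*((2-e)*Real.exp (-(h^2/2)*t^2) + (e-1)*h*(t*Real.exp (-(h^2/2)*t^2))) := by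
    apply intervalIntegral.integral_mono_interval (by norm_num) hT le_rfl
    · refine (ae_restrict_mem measurableSet_Ioc).mono (fun t ht => ?_)
      have ht0 : 0 < t := ht.1
      have a1 : 0 ≤ 2-e := by linarith
      have a2 : 0 ≤ e-1 := by linarith
      simp only [Pi.zero_apply]
      positivity
    · apply Continuous.intervalIntegrable; fun_prop
  refine (m.trans m2).trans ?_
  rw [intervalIntegral.integral_const_mul, intervalIntegral.integral_add (by apply Continuous.intervalIntegrable; fun_prop) (by apply Continuous.intervalIntegrable; fun_prop),
    intervalIntegral.integral_const_mul, intervalIntegral.integral_const_mul, e0]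
  have a1 : 0 ≤ 2-e := by linarith
  have a2 : 0 ≤ e-1 := by linarith
  calc _ ≤ C*((2-e)*(1.2534/h) + (e-1)*h*(1/h^2)) := by gcongr
    _ = _ := by field_simp

set_option maxHeartbeats 1000000 in
theorem VV_final (v h T η η' Q J : ℝ) (hv : 87 ≤ v) (h0 : 0 < h) (hh : h < 1) (hT : 8 ≤ T) (h1 : 0 < η') (h2 : η' < η)
    (h3 : η' ≤ 0.0999) (hη : η ≤ 0.4) (hZ : ZF (T+1) η) (hQ : QQ η (-η') ≤ Q)
    (hJ : ∫ t in (4:ℝ)..T, t^(Q-0.4-η'-1) * Real.exp (-(h^2/2)*t^2) ≤ J) :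
    |VV (Real.exp v)| ≤ Real.exp v * (
      0.399*h*(1+1/(1-h^2))*(0.385*v+1.54) + 0.385*(Real.exp (2*h^2)-2*Real.exp (h^2/2)+1) + 36.2*Real.exp (-0.1*v)*(Real.exp (0.405*h^2)+1)
      + 18.1/Real.pi*(1+v)^2*Real.exp (1+0.52*h^2-(h*T)^2/2)/(h*T)^2
      + 18.1*10.24/Real.pi*Real.exp (2*((1/2*Real.log (T/(2*Real.pi))+2.182)*Q+0.04)+1+0.52*h^2-(h*T)^2/2)/T*(η'+1/v)
      + 18.1*10.24/Real.pi*Real.exp (2*(0.43*Q+1.79*(0.4+η'))-v*η'+h^2/2)*(2/0.9)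
        + 18.1*10.24/Real.pi*Real.exp (2*(2.07*Q+0.865*(0.4+η'))-v*η'+h^2/2-2*h^2)*(5/6)
        + 18.1*10.24/Real.pi*Real.exp (4.364*Q+0.08-v*η'+h^2/2)*(2*Real.pi)^(-(Q-0.4-η'))*J) := by
  have hc := contour v h T η η' Q J hv h0 hT h1 h2 h3 hη hZ hQ hJ
  obtain ⟨_, hs⟩ := SS_diff v h (by linarith) h0 hh
  have hpi := Real.pi_pos
  set R := Real.sqrt (2*Real.pi) with hR
  have hR0 : 0 < R := by positivity
  have hRR : R*R = 2*Real.pi := Real.mul_self_sqrt (by positivity)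
  have hRl : 1 ≤ 0.399*R := by
    have : (2.5064:ℝ) ≤ R := Real.le_sqrt_of_sq_le (by nlinarith [Real.pi_gt_d4])
    nlinarith
  set X := Real.exp v with hX
  have hX0 : 0 < X := Real.exp_pos _
  have tri : R*|VV X| ≤ |SS v h| + |SS v h - R*VV X| := by
    have e : R*|VV X| = |R*VV X| := by rw [abs_mul, abs_of_pos hR0]
    rw [e]
    have : R*VV X = SS v h - (SS v h - R*VV X) := by ring
    calc |R*VV X| = |SS v h - (SS v h - R*VV X)| := by rw [← this]
      _ ≤ _ := abs_sub _ _
  have t2 : (2*Real.pi)*|VV X| ≤ R*|SS v h| + R*|SS v h - R*VV X| := by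
    rw [← hRR]
    have := mul_le_mul_of_nonneg_left tri hR0.le
    linarith
  have t3 := mul_le_mul_of_nonneg_left hs hR0.le
  set P := h*(1+1/(1-h^2))*(0.385*v+1.54) with hP
  have hP0 : 0 ≤ P := by
    have : 0 < 1-h^2 := by nlinarith
    positivity
  have t4 : R*P ≤ (2*Real.pi)*(0.399*P) := by
    rw [← hRR]
    have := mul_le_mul_of_nonneg_right hRl (mul_nonneg hR0.le hP0)
    linarith
  set W := 0.385*(Real.exp (2*h^2)-2*Real.exp (h^2/2)+1) + 36.2*Real.exp (-0.1*v)*(Real.exp (0.405*h^2)+1) with hW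
  have t5 : R*(X*(P + R*W)) ≤ (2*Real.pi)*(X*(0.399*P+W)) := by
    have : R*(X*(P+R*W)) = X*(R*P) + X*((R*R)*W) := by ring
    rw [this, hRR]
    have := mul_le_mul_of_nonneg_left t4 hX0.le
    linarith
  have t6 : (2*Real.pi)*|VV X| ≤ _ := t2.trans (add_le_add hc (t3.trans t5))
  rw [← mul_le_mul_iff_right₀ (show 0 < 2*Real.pi by positivity)]
  refine t6.trans (le_of_eq ?_)
  rw [hP, hW]
  field_simp
  ring

end

section
open Complex Metric Set Filter Topology MeasureTheory

theorem log_le_pow (r : ℝ) (m n : ℕ) (hm : 0 < m) (hr : 0 < r) (h : r^m ≤ 2^n) : Real.log r ≤ n/m*0.6931471808 := by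
  have h1 := Real.log_le_log (by positivity) h
  rw [Real.log_pow, Real.log_pow] at h1
  have hm' : (0:ℝ) < m := by exact_mod_cast hm
  have h2 : (n:ℝ)*Real.log 2 ≤ n*0.6931471808 := by
    have := Real.log_two_lt_d9
    gcongr
  rw [div_mul_eq_mul_div, le_div_iff₀ hm']
  linarith

theorem le_log_pow (r : ℝ) (n : ℕ) (hr : 0 < r) (h : 2^n ≤ r^64) : n/64*0.6931471803 ≤ Real.log r := by
  have h1 := Real.log_le_log (by positivity) h
  rw [Real.log_pow, Real.log_pow] at h1
  have h2 : (n:ℝ)*0.6931471803 ≤ n*Real.log 2 := by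
    have := Real.log_two_gt_d9
    gcongr
  push_cast at h1
  linarith

theorem le_log_pow_neg (r : ℝ) (n : ℕ) (hr : 0 < r) (h : 1 ≤ r^64*2^n) : -(n/64*0.6931471808) ≤ Real.log r := by
  have := log_le_pow r⁻¹ 64 n (by norm_num) (by positivity) (by
    rw [inv_pow]; exact inv_le_of_inv_le₀ (by positivity) (by rw [inv_le_iff_one_le_mul₀ (by positivity)]; exact h))
  rw [Real.log_inv] at this
  push_cast at this
  linarith

theorem exp_le_B (E B : ℝ) (n : ℕ) (hB0 : 0 < B) (hE : E ≤ n/64*0.6931471803) (hB : 2^n ≤ B^64) : Real.exp E ≤ B := by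
  rw [← Real.le_log_iff_exp_le hB0]
  exact hE.trans (le_log_pow B n hB0 hB)

theorem exp_num_bounds : (18.1/Real.pi ≤ Real.exp 1.752) ∧ (18.1*10.24/Real.pi ≤ Real.exp 4.079) ∧
    ((1+1/87:ℝ)^2 ≤ Real.exp 0.03) ∧ (Real.exp 2.8 ≤ 4.06^2) ∧ (18.1*10.24/Real.pi*(2/0.9) ≤ Real.exp 4.883) ∧
    (18.1*10.24/Real.pi*(5/6) ≤ Real.exp 3.9) ∧ (Real.exp 4 ≤ 8/0.12) := by
  have hp := Real.pi_gt_d4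
  have hp0 := Real.pi_pos
  have up : ∀ x y : ℝ, 0 < y → ∀ m n : ℕ, 0 < m → 2^n ≤ y^m → x ≤ n/m*0.6931471803 → Real.exp x ≤ y := by
    intro x y hy m n hm h1 h2
    rw [← Real.le_log_iff_exp_le hy]
    refine h2.trans ?_
    have h3 := Real.log_le_log (by positivity) h1
    rw [Real.log_pow, Real.log_pow] at h3
    have hm' : (0:ℝ) < m := by exact_mod_cast hm
    have h4 : (n:ℝ)*0.6931471803 ≤ n*Real.log 2 := by
      have := Real.log_two_gt_d9
      gcongr
    rw [div_mul_eq_mul_div, div_le_iff₀ hm']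
    linarith
  have lo : ∀ x y : ℝ, 0 < y → ∀ m n : ℕ, 0 < m → y^m ≤ 2^n → n/m*0.6931471808 ≤ x → y ≤ Real.exp x := by
    intro x y hy m n hm h1 h2
    rw [← Real.log_le_iff_le_exp hy]
    exact (log_le_pow y m n hm hy h1).trans h2
  have q1 : 18.1/Real.pi ≤ 18.1/3.1415 := by gcongr
  have q2 : 18.1*10.24/Real.pi ≤ 18.1*10.24/3.1415 := by gcongr
  refine ⟨q1.trans (lo _ _ (by norm_num) 55 139 (by norm_num) (by norm_num) (by norm_num)),
    q2.trans (lo _ _ (by norm_num) 26 153 (by norm_num) (by norm_num) (by norm_num)),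
    lo _ _ (by norm_num) 24 1 (by norm_num) (by norm_num) (by norm_num),
    up _ _ (by norm_num) 24 97 (by norm_num) (by norm_num) (by norm_num),
    (mul_le_mul_of_nonneg_right q2 (by norm_num)).trans (lo _ _ (by norm_num) 23 162 (by norm_num) (by norm_num) (by norm_num)),
    (mul_le_mul_of_nonneg_right q2 (by norm_num)).trans (lo _ _ (by norm_num) 8 45 (by norm_num) (by norm_num) (by norm_num)),
    up _ _ (by norm_num) 1 6 (by norm_num) (by norm_num) (by norm_num)⟩

theorem comb8 (v a b c d e f g i A C D E F G I R : ℝ) (h1 : v*(a+b) ≤ A) (h2 : v*c ≤ C) (h3 : v*d ≤ D) (h4 : v*e ≤ E)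
    (h5 : v*f ≤ F) (h6 : v*g ≤ G) (h7 : v*i ≤ I) (h8 : A+C+D+E+F+G+I ≤ R) : v*(a+b+c+d+e+f+g+i) ≤ R := by
  nlinarith

set_option maxHeartbeats 4000000 in
theorem row (v0 v1 h T d η η' Q lam j Bt Bh B1 B2 Bm : ℝ) (nq nT kv nt nh n1 n2 nm : ℕ)
    (hv0 : 87 ≤ v0) (h0 : 0 < h) (hh : h ≤ 0.6) (hT : 8 ≤ T) (hd : 0 < d) (hd' : d ≤ 0.19)
    (h1 : 0 < η') (h2 : η' < η) (h3 : η' ≤ 0.0999) (hη : η ≤ 0.4) (hk : 4.06 ≤ h*T)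
    (hQ1 : 1 ≤ Q-0.4-η') (hQ2 : Q-0.4-η' ≤ 2)
    (hnT : ((T+1)/6.283)^64 ≤ 2^nT)
    (hZ : (5/d - 3.47 + 1.15*d + 91/24*(nT/64*0.6931471808) + 25.6/(T+1)^2)*(d+η) ≤ 8)
    (hnq : ((0.4+η)/(η-η'))^64 ≤ 2^nq) (hQ : (0.4+η)*(nq/64*0.6931471808) ≤ Q)
    (hlam : lam ≤ Real.log (6.283*h))
    (hkv : v1^16 ≤ 2^kv)
    (ht : 1.752+1+0.03+3*(kv/16*0.6931471808)+0.52*h^2-(h*T)^2/2-2.8 ≤ nt/64*0.6931471803) (hBt : 0 < Bt) (hBt' : 2^nt ≤ Bt^64)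
    (hh' : 4.079+2*((1/2*(nT/64*0.6931471808)+2.182)*Q+0.04)+1+0.52*h^2-(h*T)^2/2-4+(kv/16*0.6931471808) ≤ nh/64*0.6931471803) (hBh : 0 < Bh) (hBh' : 2^nh ≤ Bh^64)
    (hl1 : 4.883+2*(0.43*Q+1.79*(0.4+η'))-v0*η'+h^2/2+(kv/16*0.6931471808) ≤ n1/64*0.6931471803) (hB1 : 0 < B1) (hB1' : 2^n1 ≤ B1^64)
    (hl2 : 3.9+2*(2.07*Q+0.865*(0.4+η'))-v0*η'+h^2/2-2*h^2+(kv/16*0.6931471808) ≤ n2/64*0.6931471803) (hB2 : 0 < B2) (hB2' : 2^n2 ≤ B2^64)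
    (hm : 4.079+4.364*Q+0.08-v0*η'+h^2/2-(Q-0.4-η')*lam+(kv/16*0.6931471808) ≤ nm/64*0.6931471803) (hBm : 0 < Bm) (hBm' : 2^nm ≤ Bm^64)
    (hj : (2-(Q-0.4-η'))*1.2534+((Q-0.4-η')-1) ≤ j)
    (htot : v1*(0.399*h*(1+1/(1-h^2))*(0.385*v1+1.54)+0.385*(h^2+4*h^4)) + 95600/(v0/10)^4 + Bt + Bh + B1 + B2 + j*Bm ≤ 3071.82)
    (v : ℝ) (hva : v0 ≤ v) (hvb : v ≤ v1) : v*|VV (Real.exp v)| ≤ 3071.82*Real.exp v := by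
  obtain ⟨c1, c2, c3, c4, c5, c6, c7⟩ := exp_num_bounds
  have hpi := Real.pi_pos
  have hpi2 := Real.pi_gt_d4
  have hv87 : 87 ≤ v := hv0.trans hva
  have hvp : 0 < v := by linarith
  set lv : ℝ := kv/16*0.6931471808 with hlv
  have hvl : v ≤ Real.exp lv := by
    rw [← Real.log_le_iff_le_exp hvp]
    have := log_le_pow v 16 kv (by norm_num) hvp ((pow_le_pow_left₀ hvp.le hvb 16).trans hkv)
    push_cast at this; exact this
  set LT : ℝ := nT/64*0.6931471808 with hLT
  have hlogT1 : Real.log ((T+1)/(2*Real.pi)) ≤ LT := by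
    have a := log_le_pow ((T+1)/6.283) 64 nT (by norm_num) (by positivity) hnT
    push_cast at a
    refine le_trans (Real.log_le_log (by positivity) ?_) a
    gcongr; linarith
  have hlogT : Real.log (T/(2*Real.pi)) ≤ LT := by
    refine le_trans (Real.log_le_log (by positivity) ?_) hlogT1
    gcongr; linarith
  have hZF : ZF (T+1) η := by
    apply ZF_of d (T+1) η hd hd' (by linarith) (by linarith)
    refine le_trans ?_ hZ
    have : 0 < d+η := by linarith
    gcongr
  have hQQ : QQ η (-η') ≤ Q := by
    have a := log_le_pow ((0.4+η)/(η-η')) 64 nq (by norm_num) (div_pos (by linarith) (by linarith)) hnq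
    push_cast at a
    rw [QQ, show -η'+η = η-η' by ring]
    refine le_trans ?_ hQ
    have : 0 < 0.4+η := by linarith
    gcongr
  set e := Q-0.4-η' with he
  have hJ := J_bound h T e h0 (by linarith) hQ1 hQ2
  have hfin := VV_final v h T η η' Q _ hv87 h0 (by linarith) hT h1 h2 h3 hη hZF hQQ hJ
  set X := Real.exp v with hX
  have hX0 : 0 < X := Real.exp_pos _
  have hk2 : Real.exp 2.8 ≤ (h*T)^2 := c4.trans (by gcongr)
  have hk0 : 0 < (h*T)^2 := by positivity
  have p1 : v*(18.1/Real.pi*(1+v)^2*Real.exp (1+0.52*h^2-(h*T)^2/2)/(h*T)^2) ≤ Bt := by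
    refine le_trans ?_ (exp_le_B _ Bt nt hBt ht hBt')
    have a1 : (1+v)^2 ≤ Real.exp 0.03 * (Real.exp lv)^2 := by
      calc (1+v)^2 ≤ ((1+1/87)*v)^2 := by gcongr; linarith
        _ = (1+1/87)^2*v^2 := by ring
        _ ≤ _ := by gcongr
    calc _ ≤ Real.exp lv*(Real.exp 1.752*(Real.exp 0.03 * (Real.exp lv)^2)*Real.exp (1+0.52*h^2-(h*T)^2/2)/Real.exp 2.8) := by gcongr
      _ = _ := by
        rw [← Real.exp_nat_mul, ← Real.exp_add, ← Real.exp_add, ← Real.exp_add, ← Real.exp_sub, ← Real.exp_add]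
        congr 1; push_cast; ring
  have p2 : v*(18.1*10.24/Real.pi*Real.exp (2*((1/2*Real.log (T/(2*Real.pi))+2.182)*Q+0.04)+1+0.52*h^2-(h*T)^2/2)/T*(η'+1/v)) ≤ Bh := by
    refine le_trans ?_ (exp_le_B _ Bh nh hBh hh' hBh')
    have hQ0 : 0 < Q := by linarith
    have a1 : (η'+1/v)/T ≤ 1/Real.exp 4 := by
      rw [div_le_div_iff₀ (by linarith) (Real.exp_pos _)]
      have : 1/v ≤ 1/87 := one_div_le_one_div_of_le (by norm_num) hv87
      have h5 : η'+1/v ≤ 0.12 := by linarith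
      calc (η'+1/v)*Real.exp 4 ≤ 0.12*(8/0.12) := by gcongr
        _ ≤ 1*T := by linarith
    calc _ = v*(18.1*10.24/Real.pi*Real.exp (2*((1/2*Real.log (T/(2*Real.pi))+2.182)*Q+0.04)+1+0.52*h^2-(h*T)^2/2)*((η'+1/v)/T)) := by ring
      _ ≤ Real.exp lv*(Real.exp 4.079*Real.exp (2*((1/2*LT+2.182)*Q+0.04)+1+0.52*h^2-(h*T)^2/2)*(1/Real.exp 4)) := by gcongr
      _ = _ := by
        rw [mul_one_div, ← Real.exp_add, ← Real.exp_sub, ← Real.exp_add]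
        congr 1; ring
  have hvη : v0*η' ≤ v*η' := by gcongr
  have p3 : v*(18.1*10.24/Real.pi*Real.exp (2*(0.43*Q+1.79*(0.4+η'))-v*η'+h^2/2)*(2/0.9)) ≤ B1 := by
    refine le_trans ?_ (exp_le_B _ B1 n1 hB1 hl1 hB1')
    calc _ = v*((18.1*10.24/Real.pi*(2/0.9))*Real.exp (2*(0.43*Q+1.79*(0.4+η'))-v*η'+h^2/2)) := by ring
      _ ≤ Real.exp lv*(Real.exp 4.883*Real.exp (2*(0.43*Q+1.79*(0.4+η'))-v0*η'+h^2/2)) := by gcongr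
      _ = _ := by rw [← Real.exp_add, ← Real.exp_add]; congr 1; ring
  have p4 : v*(18.1*10.24/Real.pi*Real.exp (2*(2.07*Q+0.865*(0.4+η'))-v*η'+h^2/2-2*h^2)*(5/6)) ≤ B2 := by
    refine le_trans ?_ (exp_le_B _ B2 n2 hB2 hl2 hB2')
    calc _ = v*((18.1*10.24/Real.pi*(5/6))*Real.exp (2*(2.07*Q+0.865*(0.4+η'))-v*η'+h^2/2-2*h^2)) := by ring
      _ ≤ Real.exp lv*(Real.exp 3.9*Real.exp (2*(2.07*Q+0.865*(0.4+η'))-v0*η'+h^2/2-2*h^2)) := by gcongr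
      _ = _ := by rw [← Real.exp_add, ← Real.exp_add]; congr 1; ring
  have hj0 : 0 ≤ j := le_trans (by linarith) hj
  have p5 : v*(18.1*10.24/Real.pi*Real.exp (4.364*Q+0.08-v*η'+h^2/2)*(2*Real.pi)^(-e)*(((2-e)*1.2534+(e-1))*h^(-e))) ≤ j*Bm := by
    have a1 : (2*Real.pi)^(-e)*h^(-e) ≤ Real.exp (-(e*lam)) := by
      rw [← Real.mul_rpow (by positivity) h0.le, Real.rpow_def_of_pos (by positivity)]
      apply Real.exp_le_exp.mpr
      have : lam ≤ Real.log (2*Real.pi*h) := hlam.trans (Real.log_le_log (by positivity) (by gcongr; linarith))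
      have h9 := mul_le_mul_of_nonneg_left this (zero_le_one.trans hQ1)
      rw [mul_neg, neg_le_neg_iff, mul_comm (Real.log _)]
      exact h9
    have hE := exp_le_B _ Bm nm hBm hm hBm'
    calc _ = ((2-e)*1.2534+(e-1))*(v*(18.1*10.24/Real.pi*Real.exp (4.364*Q+0.08-v*η'+h^2/2)*((2*Real.pi)^(-e)*h^(-e)))) := by ring
      _ ≤ j*(Real.exp lv*(Real.exp 4.079*Real.exp (4.364*Q+0.08-v0*η'+h^2/2)*(Real.exp (-(e*lam))))) := by gcongr
      _ = j*Real.exp (4.079+4.364*Q+0.08-v0*η'+h^2/2-e*lam+lv) := by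
        rw [← Real.exp_add, ← Real.exp_add, ← Real.exp_add]; congr 2; ring
      _ ≤ _ := by gcongr
  have hh2 : h^2 ≤ 0.36 := (pow_le_pow_left₀ h0.le hh 2).trans (by norm_num)
  have hh20 : 0 < h^2 := by positivity
  have p6 : v*(36.2*Real.exp (-0.1*v)*(Real.exp (0.405*h^2)+1)) ≤ 95600/(v0/10)^4 := by
    have a1 : Real.exp (0.405*h^2) ≤ 1.2 := by
      have b1 := Real.abs_exp_sub_one_sub_id_le (x := 0.405*h^2) (by rw [abs_of_pos (by positivity)]; linarith)
      have b2 := (abs_le.mp b1).2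
      have b3 : (0.405*h^2)^2 ≤ (0.405*0.36)^2 := by gcongr
      linarith
    have a2 : (v/10)^5/120 ≤ Real.exp (v/10) := by
      have := Real.pow_div_factorial_le_exp (v/10) (by positivity) 5
      norm_num [Nat.factorial] at this ⊢
      linarith
    have a3 : v*Real.exp (-0.1*v) ≤ 1200/(v0/10)^4 := by
      have hy0 : 0 < v0/10 := by linarith
      rw [show -0.1*v = -(v/10) by ring, Real.exp_neg, ← div_eq_mul_inv, div_le_div_iff₀ (Real.exp_pos _) (by positivity)]
      calc v*(v0/10)^4 ≤ v*(v/10)^4 := by gcongr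
        _ = 1200*((v/10)^5/120) := by ring
        _ ≤ _ := by gcongr
    have a4 : 0 < v*Real.exp (-0.1*v) := by positivity
    calc _ = 36.2*(v*Real.exp (-0.1*v))*(Real.exp (0.405*h^2)+1) := by ring
      _ ≤ 36.2*(v*Real.exp (-0.1*v))*2.2 := by gcongr; linarith
      _ ≤ 36.2*(1200/(v0/10)^4)*2.2 := by gcongr
      _ = 95568/(v0/10)^4 := by ring
      _ ≤ _ := by gcongr; norm_num
  have p7 : v*(0.399*h*(1+1/(1-h^2))*(0.385*v+1.54) + 0.385*(Real.exp (2*h^2)-2*Real.exp (h^2/2)+1)) ≤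
      v1*(0.399*h*(1+1/(1-h^2))*(0.385*v1+1.54)+0.385*(h^2+4*h^4)) := by
    have a1 : Real.exp (2*h^2)-2*Real.exp (h^2/2)+1 ≤ h^2+4*h^4 := by
      have b1 := Real.abs_exp_sub_one_sub_id_le (x := 2*h^2) (by rw [abs_of_pos (by positivity)]; linarith)
      have b2 := (abs_le.mp b1).2
      have b3 := Real.add_one_le_exp (h^2/2)
      have b4 : (2*h^2)^2 = 4*h^4 := by ring
      rw [b4] at b2
      clear * - b2 b3
      linarith
    have a2 : 0 < 1-h^2 := by linarith
    have a3 : 0 < 1+1/(1-h^2) := by positivity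
    have a4 : 0 ≤ 0.399*h*(1+1/(1-h^2))*(0.385*v1+1.54)+0.385*(h^2+4*h^4) := by
      have : 0 < v1 := by linarith
      positivity
    calc _ ≤ v*(0.399*h*(1+1/(1-h^2))*(0.385*v1+1.54)+0.385*(h^2+4*h^4)) := by gcongr
      _ ≤ _ := by gcongr
  have fin := mul_le_mul_of_nonneg_left hfin hvp.le
  refine fin.trans ?_
  rw [mul_left_comm, mul_comm 3071.82]
  apply mul_le_mul_of_nonneg_left _ hX0.le
  exact comb8 _ _ _ _ _ _ _ _ _ _ _ _ _ _ _ _ _ p7 p6 p1 p2 p3 p4 p5 htot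

end

section
open Complex Metric Set Filter Topology MeasureTheory
set_option exponentiation.threshold 2000

theorem row0 (v : ℝ) (hva : 87 ≤ v) (hvb : v ≤ 97) : v*|VV (Real.exp v)| ≤ 3071.82*Real.exp v := by
  refine row 87 97 0.532 8.3 0.19 0.13154 0.0999 1.5026 (111/64*0.6931471803) 1.253 64.001 27.498 54.996 642.755 258.788 261 37 106 384 306 370 597 513
    ?_ ?_ ?_ ?_ ?_ ?_ ?_ ?_ ?_ ?_ ?_ ?_ ?_ ?_ ?_ ?_ ?_ (by have := le_log_pow (6.283*0.532) 111 (by norm_num) (by norm_num); push_cast at this; exact this)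
    ?_ ?_ ?_ ?_ ?_ ?_ ?_ ?_ ?_ ?_ ?_ ?_ ?_ ?_ ?_ ?_ ?_ ?_ v hva hvb
  all_goals norm_num

theorem row1 (v : ℝ) (hva : 97 ≤ v) (hvb : v ≤ 116.75) : v*|VV (Real.exp v)| ≤ 3071.82*Real.exp v := by
  refine row 97 116.75 0.439 10.5 0.19 0.12301 0.09963 1.6257 (93/64*0.6931471803) 1.222 42.87 32.701 26.333 552.326 203.923 287 56 110 347 322 302 583 491
    ?_ ?_ ?_ ?_ ?_ ?_ ?_ ?_ ?_ ?_ ?_ ?_ ?_ ?_ ?_ ?_ ?_ (by have := le_log_pow (6.283*0.439) 93 (by norm_num) (by norm_num); push_cast at this; exact this)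
    ?_ ?_ ?_ ?_ ?_ ?_ ?_ ?_ ?_ ?_ ?_ ?_ ?_ ?_ ?_ ?_ ?_ ?_ v hva hvb
  all_goals norm_num

theorem row2 (v : ℝ) (hva : 116.75 ≤ v) (hvb : v ≤ 148.25) : v*|VV (Real.exp v)| ≤ 3071.82*Real.exp v := by
  refine row 116.75 148.25 0.328 14.4 0.19 0.11097 0.09155 1.6713 (66/64*0.6931471803) 1.208 52.665 48.82 11.944 346.69 148.957 302 83 116 366 359 229 540 462
    ?_ ?_ ?_ ?_ ?_ ?_ ?_ ?_ ?_ ?_ ?_ ?_ ?_ ?_ ?_ ?_ ?_ (by have := le_log_pow (6.283*0.328) 66 (by norm_num) (by norm_num); push_cast at this; exact this)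
    ?_ ?_ ?_ ?_ ?_ ?_ ?_ ?_ ?_ ?_ ?_ ?_ ?_ ?_ ?_ ?_ ?_ ?_ v hva hvb
  all_goals norm_num

theorem row3 (v : ℝ) (hva : 148.25 ≤ v) (hvb : v ≤ 193) : v*|VV (Real.exp v)| ≤ 3071.82*Real.exp v := by
  refine row 148.25 193 0.203 24.4 0.19 0.09167 0.07562 1.6827 (22/64*0.6931471803) 1.201 36.442 49.351 8.446 301.158 203.923 316 129 122 332 360 197 527 491
    ?_ ?_ ?_ ?_ ?_ ?_ ?_ ?_ ?_ ?_ ?_ ?_ ?_ ?_ ?_ ?_ ?_ (by have := le_log_pow (6.283*0.203) 22 (by norm_num) (by norm_num); push_cast at this; exact this)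
    ?_ ?_ ?_ ?_ ?_ ?_ ?_ ?_ ?_ ?_ ?_ ?_ ?_ ?_ ?_ ?_ ?_ ?_ v hva hvb
  all_goals norm_num

theorem row4 (v : ℝ) (hva : 193 ≤ v) (hvb : v ≤ 247) : v*|VV (Real.exp v)| ≤ 3071.82*Real.exp v := by
  refine row 193 247 0.134 38.1 0.19 0.07647 0.06308 1.703 (-(16/64*0.6931471808)) 1.193 36.442 69.041 4.001 164.208 179.07 330 169 128 332 391 128 471 479
    ?_ ?_ ?_ ?_ ?_ ?_ ?_ ?_ ?_ ?_ ?_ ?_ ?_ ?_ ?_ ?_ ?_ (by have := le_log_pow_neg (6.283*0.134) 16 (by norm_num) (by norm_num); push_cast at this; exact this)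
    ?_ ?_ ?_ ?_ ?_ ?_ ?_ ?_ ?_ ?_ ?_ ?_ ?_ ?_ ?_ ?_ ?_ ?_ v hva hvb
  all_goals norm_num

theorem row5 (v : ℝ) (hva : 247 ≤ v) (hvb : v ≤ 303.25) : v*|VV (Real.exp v)| ≤ 3071.82*Real.exp v := by
  refine row 247 303.25 0.0907 58.5 0.19 0.06305 0.05201 1.7302 (-(52/64*0.6931471808)) 1.183 21.669 70.553 2.379 111.19 201.726 345 208 132 284 393 80 435 490
    ?_ ?_ ?_ ?_ ?_ ?_ ?_ ?_ ?_ ?_ ?_ ?_ ?_ ?_ ?_ ?_ ?_ (by have := le_log_pow_neg (6.283*0.0907) 52 (by norm_num) (by norm_num); push_cast at this; exact this)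
    ?_ ?_ ?_ ?_ ?_ ?_ ?_ ?_ ?_ ?_ ?_ ?_ ?_ ?_ ?_ ?_ ?_ ?_ v hva hvb
  all_goals norm_num

theorem row6 (v : ℝ) (hva : 303.25 ≤ v) (hvb : v ≤ 353.25) : v*|VV (Real.exp v)| ≤ 3071.82*Real.exp v := by
  refine row 303.25 353.25 0.0691 78.2 0.19 0.05481 0.04439 1.7191 (-(78/64*0.6931471808)) 1.184 21.435 75.29 1.477 67.562 177.141 349 234 136 283 399 36 389 478
    ?_ ?_ ?_ ?_ ?_ ?_ ?_ ?_ ?_ ?_ ?_ ?_ ?_ ?_ ?_ ?_ ?_ (by have := le_log_pow_neg (6.283*0.0691) 78 (by norm_num) (by norm_num); push_cast at this; exact this)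
    ?_ ?_ ?_ ?_ ?_ ?_ ?_ ?_ ?_ ?_ ?_ ?_ ?_ ?_ ?_ ?_ ?_ ?_ v hva hvb
  all_goals norm_num

theorem row7 (v : ℝ) (hva : 353.25 ≤ v) (hvb : v ≤ 393) : v*|VV (Real.exp v)| ≤ 3071.82*Real.exp v := by
  refine row 353.25 393 0.0565 98.3 0.18 0.04864 0.04012 1.7784 (-(96/64*0.6931471808)) 1.168 12.205 81.22 1.001 46.246 167.804 366 255 138 231 406 0 354 473
    ?_ ?_ ?_ ?_ ?_ ?_ ?_ ?_ ?_ ?_ ?_ ?_ ?_ ?_ ?_ ?_ ?_ (by have := le_log_pow_neg (6.283*0.0565) 96 (by norm_num) (by norm_num); push_cast at this; exact this)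
    ?_ ?_ ?_ ?_ ?_ ?_ ?_ ?_ ?_ ?_ ?_ ?_ ?_ ?_ ?_ ?_ ?_ ?_ v hva hvb
  all_goals norm_num

theorem row8 (v : ℝ) (hva : 393 ≤ v) (hvb : v ≤ 425.5) : v*|VV (Real.exp v)| ≤ 3071.82*Real.exp v := by
  refine row 393 425.5 0.0477 118.5 0.165 0.04445 0.036 1.7618 (-(112/64*0.6931471808)) 1.171 9.111 62.629 1.001 47.774 217.614 366 272 140 204 382 0 357 497
    ?_ ?_ ?_ ?_ ?_ ?_ ?_ ?_ ?_ ?_ ?_ ?_ ?_ ?_ ?_ ?_ ?_ (by have := le_log_pow_neg (6.283*0.0477) 112 (by norm_num) (by norm_num); push_cast at this; exact this)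
    ?_ ?_ ?_ ?_ ?_ ?_ ?_ ?_ ?_ ?_ ?_ ?_ ?_ ?_ ?_ ?_ ?_ ?_ v hva hvb
  all_goals norm_num

theorem row9 (v : ℝ) (hva : 425.5 ≤ v) (hvb : v ≤ 452.25) : v*|VV (Real.exp v)| ≤ 3071.82*Real.exp v := by
  refine row 425.5 452.25 0.0423 139.5 0.155 0.0413 0.03469 1.8545 (-(123/64*0.6931471808)) 1.148 2.798 43.337 1.001 41.499 256.001 388 287 142 95 348 0 344 512
    ?_ ?_ ?_ ?_ ?_ ?_ ?_ ?_ ?_ ?_ ?_ ?_ ?_ ?_ ?_ ?_ ?_ (by have := le_log_pow_neg (6.283*0.0423) 123 (by norm_num) (by norm_num); push_cast at this; exact this)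
    ?_ ?_ ?_ ?_ ?_ ?_ ?_ ?_ ?_ ?_ ?_ ?_ ?_ ?_ ?_ ?_ ?_ ?_ v hva hvb
  all_goals norm_num

theorem row10 (v : ℝ) (hva : 452.25 ≤ v) (hvb : v ≤ 475) : v*|VV (Real.exp v)| ≤ 3071.82*Real.exp v := by
  refine row 452.25 475 0.039 148.8 0.15 0.04016 0.03313 1.8211 (-(130/64*0.6931471808)) 1.156 5.657 69.793 1.001 29.987 195.277 382 293 143 160 392 0 314 487
    ?_ ?_ ?_ ?_ ?_ ?_ ?_ ?_ ?_ ?_ ?_ ?_ ?_ ?_ ?_ ?_ ?_ (by have := le_log_pow_neg (6.283*0.039) 130 (by norm_num) (by norm_num); push_cast at this; exact this)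
    ?_ ?_ ?_ ?_ ?_ ?_ ?_ ?_ ?_ ?_ ?_ ?_ ?_ ?_ ?_ ?_ ?_ ?_ v hva hvb
  all_goals norm_num

theorem row11 (v : ℝ) (hva : 475 ≤ v) (hvb : v ≤ 494.75) : v*|VV (Real.exp v)| ≤ 3071.82*Real.exp v := by
  refine row 475 494.75 0.0356 164.4 0.145 0.03856 0.03181 1.8335 (-(139/64*0.6931471808)) 1.152 4.861 72.098 1.001 29.029 222.379 386 302 144 146 395 0 311 499
    ?_ ?_ ?_ ?_ ?_ ?_ ?_ ?_ ?_ ?_ ?_ ?_ ?_ ?_ ?_ ?_ ?_ (by have := le_log_pow_neg (6.283*0.0356) 139 (by norm_num) (by norm_num); push_cast at this; exact this)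
    ?_ ?_ ?_ ?_ ?_ ?_ ?_ ?_ ?_ ?_ ?_ ?_ ?_ ?_ ?_ ?_ ?_ ?_ v hva hvb
  all_goals norm_num

theorem row12 (v : ℝ) (hva : 494.75 ≤ v) (hvb : v ≤ 512.5) : v*|VV (Real.exp v)| ≤ 3071.82*Real.exp v := by
  refine row 494.75 512.5 0.0332 179.3 0.14 0.03724 0.03128 1.88 (-(145/64*0.6931471808)) 1.14 3.052 69.793 1.001 25.491 232.225 397 310 145 103 392 0 299 503
    ?_ ?_ ?_ ?_ ?_ ?_ ?_ ?_ ?_ ?_ ?_ ?_ ?_ ?_ ?_ ?_ ?_ (by have := le_log_pow_neg (6.283*0.0332) 145 (by norm_num) (by norm_num); push_cast at this; exact this)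
    ?_ ?_ ?_ ?_ ?_ ?_ ?_ ?_ ?_ ?_ ?_ ?_ ?_ ?_ ?_ ?_ ?_ ?_ v hva hvb
  all_goals norm_num

theorem row13 (v : ℝ) (hva : 512.5 ≤ v) (hvb : v ≤ 528.5) : v*|VV (Real.exp v)| ≤ 3071.82*Real.exp v := by
  refine row 512.5 528.5 0.0306 197.8 0.135 0.03585 0.03011 1.8882 (-(153/64*0.6931471808)) 1.138 1.682 48.82 1.001 27.498 291.53 400 319 145 48 359 0 306 524
    ?_ ?_ ?_ ?_ ?_ ?_ ?_ ?_ ?_ ?_ ?_ ?_ ?_ ?_ ?_ ?_ ?_ (by have := le_log_pow_neg (6.283*0.0306) 153 (by norm_num) (by norm_num); push_cast at this; exact this)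
    ?_ ?_ ?_ ?_ ?_ ?_ ?_ ?_ ?_ ?_ ?_ ?_ ?_ ?_ ?_ ?_ ?_ ?_ v hva hvb
  all_goals norm_num

theorem row14 (v : ℝ) (hva : 528.5 ≤ v) (hvb : v ≤ 543.25) : v*|VV (Real.exp v)| ≤ 3071.82*Real.exp v := by
  refine row 528.5 543.25 0.0288 206.6 0.13 0.03526 0.02908 1.8527 (-(158/64*0.6931471808)) 1.147 3.513 77.776 1.001 26.333 282.21 393 323 146 116 402 0 302 521
    ?_ ?_ ?_ ?_ ?_ ?_ ?_ ?_ ?_ ?_ ?_ ?_ ?_ ?_ ?_ ?_ ?_ (by have := le_log_pow_neg (6.283*0.0288) 158 (by norm_num) (by norm_num); push_cast at this; exact this)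
    ?_ ?_ ?_ ?_ ?_ ?_ ?_ ?_ ?_ ?_ ?_ ?_ ?_ ?_ ?_ ?_ ?_ ?_ v hva hvb
  all_goals norm_num

theorem row15 (v : ℝ) (hva : 543.25 ≤ v) (hvb : v ≤ 556.75) : v*|VV (Real.exp v)| ≤ 3071.82*Real.exp v := by
  refine row 543.25 556.75 0.0272 220.6 0.13 0.03443 0.0284 1.8585 (-(164/64*0.6931471808)) 1.145 2.622 68.297 1.001 25.491 301.158 395 329 146 89 390 0 299 527
    ?_ ?_ ?_ ?_ ?_ ?_ ?_ ?_ ?_ ?_ ?_ ?_ ?_ ?_ ?_ ?_ ?_ (by have := le_log_pow_neg (6.283*0.0272) 164 (by norm_num) (by norm_num); push_cast at this; exact this)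
    ?_ ?_ ?_ ?_ ?_ ?_ ?_ ?_ ?_ ?_ ?_ ?_ ?_ ?_ ?_ ?_ ?_ ?_ v hva hvb
  all_goals norm_num

theorem row16 (v : ℝ) (hva : 556.75 ≤ v) (hvb : v ≤ 569) : v*|VV (Real.exp v)| ≤ 3071.82*Real.exp v := by
  refine row 556.75 569 0.0266 227.5 0.125 0.03402 0.02806 1.8615 (-(166/64*0.6931471808)) 1.144 2.182 56.813 1.001 22.143 273.188 396 332 147 72 373 0 286 518
    ?_ ?_ ?_ ?_ ?_ ?_ ?_ ?_ ?_ ?_ ?_ ?_ ?_ ?_ ?_ ?_ ?_ (by have := le_log_pow_neg (6.283*0.0266) 166 (by norm_num) (by norm_num); push_cast at this; exact this)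
    ?_ ?_ ?_ ?_ ?_ ?_ ?_ ?_ ?_ ?_ ?_ ?_ ?_ ?_ ?_ ?_ ?_ ?_ v hva hvb
  all_goals norm_num

theorem row17 (v : ℝ) (hva : 569 ≤ v) (hvb : v ≤ 581) : v*|VV (Real.exp v)| ≤ 3071.82*Real.exp v := by
  refine row 569 581 0.0256 240.3 0.125 0.03337 0.02803 1.9056 (-(169/64*0.6931471808)) 1.133 1.19 48.294 1.001 19.235 270.246 406 337 147 16 358 0 273 517
    ?_ ?_ ?_ ?_ ?_ ?_ ?_ ?_ ?_ ?_ ?_ ?_ ?_ ?_ ?_ ?_ ?_ (by have := le_log_pow_neg (6.283*0.0256) 169 (by norm_num) (by norm_num); push_cast at this; exact this)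
    ?_ ?_ ?_ ?_ ?_ ?_ ?_ ?_ ?_ ?_ ?_ ?_ ?_ ?_ ?_ ?_ ?_ ?_ v hva hvb
  all_goals norm_num

theorem row18 (v : ℝ) (hva : 581 ≤ v) (hvb : v ≤ 592.25) : v*|VV (Real.exp v)| ≤ 3071.82*Real.exp v := by
  refine row 581 592.25 0.0243 251.1 0.125 0.03286 0.0271 1.8706 (-(174/64*0.6931471808)) 1.142 1.835 56.201 1.001 21.204 304.438 399 341 148 56 372 0 282 528
    ?_ ?_ ?_ ?_ ?_ ?_ ?_ ?_ ?_ ?_ ?_ ?_ ?_ ?_ ?_ ?_ ?_ (by have := le_log_pow_neg (6.283*0.0243) 174 (by norm_num) (by norm_num); push_cast at this; exact this)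
    ?_ ?_ ?_ ?_ ?_ ?_ ?_ ?_ ?_ ?_ ?_ ?_ ?_ ?_ ?_ ?_ ?_ ?_ v hva hvb
  all_goals norm_num

theorem row19 (v : ℝ) (hva : 592.25 ≤ v) (hvb : v ≤ 602.5) : v*|VV (Real.exp v)| ≤ 3071.82*Real.exp v := by
  refine row 592.25 602.5 0.0234 265 0.12 0.03225 0.02709 1.9148 (-(178/64*0.6931471808)) 1.13 1.001 48.294 1.001 18.823 317.916 409 346 148 0 358 0 271 532
    ?_ ?_ ?_ ?_ ?_ ?_ ?_ ?_ ?_ ?_ ?_ ?_ ?_ ?_ ?_ ?_ ?_ (by have := le_log_pow_neg (6.283*0.0234) 178 (by norm_num) (by norm_num); push_cast at this; exact this)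
    ?_ ?_ ?_ ?_ ?_ ?_ ?_ ?_ ?_ ?_ ?_ ?_ ?_ ?_ ?_ ?_ ?_ ?_ v hva hvb
  all_goals norm_num

theorem row20 (v : ℝ) (hva : 602.5 ≤ v) (hvb : v ≤ 612.5) : v*|VV (Real.exp v)| ≤ 3071.82*Real.exp v := by
  refine row 602.5 612.5 0.0227 271 0.12 0.03201 0.02688 1.9184 (-(180/64*0.6931471808)) 1.129 1.543 73.677 1.001 17.261 301.158 410 348 149 40 397 0 263 527
    ?_ ?_ ?_ ?_ ?_ ?_ ?_ ?_ ?_ ?_ ?_ ?_ ?_ ?_ ?_ ?_ ?_ (by have := le_log_pow_neg (6.283*0.0227) 180 (by norm_num) (by norm_num); push_cast at this; exact this)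
    ?_ ?_ ?_ ?_ ?_ ?_ ?_ ?_ ?_ ?_ ?_ ?_ ?_ ?_ ?_ ?_ ?_ ?_ v hva hvb
  all_goals norm_num

theorem row21 (v : ℝ) (hva : 612.5 ≤ v) (hvb : v ≤ 623) : v*|VV (Real.exp v)| ≤ 3071.82*Real.exp v := by
  refine row 612.5 623 0.0222 277.1 0.12 0.03177 0.02621 1.8799 (-(182/64*0.6931471808)) 1.139 1.543 56.201 1.001 16.891 279.17 402 350 149 40 372 0 261 520
    ?_ ?_ ?_ ?_ ?_ ?_ ?_ ?_ ?_ ?_ ?_ ?_ ?_ ?_ ?_ ?_ ?_ (by have := le_log_pow_neg (6.283*0.0222) 182 (by norm_num) (by norm_num); push_cast at this; exact this)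
    ?_ ?_ ?_ ?_ ?_ ?_ ?_ ?_ ?_ ?_ ?_ ?_ ?_ ?_ ?_ ?_ ?_ ?_ v hva hvb
  all_goals norm_num

theorem row22 (v : ℝ) (hva : 623 ≤ v) (hvb : v ≤ 633) : v*|VV (Real.exp v)| ≤ 3071.82*Real.exp v := by
  refine row 623 633 0.0213 295.8 0.115 0.03109 0.02611 1.9236 (-(186/64*0.6931471808)) 1.128 1.001 36.049 1.001 16.351 317.916 412 356 149 0 331 0 258 532
    ?_ ?_ ?_ ?_ ?_ ?_ ?_ ?_ ?_ ?_ ?_ ?_ ?_ ?_ ?_ ?_ ?_ (by have := le_log_pow_neg (6.283*0.0213) 186 (by norm_num) (by norm_num); push_cast at this; exact this)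
    ?_ ?_ ?_ ?_ ?_ ?_ ?_ ?_ ?_ ?_ ?_ ?_ ?_ ?_ ?_ ?_ ?_ ?_ v hva hvb
  all_goals norm_num

theorem row23 (v : ℝ) (hva : 633 ≤ v) (hvb : v ≤ 642.75) : v*|VV (Real.exp v)| ≤ 3071.82*Real.exp v := by
  refine row 633 642.75 0.0213 295.8 0.115 0.03109 0.02611 1.9236 (-(186/64*0.6931471808)) 1.128 1.001 37.645 1.001 13.167 256.001 412 356 150 0 335 0 238 512
    ?_ ?_ ?_ ?_ ?_ ?_ ?_ ?_ ?_ ?_ ?_ ?_ ?_ ?_ ?_ ?_ ?_ (by have := le_log_pow_neg (6.283*0.0213) 186 (by norm_num) (by norm_num); push_cast at this; exact this)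
    ?_ ?_ ?_ ?_ ?_ ?_ ?_ ?_ ?_ ?_ ?_ ?_ ?_ ?_ ?_ ?_ ?_ ?_ v hva hvb
  all_goals norm_num

theorem row24 (v : ℝ) (hva : 642.75 ≤ v) (hvb : v ≤ 652.5) : v*|VV (Real.exp v)| ≤ 3071.82*Real.exp v := by
  refine row 642.75 652.5 0.0199 319.1 0.115 0.03032 0.02546 1.9295 (-(192/64*0.6931471808)) 1.126 1.001 33.417 1.001 15.828 346.69 414 363 150 0 324 0 255 540
    ?_ ?_ ?_ ?_ ?_ ?_ ?_ ?_ ?_ ?_ ?_ ?_ ?_ ?_ ?_ ?_ ?_ (by have := le_log_pow_neg (6.283*0.0199) 192 (by norm_num) (by norm_num); push_cast at this; exact this)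
    ?_ ?_ ?_ ?_ ?_ ?_ ?_ ?_ ?_ ?_ ?_ ?_ ?_ ?_ ?_ ?_ ?_ ?_ v hva hvb
  all_goals norm_num

theorem row25 (v : ℝ) (hva : 652.5 ≤ v) (hvb : v ≤ 662.5) : v*|VV (Real.exp v)| ≤ 3071.82*Real.exp v := by
  refine row 652.5 662.5 0.0199 319.1 0.115 0.03032 0.02546 1.9295 (-(192/64*0.6931471808)) 1.126 1.001 33.417 1.001 12.338 270.246 414 363 150 0 324 0 232 517
    ?_ ?_ ?_ ?_ ?_ ?_ ?_ ?_ ?_ ?_ ?_ ?_ ?_ ?_ ?_ ?_ ?_ (by have := le_log_pow_neg (6.283*0.0199) 192 (by norm_num) (by norm_num); push_cast at this; exact this)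
    ?_ ?_ ?_ ?_ ?_ ?_ ?_ ?_ ?_ ?_ ?_ ?_ ?_ ?_ ?_ ?_ ?_ ?_ v hva hvb
  all_goals norm_num

theorem row26 (v : ℝ) (hva : 662.5 ≤ v) (hvb : v ≤ 672.75) : v*|VV (Real.exp v)| ≤ 3071.82*Real.exp v := by
  refine row 662.5 672.75 0.0187 336.9 0.11 0.0298 0.02503 1.9365 (-(198/64*0.6931471808)) 1.124 1.001 56.201 1.001 13.749 335.607 416 368 151 0 372 0 242 537
    ?_ ?_ ?_ ?_ ?_ ?_ ?_ ?_ ?_ ?_ ?_ ?_ ?_ ?_ ?_ ?_ ?_ (by have := le_log_pow_neg (6.283*0.0187) 198 (by norm_num) (by norm_num); push_cast at this; exact this)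
    ?_ ?_ ?_ ?_ ?_ ?_ ?_ ?_ ?_ ?_ ?_ ?_ ?_ ?_ ?_ ?_ ?_ ?_ v hva hvb
  all_goals norm_num

theorem row27 (v : ℝ) (hva : 672.75 ≤ v) (hvb : v ≤ 683.75) : v*|VV (Real.exp v)| ≤ 3071.82*Real.exp v := by
  refine row 672.75 683.75 0.0185 340.6 0.11 0.0297 0.02494 1.936 (-(199/64*0.6931471808)) 1.124 1.001 56.813 1.001 11.192 279.17 416 369 151 0 373 0 223 520
    ?_ ?_ ?_ ?_ ?_ ?_ ?_ ?_ ?_ ?_ ?_ ?_ ?_ ?_ ?_ ?_ ?_ (by have := le_log_pow_neg (6.283*0.0185) 199 (by norm_num) (by norm_num); push_cast at this; exact this)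
    ?_ ?_ ?_ ?_ ?_ ?_ ?_ ?_ ?_ ?_ ?_ ?_ ?_ ?_ ?_ ?_ ?_ ?_ v hva hvb
  all_goals norm_num

theorem row28 (v : ℝ) (hva : 683.75 ≤ v) (hvb : v ≤ 694.25) : v*|VV (Real.exp v)| ≤ 3071.82*Real.exp v := by
  refine row 683.75 694.25 0.0173 367.1 0.11 0.029 0.02436 1.9422 (-(205/64*0.6931471808)) 1.123 1.001 52.665 1.001 13.601 378.068 418 376 152 0 366 0 241 548
    ?_ ?_ ?_ ?_ ?_ ?_ ?_ ?_ ?_ ?_ ?_ ?_ ?_ ?_ ?_ ?_ ?_ (by have := le_log_pow_neg (6.283*0.0173) 205 (by norm_num) (by norm_num); push_cast at this; exact this)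
    ?_ ?_ ?_ ?_ ?_ ?_ ?_ ?_ ?_ ?_ ?_ ?_ ?_ ?_ ?_ ?_ ?_ ?_ v hva hvb
  all_goals norm_num

theorem row29 (v : ℝ) (hva : 694.25 ≤ v) (hvb : v ≤ 706.25) : v*|VV (Real.exp v)| ≤ 3071.82*Real.exp v := by
  refine row 694.25 706.25 0.0173 367.1 0.11 0.029 0.02436 1.9422 (-(205/64*0.6931471808)) 1.123 1.001 52.665 1.001 10.488 294.705 418 376 152 0 366 0 217 525
    ?_ ?_ ?_ ?_ ?_ ?_ ?_ ?_ ?_ ?_ ?_ ?_ ?_ ?_ ?_ ?_ ?_ (by have := le_log_pow_neg (6.283*0.0173) 205 (by norm_num) (by norm_num); push_cast at this; exact this)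
    ?_ ?_ ?_ ?_ ?_ ?_ ?_ ?_ ?_ ?_ ?_ ?_ ?_ ?_ ?_ ?_ ?_ ?_ v hva hvb
  all_goals norm_num

theorem row30 (v : ℝ) (hva : 706.25 ≤ v) (hvb : v ≤ 718) : v*|VV (Real.exp v)| ≤ 3071.82*Real.exp v := by
  refine row 706.25 718 0.0164 387.9 0.105 0.02852 0.02352 1.9075 (-(210/64*0.6931471808)) 1.131 1.001 41.052 1.001 12.338 342.955 411 381 152 0 343 0 232 539
    ?_ ?_ ?_ ?_ ?_ ?_ ?_ ?_ ?_ ?_ ?_ ?_ ?_ ?_ ?_ ?_ ?_ (by have := le_log_pow_neg (6.283*0.0164) 210 (by norm_num) (by norm_num); push_cast at this; exact this)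
    ?_ ?_ ?_ ?_ ?_ ?_ ?_ ?_ ?_ ?_ ?_ ?_ ?_ ?_ ?_ ?_ ?_ ?_ v hva hvb
  all_goals norm_num

theorem row31 (v : ℝ) (hva : 718 ≤ v) (hvb : v ≤ 730.25) : v*|VV (Real.exp v)| ≤ 3071.82*Real.exp v := by
  refine row 718 730.25 0.0164 387.9 0.105 0.02852 0.02352 1.9075 (-(210/64*0.6931471808)) 1.131 1.001 42.87 1.001 9.722 273.188 411 381 153 0 347 0 210 518
    ?_ ?_ ?_ ?_ ?_ ?_ ?_ ?_ ?_ ?_ ?_ ?_ ?_ ?_ ?_ ?_ ?_ (by have := le_log_pow_neg (6.283*0.0164) 210 (by norm_num) (by norm_num); push_cast at this; exact this)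
    ?_ ?_ ?_ ?_ ?_ ?_ ?_ ?_ ?_ ?_ ?_ ?_ ?_ ?_ ?_ ?_ ?_ ?_ v hva hvb
  all_goals norm_num

theorem row32 (v : ℝ) (hva : 730.25 ≤ v) (hvb : v ≤ 743.75) : v*|VV (Real.exp v)| ≤ 3071.82*Real.exp v := by
  refine row 730.25 743.75 0.0156 412.9 0.105 0.02797 0.02349 1.9514 (-(215/64*0.6931471808)) 1.12 1.001 42.408 1.001 8.916 301.158 421 387 153 0 346 0 202 527
    ?_ ?_ ?_ ?_ ?_ ?_ ?_ ?_ ?_ ?_ ?_ ?_ ?_ ?_ ?_ ?_ ?_ (by have := le_log_pow_neg (6.283*0.0156) 215 (by norm_num) (by norm_num); push_cast at this; exact this)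
    ?_ ?_ ?_ ?_ ?_ ?_ ?_ ?_ ?_ ?_ ?_ ?_ ?_ ?_ ?_ ?_ ?_ ?_ v hva hvb
  all_goals norm_num

theorem row33 (v : ℝ) (hva : 743.75 ≤ v) (hvb : v ≤ 758) : v*|VV (Real.exp v)| ≤ 3071.82*Real.exp v := by
  refine row 743.75 758 0.0149 432.3 0.105 0.02761 0.02319 1.959 (-(219/64*0.6931471808)) 1.118 1.001 50.981 1.001 8.725 324.878 423 391 154 0 363 0 200 534
    ?_ ?_ ?_ ?_ ?_ ?_ ?_ ?_ ?_ ?_ ?_ ?_ ?_ ?_ ?_ ?_ ?_ (by have := le_log_pow_neg (6.283*0.0149) 219 (by norm_num) (by norm_num); push_cast at this; exact this)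
    ?_ ?_ ?_ ?_ ?_ ?_ ?_ ?_ ?_ ?_ ?_ ?_ ?_ ?_ ?_ ?_ ?_ ?_ v hva hvb
  all_goals norm_num

theorem row34 (v : ℝ) (hva : 758 ≤ v) (hvb : v ≤ 774.25) : v*|VV (Real.exp v)| ≤ 3071.82*Real.exp v := by
  refine row 758 774.25 0.0141 456.8 0.1 0.02717 0.02282 1.9617 (-(224/64*0.6931471808)) 1.117 1.001 58.689 1.001 8.446 342.955 424 396 154 0 376 0 197 539
    ?_ ?_ ?_ ?_ ?_ ?_ ?_ ?_ ?_ ?_ ?_ ?_ ?_ ?_ ?_ ?_ ?_ (by have := le_log_pow_neg (6.283*0.0141) 224 (by norm_num) (by norm_num); push_cast at this; exact this)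
    ?_ ?_ ?_ ?_ ?_ ?_ ?_ ?_ ?_ ?_ ?_ ?_ ?_ ?_ ?_ ?_ ?_ ?_ v hva hvb
  all_goals norm_num

theorem row35 (v : ℝ) (hva : 774.25 ≤ v) (hvb : v ≤ 791.75) : v*|VV (Real.exp v)| ≤ 3071.82*Real.exp v := by
  refine row 774.25 791.75 0.0138 466.7 0.1 0.027 0.02227 1.9239 (-(226/64*0.6931471808)) 1.127 1.001 45.748 1.001 7.914 301.158 416 398 155 0 353 0 191 527
    ?_ ?_ ?_ ?_ ?_ ?_ ?_ ?_ ?_ ?_ ?_ ?_ ?_ ?_ ?_ ?_ ?_ (by have := le_log_pow_neg (6.283*0.0138) 226 (by norm_num) (by norm_num); push_cast at this; exact this)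
    ?_ ?_ ?_ ?_ ?_ ?_ ?_ ?_ ?_ ?_ ?_ ?_ ?_ ?_ ?_ ?_ ?_ ?_ v hva hvb
  all_goals norm_num

theorem row36 (v : ℝ) (hva : 791.75 ≤ v) (hvb : v ≤ 812) : v*|VV (Real.exp v)| ≤ 3071.82*Real.exp v := by
  refine row 791.75 812 0.0128 503.2 0.1 0.02642 0.02219 1.9674 (-(233/64*0.6931471808)) 1.116 1.001 77.776 1.001 6.875 328.415 426 405 155 0 402 0 178 535
    ?_ ?_ ?_ ?_ ?_ ?_ ?_ ?_ ?_ ?_ ?_ ?_ ?_ ?_ ?_ ?_ ?_ (by have := le_log_pow_neg (6.283*0.0128) 233 (by norm_num) (by norm_num); push_cast at this; exact this)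
    ?_ ?_ ?_ ?_ ?_ ?_ ?_ ?_ ?_ ?_ ?_ ?_ ?_ ?_ ?_ ?_ ?_ ?_ v hva hvb
  all_goals norm_num

theorem row37 (v : ℝ) (hva : 812 ≤ v) (hvb : v ≤ 835.75) : v*|VV (Real.exp v)| ≤ 3071.82*Real.exp v := by
  refine row 812 835.75 0.0124 525.9 0.1 0.0261 0.02192 1.9706 (-(236/64*0.6931471808)) 1.115 1.001 53.818 1.001 5.781 294.705 427 409 156 0 368 0 162 525
    ?_ ?_ ?_ ?_ ?_ ?_ ?_ ?_ ?_ ?_ ?_ ?_ ?_ ?_ ?_ ?_ ?_ (by have := le_log_pow_neg (6.283*0.0124) 236 (by norm_num) (by norm_num); push_cast at this; exact this)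
    ?_ ?_ ?_ ?_ ?_ ?_ ?_ ?_ ?_ ?_ ?_ ?_ ?_ ?_ ?_ ?_ ?_ ?_ v hva hvb
  all_goals norm_num

theorem row38 (v : ℝ) (hva : 835.75 ≤ v) (hvb : v ≤ 861.25) : v*|VV (Real.exp v)| ≤ 3071.82*Real.exp v := by
  refine row 835.75 861.25 0.0118 566.2 0.095 0.02556 0.02185 2.0188 (-(241/64*0.6931471808)) 1.103 1.001 34.897 1.001 4.655 294.705 438 416 157 0 328 0 142 525
    ?_ ?_ ?_ ?_ ?_ ?_ ?_ ?_ ?_ ?_ ?_ ?_ ?_ ?_ ?_ ?_ ?_ (by have := le_log_pow_neg (6.283*0.0118) 241 (by norm_num) (by norm_num); push_cast at this; exact this)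
    ?_ ?_ ?_ ?_ ?_ ?_ ?_ ?_ ?_ ?_ ?_ ?_ ?_ ?_ ?_ ?_ ?_ ?_ v hva hvb
  all_goals norm_num

theorem row39 (v : ℝ) (hva : 861.25 ≤ v) (hvb : v ≤ 893.25) : v*|VV (Real.exp v)| ≤ 3071.82*Real.exp v := by
  refine row 861.25 893.25 0.0108 618.6 0.095 0.02497 0.02097 1.9838 (-(249/64*0.6931471808)) 1.111 1.001 30.314 1.001 4.914 321.378 431 424 157 0 315 0 147 533
    ?_ ?_ ?_ ?_ ?_ ?_ ?_ ?_ ?_ ?_ ?_ ?_ ?_ ?_ ?_ ?_ ?_ (by have := le_log_pow_neg (6.283*0.0108) 249 (by norm_num) (by norm_num); push_cast at this; exact this)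
    ?_ ?_ ?_ ?_ ?_ ?_ ?_ ?_ ?_ ?_ ?_ ?_ ?_ ?_ ?_ ?_ ?_ ?_ v hva hvb
  all_goals norm_num

theorem row40 (v : ℝ) (hva : 893.25 ≤ v) (hvb : v ≤ 931) : v*|VV (Real.exp v)| ≤ 3071.82*Real.exp v := by
  refine row 893.25 931 0.00984 678.9 0.09 0.02433 0.02043 1.99 (-(258/64*0.6931471808)) 1.11 1.001 41.052 1.001 4.316 339.261 433 433 158 0 343 0 135 538
    ?_ ?_ ?_ ?_ ?_ ?_ ?_ ?_ ?_ ?_ ?_ ?_ ?_ ?_ ?_ ?_ ?_ (by have := le_log_pow_neg (6.283*0.00984) 258 (by norm_num) (by norm_num); push_cast at this; exact this)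
    ?_ ?_ ?_ ?_ ?_ ?_ ?_ ?_ ?_ ?_ ?_ ?_ ?_ ?_ ?_ ?_ ?_ ?_ v hva hvb
  all_goals norm_num

theorem row41 (v : ℝ) (hva : 931 ≤ v) (hvb : v ≤ 979) : v*|VV (Real.exp v)| ≤ 3071.82*Real.exp v := by
  refine row 931 979 0.00908 735.7 0.09 0.02386 0.02004 1.997 (-(265/64*0.6931471808)) 1.108 1.001 53.238 1.001 3.085 279.17 435 440 159 0 367 0 104 520
    ?_ ?_ ?_ ?_ ?_ ?_ ?_ ?_ ?_ ?_ ?_ ?_ ?_ ?_ ?_ ?_ ?_ (by have := le_log_pow_neg (6.283*0.00908) 265 (by norm_num) (by norm_num); push_cast at this; exact this)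
    ?_ ?_ ?_ ?_ ?_ ?_ ?_ ?_ ?_ ?_ ?_ ?_ ?_ ?_ ?_ ?_ ?_ ?_ v hva hvb
  all_goals norm_num

theorem row42 (v : ℝ) (hva : 979 ≤ v) (hvb : v ≤ 1041.5) : v*|VV (Real.exp v)| ≤ 3071.82*Real.exp v := by
  refine row 979 1041.5 0.00773 884.9 0.085 0.02279 0.01948 2.0514 (-(280/64*0.6931471808)) 1.094 1.001 47.259 1.001 2.798 390.554 448 457 161 0 356 0 95 551
    ?_ ?_ ?_ ?_ ?_ ?_ ?_ ?_ ?_ ?_ ?_ ?_ ?_ ?_ ?_ ?_ ?_ (by have := le_log_pow_neg (6.283*0.00773) 280 (by norm_num) (by norm_num); push_cast at this; exact this)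
    ?_ ?_ ?_ ?_ ?_ ?_ ?_ ?_ ?_ ?_ ?_ ?_ ?_ ?_ ?_ ?_ ?_ ?_ v hva hvb
  all_goals norm_num

theorem row43 (v : ℝ) (hva : 1041.5 ≤ v) (hvb : v ≤ 1125.5) : v*|VV (Real.exp v)| ≤ 3071.82*Real.exp v := by
  refine row 1041.5 1125.5 0.00672 1030 0.085 0.02196 0.01844 2.02 (-(293/64*0.6931471808)) 1.101 1.001 29.664 1.001 2.328 369.967 442 471 163 0 313 0 78 546
    ?_ ?_ ?_ ?_ ?_ ?_ ?_ ?_ ?_ ?_ ?_ ?_ ?_ ?_ ?_ ?_ ?_ (by have := le_log_pow_neg (6.283*0.00672) 293 (by norm_num) (by norm_num); push_cast at this; exact this)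
    ?_ ?_ ?_ ?_ ?_ ?_ ?_ ?_ ?_ ?_ ?_ ?_ ?_ ?_ ?_ ?_ ?_ ?_ v hva hvb
  all_goals norm_num

theorem row44 (v : ℝ) (hva : 1125.5 ≤ v) (hvb : v ≤ 1245.25) : v*|VV (Real.exp v)| ≤ 3071.82*Real.exp v := by
  refine row 1125.5 1245.25 0.0056 1250 0.08 0.021 0.01795 2.0747 (-(310/64*0.6931471808)) 1.087 1.001 47.259 1.001 1.177 307.753 455 489 165 0 356 0 15 529
    ?_ ?_ ?_ ?_ ?_ ?_ ?_ ?_ ?_ ?_ ?_ ?_ ?_ ?_ ?_ ?_ ?_ (by have := le_log_pow_neg (6.283*0.0056) 310 (by norm_num) (by norm_num); push_cast at this; exact this)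
    ?_ ?_ ?_ ?_ ?_ ?_ ?_ ?_ ?_ ?_ ?_ ?_ ?_ ?_ ?_ ?_ ?_ ?_ v hva hvb
  all_goals norm_num

theorem row45 (v : ℝ) (hva : 1245.25 ≤ v) (hvb : v ≤ 1432.5) : v*|VV (Real.exp v)| ≤ 3071.82*Real.exp v := by
  refine row 1245.25 1432.5 0.00419 1709 0.075 0.01961 0.01676 2.0951 (-(336/64*0.6931471808)) 1.082 1.001 40.61 1.001 1.001 339.261 461 518 168 0 342 0 0 538
    ?_ ?_ ?_ ?_ ?_ ?_ ?_ ?_ ?_ ?_ ?_ ?_ ?_ ?_ ?_ ?_ ?_ (by have := le_log_pow_neg (6.283*0.00419) 336 (by norm_num) (by norm_num); push_cast at this; exact this)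
    ?_ ?_ ?_ ?_ ?_ ?_ ?_ ?_ ?_ ?_ ?_ ?_ ?_ ?_ ?_ ?_ ?_ ?_ v hva hvb
  all_goals norm_num

theorem row46 (v : ℝ) (hva : 1432.5 ≤ v) (hvb : v ≤ 1754) : v*|VV (Real.exp v)| ≤ 3071.82*Real.exp v := by
  refine row 1432.5 1754 0.0028 2643 0.07 0.01795 0.01534 2.123 (-(374/64*0.6931471808)) 1.075 1.001 29.029 1.001 1.001 354.281 469 558 173 0 311 0 0 542
    ?_ ?_ ?_ ?_ ?_ ?_ ?_ ?_ ?_ ?_ ?_ ?_ ?_ ?_ ?_ ?_ ?_ (by have := le_log_pow_neg (6.283*0.0028) 374 (by norm_num) (by norm_num); push_cast at this; exact this)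
    ?_ ?_ ?_ ?_ ?_ ?_ ?_ ?_ ?_ ?_ ?_ ?_ ?_ ?_ ?_ ?_ ?_ ?_ v hva hvb
  all_goals norm_num

theorem row47 (v : ℝ) (hva : 1754 ≤ v) (hvb : v ≤ 2430.25) : v*|VV (Real.exp v)| ≤ 3071.82*Real.exp v := by
  refine row 1754 2430.25 0.00146 5288 0.06 0.01584 0.01354 2.1618 (-(434/64*0.6931471808)) 1.064 1.001 23.375 1.001 1.001 354.281 480 622 180 0 291 0 0 542
    ?_ ?_ ?_ ?_ ?_ ?_ ?_ ?_ ?_ ?_ ?_ ?_ ?_ ?_ ?_ ?_ ?_ (by have := le_log_pow_neg (6.283*0.00146) 434 (by norm_num) (by norm_num); push_cast at this; exact this)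
    ?_ ?_ ?_ ?_ ?_ ?_ ?_ ?_ ?_ ?_ ?_ ?_ ?_ ?_ ?_ ?_ ?_ ?_ v hva hvb
  all_goals norm_num

theorem row48 (v : ℝ) (hva : 2430.25 ≤ v) (hvb : v ≤ 4392) : v*|VV (Real.exp v)| ≤ 3071.82*Real.exp v := by
  refine row 2430.25 4392 0.00044 19319 0.05 0.01296 0.01127 2.2721 (-(544/64*0.6931471808)) 1.036 1.001 5.022 1.001 1.001 425.902 508 742 194 0 149 0 0 559
    ?_ ?_ ?_ ?_ ?_ ?_ ?_ ?_ ?_ ?_ ?_ ?_ ?_ ?_ ?_ ?_ ?_ (by have := le_log_pow_neg (6.283*0.00044) 544 (by norm_num) (by norm_num); push_cast at this; exact this)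
    ?_ ?_ ?_ ?_ ?_ ?_ ?_ ?_ ?_ ?_ ?_ ?_ ?_ ?_ ?_ ?_ ?_ ?_ v hva hvb
  all_goals norm_num

theorem row49 (v : ℝ) (hva : 4392 ≤ v) (hvb : v ≤ 17342) : v*|VV (Real.exp v)| ≤ 3071.82*Real.exp v := by
  refine row 4392 17342 0.000029 327587 0.035 0.00929 0.00808 2.3849 (-(796/64*0.6931471808)) 1.006 1.001 8.538 1.001 1.001 369.967 538 1003 226 0 198 0 0 546
    ?_ ?_ ?_ ?_ ?_ ?_ ?_ ?_ ?_ ?_ ?_ ?_ ?_ ?_ ?_ ?_ ?_ (by have := le_log_pow_neg (6.283*0.000029) 796 (by norm_num) (by norm_num); push_cast at this; exact this)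
    ?_ ?_ ?_ ?_ ?_ ?_ ?_ ?_ ?_ ?_ ?_ ?_ ?_ ?_ ?_ ?_ ?_ ?_ v hva hvb
  all_goals norm_num

theorem row50 (v : ℝ) (hva : 17342 ≤ v) (hvb : v ≤ 346839) : v*|VV (Real.exp v)| ≤ 3071.82*Real.exp v := by
  refine row 17342 346839 0.00000008 131250000 0.022 0.0058 0.00261 1.969 (-(1340/64*0.6931471808)) 1.11 1.001 1.854 1.001 1.001 20.305 448 1557 295 0 57 0 0 278
    ?_ ?_ ?_ ?_ ?_ ?_ ?_ ?_ ?_ ?_ ?_ ?_ ?_ ?_ ?_ ?_ ?_ (by have := le_log_pow_neg (6.283*0.00000008) 1340 (by norm_num) (by norm_num); push_cast at this; exact this)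
    ?_ ?_ ?_ ?_ ?_ ?_ ?_ ?_ ?_ ?_ ?_ ?_ ?_ ?_ ?_ ?_ ?_ ?_ v hva hvb
  all_goals norm_num

theorem rows_all (v : ℝ) (hva : 87 ≤ v) (hvb : v ≤ 346839) : v*|VV (Real.exp v)| ≤ 3071.82*Real.exp v := by
  rcases le_total v 97 with h0 | h0
  · exact row0 v hva h0
  rcases le_total v 116.75 with h1 | h1
  · exact row1 v h0 h1
  rcases le_total v 148.25 with h2 | h2
  · exact row2 v h1 h2
  rcases le_total v 193 with h3 | h3
  · exact row3 v h2 h3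
  rcases le_total v 247 with h4 | h4
  · exact row4 v h3 h4
  rcases le_total v 303.25 with h5 | h5
  · exact row5 v h4 h5
  rcases le_total v 353.25 with h6 | h6
  · exact row6 v h5 h6
  rcases le_total v 393 with h7 | h7
  · exact row7 v h6 h7
  rcases le_total v 425.5 with h8 | h8
  · exact row8 v h7 h8
  rcases le_total v 452.25 with h9 | h9
  · exact row9 v h8 h9
  rcases le_total v 475 with h10 | h10
  · exact row10 v h9 h10
  rcases le_total v 494.75 with h11 | h11
  · exact row11 v h10 h11
  rcases le_total v 512.5 with h12 | h12
  · exact row12 v h11 h12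
  rcases le_total v 528.5 with h13 | h13
  · exact row13 v h12 h13
  rcases le_total v 543.25 with h14 | h14
  · exact row14 v h13 h14
  rcases le_total v 556.75 with h15 | h15
  · exact row15 v h14 h15
  rcases le_total v 569 with h16 | h16
  · exact row16 v h15 h16
  rcases le_total v 581 with h17 | h17
  · exact row17 v h16 h17
  rcases le_total v 592.25 with h18 | h18
  · exact row18 v h17 h18
  rcases le_total v 602.5 with h19 | h19
  · exact row19 v h18 h19
  rcases le_total v 612.5 with h20 | h20
  · exact row20 v h19 h20
  rcases le_total v 623 with h21 | h21
  · exact row21 v h20 h21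
  rcases le_total v 633 with h22 | h22
  · exact row22 v h21 h22
  rcases le_total v 642.75 with h23 | h23
  · exact row23 v h22 h23
  rcases le_total v 652.5 with h24 | h24
  · exact row24 v h23 h24
  rcases le_total v 662.5 with h25 | h25
  · exact row25 v h24 h25
  rcases le_total v 672.75 with h26 | h26
  · exact row26 v h25 h26
  rcases le_total v 683.75 with h27 | h27
  · exact row27 v h26 h27
  rcases le_total v 694.25 with h28 | h28
  · exact row28 v h27 h28
  rcases le_total v 706.25 with h29 | h29
  · exact row29 v h28 h29
  rcases le_total v 718 with h30 | h30
  · exact row30 v h29 h30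
  rcases le_total v 730.25 with h31 | h31
  · exact row31 v h30 h31
  rcases le_total v 743.75 with h32 | h32
  · exact row32 v h31 h32
  rcases le_total v 758 with h33 | h33
  · exact row33 v h32 h33
  rcases le_total v 774.25 with h34 | h34
  · exact row34 v h33 h34
  rcases le_total v 791.75 with h35 | h35
  · exact row35 v h34 h35
  rcases le_total v 812 with h36 | h36
  · exact row36 v h35 h36
  rcases le_total v 835.75 with h37 | h37
  · exact row37 v h36 h37
  rcases le_total v 861.25 with h38 | h38
  · exact row38 v h37 h38
  rcases le_total v 893.25 with h39 | h39
  · exact row39 v h38 h39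
  rcases le_total v 931 with h40 | h40
  · exact row40 v h39 h40
  rcases le_total v 979 with h41 | h41
  · exact row41 v h40 h41
  rcases le_total v 1041.5 with h42 | h42
  · exact row42 v h41 h42
  rcases le_total v 1125.5 with h43 | h43
  · exact row43 v h42 h43
  rcases le_total v 1245.25 with h44 | h44
  · exact row44 v h43 h44
  rcases le_total v 1432.5 with h45 | h45
  · exact row45 v h44 h45
  rcases le_total v 1754 with h46 | h46
  · exact row46 v h45 h46
  rcases le_total v 2430.25 with h47 | h47
  · exact row47 v h46 h47
  rcases le_total v 4392 with h48 | h48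
  · exact row48 v h47 h48
  rcases le_total v 17342 with h49 | h49
  · exact row49 v h48 h49
  exact row50 v h49 hvb

end

section
open Complex Metric Set Filter Topology MeasureTheory

theorem big_key (ℓ : ℝ) (h : 12 ≤ ℓ) :
    ℓ*(ℓ+8+(3*ℓ+4.4)*(0.41*(5.2+ℓ/12))) ≤ 0.02*Real.exp ℓ := by
  obtain ⟨u, hu, rfl⟩ : ∃ u : ℝ, 0 ≤ u ∧ ℓ = 12+u := ⟨ℓ-12, by linarith, by ring⟩
  have h1 : (150000:ℝ) ≤ Real.exp 12 := by
    have := Real.exp_one_gt_d9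
    have h2 : Real.exp 12 = (Real.exp 1)^12 := by rw [← Real.exp_nat_mul]; norm_num
    rw [h2]
    calc (150000:ℝ) ≤ 2.71^12 := by norm_num
      _ ≤ _ := by gcongr; linarith
  have h3 : 1+u+u^2/2+u^3/6 ≤ Real.exp u := by
    have := Real.sum_le_exp_of_nonneg hu 4
    norm_num [Finset.sum_range_succ, Nat.factorial] at this
    linarith
  rw [Real.exp_add]
  have h4 : 150000*(1+u+u^2/2+u^3/6) ≤ Real.exp 12*Real.exp u := by gcongr
  have : 0 ≤ u^2 := by positivity
  have : 0 ≤ u^3 := by positivity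
  nlinarith

theorem big_J (h T e : ℝ) (hT : 4 ≤ T) (he : 1 ≤ e) :
    ∫ t in (4:ℝ)..T, t^(e-1)*Real.exp (-(h^2/2)*t^2) ≤ T^e := by
  have hc : ContinuousOn (fun t : ℝ => t^(e-1)*Real.exp (-(h^2/2)*t^2)) (Set.uIcc 4 T) := by
    apply ContinuousOn.mul
    · apply ContinuousOn.rpow_const continuousOn_id
      intro t ht; right; linarith
    · fun_prop
  calc ∫ t in (4:ℝ)..T, t^(e-1)*Real.exp (-(h^2/2)*t^2) ≤ ∫ t in (4:ℝ)..T, T^(e-1) := by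
        apply intervalIntegral.integral_mono_on hT hc.intervalIntegrable (by simp)
        intro t ht
        have h1 : t^(e-1) ≤ T^(e-1) := Real.rpow_le_rpow (by linarith [ht.1]) ht.2 (by linarith)
        have h2 : Real.exp (-(h^2/2)*t^2) ≤ 1 := by
          rw [Real.exp_le_one_iff]
          have : 0 ≤ h^2/2*t^2 := by positivity
          linarith
        have h3 : 0 ≤ T^(e-1) := Real.rpow_nonneg (by linarith) _
        calc _ ≤ T^(e-1)*1 := by gcongr
          _ = _ := by ring
    _ = (T-4)*T^(e-1) := by simp
    _ ≤ T*T^(e-1) := by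
        have h3 : 0 ≤ T^(e-1) := Real.rpow_nonneg (by linarith) _
        gcongr; linarith
    _ = T^e := by
        rw [← Real.rpow_one_add' (by linarith) (by linarith)]
        congr 1; ring

theorem big_QQ (ℓ : ℝ) (h : 12 ≤ ℓ) : QQ (0.03/ℓ) (-(0.02/ℓ)) ≤ 0.41*(5.2+ℓ/12) := by
  have hl : 0 < ℓ := by linarith
  rw [QQ]
  have e1 : (0.4+0.03/ℓ)/(-(0.02/ℓ)+0.03/ℓ) = 40*ℓ+3 := by field_simp; ring
  rw [e1]
  have h1 : Real.log (40*ℓ+3) ≤ 5.2+ℓ/12 := by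
    have a : Real.log (40*ℓ+3) ≤ Real.log (492*(ℓ/12)) := Real.log_le_log (by positivity) (by linarith)
    rw [Real.log_mul (by norm_num) (by positivity)] at a
    have b := Real.log_le_sub_one_of_pos (x := ℓ/12) (by positivity)
    have c := log_le_pow 492 18 161 (by norm_num) (by norm_num) (by norm_num)
    norm_num at c
    linarith
  have h2 : 0.4+0.03/ℓ ≤ 0.41 := by
    have : 0.03/ℓ ≤ 0.03/12 := by gcongr
    linarith
  have h3 : 0 ≤ Real.log (40*ℓ+3) := Real.log_nonneg (by linarith)
  gcongr

theorem big_ZF (v ℓ : ℝ) (hℓ : ℓ = Real.log v) (hv : 87 ≤ v) (h : 12 ≤ ℓ) : ZF (v^3+1) (0.03/ℓ) := by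
  have hl : 0 < ℓ := by linarith
  have hv0 : 0 < v := by linarith
  have h3 : 0.03/ℓ ≤ 0.03/12 := by gcongr
  have h4 : 0.13/ℓ ≤ 0.13/12 := by gcongr
  have h5 : 0 < 0.13/ℓ := by positivity
  apply ZF_of (0.13/ℓ) _ _ h5 (by linarith) (by positivity) (by linarith)
  have hp := Real.pi_gt_three
  have hv3 : 1 ≤ v^3 := one_le_pow₀ (by linarith)
  have h1 : Real.log ((v^3+1)/(2*Real.pi)) ≤ 3*ℓ := by
    have : Real.log ((v^3+1)/(2*Real.pi)) ≤ Real.log (v^3) := by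
      apply Real.log_le_log (by positivity)
      rw [div_le_iff₀ (by positivity)]
      nlinarith
    rw [Real.log_pow] at this
    push_cast at this; rw [hℓ]; exact this
  have h6 : 25.6/(v^3+1)^2 ≤ 1 := by
    rw [div_le_one (by positivity)]
    have : (87:ℝ)^3 ≤ v^3 := by gcongr
    nlinarith
  have h7 : 5/(0.13/ℓ) = 5/0.13*ℓ := by field_simp
  calc _ ≤ (5/0.13*ℓ+91/24*(3*ℓ))*(0.13/ℓ+0.03/ℓ) := by
        apply mul_le_mul_of_nonneg_right _ (by positivity)
        rw [h7]; linarith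
    _ = (5/0.13+91/24*3)*0.16 := by field_simp; ring
    _ ≤ 8 := by norm_num

set_option maxHeartbeats 2000000 in
theorem big_row (v : ℝ) (hv : 346839 ≤ v) : v*|VV (Real.exp v)| ≤ 3071.82*Real.exp v := by
  have hvp : 0 < v := by linarith
  obtain ⟨ℓ, hℓ⟩ : ∃ ℓ, ℓ = Real.log v := ⟨_, rfl⟩
  have hvl : v = Real.exp ℓ := by rw [hℓ, Real.exp_log hvp]
  have hl12 : 12 ≤ ℓ := by
    rw [hℓ, Real.le_log_iff_exp_le hvp]
    have h2 : Real.exp 12 = (Real.exp 1)^12 := by rw [← Real.exp_nat_mul]; norm_num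
    rw [h2]
    have := Real.exp_one_lt_d9
    calc _ ≤ (2.72:ℝ)^12 := by gcongr; linarith
      _ ≤ 346839 := by norm_num
      _ ≤ v := hv
  have hl0 : 0 < ℓ := by linarith
  have hkey := big_key ℓ hl12
  rw [← hvl] at hkey
  obtain ⟨Q, hQ⟩ : ∃ Q, Q = 0.41*(5.2+ℓ/12) := ⟨_, rfl⟩
  rw [← hQ] at hkey
  have hQ2 : 2.5 ≤ Q := by rw [hQ]; linarith
  obtain ⟨a, ha⟩ : ∃ a, a = 0.02/ℓ := ⟨_, rfl⟩
  have ha0 : 0 < a := by rw [ha]; positivity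
  have ha1 : a ≤ 0.002 := by
    rw [ha, div_le_iff₀ hl0]; linarith
  have hW : ℓ+8+(3*ℓ+4.4)*Q ≤ v*a := by
    rw [ha, mul_div_assoc', le_div_iff₀ hl0]; linarith
  obtain ⟨h, hh⟩ : ∃ h, h = 1/v^2 := ⟨_, rfl⟩
  have hh0 : 0 < h := by rw [hh]; positivity
  have hh1 : h ≤ 0.001 := by
    rw [hh, div_le_iff₀ (by positivity)]
    have : (346839:ℝ)^2 ≤ v^2 := by gcongr
    linarith
  have hhT : h*v^3 = v := by rw [hh]; field_simp
  have hhv : h*v*v = 1 := by rw [hh]; field_simp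
  have hv3 : (346839:ℝ)^3 ≤ v^3 := by gcongr
  have hJ := big_J h (v^3) (Q-0.4-a) (by linarith) (by linarith)
  have hfin := VV_final v h (v^3) (0.03/ℓ) a Q _ (by linarith) hh0 (by linarith) (by linarith) ha0
    (by rw [ha]; gcongr; norm_num) (by linarith) (by rw [div_le_iff₀ hl0]; linarith) (big_ZF v ℓ hℓ (by linarith) hl12)
    (by rw [ha, hQ]; exact big_QQ ℓ hl12) hJ
  rw [hhT] at hfin
  obtain ⟨c1, c2, c3, c4, c5, c6, c7⟩ := exp_num_bounds
  have hpi := Real.pi_gt_three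
  have hlT : Real.log (v^3/(2*Real.pi)) ≤ 3*ℓ := by
    have : Real.log (v^3/(2*Real.pi)) ≤ Real.log (v^3) := by
      apply Real.log_le_log (by positivity)
      apply div_le_self (by positivity); linarith
    rw [Real.log_pow] at this
    push_cast at this; rw [hℓ]; exact this
  have hh2 : h^2 ≤ 0.000001 := (pow_le_pow_left₀ hh0.le hh1 2).trans (by norm_num)
  have hh20 : 0 < h^2 := by positivity
  have hlQ : 0 < ℓ*Q := by positivity
  have hvv : v*a ≤ v^2/2 := by
    have : v*a ≤ v*(v/2) := mul_le_mul_of_nonneg_left (by clear * - ha1 hv; linarith) hvp.le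
    calc v*a ≤ v*(v/2) := this
      _ = v^2/2 := by ring
  have one : ∀ E : ℝ, E ≤ 0 → Real.exp E ≤ 1 := fun E hE => Real.exp_le_one_iff.mpr hE
  have p1 : v*(18.1/Real.pi*(1+v)^2*Real.exp (1+0.52*h^2-v^2/2)/v^2) ≤ 1 := by
    have a1 : (1+v)^2/v^2 ≤ Real.exp 1 := by
      rw [div_le_iff₀ (by positivity)]
      have h5 := Real.add_one_le_exp 1
      have h6 : 2*v^2 ≤ Real.exp 1*v^2 := by gcongr; linarith
      have h7 : 3*v ≤ v*v := mul_le_mul_of_nonneg_right (by linarith) hvp.le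
      clear * - h6 h7 hv
      linarith
    calc _ = v*(18.1/Real.pi*((1+v)^2/v^2)*Real.exp (1+0.52*h^2-v^2/2)) := by ring
      _ ≤ Real.exp ℓ*(Real.exp 1.752*Real.exp 1*Real.exp (1+0.52*h^2-v^2/2)) := by
        rw [← hvl]; gcongr
      _ = Real.exp (ℓ+(1.752+1+(1+0.52*h^2-v^2/2))) := by simp only [Real.exp_add]
      _ ≤ 1 := one _ (by linarith)
  have p2 : v*(18.1*10.24/Real.pi*Real.exp (2*((1/2*Real.log (v^3/(2*Real.pi))+2.182)*Q+0.04)+1+0.52*h^2-v^2/2)/v^3*(a+1/v)) ≤ 1 := by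
    have hQ0 : 0 < Q := by linarith
    have a1 : (a+1/v)/v^3 ≤ 1 := by
      have : 1/v ≤ 1/346839 := one_div_le_one_div_of_le (by norm_num) hv
      rw [div_le_one (by positivity)]; linarith
    calc _ = v*(18.1*10.24/Real.pi*Real.exp (2*((1/2*Real.log (v^3/(2*Real.pi))+2.182)*Q+0.04)+1+0.52*h^2-v^2/2)*((a+1/v)/v^3)) := by ring
      _ ≤ Real.exp ℓ*(Real.exp 4.079*Real.exp (2*((1/2*(3*ℓ)+2.182)*Q+0.04)+1+0.52*h^2-v^2/2)*1) := by
        rw [← hvl]; gcongr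
      _ = Real.exp (ℓ+(4.079+(2*((1/2*(3*ℓ)+2.182)*Q+0.04)+1+0.52*h^2-v^2/2))) := by rw [mul_one, Real.exp_add ℓ, Real.exp_add 4.079]
      _ ≤ 1 := one _ (by linarith)
  have p3 : v*(18.1*10.24/Real.pi*Real.exp (2*(0.43*Q+1.79*(0.4+a))-v*a+h^2/2)*(2/0.9)) ≤ 1 := by
    calc _ = v*((18.1*10.24/Real.pi*(2/0.9))*Real.exp (2*(0.43*Q+1.79*(0.4+a))-v*a+h^2/2)) := by ring
      _ ≤ Real.exp ℓ*(Real.exp 4.883*Real.exp (2*(0.43*Q+1.79*(0.4+a))-v*a+h^2/2)) := by rw [← hvl]; gcongr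
      _ = Real.exp (ℓ+(4.883+(2*(0.43*Q+1.79*(0.4+a))-v*a+h^2/2))) := by rw [Real.exp_add ℓ, Real.exp_add 4.883]
      _ ≤ 1 := one _ (by linarith)
  have p4 : v*(18.1*10.24/Real.pi*Real.exp (2*(2.07*Q+0.865*(0.4+a))-v*a+h^2/2-2*h^2)*(5/6)) ≤ 1 := by
    calc _ = v*((18.1*10.24/Real.pi*(5/6))*Real.exp (2*(2.07*Q+0.865*(0.4+a))-v*a+h^2/2-2*h^2)) := by ring
      _ ≤ Real.exp ℓ*(Real.exp 3.9*Real.exp (2*(2.07*Q+0.865*(0.4+a))-v*a+h^2/2-2*h^2)) := by rw [← hvl]; gcongr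
      _ = Real.exp (ℓ+(3.9+(2*(2.07*Q+0.865*(0.4+a))-v*a+h^2/2-2*h^2))) := by rw [Real.exp_add ℓ, Real.exp_add 3.9]
      _ ≤ 1 := one _ (by linarith)
  have p5 : v*(18.1*10.24/Real.pi*Real.exp (4.364*Q+0.08-v*a+h^2/2)*(2*Real.pi)^(-(Q-0.4-a))*((v^3)^(Q-0.4-a))) ≤ 1 := by
    have a1 : (2*Real.pi)^(-(Q-0.4-a)) ≤ 1 := Real.rpow_le_one_of_one_le_of_nonpos (by linarith) (by linarith)
    have a2 : (v^3)^(Q-0.4-a) ≤ Real.exp (3*ℓ*Q) := by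
      rw [Real.rpow_def_of_pos (by positivity), Real.log_pow, ← hℓ]
      apply Real.exp_le_exp.mpr
      push_cast
      gcongr
      linarith
    have a3 : 0 ≤ (2*Real.pi)^(-(Q-0.4-a)) := by positivity
    calc _ ≤ Real.exp ℓ*(Real.exp 4.079*Real.exp (4.364*Q+0.08-v*a+h^2/2)*1*Real.exp (3*ℓ*Q)) := by rw [← hvl]; gcongr
      _ = Real.exp (ℓ+(4.079+(4.364*Q+0.08-v*a+h^2/2)+3*ℓ*Q)) := by rw [mul_one, Real.exp_add ℓ, Real.exp_add (4.079+_), Real.exp_add 4.079]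
      _ ≤ 1 := one _ (by linarith)
  have p6 : v*(36.2*Real.exp (-0.1*v)*(Real.exp (0.405*h^2)+1)) ≤ 1000 := by
    have b0 : Real.exp (0.405*h^2) ≤ 1.2 := by
      have b1 := Real.abs_exp_sub_one_sub_id_le (x := 0.405*h^2) (by rw [abs_of_pos (by positivity)]; linarith)
      have b2 := (abs_le.mp b1).2
      have b4 : (0.405*h^2)^2 ≤ (0.405*0.000001)^2 := by gcongr
      clear * - b2 b4 hh2
      linarith
    have b3 : v*Real.exp (-0.1*v) ≤ 10 := by
      have := Real.add_one_le_exp (v/10)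
      rw [show -0.1*v = -(v/10) by ring, Real.exp_neg, ← div_eq_mul_inv, div_le_iff₀ (Real.exp_pos _)]
      linarith
    have a4 : 0 < v*Real.exp (-0.1*v) := by positivity
    calc _ = 36.2*(v*Real.exp (-0.1*v))*(Real.exp (0.405*h^2)+1) := by ring
      _ ≤ 36.2*10*2.2 := by gcongr; linarith
      _ ≤ 1000 := by norm_num
  have p7 : v*(0.399*h*(1+1/(1-h^2))*(0.385*v+1.54) + 0.385*(Real.exp (2*h^2)-2*Real.exp (h^2/2)+1)) ≤ 100 := by
    have a1 : Real.exp (2*h^2)-2*Real.exp (h^2/2)+1 ≤ 2*h^2 := by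
      have b1 := Real.abs_exp_sub_one_sub_id_le (x := 2*h^2) (by rw [abs_of_pos (by positivity)]; linarith)
      have b2 := (abs_le.mp b1).2
      have b3 := Real.add_one_le_exp (h^2/2)
      clear * - b2 b3 hh2 hh20
      nlinarith
    have a2 : 0 < 1-h^2 := by linarith
    have a3 : 1/(1-h^2) ≤ 2 := by rw [div_le_iff₀ a2]; linarith
    calc _ ≤ v*(0.399*h*(1+2)*(0.385*v+1.54*v)+0.385*(2*h^2)) := by
          gcongr
          linarith
      _ = 0.399*3*1.925*(h*v*v)+0.77*(h*(h*v)) := by ring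
      _ ≤ 100 := by
        rw [hhv]
        have h8 : h*v*1 ≤ h*v*v := mul_le_mul_of_nonneg_left (by linarith) (by positivity)
        have h9 : h*(h*v) ≤ h*1 := mul_le_mul_of_nonneg_left (by linarith) hh0.le
        clear * - h9 hh1
        linarith
  have fin := mul_le_mul_of_nonneg_left hfin hvp.le
  refine fin.trans ?_
  rw [mul_left_comm, mul_comm 3071.82]
  apply mul_le_mul_of_nonneg_left _ (Real.exp_pos _).le
  exact comb8 _ _ _ _ _ _ _ _ _ _ _ _ _ _ _ _ _ p7 p6 p1 p2 p3 p4 p5 (by norm_num)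

end

section
open Complex Metric Set Filter Topology MeasureTheory

theorem small_row (v : ℝ) (h0 : 0 ≤ v) (h1 : v ≤ 87) : v*|VV (Real.exp v)| ≤ 3071.82*Real.exp v := by
  have h := VV_triv v h0
  have key : v*(0.385*v+1.54 + 36.2 * Real.exp (-0.1*v)) ≤ 3071.82 := by
    rcases le_total v 80 with h8 | h8
    · have b3 : v*Real.exp (-0.1*v) ≤ 10 := by
        have := Real.add_one_le_exp (v/10)
        rw [show -0.1*v = -(v/10) by ring, Real.exp_neg, ← div_eq_mul_inv, div_le_iff₀ (Real.exp_pos _)]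
        linarith
      nlinarith
    · have b3 : v*Real.exp (-0.1*v) ≤ 0.3 := by
        have a2 := Real.pow_div_factorial_le_exp (v/10) (by positivity) 5
        norm_num [Nat.factorial] at a2
        have a3 : 8^4 ≤ (v/10)^4 := by gcongr; linarith
        have a4 : 8^4*(v/10) ≤ (v/10)^4*(v/10) := by gcongr
        rw [show -0.1*v = -(v/10) by ring, Real.exp_neg, ← div_eq_mul_inv, div_le_iff₀ (Real.exp_pos _)]
        linarith
      nlinarith
  calc v*|VV (Real.exp v)| ≤ v*(Real.exp v * (0.385*v+1.54 + 36.2 * Real.exp (-0.1*v))) := by gcongr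
    _ = Real.exp v*(v*(0.385*v+1.54 + 36.2 * Real.exp (-0.1*v))) := by ring
    _ ≤ Real.exp v*3071.82 := by gcongr
    _ = _ := by ring

theorem all_rows (v : ℝ) (h0 : 0 ≤ v) : v*|VV (Real.exp v)| ≤ 3071.82*Real.exp v := by
  rcases le_total v 87 with h | h
  · exact small_row v h0 h
  rcases le_total v 346839 with h2 | h2
  · exact rows_all v h h2
  · exact big_row v h2

theorem VV_eq (x : ℝ) : ∑ n ∈ (Finset.Icc 1 ⌊x⌋₊).filter (fun n => Odd n), (-2 : ℝ) ^ (ArithmeticFunction.cardFactors n) = VV x := by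
  rw [VV, Finset.sum_filter]
  apply Finset.sum_congr rfl
  intro n _
  rw [pw_apply]
  split_ifs <;> simp

theorem VV_bound (x : ℝ) (hx : 2.5e14 ≤ x) : |VV x| ≤ 3071.82 * x / Real.log x := by
  have hx0 : 0 < x := by linarith
  have hl : 0 < Real.log x := Real.log_pos (by linarith)
  have := all_rows (Real.log x) hl.le
  rw [Real.exp_log hx0] at this
  rw [le_div_iff₀ hl]
  linarith

end

theorem U_bound :
    ∀ x : ℝ, 2.5e14 ≤ x → |U x| ≤ 3071.82 * x / Real.log x := by
  intro x hx
  have h : U x = VV x := VV_eq x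
  rw [h]
  exact VV_bound x hx
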